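/- Let W be a d-dimensional Brownian sheet on [0,1]^2, let ξ ∈ ℝ^d, and let b : [0,1]^2 × ℝ^d → ℝ^d be Borel measurable such that b = b̂ − b̌ where every component b̂_i(s,t,·) and b̌_i(s,t,·) is componentwise nondecreasing, and such that |b(s,t,x)| ≤ M(1+|x|) for some constant M > 0 and all (s,t,x). Then the equation X_{s,t} = ξ + ∫_0^t ∫_0^s b(s₁,t₁,X_{s₁,t₁}) ds₁ dt₁ + W_{s,t}, (s,t) ∈ [0,1]^2, admits a strong solution, and any two strong solutions are indistinguishable (almost surely equal as continuous processes). -/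

import Mathlib

open MeasureTheory ProbabilityTheory Set Filter

noncomputable section

/-- A `d`-dimensional Brownian sheet on `[0,1]²`. -/
def IsBrownianSheet {Ω : Type*} [MeasurableSpace Ω] (P : Measure Ω) (d : ℕ)
    (W : ℝ × ℝ → Ω → EuclideanSpace ℝ (Fin d)) : Prop :=
  (∀ p, Measurable (W p)) ∧
  (∀ ω, ContinuousOn (fun p => W p ω) (Set.Icc (0 : ℝ × ℝ) 1)) ∧
  (∀ ω, ∀ p ∈ Set.Icc (0 : ℝ × ℝ) 1, p.1 = 0 ∨ p.2 = 0 → W p ω = 0) ∧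
  (∀ (n : ℕ) (p : Fin n → ℝ × ℝ) (idx : Fin n → Fin d) (c : Fin n → ℝ),
    (∀ j, p j ∈ Set.Icc (0 : ℝ × ℝ) 1) →
    P.map (fun ω => ∑ j, c j * W (p j) ω (idx j)) =
      gaussianReal 0 (∑ j, ∑ k, c j * c k *
        (if idx j = idx k then min (p j).1 (p k).1 * min (p j).2 (p k).2 else 0)).toNNReal)

/-- The σ-algebra generated by the sheet up to `p`. -/
def sheetSigma {Ω : Type*} [MeasurableSpace Ω] {d : ℕ}
    (W : ℝ × ℝ → Ω → EuclideanSpace ℝ (Fin d)) (p : ℝ × ℝ) : MeasurableSpace Ω :=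
  ⨆ q ∈ Set.Icc (0 : ℝ × ℝ) p, MeasurableSpace.comap (W q) inferInstance

/-- A strong solution of the sheet SDE. -/
def IsStrongSolution {Ω : Type*} [MeasurableSpace Ω] (P : Measure Ω) {d : ℕ}
    (W : ℝ × ℝ → Ω → EuclideanSpace ℝ (Fin d))
    (b : ℝ × ℝ → EuclideanSpace ℝ (Fin d) → EuclideanSpace ℝ (Fin d))
    (ξ : EuclideanSpace ℝ (Fin d))
    (X : ℝ × ℝ → Ω → EuclideanSpace ℝ (Fin d)) : Prop :=
  (∀ ω, ContinuousOn (fun p => X p ω) (Set.Icc (0 : ℝ × ℝ) 1)) ∧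
  (∀ p ∈ Set.Icc (0 : ℝ × ℝ) 1, ∃ Y : Ω → EuclideanSpace ℝ (Fin d),
      Measurable[sheetSigma W p] Y ∧ ∀ᵐ ω ∂P, X p ω = Y ω) ∧
  (∀ᵐ ω ∂P, ∀ p ∈ Set.Icc (0 : ℝ × ℝ) 1,
      X p ω = ξ + (∫ t₁ in (0:ℝ)..p.2, ∫ s₁ in (0:ℝ)..p.1, b (s₁, t₁) (X (s₁, t₁) ω)) + W p ω)

section Sewing

universe u

variable {V : Type u} [NormedAddCommGroup V]

/-- Dyadic scale `√(2^l / N)`. -/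
noncomputable def dyScale (N l : ℕ) : ℝ := Real.sqrt ((2:ℝ) ^ l / N)

lemma dyScale_succ (N l : ℕ) : dyScale N (l+1) = Real.sqrt 2 * dyScale N l := by
  unfold dyScale
  rw [← Real.sqrt_mul (by norm_num), pow_succ]
  congr 1; ring

lemma dyScale_sq (N l : ℕ) : dyScale N l ^ 2 = (2:ℝ) ^ l / N :=
  Real.sq_sqrt (by positivity)

lemma dyScale_nonneg (N l : ℕ) : 0 ≤ dyScale N l := Real.sqrt_nonneg _

lemma dyScale_mono (N : ℕ) {l l' : ℕ} (h : l ≤ l') : dyScale N l ≤ dyScale N l' := by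
  unfold dyScale
  apply Real.sqrt_le_sqrt
  gcongr
  norm_num

/-- Hypotheses of the discrete sewing lemma. -/
structure SewData (N : ℕ) (v : ℕ → V) (A : ℕ → ℕ → V) (C Λ ε : ℝ) : Prop where
  bound : ∀ i j, i ≤ j → j ≤ N → ‖A i j‖ ≤ C * Real.sqrt (((j:ℝ) - i) / N) * ‖v i‖
  defect : ∀ i m j, i ≤ m → m ≤ j → j ≤ N →
    ‖A i j - A i m - A m j‖ ≤ C * Real.sqrt (((j:ℝ) - m) / N) * ‖v m - v i‖
  error : ∀ i j, i ≤ j → j ≤ N →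
    ‖∑ k ∈ Finset.Ico i j, (v (k+1) - v k - A k (k+1))‖ ≤ ε
  lip : ∀ i j, i ≤ j → j ≤ N → ‖v j - v i‖ ≤ Λ * (((j:ℝ) - i) / N)

/-- Remainder of the local expansion. -/
def sewRem (v : ℕ → V) (A : ℕ → ℕ → V) (i j : ℕ) : V :=
  v j - v i - A i j - ∑ k ∈ Finset.Ico i j, (v (k+1) - v k - A k (k+1))

lemma sewRem_succ (v : ℕ → V) (A : ℕ → ℕ → V) (i : ℕ) : sewRem v A i (i+1) = 0 := by
  simp [sewRem]

lemma sewRem_split (v : ℕ → V) (A : ℕ → ℕ → V) {i m j : ℕ} (h1 : i ≤ m) (h2 : m ≤ j) :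
    sewRem v A i j = sewRem v A i m + sewRem v A m j - (A i j - A i m - A m j) := by
  unfold sewRem
  rw [← Finset.sum_Ico_consecutive _ h1 h2]
  abel

variable {N : ℕ} {v : ℕ → V} {A : ℕ → ℕ → V} {C Λ ε : ℝ}

lemma sewRem_double (h : SewData N v A C Λ ε) {i l : ℕ} {e D : ℝ} (hC : 0 ≤ C)
    (hi : i + 2^(l+1) ≤ N)
    (h1 : ‖sewRem v A i (i+2^l)‖ ≤ e) (h2 : ‖sewRem v A (i+2^l) (i+2^l+2^l)‖ ≤ e)
    (hD : ‖v (i+2^l) - v i‖ ≤ D) :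
    ‖sewRem v A i (i+2^(l+1))‖ ≤ 2 * e + C * dyScale N l * D := by
  have hp := Nat.zero_le (2^l)
  have e1 : i + 2^(l+1) = i + 2^l + 2^l := by ring
  rw [e1] at hi ⊢
  rw [sewRem_split v A (m := i+2^l) (by omega) (by omega)]
  have h3 := h.defect i (i+2^l) (i+2^l+2^l) (by omega) (by omega) hi
  have e2 : (((i+2^l+2^l:ℕ):ℝ) - ((i+2^l:ℕ):ℝ)) = 2^l := by push_cast; ring
  rw [e2] at h3
  have h4 : C * Real.sqrt ((2:ℝ)^l / N) * ‖v (i+2^l) - v i‖ ≤ C * dyScale N l * D := by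
    unfold dyScale; gcongr
  calc _ ≤ _ := norm_sub_le _ _
    _ ≤ (e + e) + C * dyScale N l * D := add_le_add ((norm_add_le _ _).trans (add_le_add h1 h2)) (h3.trans h4)
    _ = _ := by ring

lemma sew_lip (h : SewData N v A C Λ ε) {i l : ℕ} (hi : i + 2^l ≤ N) :
    ‖v (i+2^l) - v i‖ ≤ Λ * dyScale N l ^ 2 := by
  have hp := Nat.zero_le (2^l)
  have := h.lip i (i+2^l) (by omega) hi
  rw [dyScale_sq]
  convert this using 3
  push_cast; ring

lemma sew_small (h : SewData N v A C Λ ε) (hC : 0 ≤ C) (hΛ : 0 ≤ Λ) (l : ℕ) :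
    ∀ i, i + 2^l ≤ N → ‖sewRem v A i (i+2^l)‖ ≤ 2 * C * Λ * dyScale N l ^ 3 := by
  induction l with
  | zero =>
    intro i _
    rw [pow_zero, sewRem_succ, norm_zero]
    have := dyScale_nonneg N 0
    positivity
  | succ l ih =>
    intro i hi
    have hp := Nat.zero_le (2^l)
    have e1 : (2:ℕ)^(l+1) = 2^l + 2^l := by ring
    refine (sewRem_double h hC hi (ih i (by omega)) (ih (i+2^l) (by omega))
      (sew_lip h (by omega))).trans ?_
    rw [dyScale_succ]
    have hs := dyScale_nonneg N l
    have h2 : Real.sqrt 2 ^ 3 = 2 * Real.sqrt 2 := by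
      rw [pow_succ, Real.sq_sqrt (by norm_num)]
    have h3 : (1.25:ℝ) ≤ Real.sqrt 2 := Real.le_sqrt_of_sq_le (by norm_num)
    rw [mul_pow, h2]
    have h4 : 0 ≤ C * Λ * dyScale N l ^ 3 := by positivity
    nlinarith

lemma sew_step (h : SewData N v A C Λ ε) (hC : 0 ≤ C) (hΛ : 0 ≤ Λ) (hε : 0 ≤ ε)
    {i0 i1 l0 K : ℕ} (hi1 : i1 ≤ N) (hN : 0 < N) {ψ G σ : ℝ}
    (hσ : dyScale N (l0 + K) ≤ σ) (hK : C * K * σ ≤ 1)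
    (hψ : ∀ i, i0 ≤ i → i ≤ i1 → ‖v i‖ ≤ ψ)
    (hG : G = 4 * C * Λ * σ * dyScale N l0 + 2 * C * ψ + 2 * ε / dyScale N l0) {k : ℕ} (hk : k ≤ K)
    {i : ℕ} (hi : i0 ≤ i) (hi' : i + 2^(l0+k) ≤ i1)
    (hR : ‖sewRem v A i (i+2^(l0+k))‖ ≤
      dyScale N (l0+k) ^ 2 * (2 * C * Λ * dyScale N l0 + C / 2 * k * G)) :
    ‖v (i+2^(l0+k)) - v i‖ ≤ G * dyScale N (l0+k) := by
  have hp := Nat.zero_le (2^(l0+k))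
  have hs0 : 0 < dyScale N l0 := Real.sqrt_pos.2 (by positivity)
  have hσ0 : 0 ≤ σ := (dyScale_nonneg _ _).trans hσ
  have hs := dyScale_nonneg N (l0+k)
  have hψ0 : 0 ≤ ψ := (norm_nonneg _).trans (hψ i hi (by omega))
  have hG0 : 0 ≤ G := by rw [hG]; positivity
  have hA := h.bound i (i+2^(l0+k)) (by omega) (by omega)
  have hA' : ‖A i (i+2^(l0+k))‖ ≤ C * dyScale N (l0+k) * ψ := by
    refine hA.trans ?_
    have e2 : (((i+2^(l0+k):ℕ):ℝ) - (i:ℝ)) = 2^(l0+k) := by push_cast; ring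
    rw [e2]
    have := hψ i hi (by omega)
    unfold dyScale; gcongr
  have hE := h.error i (i+2^(l0+k)) (by omega) (by omega)
  have hdec : v (i+2^(l0+k)) - v i = sewRem v A i (i+2^(l0+k)) + A i (i+2^(l0+k)) +
      ∑ k ∈ Finset.Ico i (i+2^(l0+k)), (v (k+1) - v k - A k (k+1)) := by
    unfold sewRem; abel
  rw [hdec]
  have hsσ : dyScale N (l0+k) ≤ σ := (dyScale_mono N (by omega)).trans hσ
  have hs0k : dyScale N l0 ≤ dyScale N (l0+k) := dyScale_mono N (by omega)
  have h1 : ε ≤ dyScale N (l0+k) * (ε / dyScale N l0) := by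
    rw [mul_div_assoc', le_div_iff₀ hs0, mul_comm]; gcongr
  have hkK : (k:ℝ) ≤ K := by exact_mod_cast hk
  have h2 : dyScale N (l0+k) * (2 * C * Λ * dyScale N l0 + C / 2 * k * G) ≤
      2 * C * Λ * σ * dyScale N l0 + G / 2 := by
    calc _ ≤ σ * (2 * C * Λ * dyScale N l0 + C / 2 * K * G) := by gcongr
      _ = 2 * C * Λ * σ * dyScale N l0 + (C * K * σ) * G / 2 := by ring
      _ ≤ 2 * C * Λ * σ * dyScale N l0 + 1 * G / 2 := by gcongr
      _ = _ := by ring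
  calc _ ≤ _ := norm_add₃_le
    _ ≤ dyScale N (l0+k) ^ 2 * (2 * C * Λ * dyScale N l0 + C / 2 * k * G) + C * dyScale N (l0+k) * ψ
        + dyScale N (l0+k) * (ε / dyScale N l0) := by
          gcongr; exact hE.trans h1
    _ = dyScale N (l0+k) * (dyScale N (l0+k) * (2 * C * Λ * dyScale N l0 + C / 2 * k * G) + C * ψ +
        ε / dyScale N l0) := by ring
    _ ≤ dyScale N (l0+k) * (2 * C * Λ * σ * dyScale N l0 + G / 2 + C * ψ + ε / dyScale N l0) := by gcongr
    _ = G * dyScale N (l0+k) := by rw [hG]; ring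

lemma sew_large (h : SewData N v A C Λ ε) (hC : 0 ≤ C) (hΛ : 0 ≤ Λ) (hε : 0 ≤ ε)
    {i0 i1 l0 K : ℕ} (hi1 : i1 ≤ N) (hN : 0 < N) {ψ G σ : ℝ}
    (hσ : dyScale N (l0 + K) ≤ σ) (hK : C * K * σ ≤ 1)
    (hψ : ∀ i, i0 ≤ i → i ≤ i1 → ‖v i‖ ≤ ψ)
    (hG : G = 4 * C * Λ * σ * dyScale N l0 + 2 * C * ψ + 2 * ε / dyScale N l0)
    (k : ℕ) (hk : k ≤ K) (i : ℕ) (hi : i0 ≤ i) (hi' : i + 2^(l0+k) ≤ i1) :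
    ‖sewRem v A i (i+2^(l0+k))‖ ≤
      dyScale N (l0+k) ^ 2 * (2 * C * Λ * dyScale N l0 + C / 2 * k * G) := by
  induction k generalizing i with
  | zero =>
    refine (sew_small h hC hΛ l0 i (by simpa using hi'.trans hi1)).trans (le_of_eq ?_)
    simp; ring
  | succ k ih =>
    have hp := Nat.zero_le (2^(l0+k))
    have e1 : (2:ℕ)^(l0+(k+1)) = 2^(l0+k) + 2^(l0+k) := by ring
    have hR := ih (by omega) i hi (by omega)
    refine (sewRem_double h hC (l := l0+k) (by rw [add_assoc]; omega) hR
      (ih (by omega) (i+2^(l0+k)) (by omega) (by omega))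
      (sew_step h hC hΛ hε hi1 hN hσ hK hψ hG (by omega) hi (by omega) hR)).trans (le_of_eq ?_)
    rw [← add_assoc, dyScale_succ, mul_pow, Real.sq_sqrt (by norm_num)]
    push_cast; ring

lemma sew_within (h : SewData N v A C Λ ε) (hC : 0 ≤ C) (hΛ : 0 ≤ Λ) (hε : 0 ≤ ε)
    {i0 i1 l0 K : ℕ} (hi1 : i1 ≤ N) (hN : 0 < N) {ψ G σ : ℝ}
    (hσ : dyScale N (l0 + K) ≤ σ) (hK : C * K * σ ≤ 1)
    (hψ : ∀ i, i0 ≤ i → i ≤ i1 → ‖v i‖ ≤ ψ) (hψ0 : 0 ≤ ψ)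
    (hG : G = 4 * C * Λ * σ * dyScale N l0 + 2 * C * ψ + 2 * ε / dyScale N l0)
    (k : ℕ) (hk : k ≤ K) (i j : ℕ) (hi : i0 ≤ i) (hij : i ≤ j) (hj : j ≤ i1) (hj' : j ≤ i + 2^(l0+k)) :
    ‖v j - v i‖ ≤ 4 * G * dyScale N (l0+k) + Λ * dyScale N l0 ^ 2 := by
  have hG0 : 0 ≤ G := by
    have := dyScale_nonneg N l0
    have hσ0 : 0 ≤ σ := (dyScale_nonneg _ _).trans hσ
    rw [hG]; positivity
  induction k generalizing i with
  | zero =>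
    have h1 := h.lip i j hij (by omega)
    have h2 : (j:ℝ) - i ≤ 2^l0 := by
      have : ((j:ℕ):ℝ) ≤ ((i + 2^(l0+0) : ℕ) : ℝ) := by exact_mod_cast hj'
      push_cast at this; simp at this; linarith
    have h3 : Λ * (((j:ℝ)-i)/N) ≤ Λ * dyScale N l0 ^ 2 := by
      rw [dyScale_sq]; gcongr
    have := dyScale_nonneg N (l0+0)
    have : 0 ≤ 4 * G * dyScale N (l0+0) := by positivity
    linarith
  | succ k ih =>
    have e1 : (2:ℕ)^(l0+(k+1)) = 2^(l0+k) + 2^(l0+k) := by ring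
    have h3 : (1.25:ℝ) ≤ Real.sqrt 2 := Real.le_sqrt_of_sq_le (by norm_num)
    have hs := dyScale_nonneg N (l0+k)
    have h4 : 1.25 * (G * dyScale N (l0+k)) ≤ Real.sqrt 2 * (G * dyScale N (l0+k)) := by gcongr
    rw [← add_assoc, dyScale_succ]
    rcases le_or_gt j (i + 2^(l0+k)) with hc | hc
    · have := ih (by omega) i hi hij hc
      nlinarith [mul_nonneg hG0 hs]
    · have h5 := ih (by omega) (i+2^(l0+k)) (by omega) (by omega) (by omega)
      have h6 := sew_step h hC hΛ hε hi1 hN hσ hK hψ hG (k := k) (by omega) hi (by omega)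
        (sew_large h hC hΛ hε hi1 hN hσ hK hψ hG k (by omega) i hi (by omega))
      have h7 : ‖v j - v i‖ ≤ ‖v j - v (i+2^(l0+k))‖ + ‖v (i+2^(l0+k)) - v i‖ := norm_sub_le_norm_sub_add_norm_sub _ _ _
      linarith

/-- One window. -/
lemma sew_window (h : SewData N v A C Λ ε) (hC : 0 ≤ C) (hΛ : 0 ≤ Λ) (hε : 0 ≤ ε)
    {i0 i1 l0 K : ℕ} (h01 : i0 ≤ i1) (hi1 : i1 ≤ N) (hN : 0 < N) {σ : ℝ}
    (hσ : dyScale N (l0 + K) ≤ σ) (hK : C * K * σ ≤ 1) (hσ' : 16 * C * σ ≤ 1) (hσ1 : σ ≤ 1)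
    (hlen : i1 ≤ i0 + 2^(l0+K)) (j : ℕ) (hj0 : i0 ≤ j) (hj : j ≤ i1) :
    ‖v j‖ ≤ (1 + 16 * C * σ) * (‖v i0‖ + (16 * C * Λ * dyScale N l0 + 8 * ε / dyScale N l0 +
      Λ * dyScale N l0 ^ 2)) := by
  obtain ⟨m, hm, hmax⟩ := Finset.exists_max_image (Finset.Icc i0 i1) (fun i => ‖v i‖)
    ⟨i0, by simp [h01]⟩
  have hψ : ∀ i, i0 ≤ i → i ≤ i1 → ‖v i‖ ≤ ‖v m‖ := fun i h1 h2 => hmax i (by simp [h1, h2])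
  rw [Finset.mem_Icc] at hm
  have h1 := sew_within h hC hΛ hε hi1 hN hσ hK hψ (norm_nonneg _) rfl K le_rfl i0 m le_rfl hm.1 hm.2 (by omega)
  have h2 : ‖v m‖ ≤ ‖v i0‖ + ‖v m - v i0‖ := by
    have := norm_add_le (v i0) (v m - v i0); simpa using this
  refine (hψ j hj0 hj).trans ?_
  have hs0 : 0 < dyScale N l0 := Real.sqrt_pos.2 (by positivity)
  have hσ0 : 0 ≤ σ := (dyScale_nonneg _ _).trans hσ
  set s := dyScale N l0
  have h3 : 4 * (4 * C * Λ * σ * s + 2 * C * ‖v m‖ + 2 * ε / s) * dyScale N (l0+K) ≤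
      4 * (4 * C * Λ * σ * s + 2 * C * ‖v m‖ + 2 * ε / s) * σ := by gcongr
  have h4 : 4 * (4 * C * Λ * σ * s + 2 * C * ‖v m‖ + 2 * ε / s) * σ ≤
      16 * C * Λ * s + 8 * C * σ * ‖v m‖ + 8 * ε / s := by
    have a1 : 16 * C * Λ * s * σ * σ ≤ 16 * C * Λ * s * 1 * 1 := by gcongr
    have a2 : 8 * ε / s * σ ≤ 8 * ε / s * 1 := by gcongr
    have : 4 * (4 * C * Λ * σ * s + 2 * C * ‖v m‖ + 2 * ε / s) * σ =
      16 * C * Λ * s * σ * σ + 8 * C * σ * ‖v m‖ + 8 * ε / s * σ := by ring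
    linarith
  set B := 16 * C * Λ * s + 8 * ε / s + Λ * s ^ 2
  set x := C * σ
  have hx : 0 ≤ x := by positivity
  have h5 : ‖v m‖ * (1 - 8 * x) ≤ ‖v i0‖ + B := by
    have : 8 * C * σ * ‖v m‖ = 8 * x * ‖v m‖ := by ring
    linarith
  have h6 : 16 * x ≤ 1 := by linarith
  have h7 : 1 ≤ (1 + 16 * x) * (1 - 8 * x) := by nlinarith
  calc ‖v m‖ = 1 * ‖v m‖ := by ring
    _ ≤ ((1 + 16 * x) * (1 - 8 * x)) * ‖v m‖ := by gcongr
    _ = (1 + 16 * x) * (‖v m‖ * (1 - 8 * x)) := by ring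
    _ ≤ (1 + 16 * x) * (‖v i0‖ + B) := by gcongr
    _ = _ := by ring

lemma sew_windows (h : SewData N v A C Λ ε) (hC : 0 ≤ C) (hΛ : 0 ≤ Λ) (hε : 0 ≤ ε)
    {i0 l0 K : ℕ} (hN : 0 < N) {σ : ℝ}
    (hσ : dyScale N (l0 + K) ≤ σ) (hK : C * K * σ ≤ 1) (hσ' : 16 * C * σ ≤ 1) (hσ1 : σ ≤ 1)
    (w : ℕ) (j : ℕ) (hj0 : i0 ≤ j) (hj : j ≤ i0 + w * 2^(l0+K)) (hjN : j ≤ N) :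
    ‖v j‖ ≤ (1 + 16 * C * σ) ^ w * (‖v i0‖ + w * (16 * C * Λ * dyScale N l0 + 8 * ε / dyScale N l0 +
      Λ * dyScale N l0 ^ 2)) := by
  have hs0 := dyScale_nonneg N l0
  have hσ0 : 0 ≤ σ := (dyScale_nonneg _ _).trans hσ
  set B := 16 * C * Λ * dyScale N l0 + 8 * ε / dyScale N l0 + Λ * dyScale N l0 ^ 2 with hB
  have hB0 : 0 ≤ B := by positivity
  have hg : 1 ≤ 1 + 16 * C * σ := by have : 0 ≤ 16 * C * σ := by positivity
                                     linarith
  set g := 1 + 16 * C * σ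
  induction w generalizing j with
  | zero =>
    have : j = i0 := by simp at hj; omega
    simp [this]
  | succ w ih =>
    have hgw : 1 ≤ g ^ w := one_le_pow₀ hg
    rcases le_or_gt j (i0 + w * 2^(l0+K)) with hc | hc
    · refine (ih j hj0 hc hjN).trans ?_
      gcongr
      · omega
      · omega
    · have h1 := sew_window h hC hΛ hε (i0 := i0 + w * 2^(l0+K)) (i1 := j) hc.le hjN hN hσ hK hσ' hσ1
        (by rw [add_mul, one_mul] at hj; omega) j hc.le le_rfl
      have h2 := ih (i0 + w * 2^(l0+K)) (by omega) le_rfl (by omega)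
      calc ‖v j‖ ≤ g * (‖v (i0 + w * 2^(l0+K))‖ + B) := h1
        _ ≤ g * (g ^ w * (‖v i0‖ + w * B) + g ^ w * B) := by
          gcongr
          nlinarith
        _ = _ := by push_cast; ring

lemma sew_scale_choice {C Λ η : ℝ} (hC : 1 ≤ C) (hη : 0 < η) :
    ∃ κ : ℕ, 16 * C ≤ 2 ^ κ ∧
      Real.exp 1 * Real.exp ((2:ℝ)^κ / (8 * C)) * ((((2:ℝ)^κ)^2 + 2) *
        (17 * C * Λ * Real.exp (1/4 - (2:ℝ)^κ/(4 * C)))) ≤ η := by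
  have hy : Filter.Tendsto (fun κ : ℕ => (2:ℝ)^κ) Filter.atTop Filter.atTop :=
    tendsto_pow_atTop_atTop_of_one_lt (by norm_num)
  have hz : Filter.Tendsto (fun κ : ℕ => (2:ℝ)^κ / (8 * C)) Filter.atTop Filter.atTop :=
    hy.atTop_div_const (by positivity)
  have h2 := (Real.tendsto_pow_mul_exp_neg_atTop_nhds_zero 2).comp hz
  have h0 := (Real.tendsto_pow_mul_exp_neg_atTop_nhds_zero 0).comp hz
  have h3 : Filter.Tendsto (fun κ : ℕ => Real.exp 1 * Real.exp ((2:ℝ)^κ / (8 * C)) * ((((2:ℝ)^κ)^2 + 2) *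
        (17 * C * Λ * Real.exp (1/4 - (2:ℝ)^κ/(4 * C))))) Filter.atTop (nhds 0) := by
    have := ((h2.const_mul ((8*C)^2)).add (h0.const_mul 2)).const_mul (Real.exp 1 * (17 * C * Λ) * Real.exp (1/4))
    simp only [mul_zero, add_zero] at this
    refine this.congr fun κ => ?_
    simp only [Function.comp]
    have e : Real.exp (1/4 - (2:ℝ)^κ/(4*C)) = Real.exp (1/4) * (Real.exp (-((2:ℝ)^κ/(8*C))) *
        Real.exp (-((2:ℝ)^κ/(8*C)))) := by
      rw [← Real.exp_add, ← Real.exp_add]; congr 1; field_simp; ring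
    have e2 : Real.exp ((2:ℝ)^κ / (8 * C)) * Real.exp (-((2:ℝ)^κ/(8*C))) = 1 := by
      rw [← Real.exp_add]; simp
    rw [e]
    have hC0 : C ≠ 0 := by positivity
    set E := Real.exp (-((2:ℝ)^κ/(8*C)))
    set F := Real.exp ((2:ℝ)^κ/(8*C))
    have e3 : (8 * C)^2 * ((2^κ/(8*C))^2 * E) = ((2:ℝ)^κ)^2 * E := by field_simp
    rw [e3]
    linear_combination (-(Real.exp 1 * (17 * C * Λ) * Real.exp (1/4) * (((2:ℝ)^κ)^2 + 2) * E)) * e2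
  obtain ⟨κ, h4, h5⟩ := ((hy.eventually_ge_atTop (16*C)).and (h3.eventually_le_const hη)).exists
  exact ⟨κ, h4, h5⟩

lemma sew_coarse (C Λ : ℝ) (hC : 1 ≤ C) (hΛ : 0 ≤ Λ) {η : ℝ} (hη : 0 < η) :
    ∃ δ > 0, ∃ n0 : ℕ, ∀ n ≥ n0, ∀ {V : Type u} [NormedAddCommGroup V] (v : ℕ → V) (A : ℕ → ℕ → V) (ε : ℝ),
      0 ≤ ε → ε ≤ δ → SewData (2^n) v A C Λ ε → ∀ i0, ‖v i0‖ ≤ δ → ∀ j, i0 ≤ j → j ≤ 2^n →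
      (j:ℝ) - i0 ≤ 1 / (128 * C^2) * 2^n → ‖v j‖ ≤ η := by
  obtain ⟨κ, hκ, hκ2⟩ := sew_scale_choice (Λ := Λ) hC (half_pos hη)
  set y : ℝ := 2 ^ κ with hy
  have hC0 : 0 < C := by linarith
  have hy1 : 16 ≤ y := by linarith
  set K := ⌊y / C⌋₊ with hK
  set w := ⌈1 / (128 * C^2) * y^2⌉₊ with hw
  set s : ℝ := Real.sqrt (1 / (y^2 * 2^K)) with hs
  have hs0 : 0 < s := Real.sqrt_pos.2 (by positivity)
  set g : ℝ := (1 + 16 * C * (1/y)) ^ w with hg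
  have hg0 : 0 < g := by positivity
  have hsy : s ≤ 1 := by
    rw [hs, Real.sqrt_le_one, div_le_one (by positivity)]
    have : (1:ℝ) ≤ 2^K := one_le_pow₀ (by norm_num)
    nlinarith
  have hse : s ≤ Real.exp (1/4 - y/(4*C)) := by
    apply Real.sqrt_le_iff.2 ⟨(Real.exp_pos _).le, ?_⟩
    rw [← Real.exp_nat_mul, div_le_iff₀ (by positivity)]
    have h1 : y / C < K + 1 := Nat.lt_floor_add_one _
    have h2 : Real.exp ((K:ℝ) * (1/2)) ≤ 2 ^ K := by
      rw [Real.exp_nat_mul]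
      gcongr
      have := Real.exp_one_lt_d9
      have h3 : Real.exp (1/2) ^ 2 = Real.exp 1 := by rw [← Real.exp_nat_mul]; norm_num
      nlinarith [Real.exp_pos (1/2)]
    have h3 : 1 ≤ Real.exp (((2:ℕ):ℝ) * (1/4 - y/(4*C))) * Real.exp ((K:ℝ) * (1/2)) := by
      rw [← Real.exp_add]
      apply Real.one_le_exp
      have : y / (4*C) = (y / C) / 4 := by field_simp
      push_cast
      linarith
    have hy2 : 1 ≤ y^2 := by nlinarith
    calc 1 ≤ _ := h3
      _ ≤ Real.exp (((2:ℕ):ℝ) * (1/4 - y/(4*C))) * (1 * 2^K) := by gcongr; linarith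
      _ ≤ _ := by gcongr
  have hwle : (w:ℝ) ≤ 1 / (128 * C^2) * y^2 + 1 := (Nat.ceil_lt_add_one (by positivity)).le
  have hw1 : (w:ℝ) ≤ y^2 + 2 := by
    have : 1 / (128 * C^2) ≤ 1 := by rw [div_le_one (by positivity)]; nlinarith
    nlinarith [sq_nonneg y]
  have hge : g ≤ Real.exp 1 * Real.exp (y / (8*C)) := by
    have h1 : 1 + 16 * C * (1/y) ≤ Real.exp (16 * C * (1/y)) := by
      have := Real.add_one_le_exp (16 * C * (1/y)); linarith
    calc g ≤ Real.exp (16 * C * (1/y)) ^ w := by rw [hg]; gcongr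
      _ = Real.exp (w * (16 * C * (1/y))) := by rw [← Real.exp_nat_mul]
      _ ≤ Real.exp ((1 / (128 * C^2) * y^2 + 1) * (16 * C * (1/y))) := by gcongr
      _ = Real.exp (16 * C / y + y / (8 * C)) := by congr 1; field_simp; ring
      _ ≤ Real.exp (1 + y / (8*C)) := by
        gcongr
        rw [div_le_one (by positivity)]; exact hκ
      _ = _ := Real.exp_add _ _
  have hmain : g * (w * (17 * C * Λ * s)) ≤ η / 2 := by
    refine le_trans ?_ hκ2
    gcongr
  refine ⟨η / (2 * g * (1 + w * (8 / s))), by positivity, 2*κ + K, ?_⟩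
  intro n hn V _ v A ε hε hεδ h i0 hi0 j hj0 hjN hjT
  set δ := η / (2 * g * (1 + w * (8 / s))) with hδ
  have hN : 0 < 2^n := by positivity
  obtain ⟨l0, rfl⟩ : ∃ l0, n = l0 + K + 2*κ := ⟨n - (2*κ+K), by omega⟩
  have hsc : dyScale (2^(l0+K+2*κ)) (l0+K) ≤ 1 / y := by
    unfold dyScale
    apply Real.sqrt_le_iff.2 ⟨by positivity, le_of_eq ?_⟩
    rw [hy]; push_cast; rw [pow_add _ (l0+K)]; field_simp; rw [← pow_mul]; ring
  have hsl : dyScale (2^(l0+K+2*κ)) l0 = s := by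
    unfold dyScale
    rw [hs, hy]; congr 1; push_cast; rw [pow_add, pow_add, mul_comm 2 κ, pow_mul _ κ]; field_simp
  have hKC : C * K * (1/y) ≤ 1 := by
    have : (K:ℝ) ≤ y / C := Nat.floor_le (by positivity)
    rw [le_div_iff₀ hC0] at this
    rw [mul_one_div, div_le_one (by positivity)]; linarith
  have h16 : 16 * C * (1/y) ≤ 1 := by
    rw [mul_one_div, div_le_one (by positivity)]; exact hκ
  have hj : j ≤ i0 + w * 2^(l0+K) := by
    have h1 : 1 / (128 * C^2) * y^2 ≤ w := Nat.le_ceil _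
    have h2 : (2:ℝ)^(l0+K+2*κ) = y^2 * 2^(l0+K) := by rw [pow_add, hy, ← pow_mul, mul_comm κ 2, mul_comm]
    rw [h2] at hjT
    have : (j:ℝ) ≤ i0 + w * 2^(l0+K) := by
      have h3 : 1 / (128 * C^2) * y^2 * 2^(l0+K) ≤ w * 2^(l0+K) := by gcongr
      linarith
    exact_mod_cast this
  have := sew_windows h hC0.le hΛ hε hN hsc hKC h16 (by rw [div_le_one (by positivity)]; linarith) w j hj0 hj hjN
  rw [hsl] at this
  refine this.trans ?_
  have hb : 16 * C * Λ * s + 8 * ε / s + Λ * s^2 ≤ 17 * C * Λ * s + 8 / s * δ := by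
    have a1 : 8 * ε / s ≤ 8 / s * δ := by
      rw [div_mul_eq_mul_div]; gcongr
    have a2 : Λ * s^2 ≤ C * Λ * s := by
      have : s^2 ≤ s := by nlinarith
      calc Λ * s^2 ≤ Λ * s := by gcongr
        _ ≤ C * (Λ * s) := le_mul_of_one_le_left (by positivity) hC
        _ = _ := by ring
    linarith
  calc (1 + 16 * C * (1/y)) ^ w * (‖v i0‖ + w * (16 * C * Λ * s + 8 * ε / s + Λ * s^2))
      ≤ g * (δ + w * (17 * C * Λ * s + 8 / s * δ)) := by gcongr
    _ = g * (w * (17 * C * Λ * s)) + g * (1 + w * (8/s)) * δ := by ring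
    _ ≤ η/2 + η/2 := by
      gcongr
      rw [hδ]; apply le_of_eq; field_simp
    _ = η := by ring

/-- Discrete sewing lemma with critical exponent. -/
theorem sewing (C Λ : ℝ) (hC : 1 ≤ C) (hΛ : 0 ≤ Λ) {η : ℝ} (hη : 0 < η) :
    ∃ δ > 0, ∃ n0 : ℕ, ∀ n ≥ n0, ∀ {V : Type u} [NormedAddCommGroup V] (v : ℕ → V) (A : ℕ → ℕ → V) (ε : ℝ),
      0 ≤ ε → ε ≤ δ → SewData (2^n) v A C Λ ε → v 0 = 0 → ∀ j : ℕ, j ≤ 2^n → ‖v j‖ ≤ η := by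
  set T : ℝ := 1 / (256 * C^2) with hT
  have hT0 : 0 < T := by positivity
  suffices H : ∀ m : ℕ, ∀ η > 0, ∃ δ > 0, ∃ n0 : ℕ, ∀ n ≥ n0, ∀ {V : Type u} [NormedAddCommGroup V]
      (v : ℕ → V) (A : ℕ → ℕ → V) (ε : ℝ),
      0 ≤ ε → ε ≤ δ → SewData (2^n) v A C Λ ε → v 0 = 0 → ∀ j : ℕ, j ≤ 2^n → (j:ℝ) ≤ m * T * 2^n → ‖v j‖ ≤ η by
    obtain ⟨δ, hδ, n0, h⟩ := H ⌈1/T⌉₊ η hη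
    refine ⟨δ, hδ, n0, fun n hn V _ v A ε h1 h2 h3 h4 j hj => h n hn v A ε h1 h2 h3 h4 j hj ?_⟩
    have : 1 / T ≤ ⌈1/T⌉₊ := Nat.le_ceil _
    rw [div_le_iff₀ hT0] at this
    have hj' : (j:ℝ) ≤ 2^n := by exact_mod_cast hj
    nlinarith [pow_pos (two_pos : (0:ℝ) < 2) n]
  intro m
  induction m with
  | zero =>
    intro η hη
    refine ⟨1, one_pos, 0, fun n hn V _ v A ε h1 h2 h3 h4 j hj hj' => ?_⟩
    have : j = 0 := by simpa using hj'
    simp [this, h4, hη.le]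
  | succ m ih =>
    intro η hη
    obtain ⟨δ1, hδ1, n1, H1⟩ := sew_coarse C Λ hC hΛ hη
    obtain ⟨δ2, hδ2, n2, H2⟩ := ih δ1 hδ1
    obtain ⟨n3, hn3⟩ := pow_unbounded_of_one_lt (1/T) (one_lt_two : (1:ℝ) < 2)
    refine ⟨min δ1 δ2, lt_min hδ1 hδ2, max (max n1 n2) n3, fun n hn V _ v A ε h1 h2 h3 h4 j hj hj' => ?_⟩
    set i0 := min j ⌊m * T * 2^n⌋₊ with hi0
    have hi0' : (i0:ℝ) ≤ m * T * 2^n :=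
      (Nat.cast_le.2 (min_le_right _ _)).trans (Nat.floor_le (by positivity))
    have hn1 : n ≥ n1 := (le_max_left n1 n2).trans ((le_max_left _ n3).trans hn)
    have hn2 : n ≥ n2 := (le_max_right n1 n2).trans ((le_max_left _ n3).trans hn)
    have hn3' : n ≥ n3 := (le_max_right _ n3).trans hn
    refine H1 n hn1 v A ε h1 (h2.trans (min_le_left _ _)) h3 i0
      (H2 n hn2 v A ε h1 (h2.trans (min_le_right _ _)) h3 h4 i0 ((min_le_left _ _).trans hj) hi0')
      j (min_le_left _ _) hj ?_
    have hbig : 1 ≤ T * 2^n := by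
      have : (2:ℝ)^n3 ≤ 2^n := pow_le_pow_right₀ (by norm_num) hn3'
      rw [div_lt_iff₀ hT0] at hn3
      nlinarith
    have e : 1 / (128 * C^2) = 2 * T := by rw [hT]; field_simp; norm_num
    rw [e]
    rcases le_total j ⌊m * T * 2^n⌋₊ with hc | hc
    · rw [hi0, min_eq_left hc]; simp; positivity
    · rw [hi0, min_eq_right hc]
      have := Nat.lt_floor_add_one ((m:ℝ) * T * 2^n)
      push_cast at hj'
      linarith

end Sewing

section

open scoped RealInnerProductSpace NNReal ENNReal

set_option linter.unusedSectionVars false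

variable {Ω : Type*} [MeasurableSpace Ω] {P : Measure Ω} {d : ℕ} {W : ℝ × ℝ → Ω → EuclideanSpace ℝ (Fin d)}

/-- Pairs `(h, ∫ h dW)` with `h` a step function. -/
def wienerSpan (W : ℝ × ℝ → Ω → EuclideanSpace ℝ (Fin d)) :
    Submodule ℝ ((ℝ × ℝ → EuclideanSpace ℝ (Fin d)) × (Ω → ℝ)) :=
  Submodule.span ℝ (range fun a : Icc (0 : ℝ × ℝ) 1 × Fin d =>
    ((Icc (0 : ℝ × ℝ) a.1).indicator (fun _ => EuclideanSpace.single a.2 (1:ℝ)), fun ω => W a.1 ω a.2))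

lemma mem_wienerSpan_iff {z} : z ∈ wienerSpan W ↔ ∃ (n : ℕ) (c : Fin n → ℝ)
    (a : Fin n → Icc (0 : ℝ × ℝ) 1 × Fin d),
    z = ((fun q => ∑ j, c j • (Icc (0 : ℝ × ℝ) (a j).1).indicator (fun _ => EuclideanSpace.single (a j).2 (1:ℝ)) q),
      fun ω => ∑ j, c j * W (a j).1 ω (a j).2) := by
  unfold wienerSpan
  rw [Submodule.mem_span_set']
  constructor
  · rintro ⟨n, c, g, rfl⟩
    choose a ha using fun j => (g j).2
    refine ⟨n, c, a, ?_⟩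
    simp only [← ha]
    ext1
    · ext1 q; simp [Prod.fst_sum, Finset.sum_apply]
    · ext1 q; simp [Prod.snd_sum, Finset.sum_apply]
  · rintro ⟨n, c, a, rfl⟩
    refine ⟨n, c, fun j => ⟨_, a j, rfl⟩, ?_⟩
    ext1
    · ext1 q; simp [Prod.fst_sum, Finset.sum_apply]
    · ext1 q; simp [Prod.snd_sum, Finset.sum_apply]

lemma wienerSpan_inner {p : ℝ × ℝ} (hp : p ∈ Icc (0 : ℝ × ℝ) 1) (c : EuclideanSpace ℝ (Fin d)) :
    ((Icc (0 : ℝ × ℝ) p).indicator (fun _ => c), fun ω => ⟪c, W p ω⟫) ∈ wienerSpan W := by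
  rw [mem_wienerSpan_iff]
  refine ⟨d, fun i => c i, fun i => (⟨p, hp⟩, i), ?_⟩
  ext1
  · ext1 q
    by_cases hq : q ∈ Icc (0:ℝ×ℝ) p
    · ext i
      simp [hq, Finset.sum_apply, Pi.single_apply]
    · simp [hq]
  · ext ω
    simp [PiLp.inner_apply, mul_comm]

lemma volume_Icc_prod (p : ℝ × ℝ) : volume (Icc (0 : ℝ × ℝ) p) = ENNReal.ofReal p.1 * ENNReal.ofReal p.2 := by
  have : Icc (0:ℝ×ℝ) p = Icc (0:ℝ) p.1 ×ˢ Icc (0:ℝ) p.2 := by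
    rw [Icc_prod_Icc]; rfl
  rw [this, Measure.volume_eq_prod, Measure.prod_prod, Real.volume_Icc, Real.volume_Icc, sub_zero, sub_zero]

lemma memLp_indicator_Icc (p : ℝ × ℝ) (c : EuclideanSpace ℝ (Fin d)) :
    MemLp ((Icc (0 : ℝ × ℝ) p).indicator (fun _ => c)) 2 volume := by
  refine memLp_indicator_const _ measurableSet_Icc _ (Or.inr ?_)
  rw [volume_Icc_prod]
  finiteness

lemma memLp_wiener {z} (hz : z ∈ wienerSpan W) : MemLp z.1 2 volume := by
  unfold wienerSpan at hz
  induction hz using Submodule.span_induction with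
  | mem x h => obtain ⟨a, rfl⟩ := h; exact memLp_indicator_Icc _ _
  | zero => exact MemLp.zero
  | add x y _ _ hx hy => exact hx.add hy
  | smul a x _ hx => exact hx.const_smul a

lemma MemLp.integrable_real_inner {α E : Type*} [MeasurableSpace α] {μ : Measure α} [NormedAddCommGroup E]
    [InnerProductSpace ℝ E] {f g : α → E} (hf : MemLp f 2 μ) (hg : MemLp g 2 μ) :
    Integrable (fun q => ⟪f q, g q⟫) μ := by
  refine Integrable.mono' (hf.norm.integrable_mul hg.norm) (hf.1.inner hg.1) (ae_of_all _ fun q => ?_)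
  simpa using abs_real_inner_le_norm (f q) (g q)

lemma integrable_inner_wiener {z z'} (hz : z ∈ wienerSpan W) (hz' : z' ∈ wienerSpan W) :
    Integrable (fun q => ⟪z.1 q, z'.1 q⟫) volume :=
  MemLp.integrable_real_inner (memLp_wiener hz) (memLp_wiener hz')

lemma integral_indicator_mul {p p' : ℝ × ℝ} (hp : 0 ≤ p) (hp' : 0 ≤ p') (i i' : Fin d) :
    ∫ q, ⟪(Icc (0 : ℝ × ℝ) p).indicator (fun _ => EuclideanSpace.single i (1:ℝ)) q,
      (Icc (0 : ℝ × ℝ) p').indicator (fun _ => EuclideanSpace.single i' (1:ℝ)) q⟫ =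
    if i = i' then min p.1 p'.1 * min p.2 p'.2 else 0 := by
  have : ∀ q, ⟪(Icc (0 : ℝ × ℝ) p).indicator (fun _ => EuclideanSpace.single i (1:ℝ)) q,
      (Icc (0 : ℝ × ℝ) p').indicator (fun _ => EuclideanSpace.single i' (1:ℝ)) q⟫ =
      (Icc (0 : ℝ × ℝ) (p ⊓ p')).indicator (fun _ => if i = i' then (1:ℝ) else 0) q := by
    intro q
    have hI : Icc (0 : ℝ × ℝ) (p ⊓ p') = Icc 0 p ∩ Icc 0 p' := by
      rw [Icc_inter_Icc]; simp
    rw [hI]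
    by_cases h1 : q ∈ Icc 0 p <;> by_cases h2 : q ∈ Icc 0 p' <;>
      simp [h1, h2, EuclideanSpace.inner_single_left, PiLp.single_apply]
  simp_rw [this]
  rw [integral_indicator_const _ measurableSet_Icc, measureReal_def, volume_Icc_prod, ENNReal.toReal_mul,
    Prod.fst_inf, Prod.snd_inf, ENNReal.toReal_ofReal (le_inf hp.1 hp'.1), ENNReal.toReal_ofReal (le_inf hp.2 hp'.2)]
  split_ifs <;> simp

lemma integral_sum_indicator_sq {n : ℕ} (c : Fin n → ℝ) (p : Fin n → ℝ × ℝ) (i : Fin n → Fin d)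
    (hp : ∀ j, 0 ≤ p j) :
    ∫ q, ‖∑ j, c j • (Icc (0 : ℝ × ℝ) (p j)).indicator (fun _ => EuclideanSpace.single (i j) (1:ℝ)) q‖ ^ 2 =
      ∑ j, ∑ k, c j * c k * (if i j = i k then min (p j).1 (p k).1 * min (p j).2 (p k).2 else 0) := by
  simp_rw [← real_inner_self_eq_norm_sq, sum_inner, inner_sum, real_inner_smul_left, real_inner_smul_right]
  have hI : ∀ j k, Integrable (fun q => ⟪(Icc (0 : ℝ × ℝ) (p j)).indicator (fun _ => EuclideanSpace.single (i j) (1:ℝ)) q,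
      (Icc (0 : ℝ × ℝ) (p k)).indicator (fun _ => EuclideanSpace.single (i k) (1:ℝ)) q⟫) volume := fun j k =>
    MemLp.integrable_real_inner (memLp_indicator_Icc _ _) (memLp_indicator_Icc _ _)
  rw [integral_finsetSum _ fun j _ => integrable_finsetSum _ fun k _ => ((hI j k).const_mul _).const_mul _]
  refine Finset.sum_congr rfl fun j _ => ?_
  rw [integral_finsetSum _ fun k _ => ((hI j k).const_mul _).const_mul _]
  refine Finset.sum_congr rfl fun k _ => ?_
  rw [integral_const_mul, integral_const_mul, integral_indicator_mul (hp j) (hp k), mul_assoc]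

lemma wiener_map (hW : IsBrownianSheet P d W) {z} (hz : z ∈ wienerSpan W) :
    P.map z.2 = gaussianReal 0 (∫ q, ‖z.1 q‖^2).toNNReal := by
  obtain ⟨n, c, a, h⟩ := mem_wienerSpan_iff.1 hz
  have h1 := congrArg Prod.fst h
  have h2 := congrArg Prod.snd h
  dsimp only at h1 h2
  rw [h1, h2, hW.2.2.2 n (fun j => (a j).1) (fun j => (a j).2) c (fun j => (a j).1.2),
    integral_sum_indicator_sq c (fun j => (a j).1) (fun j => (a j).2) (fun j => (a j).1.2.1)]

lemma wiener_measurable (hW : IsBrownianSheet P d W) {z} (hz : z ∈ wienerSpan W) : Measurable z.2 := by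
  obtain ⟨n, c, a, h⟩ := mem_wienerSpan_iff.1 hz
  have h2 := congrArg Prod.snd h
  dsimp only at h2
  rw [h2]
  refine Finset.measurable_fun_sum _ fun j _ => Measurable.const_mul ?_ (c j)
  exact (EuclideanSpace.proj (𝕜 := ℝ) (a j).2).continuous.measurable.comp (hW.1 _)

lemma wiener_gaussian [IsProbabilityMeasure P] (hW : IsBrownianSheet P d W) {ι : Type*}
    {z : ι → _} (hz : ∀ i, z i ∈ wienerSpan W) : IsGaussianProcess (fun i => (z i).2) P where
  hasGaussianLaw I := by
    classical
    have hm : Measurable (fun ω => I.restrict (fun i => (z i).2 ω)) :=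
      measurable_pi_lambda _ fun i => wiener_measurable hW (hz i)
    refine ⟨isGaussian_of_map_eq_gaussianReal fun L => ?_⟩
    have hmem : ∑ i : I, L (Pi.single i 1) • z i ∈ wienerSpan W :=
      Submodule.sum_mem _ fun i _ => Submodule.smul_mem _ _ (hz i)
    refine ⟨0, (∫ q, ‖(∑ i : I, L (Pi.single i 1) • z i).1 q‖^2).toNNReal, ?_⟩
    rw [Measure.map_map (by fun_prop) hm, ← wiener_map hW hmem]
    congr 1
    ext ω
    simp only [Function.comp, Prod.snd_sum, Finset.sum_apply, Prod.smul_snd, Pi.smul_apply, smul_eq_mul]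
    have := LinearMap.pi_apply_eq_sum_univ L.toLinearMap (I.restrict fun i => (z i).2 ω)
    simp only [ContinuousLinearMap.coe_coe] at this
    rw [this]
    refine Finset.sum_congr rfl fun i _ => ?_
    rw [smul_eq_mul, mul_comm]
    congr 2
    ext j
    simp [Pi.single_apply, eq_comm]

lemma wiener_memLp [IsProbabilityMeasure P] (hW : IsBrownianSheet P d W) {z} (hz : z ∈ wienerSpan W)
    {p : ℝ≥0∞} (hp : p ≠ ∞) : MemLp z.2 p P := by
  have h : MemLp id p (P.map z.2) := by
    rw [wiener_map hW hz]
    lift p to ℝ≥0 using hp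
    exact memLp_id_gaussianReal _
  exact (memLp_map_measure_iff (by fun_prop) (wiener_measurable hW hz).aemeasurable).1 h

lemma wiener_integral [IsProbabilityMeasure P] (hW : IsBrownianSheet P d W) {z} (hz : z ∈ wienerSpan W) :
    ∫ ω, z.2 ω ∂P = 0 := by
  have := integral_map (μ := P) (wiener_measurable hW hz).aemeasurable (f := fun x : ℝ => x) (by fun_prop)
  rw [← this, wiener_map hW hz]
  exact integral_id_gaussianReal

lemma wiener_variance [IsProbabilityMeasure P] (hW : IsBrownianSheet P d W) {z} (hz : z ∈ wienerSpan W) :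
    Var[z.2; P] = ∫ q, ‖z.1 q‖^2 := by
  have := variance_map (μ := P) (X := fun x : ℝ => x) (by fun_prop) (wiener_measurable hW hz).aemeasurable
  have h2 : Var[z.2; P] = Var[(fun x : ℝ => x) ∘ z.2; P] := rfl
  rw [h2, ← this, wiener_map hW hz, variance_fun_id_gaussianReal, Real.coe_toNNReal]
  exact integral_nonneg fun _ => by positivity

lemma wiener_sq [IsProbabilityMeasure P] (hW : IsBrownianSheet P d W) {z} (hz : z ∈ wienerSpan W) :
    ∫ ω, z.2 ω ^ 2 ∂P = ∫ q, ‖z.1 q‖^2 := by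
  rw [← wiener_variance hW hz, variance_of_integral_eq_zero (wiener_measurable hW hz).aemeasurable (wiener_integral hW hz)]

lemma wiener_cov [IsProbabilityMeasure P] (hW : IsBrownianSheet P d W) {z z'} (hz : z ∈ wienerSpan W)
    (hz' : z' ∈ wienerSpan W) : cov[z.2, z'.2; P] = ∫ q, ⟪z.1 q, z'.1 q⟫ := by
  have h1 := variance_add (wiener_memLp hW hz (p := 2) (by simp)) (wiener_memLp hW hz' (p := 2) (by simp))
  have h2 := wiener_variance hW (Submodule.add_mem _ hz hz')
  rw [Prod.snd_add, h1, wiener_variance hW hz, wiener_variance hW hz'] at h2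
  simp only [Prod.fst_add, Pi.add_apply, norm_add_sq_real] at h2
  have i1 := (memLp_wiener hz).integrable_norm_pow (by norm_num)
  have i2 := (memLp_wiener hz').integrable_norm_pow (by norm_num)
  have i3 := (integrable_inner_wiener hz hz').const_mul 2
  have e1 := integral_add (i1.add i3) i2
  have e2 := integral_add i1 i3
  simp only [Pi.add_apply] at e1
  rw [e1, e2, integral_const_mul] at h2
  linarith

lemma wiener_indep [IsProbabilityMeasure P] (hW : IsBrownianSheet P d W) {ι κ : Type*}
    {z : ι → _} {y : κ → _} (hz : ∀ i, z i ∈ wienerSpan W) (hy : ∀ j, y j ∈ wienerSpan W)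
    (h : ∀ i j, ∫ q, ⟪(z i).1 q, (y j).1 q⟫ = 0) :
    IndepFun (fun ω i => (z i).2 ω) (fun ω j => (y j).2 ω) P := by
  refine IsGaussianProcess.indepFun_of_covariance_eq_zero ?_ (fun i => (wiener_measurable hW (hz i)).aemeasurable)
    (fun j => (wiener_measurable hW (hy j)).aemeasurable) fun i j => by rw [wiener_cov hW (hz i) (hy j), h]
  have : (Sum.elim (fun i => (z i).2) (fun j => (y j).2)) = fun s : ι ⊕ κ => (Sum.elim z y s).2 := by
    ext s; cases s <;> rfl
  rw [this]
  exact wiener_gaussian hW (fun s => by cases s; exacts [hz _, hy _])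

lemma wiener_lintegral_exp [IsProbabilityMeasure P] (hW : IsBrownianSheet P d W) {z} (hz : z ∈ wienerSpan W) :
    ∫⁻ ω, ENNReal.ofReal (Real.exp (z.2 ω)) ∂P = ENNReal.ofReal (Real.exp ((∫ q, ‖z.1 q‖^2) / 2)) := by
  have hm := mgf_gaussianReal (wiener_map hW hz) 1
  have h0 : 0 ≤ ∫ q, ‖z.1 q‖^2 := integral_nonneg fun _ => by positivity
  rw [Real.coe_toNNReal _ h0] at hm
  simp only [mgf, one_mul, one_pow, mul_one, zero_add] at hm
  rw [← hm, ofReal_integral_eq_lintegral_ofReal]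
  · by_contra hc
    rw [integral_undef hc] at hm
    exact (Real.exp_pos _).ne hm
  · exact ae_of_all _ fun _ => (Real.exp_pos _).le

/-- The `L²` pairing of the integrands of two elements of `wienerSpan`. -/
def wip (z z' : (ℝ × ℝ → EuclideanSpace ℝ (Fin d)) × (Ω → ℝ)) : ℝ := ∫ q, ⟪z.1 q, z'.1 q⟫

lemma wip_comm (z z' : (ℝ × ℝ → EuclideanSpace ℝ (Fin d)) × (Ω → ℝ)) : wip z z' = wip z' z := by
  unfold wip; simp_rw [real_inner_comm]

lemma wip_add_left {x y z} (hx : x ∈ wienerSpan W) (hy : y ∈ wienerSpan W) (hz : z ∈ wienerSpan W) :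
    wip (x + y) z = wip x z + wip y z := by
  unfold wip
  simp only [Prod.fst_add, Pi.add_apply, inner_add_left]
  exact integral_add (integrable_inner_wiener hx hz) (integrable_inner_wiener hy hz)

lemma wip_smul_left (a : ℝ) (x z : (ℝ × ℝ → EuclideanSpace ℝ (Fin d)) × (Ω → ℝ)) :
    wip (a • x) z = a * wip x z := by
  unfold wip
  simp only [Prod.smul_fst, Pi.smul_apply, real_inner_smul_left]
  exact integral_const_mul _ _

lemma wip_sub_left {x y z} (hx : x ∈ wienerSpan W) (hy : y ∈ wienerSpan W) (hz : z ∈ wienerSpan W) :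
    wip (x - y) z = wip x z - wip y z := by
  unfold wip
  simp only [Prod.fst_sub, Pi.sub_apply, inner_sub_left]
  exact integral_sub (integrable_inner_wiener hx hz) (integrable_inner_wiener hy hz)

lemma wip_smul_right (a : ℝ) (x z : (ℝ × ℝ → EuclideanSpace ℝ (Fin d)) × (Ω → ℝ)) :
    wip z (a • x) = a * wip z x := by
  rw [wip_comm, wip_smul_left, wip_comm x]

lemma wip_sub_right {x y z} (hx : x ∈ wienerSpan W) (hy : y ∈ wienerSpan W) (hz : z ∈ wienerSpan W) :
    wip z (x - y) = wip z x - wip z y := by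
  rw [wip_comm, wip_sub_left hx hy hz, wip_comm x, wip_comm y]

/-- The element of `wienerSpan` corresponding to `⟪c, W p⟫`. -/
def wpt (W : ℝ × ℝ → Ω → EuclideanSpace ℝ (Fin d)) (p : ℝ × ℝ) (c : EuclideanSpace ℝ (Fin d)) :
    (ℝ × ℝ → EuclideanSpace ℝ (Fin d)) × (Ω → ℝ) :=
  ((Icc (0 : ℝ × ℝ) p).indicator (fun _ => c), fun ω => ⟪c, W p ω⟫)

lemma wpt_mem {p : ℝ × ℝ} (hp : p ∈ Icc (0 : ℝ × ℝ) 1) (c : EuclideanSpace ℝ (Fin d)) :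
    wpt W p c ∈ wienerSpan W := wienerSpan_inner hp c

lemma wip_wpt {p p' : ℝ × ℝ} (hp : 0 ≤ p) (hp' : 0 ≤ p') (c c' : EuclideanSpace ℝ (Fin d)) :
    wip (wpt W p c) (wpt W p' c') = ⟪c, c'⟫ * (min p.1 p'.1 * min p.2 p'.2) := by
  unfold wip wpt
  have : ∀ q, ⟪(Icc (0 : ℝ × ℝ) p).indicator (fun _ => c) q, (Icc (0 : ℝ × ℝ) p').indicator (fun _ => c') q⟫ =
      (Icc (0 : ℝ × ℝ) (p ⊓ p')).indicator (fun _ => ⟪c, c'⟫) q := by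
    intro q
    have hI : Icc (0 : ℝ × ℝ) (p ⊓ p') = Icc 0 p ∩ Icc 0 p' := by
      rw [Icc_inter_Icc]; simp
    rw [hI]
    by_cases h1 : q ∈ Icc 0 p <;> by_cases h2 : q ∈ Icc 0 p' <;> simp [h1, h2]
  simp_rw [this]
  rw [integral_indicator_const _ measurableSet_Icc, measureReal_def, volume_Icc_prod, ENNReal.toReal_mul,
    Prod.fst_inf, Prod.snd_inf, ENNReal.toReal_ofReal (le_inf hp.1 hp'.1), ENNReal.toReal_ofReal (le_inf hp.2 hp'.2)]
  simp [mul_comm]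

lemma indep_vec_of_wip [IsProbabilityMeasure P] (hW : IsBrownianSheet P d W) {ι κ : Type*}
    {V : ι → Ω → EuclideanSpace ℝ (Fin d)} (z : ι → EuclideanSpace ℝ (Fin d) → _)
    (hz : ∀ i c, z i c ∈ wienerSpan W) (hV : ∀ i c, (z i c).2 = fun ω => ⟪c, V i ω⟫)
    {y : κ → _} (hy : ∀ j, y j ∈ wienerSpan W) (h : ∀ i c j, wip (z i c) (y j) = 0) :
    IndepFun (fun ω i => V i ω) (fun ω j => (y j).2 ω) P := by
  have := wiener_indep hW (z := fun a : ι × Fin d => z a.1 (EuclideanSpace.single a.2 1)) (fun _ => hz _ _) hy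
    (fun a j => h a.1 _ j)
  have hm : Measurable (fun (x : ι × Fin d → ℝ) (i : ι) => (WithLp.toLp 2 fun l => x (i, l) : EuclideanSpace ℝ (Fin d))) := by
    refine measurable_pi_lambda _ fun i => ?_
    exact (PiLp.continuous_toLp 2 (fun _ : Fin d => ℝ)).measurable.comp
      (measurable_pi_lambda _ fun l => measurable_pi_apply _)
  have h2 := this.comp hm measurable_id
  convert h2 using 1
  · ext ω i l
    simp [Function.comp, hV, EuclideanSpace.inner_single_left]
  · rfl

/-- Bounded combinations of orthogonal increments. -/
lemma integral_sq_sum_orthogonal [IsProbabilityMeasure P] {m : ℕ} {G η : ℕ → Ω → ℝ} {K v : ℝ}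
    (hG : ∀ k, Measurable (G k)) (hK : ∀ k ω, |G k ω| ≤ K) (hη : ∀ k, Measurable (η k))
    (hη2 : ∀ k < m, MemLp (η k) 2 P)
    (hv : ∀ k < m, ∫ ω, η k ω ^ 2 ∂P ≤ v)
    (hind : ∀ j k, j < k → k < m → ∫ ω, (G j ω * η j ω) * (G k ω * η k ω) ∂P = 0) :
    MemLp (fun ω => ∑ k ∈ Finset.range m, G k ω * η k ω) 2 P ∧
    ∫ ω, (∑ k ∈ Finset.range m, G k ω * η k ω) ^ 2 ∂P ≤ K ^ 2 * m * v := by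
  have hL : ∀ k < m, MemLp (fun ω => G k ω * η k ω) 2 P := fun k hk => by
    refine MemLp.of_le_mul (c := K) (hη2 k hk) ((hG k).mul (hη k)).aestronglyMeasurable (ae_of_all _ fun ω => ?_)
    rw [norm_mul]; exact mul_le_mul_of_nonneg_right (hK k ω) (norm_nonneg _)
  have hI : ∀ j k, j < m → k < m → Integrable (fun ω => (G j ω * η j ω) * (G k ω * η k ω)) P := fun j k hj hk =>
    (hL j hj).integrable_mul (hL k hk)
  refine ⟨memLp_finsetSum _ fun k hk => hL k (Finset.mem_range.1 hk), ?_⟩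
  simp_rw [sq, Finset.sum_mul_sum]
  rw [integral_finsetSum _ fun j hj => integrable_finsetSum _ fun k hk =>
    hI j k (Finset.mem_range.1 hj) (Finset.mem_range.1 hk)]
  have : ∀ j ∈ Finset.range m, ∫ ω, ∑ k ∈ Finset.range m, (G j ω * η j ω) * (G k ω * η k ω) ∂P ≤ K * K * v := by
    intro j hj
    have hj' := Finset.mem_range.1 hj
    rw [integral_finsetSum _ fun k hk => hI j k hj' (Finset.mem_range.1 hk),
      Finset.sum_eq_single_of_mem j hj]
    · calc ∫ ω, (G j ω * η j ω) * (G j ω * η j ω) ∂P ≤ ∫ ω, K * K * (η j ω ^ 2) ∂P := by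
            refine integral_mono (hI j j hj' hj') ((hη2 j hj').integrable_sq.const_mul _) fun ω => ?_
            have := abs_le.1 (hK j ω)
            have h2 : G j ω * G j ω ≤ K * K := by nlinarith
            nlinarith [sq_nonneg (η j ω)]
        _ ≤ K * K * v := by
            rw [integral_const_mul]; exact mul_le_mul_of_nonneg_left (hv j hj') (mul_self_nonneg K)
    · intro k hk hkj
      rcases lt_or_gt_of_ne hkj with h | h
      · rw [← hind k j h hj']; exact integral_congr_ae (ae_of_all _ fun ω => by ring)
      · exact hind j k h (Finset.mem_range.1 hk)
  refine (Finset.sum_le_sum this).trans ?_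
  simp; linarith

lemma eLpNorm_two_le {α : Type*} [MeasurableSpace α] {μ : Measure α} {X : α → ℝ} {a : ℝ} (hX : MemLp X 2 μ) (ha : 0 ≤ a) (h : ∫ ω, X ω ^ 2 ∂μ ≤ a ^ 2) :
    eLpNorm X 2 μ ≤ ENNReal.ofReal a := by
  rw [hX.eLpNorm_eq_integral_rpow_norm (by norm_num) (by norm_num)]
  refine ENNReal.ofReal_le_ofReal ?_
  simp only [ENNReal.toReal_ofNat, Real.rpow_ofNat, Real.norm_eq_abs, sq_abs]
  rw [← one_div, ← Real.sqrt_eq_rpow]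
  exact Real.sqrt_le_iff.2 ⟨ha, h⟩

lemma integral_sq_le_of_eLpNorm {α : Type*} [MeasurableSpace α] {μ : Measure α} {X : α → ℝ} {a : ℝ} (hX : MemLp X 2 μ) (ha : 0 ≤ a) (h : eLpNorm X 2 μ ≤ ENNReal.ofReal a) :
    ∫ ω, X ω ^ 2 ∂μ ≤ a ^ 2 := by
  rw [hX.eLpNorm_eq_integral_rpow_norm (by norm_num) (by norm_num), ENNReal.ofReal_le_ofReal_iff ha] at h
  simp only [ENNReal.toReal_ofNat, Real.rpow_ofNat, Real.norm_eq_abs, sq_abs] at h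
  rw [← one_div, ← Real.sqrt_eq_rpow] at h
  exact (Real.sqrt_le_iff.1 h).2

/-- Increments of the walk `k ↦ W (s, t₀ + k Δ)`. -/
def walkInc (W : ℝ × ℝ → Ω → EuclideanSpace ℝ (Fin d)) (s t₀ Δ : ℝ) (c : EuclideanSpace ℝ (Fin d)) (k : ℕ) :
    (ℝ × ℝ → EuclideanSpace ℝ (Fin d)) × (Ω → ℝ) := wpt W (s, t₀ + k * Δ) c - wpt W (s, t₀) c

structure WalkTimes (s t₀ Δ : ℝ) (m : ℕ) : Prop where
  s0 : 0 ≤ s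
  s1 : s ≤ 1
  t0 : 0 ≤ t₀
  Δ0 : 0 ≤ Δ
  t1 : t₀ + m * Δ ≤ 1

namespace WalkTimes
variable {s t₀ Δ : ℝ} {m : ℕ}

lemma mem (h : WalkTimes s t₀ Δ m) {k : ℕ} (hk : k ≤ m) : ((s, t₀ + k * Δ) : ℝ × ℝ) ∈ Icc (0 : ℝ × ℝ) 1 := by
  have h1 := h.s0; have h2 := h.s1; have h3 := h.t0; have h4 := h.Δ0; have h5 := h.t1
  have : (k : ℝ) * Δ ≤ m * Δ := mul_le_mul_of_nonneg_right (by exact_mod_cast hk) h4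
  exact ⟨⟨h1, by positivity⟩, ⟨h2, by simp only [Prod.snd_one]; linarith⟩⟩

lemma mem0 (h : WalkTimes s t₀ Δ m) : ((s, t₀) : ℝ × ℝ) ∈ Icc (0 : ℝ × ℝ) 1 := by
  simpa using h.mem (Nat.zero_le m)

lemma walkInc_mem (h : WalkTimes s t₀ Δ m) {k : ℕ} (hk : k ≤ m) (c) : walkInc W s t₀ Δ c k ∈ wienerSpan W :=
  Submodule.sub_mem _ (wpt_mem (h.mem hk) c) (wpt_mem h.mem0 c)

lemma wip_walkInc (h : WalkTimes s t₀ Δ m) {j k : ℕ} (hj : j ≤ m) (hk : k ≤ m) (c c' : EuclideanSpace ℝ (Fin d)) :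
    wip (walkInc W s t₀ Δ c j) (walkInc W s t₀ Δ c' k) = ⟪c, c'⟫ * (s * Δ) * min (j : ℝ) k := by
  have h4 := h.Δ0
  unfold walkInc
  rw [wip_sub_left (wpt_mem (h.mem hj) c) (wpt_mem h.mem0 c)
      (Submodule.sub_mem _ (wpt_mem (h.mem hk) c') (wpt_mem h.mem0 c')),
    wip_sub_right (wpt_mem (h.mem hk) c') (wpt_mem h.mem0 c') (wpt_mem (h.mem hj) c),
    wip_sub_right (wpt_mem (h.mem hk) c') (wpt_mem h.mem0 c') (wpt_mem h.mem0 c),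
    wip_wpt (h.mem hj).1 (h.mem hk).1, wip_wpt (h.mem hj).1 h.mem0.1, wip_wpt h.mem0.1 (h.mem hk).1,
    wip_wpt h.mem0.1 h.mem0.1]
  simp only [min_self, min_add_add_left]
  rw [min_eq_right (a := t₀ + j * Δ) (by simp; positivity), min_eq_left (b := t₀ + k * Δ) (by simp; positivity),
    ← min_mul_of_nonneg _ _ h4]
  ring

end WalkTimes

lemma walkInc_snd (s t₀ Δ : ℝ) (c : EuclideanSpace ℝ (Fin d)) (k : ℕ) :
    (walkInc W s t₀ Δ c k).2 = fun ω => ⟪c, W (s, t₀ + k * Δ) ω - W (s, t₀) ω⟫ := by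
  ext ω; simp [walkInc, wpt, inner_sub_right]

lemma wiener_sq' [IsProbabilityMeasure P] (hW : IsBrownianSheet P d W) {z} (hz : z ∈ wienerSpan W) :
    ∫ ω, z.2 ω ^ 2 ∂P = wip z z := by
  rw [wiener_sq hW hz, wip]; simp_rw [real_inner_self_eq_norm_sq]

section walk
variable {s t₀ Δ : ℝ} {m : ℕ}

/-- `W (s, t₀ + k Δ) - W (s, t₀)`. -/
def walk (W : ℝ × ℝ → Ω → EuclideanSpace ℝ (Fin d)) (s t₀ Δ : ℝ) (k : ℕ) (ω : Ω) :
    EuclideanSpace ℝ (Fin d) := W (s, t₀ + k * Δ) ω - W (s, t₀) ω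

lemma walk_measurable (hW : IsBrownianSheet P d W) (k : ℕ) : Measurable (walk W s t₀ Δ k) :=
  (hW.1 _).sub (hW.1 _)

lemma walk_forward_indep [IsProbabilityMeasure P] (hW : IsBrownianSheet P d W) (h : WalkTimes s t₀ Δ m)
    (e : EuclideanSpace ℝ (Fin d)) {k : ℕ} (hk : k < m) :
    IndepFun (fun ω (i : Fin (k + 1)) => walk W s t₀ Δ i ω)
      (fun ω => ⟪e, walk W s t₀ Δ (k + 1) ω⟫ - ⟪e, walk W s t₀ Δ k ω⟫) P := by
  have := indep_vec_of_wip hW (fun (i : Fin (k + 1)) c => walkInc W s t₀ Δ c i)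
    (V := fun (i : Fin (k + 1)) => walk W s t₀ Δ i)
    (fun i c => h.walkInc_mem (by omega) c) (fun i c => walkInc_snd _ _ _ _ _)
    (y := fun _ : Unit => walkInc W s t₀ Δ e (k + 1) - walkInc W s t₀ Δ e k)
    (fun _ => Submodule.sub_mem _ (h.walkInc_mem (by omega) e) (h.walkInc_mem (by omega) e))
    (fun i c _ => by
      have hi : (i : ℕ) < k + 1 := i.2
      rw [wip_sub_right (h.walkInc_mem (by omega) e) (h.walkInc_mem (by omega) e) (h.walkInc_mem (by omega) c),
        h.wip_walkInc (by omega) (by omega), h.wip_walkInc (by omega) (by omega),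
        min_eq_left (by exact_mod_cast hi.le), min_eq_left (by exact_mod_cast (Nat.lt_succ_iff.1 hi))]
      ring)
  have h2 := this.comp measurable_id (measurable_pi_apply ())
  convert h2 using 1
  · rfl
  · ext ω; simp [Function.comp, walkInc_snd, walk]

lemma walk_backward_indep [IsProbabilityMeasure P] (hW : IsBrownianSheet P d W) (h : WalkTimes s t₀ Δ m)
    {e : EuclideanSpace ℝ (Fin d)} (he : ‖e‖ = 1) {k : ℕ} (hk : k < m) :
    IndepFun (fun ω (i : {i : ℕ // k ≤ i ∧ i < m}) =>
        walk W s t₀ Δ i ω + (⟪e, walk W s t₀ Δ (i + 1) ω⟫ - ⟪e, walk W s t₀ Δ i ω⟫) • e)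
      (fun ω => (k / (k + 1) : ℝ) * ⟪e, walk W s t₀ Δ (k + 1) ω⟫ - ⟪e, walk W s t₀ Δ k ω⟫) P := by
  have hy : ((k / (k + 1) : ℝ) • walkInc W s t₀ Δ e (k + 1) - walkInc W s t₀ Δ e k) ∈ wienerSpan W :=
    Submodule.sub_mem _ (Submodule.smul_mem _ _ (h.walkInc_mem (by omega) e)) (h.walkInc_mem (by omega) e)
  have hin : ∀ (c : EuclideanSpace ℝ (Fin d)) (j : ℕ), j ≤ m →
      wip (walkInc W s t₀ Δ c j) ((k / (k + 1) : ℝ) • walkInc W s t₀ Δ e (k + 1) - walkInc W s t₀ Δ e k) =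
      ⟪c, e⟫ * (s * Δ) * (k / (k + 1) * min (j : ℝ) (k + 1) - min (j : ℝ) k) := by
    intro c j hj
    rw [wip_sub_right (Submodule.smul_mem _ _ (h.walkInc_mem (by omega) e)) (h.walkInc_mem (by omega) e) (h.walkInc_mem hj c),
      wip_smul_right, h.wip_walkInc hj (by omega), h.wip_walkInc hj (by omega)]
    push_cast; ring
  have := indep_vec_of_wip hW (fun (i : {i : ℕ // k ≤ i ∧ i < m}) c => walkInc W s t₀ Δ c i +
      ⟪c, e⟫ • (walkInc W s t₀ Δ e (i + 1) - walkInc W s t₀ Δ e i))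
    (V := fun (i : {i : ℕ // k ≤ i ∧ i < m}) ω => walk W s t₀ Δ i ω + (⟪e, walk W s t₀ Δ (i + 1) ω⟫ - ⟪e, walk W s t₀ Δ i ω⟫) • e)
    (fun i c => by
      have := i.2
      exact Submodule.add_mem _ (h.walkInc_mem (by omega) c) (Submodule.smul_mem _ _
        (Submodule.sub_mem _ (h.walkInc_mem (by omega) e) (h.walkInc_mem (by omega) e))))
    (fun i c => by
      ext ω
      simp only [Prod.snd_add, Prod.smul_snd, Prod.snd_sub, walkInc_snd, walk, Pi.add_apply, Pi.smul_apply,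
        Pi.sub_apply, inner_add_right, real_inner_smul_right, smul_eq_mul]
      push_cast
      ring)
    (y := fun _ : Unit => (k / (k + 1) : ℝ) • walkInc W s t₀ Δ e (k + 1) - walkInc W s t₀ Δ e k)
    (fun _ => hy)
    (fun i c _ => by
      have hi := i.2
      have m1 := h.walkInc_mem (W := W) (k := i) (by omega) c
      have m2 := h.walkInc_mem (W := W) (k := i) (by omega) e
      have m3 := h.walkInc_mem (W := W) (k := i + 1) (by omega) e
      rw [wip_add_left m1 (Submodule.smul_mem _ _ (Submodule.sub_mem _ m3 m2)) hy, wip_smul_left,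
        wip_sub_left m3 m2 hy, hin _ _ (by omega), hin _ _ (by omega), hin _ _ (by omega), real_inner_self_eq_norm_sq, he]
      have hk1 : (0:ℝ) < k + 1 := by positivity
      rcases eq_or_lt_of_le hi.1 with hki | hki
      · rw [← hki]
        push_cast
        rw [min_self, min_self, min_eq_left (by linarith), min_eq_right (a := (k:ℝ) + 1) (by linarith)]
        field_simp
        ring
      · have h1 : ((k:ℝ) + 1) ≤ (i : ℕ) := by exact_mod_cast hki
        push_cast
        rw [min_eq_right h1, min_eq_right (b := (k:ℝ)) (by linarith),
          min_eq_right (b := (k:ℝ) + 1) (by linarith), min_eq_right (b := (k:ℝ)) (by linarith)]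
        field_simp
        ring)
  have h2 := this.comp measurable_id (measurable_pi_apply ())
  convert h2 using 1
  · rfl
  · ext ω; simp [Function.comp, walkInc_snd, walk]

end walk

lemma wip_self_nonneg (z : (ℝ × ℝ → EuclideanSpace ℝ (Fin d)) × (Ω → ℝ)) : 0 ≤ wip z z :=
  integral_nonneg fun _ => real_inner_self_nonneg

lemma wiener_map' (hW : IsBrownianSheet P d W) {z} (hz : z ∈ wienerSpan W) :
    P.map z.2 = (gaussianReal 0 1).map (√(wip z z) * ·) := by
  rw [wiener_map hW hz, gaussianReal_map_const_mul]
  congr 1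
  · simp
  · ext
    have : ∫ q, ‖z.1 q‖^2 = wip z z := by unfold wip; simp_rw [real_inner_self_eq_norm_sq]
    rw [this]
    simp [Real.sq_sqrt (wip_self_nonneg z), wip_self_nonneg z]

/-- Absolute moments of the standard Gaussian. -/
def gmom (n : ℕ) : ℝ := ∫ x, |x| ^ n ∂(gaussianReal 0 1)

lemma gmom_nonneg (n : ℕ) : 0 ≤ gmom n := integral_nonneg fun _ => by positivity

lemma wiener_moment (hW : IsBrownianSheet P d W) {z} (hz : z ∈ wienerSpan W) (n : ℕ) :
    ∫ ω, |z.2 ω| ^ n ∂P = gmom n * √(wip z z) ^ n := by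
  have h1 := integral_map (μ := P) (wiener_measurable hW hz).aemeasurable (f := fun x : ℝ => |x| ^ n) (by fun_prop)
  rw [← h1, wiener_map' hW hz, integral_map (by fun_prop) (by fun_prop)]
  simp_rw [abs_mul, mul_pow, abs_of_nonneg (Real.sqrt_nonneg _)]
  rw [integral_const_mul, gmom, mul_comm]

lemma wiener_integrable_pow [IsProbabilityMeasure P] (hW : IsBrownianSheet P d W) {z} (hz : z ∈ wienerSpan W) (n : ℕ) :
    Integrable (fun ω => |z.2 ω| ^ n) P := by
  rcases Nat.eq_zero_or_pos n with rfl | hn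
  · simp
  · have := (wiener_memLp hW hz (p := n) (by simp)).integrable_norm_pow hn.ne'
    simpa using this

lemma sum_inv_sqrt_le (m : ℕ) : ∑ k ∈ Finset.range m, 1 / √((k : ℝ) + 1) ≤ 2 * √m := by
  induction m with
  | zero => simp
  | succ n ih =>
    rw [Finset.sum_range_succ]
    have h1 : 0 < √((n : ℝ) + 1) := Real.sqrt_pos.2 (by positivity)
    have h2 := Real.sqrt_nonneg (n : ℝ)
    have h3 := Real.sq_sqrt (show (0 : ℝ) ≤ n by positivity)
    have h4 := Real.sq_sqrt (show (0 : ℝ) ≤ (n : ℝ) + 1 by positivity)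
    have : 1 / √((n : ℝ) + 1) ≤ 2 * √((n : ℝ) + 1) - 2 * √n := by
      rw [div_le_iff₀ h1]
      nlinarith [sq_nonneg (√((n : ℝ) + 1) - √n)]
    push_cast
    linarith

section
variable [IsProbabilityMeasure P] {s t₀ Δ : ℝ} {m : ℕ} {e : EuclideanSpace ℝ (Fin d)}

local notation "bb" => fun (k : ℕ) (ω : Ω) => ⟪e, walk W s t₀ Δ k ω⟫

lemma walk_inner_measurable (hW : IsBrownianSheet P d W) (k : ℕ) : Measurable (fun ω => ⟪e, walk W s t₀ Δ k ω⟫) :=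
  measurable_const.inner (walk_measurable hW k)

lemma incr_mem (h : WalkTimes s t₀ Δ m) {k : ℕ} (hk : k < m) (a : ℝ) :
    a • walkInc W s t₀ Δ e (k + 1) - walkInc W s t₀ Δ e k ∈ wienerSpan W :=
  Submodule.sub_mem _ (Submodule.smul_mem _ _ (h.walkInc_mem (by omega) e)) (h.walkInc_mem (by omega) e)

lemma incr_snd (a : ℝ) (k : ℕ) : (a • walkInc W s t₀ Δ e (k + 1) - walkInc W s t₀ Δ e k).2 =
    fun ω => a * ⟪e, walk W s t₀ Δ (k + 1) ω⟫ - ⟪e, walk W s t₀ Δ k ω⟫ := by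
  ext ω; simp [walkInc_snd, walk]

lemma incr_wip (h : WalkTimes s t₀ Δ m) (he : ‖e‖ = 1) {k : ℕ} (hk : k < m) (a : ℝ) :
    wip (a • walkInc W s t₀ Δ e (k + 1) - walkInc W s t₀ Δ e k)
      (a • walkInc W s t₀ Δ e (k + 1) - walkInc W s t₀ Δ e k) = s * Δ * (a ^ 2 * (k + 1) - 2 * a * k + k) := by
  have m1 := h.walkInc_mem (W := W) (k := k) (by omega) e
  have m2 := h.walkInc_mem (W := W) (k := k + 1) (by omega) e
  have m3 := Submodule.smul_mem _ a m2
  rw [wip_sub_left m3 m1 (incr_mem h hk a), wip_sub_right m3 m1 m3, wip_sub_right m3 m1 m1, wip_smul_left, wip_smul_left,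
    wip_smul_right, wip_smul_right, h.wip_walkInc (by omega) (by omega), h.wip_walkInc (by omega) (by omega),
    h.wip_walkInc (by omega) (by omega), h.wip_walkInc (by omega) (by omega), real_inner_self_eq_norm_sq, he]
  push_cast
  rw [min_self, min_self, min_eq_right (by linarith), min_eq_left (by linarith)]
  ring

lemma forward_sum (hW : IsBrownianSheet P d W) (h : WalkTimes s t₀ Δ m)
    {γ : ℕ → EuclideanSpace ℝ (Fin d) → ℝ} (hγ : ∀ k, Measurable (γ k)) {K : ℝ} (hK : ∀ k z, |γ k z| ≤ K)
    {ψ : ℝ → ℝ} (hψ : Measurable ψ) {v : ℝ}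
    (h2 : ∀ k < m, MemLp (fun ω => ψ (bb (k + 1) ω - bb k ω)) 2 P)
    (h0 : ∀ k < m, ∫ ω, ψ (bb (k + 1) ω - bb k ω) ∂P = 0)
    (hv : ∀ k < m, ∫ ω, ψ (bb (k + 1) ω - bb k ω) ^ 2 ∂P ≤ v) :
    MemLp (fun ω => ∑ k ∈ Finset.range m, γ k (walk W s t₀ Δ k ω) * ψ (bb (k + 1) ω - bb k ω)) 2 P ∧
    ∫ ω, (∑ k ∈ Finset.range m, γ k (walk W s t₀ Δ k ω) * ψ (bb (k + 1) ω - bb k ω)) ^ 2 ∂P ≤ K ^ 2 * m * v := by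
  refine integral_sq_sum_orthogonal (P := P) (G := fun k ω => γ k (walk W s t₀ Δ k ω))
    (η := fun k ω => ψ (bb (k + 1) ω - bb k ω))
    (fun k => (hγ k).comp (walk_measurable hW k)) (fun k ω => hK _ _)
    (fun k => hψ.comp ((walk_inner_measurable hW _).sub (walk_inner_measurable hW _))) h2 hv ?_
  intro j k hjk hk
  have hi := walk_forward_indep hW h e hk
  have hj : j < k + 1 := by omega
  have hj1 : j + 1 < k + 1 := by omega
  have hk1 : k < k + 1 := by omega
  have hF : Measurable fun v : Fin (k + 1) → EuclideanSpace ℝ (Fin d) =>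
      γ j (v ⟨j, hj⟩) * ψ (⟪e, v ⟨j + 1, hj1⟩⟫ - ⟪e, v ⟨j, hj⟩⟫) * γ k (v ⟨k, hk1⟩) := by
    have := hγ j; have := hγ k
    fun_prop
  have := hi.integral_fun_comp_mul_comp (f := fun v : Fin (k + 1) → EuclideanSpace ℝ (Fin d) =>
      γ j (v ⟨j, hj⟩) * ψ (⟪e, v ⟨j + 1, hj1⟩⟫ - ⟪e, v ⟨j, hj⟩⟫) * γ k (v ⟨k, hk1⟩)) (g := ψ)
    (measurable_pi_lambda _ fun i : Fin (k + 1) => walk_measurable hW i).aemeasurable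
    ((walk_inner_measurable hW _).sub (walk_inner_measurable hW _)).aemeasurable hF.aestronglyMeasurable
    hψ.aestronglyMeasurable
  rw [h0 k hk, mul_zero] at this
  rw [← this]
  refine integral_congr_ae (ae_of_all _ fun ω => ?_)
  simp only
  ring

lemma backward_sum (hW : IsBrownianSheet P d W) (h : WalkTimes s t₀ Δ m) (he : ‖e‖ = 1)
    {γ : ℕ → EuclideanSpace ℝ (Fin d) → ℝ} (hγ : ∀ k, Measurable (γ k)) {K : ℝ} (hK : ∀ k z, |γ k z| ≤ K) :
    MemLp (fun ω => ∑ k ∈ Finset.range m, γ k (walk W s t₀ Δ k ω + (bb (k + 1) ω - bb k ω) • e) *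
      ((k / (k + 1) : ℝ) * bb (k + 1) ω - bb k ω)) 2 P ∧
    ∫ ω, (∑ k ∈ Finset.range m, γ k (walk W s t₀ Δ k ω + (bb (k + 1) ω - bb k ω) • e) *
      ((k / (k + 1) : ℝ) * bb (k + 1) ω - bb k ω)) ^ 2 ∂P ≤ K ^ 2 * m * (s * Δ) := by
  have hs := h.s0
  have hΔ := h.Δ0
  have hC : ∀ k, Measurable fun ω => walk W s t₀ Δ k ω + (bb (k + 1) ω - bb k ω) • e := fun k =>
    (walk_measurable hW k).add (((walk_inner_measurable hW _).sub (walk_inner_measurable hW _)).smul_const e)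
  have hη : ∀ k : ℕ, Measurable fun ω => (k / (k + 1) : ℝ) * bb (k + 1) ω - bb k ω := fun k =>
    ((walk_inner_measurable hW _).const_mul _).sub (walk_inner_measurable hW _)
  refine integral_sq_sum_orthogonal (P := P) (G := fun k ω => γ k (walk W s t₀ Δ k ω + (bb (k + 1) ω - bb k ω) • e))
    (η := fun k ω => (k / (k + 1) : ℝ) * bb (k + 1) ω - bb k ω)
    (fun k => (hγ k).comp (hC k)) (fun k ω => hK _ _) hη ?_ ?_ ?_
  · intro k hk
    have := wiener_memLp hW (incr_mem (e := e) h hk (k / (k + 1) : ℝ)) (p := 2) (by simp)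
    rwa [incr_snd] at this
  · intro k hk
    have := wiener_sq' hW (incr_mem (e := e) h hk (k / (k + 1) : ℝ))
    rw [incr_snd, incr_wip h he hk] at this
    rw [this]
    have h1 : (0:ℝ) < k + 1 := by positivity
    have : (k / (k + 1) : ℝ) ^ 2 * (k + 1) - 2 * (k / (k + 1)) * k + k = k / (k + 1) := by field_simp; ring
    rw [this]
    have : (k / (k + 1) : ℝ) ≤ 1 := by rw [div_le_one h1]; linarith
    nlinarith [mul_nonneg hs hΔ]
  · intro j k hjk hk
    have hi := walk_backward_indep hW h he (k := j) (by omega)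
    have q1 : j ≤ j ∧ j < m := ⟨le_rfl, by omega⟩
    have q2 : j ≤ k ∧ k < m := ⟨by omega, by omega⟩
    have q3 : j ≤ k - 1 ∧ k - 1 < m := ⟨by omega, by omega⟩
    have := hi.integral_fun_comp_mul_comp (f := fun v : {i : ℕ // j ≤ i ∧ i < m} → EuclideanSpace ℝ (Fin d) =>
        γ k (v ⟨k, q2⟩) * ((k / (k + 1) : ℝ) * ⟪e, v ⟨k, q2⟩⟫ - ⟪e, v ⟨k - 1, q3⟩⟫) * γ j (v ⟨j, q1⟩)) (g := id)
      (measurable_pi_lambda _ fun i : {i : ℕ // j ≤ i ∧ i < m} => hC i).aemeasurable (hη j).aemeasurable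
      (by have := hγ j; have := hγ k; fun_prop) (by fun_prop)
    have h0 : ∫ ω, id ((j / (j + 1) : ℝ) * bb (j + 1) ω - bb j ω) ∂P = 0 := by
      have := wiener_integral hW (incr_mem (e := e) h (k := j) (by omega) (j / (j + 1) : ℝ))
      rwa [incr_snd] at this
    rw [h0, mul_zero] at this
    rw [← this]
    refine integral_congr_ae (ae_of_all _ fun ω => ?_)
    have e1 : ∀ i : ℕ, ⟪e, walk W s t₀ Δ i ω + (⟪e, walk W s t₀ Δ (i + 1) ω⟫ - ⟪e, walk W s t₀ Δ i ω⟫) • e⟫ =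
        ⟪e, walk W s t₀ Δ (i + 1) ω⟫ := fun i => by
      rw [inner_add_right, real_inner_smul_right, real_inner_self_eq_norm_sq, he]; ring
    have e2 := e1 (k - 1)
    rw [Nat.sub_add_cancel (show 1 ≤ k by omega)] at e2
    simp only [e1 k, e2, id, Nat.sub_add_cancel (show 1 ≤ k by omega)]
    ring
end

section
variable [IsProbabilityMeasure P] {s t₀ Δ : ℝ} {m : ℕ} {e : EuclideanSpace ℝ (Fin d)}

local notation "bb" => fun (k : ℕ) (ω : Ω) => ⟪e, walk W s t₀ Δ k ω⟫

lemma walk_moment (hW : IsBrownianSheet P d W) (h : WalkTimes s t₀ Δ m) (he : ‖e‖ = 1) {k : ℕ} (hk : k < m) (n : ℕ) :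
    Integrable (fun ω => |bb (k + 1) ω - bb k ω| ^ n) P ∧
    ∫ ω, |bb (k + 1) ω - bb k ω| ^ n ∂P = gmom n * √(s * Δ) ^ n := by
  have h1 := incr_snd (W := W) (s := s) (t₀ := t₀) (Δ := Δ) (e := e) 1 k
  simp only [one_mul] at h1
  have h2 := wiener_integrable_pow hW (incr_mem (e := e) h hk 1) n
  have h3 := wiener_moment hW (incr_mem (e := e) h hk 1) n
  rw [h1] at h2 h3
  rw [incr_wip h he hk] at h3
  refine ⟨h2, ?_⟩
  rw [h3]
  congr 3
  ring

lemma eLpNorm_walk_pow_le (hW : IsBrownianSheet P d W) (h : WalkTimes s t₀ Δ m) (he : ‖e‖ = 1) {k : ℕ} (hk : k < m) (n : ℕ) :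
    MemLp (fun ω => |bb (k + 1) ω - bb k ω| ^ n) 2 P ∧
    eLpNorm (fun ω => |bb (k + 1) ω - bb k ω| ^ n) 2 P ≤ ENNReal.ofReal (√(gmom (n * 2)) * √(s * Δ) ^ n) := by
  have h1 := walk_moment hW h he hk (n * 2)
  have hm : Measurable fun ω => |bb (k + 1) ω - bb k ω| ^ n :=
    (((walk_inner_measurable hW _).sub (walk_inner_measurable hW _)).abs).pow_const n
  have h2 : MemLp (fun ω => |bb (k + 1) ω - bb k ω| ^ n) 2 P := by
    rw [memLp_two_iff_integrable_sq hm.aestronglyMeasurable]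
    simpa only [← pow_mul] using h1.1
  refine ⟨h2, eLpNorm_two_le h2 (by positivity) ?_⟩
  simp only [← pow_mul]
  rw [h1.2, mul_pow, Real.sq_sqrt (gmom_nonneg _), pow_mul]

lemma davie_discrete (hW : IsBrownianSheet P d W) (h : WalkTimes s t₀ Δ m) (he : ‖e‖ = 1)
    {φ g : ℕ → EuclideanSpace ℝ (Fin d) → ℝ} (hφ : ∀ k, Measurable (φ k)) (hg : ∀ k, Measurable (g k))
    {K G ε C : ℝ} (hK0 : 0 ≤ K) (hG0 : 0 ≤ G) (hε : 0 ≤ ε) (hC : 0 ≤ C) (hK : ∀ k z, |φ k z| ≤ K) (hG : ∀ k z, |g k z| ≤ G)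
    (hexp : ∀ k z (x : ℝ), |φ k (z + x • e) - φ k z - x * g k z| ≤ |x| * (ε + C * |x|)) :
    ∫ ω, (s * Δ * ∑ k ∈ Finset.range m, g k (walk W s t₀ Δ k ω)) ^ 2 ∂P ≤
      (4 * K * √(m * (s * Δ)) + m * (ε * (√(gmom 4) * √(s * Δ) ^ 2) + C * (√(gmom 6) * √(s * Δ) ^ 3)) +
        G * √(m * (gmom 4 + 1)) * (s * Δ)) ^ 2 := by
  have hv0 : 0 ≤ s * Δ := mul_nonneg h.s0 h.Δ0
  have hbm : ∀ k, Measurable (bb k) := fun k => walk_inner_measurable hW k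
  have g4 := gmom_nonneg 4
  -- the forward sum
  have F1 := forward_sum hW h hφ hK (ψ := id) measurable_id (v := s * Δ)
    (fun k hk => by
      have := wiener_memLp hW (incr_mem (e := e) h hk 1) (p := 2) (by simp)
      rw [incr_snd] at this; simpa using this)
    (fun k hk => by
      have := wiener_integral hW (incr_mem (e := e) h hk 1)
      rw [incr_snd] at this; simpa using this)
    (fun k hk => by
      have := wiener_sq' hW (incr_mem (e := e) h hk 1)
      rw [incr_snd, incr_wip h he hk] at this
      simp only [one_mul] at this
      simp only [id]
      rw [this]; apply le_of_eq; ring)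
  have E1 := eLpNorm_two_le (a := K * √(m * (s * Δ))) F1.1 (by positivity)
    (F1.2.trans_eq (by rw [mul_pow, Real.sq_sqrt (by positivity)]; ring))
  -- the backward sum
  have F2 := backward_sum hW h he hφ hK
  have E2 := eLpNorm_two_le (a := K * √(m * (s * Δ))) F2.1 (by positivity)
    (F2.2.trans_eq (by rw [mul_pow, Real.sq_sqrt (by positivity)]; ring))
  -- the quadratic variation
  have F5 := forward_sum hW h hg hG (ψ := fun x => x ^ 2 - s * Δ) (by fun_prop) (v := (gmom 4 + 1) * (s * Δ) ^ 2)
    (fun k hk => by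
      have := (eLpNorm_walk_pow_le hW h he hk 2).1
      simp only [sq_abs] at this
      exact this.sub (memLp_const _))
    (fun k hk => by
      have hi := (walk_moment hW h he hk 2).1
      have := wiener_sq' hW (incr_mem (e := e) h hk 1)
      rw [incr_snd, incr_wip h he hk] at this
      simp only [one_mul] at this
      simp only [sq_abs] at hi
      rw [integral_sub hi (integrable_const _), this]
      simp; ring)
    (fun k hk => by
      have hi := (walk_moment hW h he hk 4)
      have hi2 := (walk_moment hW h he hk 2).1
      calc ∫ ω, ((bb (k + 1) ω - bb k ω) ^ 2 - s * Δ) ^ 2 ∂P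
          ≤ ∫ ω, (|bb (k + 1) ω - bb k ω| ^ 4 + (s * Δ) ^ 2) ∂P := by
            refine integral_mono_of_nonneg (ae_of_all _ fun _ => sq_nonneg _) (hi.1.add (integrable_const _)) (ae_of_all _ fun ω => ?_)
            have e4 : |bb (k + 1) ω - bb k ω| ^ 4 = ((bb (k + 1) ω - bb k ω) ^ 2) ^ 2 := by
              rw [← sq_abs (bb (k + 1) ω - bb k ω), ← pow_mul]
            simp only at e4 ⊢
            rw [e4]
            nlinarith [mul_nonneg hv0 (sq_nonneg (bb (k + 1) ω - bb k ω))]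
        _ = _ := by
            rw [integral_add hi.1 (integrable_const _), hi.2]
            have : √(s * Δ) ^ 4 = (s * Δ) ^ 2 := by
              rw [show √(s * Δ) ^ 4 = (√(s * Δ) ^ 2) ^ 2 by ring, Real.sq_sqrt hv0]
            rw [this]; simp; ring)
  have E5 := eLpNorm_two_le (a := G * √(m * (gmom 4 + 1)) * (s * Δ)) F5.1 (by positivity)
    (F5.2.trans_eq (by
      have := Real.sq_sqrt (show 0 ≤ (m:ℝ) * (gmom 4 + 1) by positivity)
      rw [show (G * √(m * (gmom 4 + 1)) * (s * Δ)) ^ 2 = G ^ 2 * (√(m * (gmom 4 + 1)) ^ 2) * (s * Δ) ^ 2 by ring, this]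
      ring))
  have hCm : ∀ k, Measurable fun ω => walk W s t₀ Δ k ω + (bb (k + 1) ω - bb k ω) • e := fun k =>
    (walk_measurable hW k).add (((hbm _).sub (hbm _)).smul_const e)
  -- the drift part of the backward sum
  have T3 : ∀ k ∈ Finset.range m, MemLp (fun ω => φ k (walk W s t₀ Δ k ω + (bb (k + 1) ω - bb k ω) • e) *
      ((1 / (k + 1) : ℝ) * bb (k + 1) ω)) 2 P ∧
      eLpNorm (fun ω => φ k (walk W s t₀ Δ k ω + (bb (k + 1) ω - bb k ω) • e) *
      ((1 / (k + 1) : ℝ) * bb (k + 1) ω)) 2 P ≤ ENNReal.ofReal (K * √(s * Δ) * (1 / √((k : ℝ) + 1))) := by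
    intro k hk
    have hk := Finset.mem_range.1 hk
    have hz := h.walkInc_mem (W := W) (k := k + 1) (by omega) e
    have m1 := wiener_memLp hW hz (p := 2) (by simp)
    have s1 := wiener_sq' hW hz
    rw [walkInc_snd] at m1 s1
    rw [h.wip_walkInc (by omega) (by omega), real_inner_self_eq_norm_sq, he, min_self] at s1
    have m2 : MemLp (fun ω => φ k (walk W s t₀ Δ k ω + (bb (k + 1) ω - bb k ω) • e) *
      ((1 / (k + 1) : ℝ) * bb (k + 1) ω)) 2 P := by
      refine MemLp.of_le_mul (c := K * (1 / (k + 1))) m1 (((hφ k).comp (hCm k)).mul ((hbm _).const_mul _)).aestronglyMeasurable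
        (ae_of_all _ fun ω => ?_)
      rw [norm_mul, norm_mul, Real.norm_eq_abs, Real.norm_of_nonneg (by positivity : (0:ℝ) ≤ 1 / (k + 1)), ← mul_assoc]
      exact mul_le_mul_of_nonneg_right (mul_le_mul_of_nonneg_right (hK _ _) (by positivity)) (norm_nonneg _)
    refine ⟨m2, eLpNorm_two_le m2 (by positivity) ?_⟩
    calc _ ≤ ∫ ω, (K * (1 / (k + 1))) ^ 2 * (⟪e, W (s, t₀ + (k + 1 : ℕ) * Δ) ω - W (s, t₀) ω⟫) ^ 2 ∂P := by
            refine integral_mono m2.integrable_sq (m1.integrable_sq.const_mul _) fun ω => ?_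
            have := sq_le_sq' (abs_le.1 (hK k (walk W s t₀ Δ k ω + (bb (k + 1) ω - bb k ω) • e))).1 (abs_le.1 (hK k (walk W s t₀ Δ k ω + (bb (k + 1) ω - bb k ω) • e))).2
            simp only [mul_pow]
            rw [mul_assoc]
            exact mul_le_mul_of_nonneg_right this (by positivity)
      _ = _ := by
            rw [integral_const_mul, s1]
            simp only [mul_pow, div_pow]
            rw [Real.sq_sqrt hv0, Real.sq_sqrt (by positivity)]
            push_cast
            field_simp
  have E3 : eLpNorm (fun ω => ∑ k ∈ Finset.range m, φ k (walk W s t₀ Δ k ω + (bb (k + 1) ω - bb k ω) • e) *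
      ((1 / (k + 1) : ℝ) * bb (k + 1) ω)) 2 P ≤ ENNReal.ofReal (2 * K * √(m * (s * Δ))) := by
    have := eLpNorm_sum_le (μ := P) (p := 2) (s := Finset.range m) (f := fun k ω => φ k (walk W s t₀ Δ k ω + (bb (k + 1) ω - bb k ω) • e) *
      ((1 / (k + 1) : ℝ) * bb (k + 1) ω)) (fun k hk => (T3 k hk).1.1) (by norm_num)
    have h2 : (fun ω => ∑ k ∈ Finset.range m, φ k (walk W s t₀ Δ k ω + (bb (k + 1) ω - bb k ω) • e) *
      ((1 / (k + 1) : ℝ) * bb (k + 1) ω)) = ∑ k ∈ Finset.range m, fun ω => φ k (walk W s t₀ Δ k ω + (bb (k + 1) ω - bb k ω) • e) *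
      ((1 / (k + 1) : ℝ) * bb (k + 1) ω) := by ext ω; simp
    rw [h2]
    refine this.trans ((Finset.sum_le_sum fun k hk => (T3 k hk).2).trans ?_)
    rw [← ENNReal.ofReal_sum_of_nonneg fun k _ => by positivity, ← Finset.mul_sum]
    refine ENNReal.ofReal_le_ofReal ?_
    rw [Real.sqrt_mul (Nat.cast_nonneg m) (s * Δ)]
    have := mul_le_mul_of_nonneg_left (sum_inv_sqrt_le m) (by positivity : 0 ≤ K * √(s * Δ))
    linarith
  -- the remainder
  have T4 : ∀ k ∈ Finset.range m, MemLp (fun ω => (φ k (walk W s t₀ Δ k ω + (bb (k + 1) ω - bb k ω) • e) -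
      φ k (walk W s t₀ Δ k ω) - (bb (k + 1) ω - bb k ω) * g k (walk W s t₀ Δ k ω)) * (bb (k + 1) ω - bb k ω)) 2 P ∧
      eLpNorm (fun ω => (φ k (walk W s t₀ Δ k ω + (bb (k + 1) ω - bb k ω) • e) -
      φ k (walk W s t₀ Δ k ω) - (bb (k + 1) ω - bb k ω) * g k (walk W s t₀ Δ k ω)) * (bb (k + 1) ω - bb k ω)) 2 P ≤
      ENNReal.ofReal (ε * (√(gmom 4) * √(s * Δ) ^ 2) + C * (√(gmom 6) * √(s * Δ) ^ 3)) := by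
    intro k hk
    have hk := Finset.mem_range.1 hk
    have a2 := eLpNorm_walk_pow_le hW h he hk 2
    have a3 := eLpNorm_walk_pow_le hW h he hk 3
    have hm : Measurable (fun ω => (φ k (walk W s t₀ Δ k ω + (bb (k + 1) ω - bb k ω) • e) -
      φ k (walk W s t₀ Δ k ω) - (bb (k + 1) ω - bb k ω) * g k (walk W s t₀ Δ k ω)) * (bb (k + 1) ω - bb k ω)) :=
      ((((hφ k).comp (hCm k)).sub ((hφ k).comp (walk_measurable hW k))).sub
        (((hbm _).sub (hbm _)).mul ((hg k).comp (walk_measurable hW k)))).mul ((hbm _).sub (hbm _))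
    have hle : ∀ ω, ‖(φ k (walk W s t₀ Δ k ω + (bb (k + 1) ω - bb k ω) • e) -
      φ k (walk W s t₀ Δ k ω) - (bb (k + 1) ω - bb k ω) * g k (walk W s t₀ Δ k ω)) * (bb (k + 1) ω - bb k ω)‖ ≤
      ((fun ω => ε * |bb (k + 1) ω - bb k ω| ^ 2) + (fun ω => C * |bb (k + 1) ω - bb k ω| ^ 3)) ω := by
      intro ω
      rw [norm_mul, Real.norm_eq_abs, Real.norm_eq_abs]
      refine (mul_le_mul_of_nonneg_right (hexp _ _ _) (abs_nonneg _)).trans_eq ?_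
      simp only [Pi.add_apply]
      ring
    have c2 := a2.1.const_mul ε
    have c3 := a3.1.const_mul C
    refine ⟨(c2.add c3).mono' hm.aestronglyMeasurable (ae_of_all _ hle), ?_⟩
    refine (eLpNorm_mono_real hle).trans ((eLpNorm_add_le c2.1 c3.1 (by norm_num)).trans ?_)
    rw [ENNReal.ofReal_add (by positivity) (by positivity)]
    refine add_le_add ?_ ?_
    · have := eLpNorm_const_smul (μ := P) (p := 2) ε (fun ω => |bb (k + 1) ω - bb k ω| ^ 2)
      refine this.trans_le ?_
      rw [ENNReal.ofReal_mul hε, Real.enorm_eq_ofReal hε]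
      gcongr
      exact a2.2
    · have := eLpNorm_const_smul (μ := P) (p := 2) C (fun ω => |bb (k + 1) ω - bb k ω| ^ 3)
      refine this.trans_le ?_
      rw [ENNReal.ofReal_mul hC, Real.enorm_eq_ofReal hC]
      gcongr
      exact a3.2
  have E4 : eLpNorm (fun ω => ∑ k ∈ Finset.range m, (φ k (walk W s t₀ Δ k ω + (bb (k + 1) ω - bb k ω) • e) -
      φ k (walk W s t₀ Δ k ω) - (bb (k + 1) ω - bb k ω) * g k (walk W s t₀ Δ k ω)) * (bb (k + 1) ω - bb k ω)) 2 P ≤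
      ENNReal.ofReal (m * (ε * (√(gmom 4) * √(s * Δ) ^ 2) + C * (√(gmom 6) * √(s * Δ) ^ 3))) := by
    have := eLpNorm_sum_le (μ := P) (p := 2) (s := Finset.range m) (f := fun k ω => (φ k (walk W s t₀ Δ k ω + (bb (k + 1) ω - bb k ω) • e) -
      φ k (walk W s t₀ Δ k ω) - (bb (k + 1) ω - bb k ω) * g k (walk W s t₀ Δ k ω)) * (bb (k + 1) ω - bb k ω)) (fun k hk => (T4 k hk).1.1) (by norm_num)
    have h2 : (fun ω => ∑ k ∈ Finset.range m, (φ k (walk W s t₀ Δ k ω + (bb (k + 1) ω - bb k ω) • e) -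
      φ k (walk W s t₀ Δ k ω) - (bb (k + 1) ω - bb k ω) * g k (walk W s t₀ Δ k ω)) * (bb (k + 1) ω - bb k ω)) = ∑ k ∈ Finset.range m, fun ω => (φ k (walk W s t₀ Δ k ω + (bb (k + 1) ω - bb k ω) • e) -
      φ k (walk W s t₀ Δ k ω) - (bb (k + 1) ω - bb k ω) * g k (walk W s t₀ Δ k ω)) * (bb (k + 1) ω - bb k ω) := by ext ω; simp
    rw [h2]
    refine this.trans ((Finset.sum_le_sum fun k hk => (T4 k hk).2).trans ?_)
    rw [← ENNReal.ofReal_sum_of_nonneg fun k _ => by positivity]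
    refine ENNReal.ofReal_le_ofReal (le_of_eq ?_)
    rw [Finset.sum_const, Finset.card_range, nsmul_eq_mul]
  have M3 := memLp_finsetSum (p := 2) (Finset.range m) fun k hk => (T3 k hk).1
  have M4 := memLp_finsetSum (p := 2) (Finset.range m) fun k hk => (T4 k hk).1
  have key : (fun ω => s * Δ * ∑ k ∈ Finset.range m, g k (walk W s t₀ Δ k ω)) =
      ((((fun ω => ∑ k ∈ Finset.range m, φ k (walk W s t₀ Δ k ω + (bb (k + 1) ω - bb k ω) • e) *
      ((k / (k + 1) : ℝ) * bb (k + 1) ω - bb k ω)) + (fun ω => ∑ k ∈ Finset.range m, φ k (walk W s t₀ Δ k ω + (bb (k + 1) ω - bb k ω) • e) *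
      ((1 / (k + 1) : ℝ) * bb (k + 1) ω))) - (fun ω => ∑ k ∈ Finset.range m, φ k (walk W s t₀ Δ k ω) * id (bb (k + 1) ω - bb k ω))) -
      (fun ω => ∑ k ∈ Finset.range m, (φ k (walk W s t₀ Δ k ω + (bb (k + 1) ω - bb k ω) • e) -
      φ k (walk W s t₀ Δ k ω) - (bb (k + 1) ω - bb k ω) * g k (walk W s t₀ Δ k ω)) * (bb (k + 1) ω - bb k ω))) -
      (fun ω => ∑ k ∈ Finset.range m, g k (walk W s t₀ Δ k ω) * ((bb (k + 1) ω - bb k ω) ^ 2 - s * Δ)) := by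
    ext ω
    simp only [Pi.add_apply, Pi.sub_apply, ← Finset.sum_add_distrib, ← Finset.sum_sub_distrib, Finset.mul_sum]
    refine Finset.sum_congr rfl fun k _ => ?_
    have h1 : (0:ℝ) < k + 1 := by positivity
    simp only [id]
    field_simp
    ring
  have MM := ((((F2.1.add M3).sub F1.1).sub M4).sub F5.1)
  rw [← key] at MM
  refine integral_sq_le_of_eLpNorm MM (by positivity) ?_
  rw [key]
  refine (eLpNorm_sub_le (((F2.1.add M3).sub F1.1).sub M4).1 F5.1.1 (by norm_num)).trans ?_
  rw [ENNReal.ofReal_add (by positivity) (by positivity)]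
  refine add_le_add ?_ E5
  refine (eLpNorm_sub_le ((F2.1.add M3).sub F1.1).1 M4.1 (by norm_num)).trans ?_
  rw [ENNReal.ofReal_add (by positivity) (by positivity)]
  refine add_le_add ?_ E4
  refine (eLpNorm_sub_le (F2.1.add M3).1 F1.1.1 (by norm_num)).trans ?_
  rw [show 4 * K * √(m * (s * Δ)) = (K * √(m * (s * Δ)) + 2 * K * √(m * (s * Δ))) + K * √(m * (s * Δ)) by ring,
    ENNReal.ofReal_add (by positivity) (by positivity), ENNReal.ofReal_add (by positivity) (by positivity)]
  refine add_le_add ((eLpNorm_add_le F2.1.1 M3.1 (by norm_num)).trans (add_le_add E2 E3)) E1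
end

section

open scoped Topology in
lemma tendsto_riemann_sum {u : ℝ → ℝ} (hu : Continuous u) {t b : ℝ} (htb : t ≤ b) :
    Tendsto (fun m : ℕ => (b - t) / m * ∑ k ∈ Finset.range m, u (t + k * ((b - t) / m))) atTop
      (𝓝 (∫ r in t..b, u r)) := by
  rw [Metric.tendsto_atTop]
  intro η hη
  set h := b - t with hh
  have h0 : 0 ≤ h := sub_nonneg.2 htb
  have huc : UniformContinuousOn u (Icc t b) := isCompact_Icc.uniformContinuousOn_of_continuous hu.continuousOn
  rw [Metric.uniformContinuousOn_iff] at huc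
  obtain ⟨δ, hδ, H⟩ := huc (η / (h + 1)) (by positivity)
  obtain ⟨n, hn⟩ := exists_nat_gt (h / δ)
  refine ⟨n + 1, fun m hm => ?_⟩
  have hm0 : (0 : ℝ) < m := by exact_mod_cast (by omega : 0 < m)
  have hmn : (n : ℝ) < m := by exact_mod_cast (by omega : n < m)
  set Δ := h / m with hΔ
  have hΔ0 : 0 ≤ Δ := by positivity
  have hΔδ : Δ < δ := by
    rw [hΔ, div_lt_iff₀ hm0]
    rw [div_lt_iff₀ hδ] at hn
    nlinarith
  have hmΔ : m * Δ = h := by rw [hΔ]; field_simp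
  have hsum := intervalIntegral.sum_integral_adjacent_intervals (μ := volume) (f := u) (a := fun k : ℕ => t + k * Δ) (n := m)
    (fun k _ => hu.intervalIntegrable _ _)
  simp only [Nat.cast_zero, zero_mul, add_zero, hmΔ] at hsum
  rw [show t + h = b by rw [hh]; ring] at hsum
  rw [← hsum, Finset.mul_sum, dist_eq_norm, ← Finset.sum_sub_distrib]
  have hcell : ∀ k ∈ Finset.range m, ‖Δ * u (t + k * Δ) - ∫ r in (t + k * Δ)..(t + (k + 1 : ℕ) * Δ), u r‖ ≤ η / (h + 1) * Δ := by
    intro k hk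
    have hk : (k : ℝ) + 1 ≤ m := by exact_mod_cast Finset.mem_range.1 hk
    have e1 : t + (k + 1 : ℕ) * Δ - (t + k * Δ) = Δ := by push_cast; ring
    have : Δ * u (t + k * Δ) = ∫ r in (t + k * Δ)..(t + (k + 1 : ℕ) * Δ), u (t + k * Δ) := by
      rw [intervalIntegral.integral_const, e1, smul_eq_mul]
    rw [this, ← intervalIntegral.integral_sub (intervalIntegrable_const) (hu.intervalIntegrable _ _)]
    refine (intervalIntegral.norm_integral_le_of_norm_le_const fun r hr => ?_).trans_eq
      (by rw [e1, abs_of_nonneg hΔ0])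
    rw [uIoc_of_le (by push_cast; nlinarith)] at hr
    have h1 : 0 ≤ (k:ℝ) * Δ := by positivity
    have h2 : (k + 1 : ℝ) * Δ ≤ h := by rw [← hmΔ]; exact mul_le_mul_of_nonneg_right hk hΔ0
    have h3 := hr.2
    push_cast at h3
    have hb : b = t + h := by rw [hh]; ring
    refine (H _ ⟨by linarith, by linarith⟩ _ ⟨by linarith [hr.1], by linarith⟩ ?_).le
    rw [Real.dist_eq, abs_lt]
    constructor <;> linarith [hr.1]
  refine (norm_sum_le_of_le _ hcell).trans_lt ?_
  rw [Finset.sum_const, Finset.card_range, nsmul_eq_mul, mul_left_comm, hmΔ, div_mul_eq_mul_div, div_lt_iff₀ (by positivity)]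
  nlinarith

/-- The line primitive of a continuous function, whose increments are integrals of
differences. -/
lemma line_primitive {c : EuclideanSpace ℝ (Fin d) → ℝ} (hc : Continuous c) {L ε C : ℝ} (hL : ∀ z, |c z| ≤ L)
    (hmod : ∀ z w, |c (z + w) - c z| ≤ ε + C * ‖w‖) (hC : 0 ≤ C) (x₂ e : EuclideanSpace ℝ (Fin d)) (he : ‖e‖ = 1) (l : ℝ) (hl : 0 ≤ l) :
    Continuous (fun z => ∫ θ in (0:ℝ)..l, c (z + x₂ + θ • e)) ∧
    (∀ z, |∫ θ in (0:ℝ)..l, c (z + x₂ + θ • e)| ≤ l * L) ∧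
    ∀ z (y : ℝ), |(∫ θ in (0:ℝ)..l, c (z + y • e + x₂ + θ • e)) - (∫ θ in (0:ℝ)..l, c (z + x₂ + θ • e)) -
      y * (c (z + (x₂ + l • e)) - c (z + x₂))| ≤ |y| * (2 * ε + 2 * C * |y|) := by
  refine ⟨?_, fun z => ?_, fun z y => ?_⟩
  · exact intervalIntegral.continuous_parametric_intervalIntegral_of_continuous' (by fun_prop) _ _
  · refine (intervalIntegral.norm_integral_le_of_norm_le_const (C := L) (f := fun θ : ℝ => c (z + x₂ + θ • e)) fun r hr => hL _).trans_eq ?_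
    rw [sub_zero, abs_of_nonneg hl, mul_comm]
  · have hcont : Continuous fun θ : ℝ => c (z + x₂ + θ • e) := by fun_prop
    have hii : ∀ a b, IntervalIntegrable (fun θ : ℝ => c (z + x₂ + θ • e)) volume a b := fun a b => hcont.intervalIntegrable _ _
    have e1 : (∫ θ in (0:ℝ)..l, c (z + y • e + x₂ + θ • e)) = ∫ θ in y..(l + y), c (z + x₂ + θ • e) := by
      have := intervalIntegral.integral_comp_add_right (a := 0) (b := l) (fun θ : ℝ => c (z + x₂ + θ • e)) y
      rw [zero_add] at this
      rw [← this]
      refine intervalIntegral.integral_congr fun θ _ => ?_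
      simp only [add_smul]
      congr 1
      abel
    have e2 : (∫ θ in l..(l + y), c (z + x₂ + θ • e)) = ∫ θ in (0:ℝ)..y, c (z + x₂ + (θ + l) • e) := by
      have := intervalIntegral.integral_comp_add_right (a := 0) (b := y) (fun θ : ℝ => c (z + x₂ + θ • e)) l
      rw [zero_add, add_comm y l] at this
      rw [← this]
    have e3 : (∫ θ in (0:ℝ)..l, c (z + y • e + x₂ + θ • e)) - (∫ θ in (0:ℝ)..l, c (z + x₂ + θ • e)) -
      y * (c (z + (x₂ + l • e)) - c (z + x₂)) = ∫ θ in (0:ℝ)..y, ((c (z + x₂ + (θ + l) • e) - c (z + x₂ + l • e)) - (c (z + x₂ + θ • e) - c (z + x₂))) := by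
      rw [intervalIntegral.integral_sub ((by fun_prop : Continuous fun θ : ℝ => c (z + x₂ + (θ + l) • e) - c (z + x₂ + l • e)).intervalIntegrable _ _)
        ((hii _ _).sub intervalIntegrable_const),
        intervalIntegral.integral_sub ((by fun_prop : Continuous fun θ : ℝ => c (z + x₂ + (θ + l) • e)).intervalIntegrable _ _) intervalIntegrable_const,
        intervalIntegral.integral_sub (hii _ _) intervalIntegrable_const, ← e2, e1,
        ← intervalIntegral.integral_add_adjacent_intervals (hii y l) (hii l (l + y)),
        ← intervalIntegral.integral_add_adjacent_intervals (hii 0 y) (hii y l)]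
      simp only [intervalIntegral.integral_const, smul_eq_mul, sub_zero, add_assoc]
      ring
    rw [e3]
    refine (intervalIntegral.norm_integral_le_of_norm_le_const (C := 2 * ε + 2 * C * |y|) (f := fun θ : ℝ => ((c (z + x₂ + (θ + l) • e) - c (z + x₂ + l • e)) - (c (z + x₂ + θ • e) - c (z + x₂)))) fun θ hθ => ?_).trans_eq (by rw [sub_zero, mul_comm])
    have hθy : |θ| ≤ |y| := by
      rcases le_total 0 y with h | h
      · rw [uIoc_of_le h] at hθ
        exact abs_le_abs_of_nonneg hθ.1.le hθ.2
      · rw [uIoc_of_ge h] at hθ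
        exact abs_le_abs_of_nonpos hθ.2 hθ.1.le
    have hn : ‖θ • e‖ = |θ| := by rw [norm_smul, he, mul_one, Real.norm_eq_abs]
    have a1 := hmod (z + x₂ + l • e) (θ • e)
    have a2 := hmod (z + x₂) (θ • e)
    rw [hn] at a1 a2
    rw [show z + x₂ + (θ + l) • e = z + x₂ + l • e + θ • e by rw [add_smul]; abel]
    refine (norm_sub_le _ _).trans ?_
    have := mul_le_mul_of_nonneg_left hθy hC
    rw [Real.norm_eq_abs, Real.norm_eq_abs]
    linarith

lemma modulus_affine {c : ℝ × EuclideanSpace ℝ (Fin d) → ℝ} (hc : UniformContinuous c) {L : ℝ} (hL : ∀ z, |c z| ≤ L) {ε : ℝ} (hε : 0 < ε) :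
    ∃ C, 0 ≤ C ∧ ∀ p q, |c p - c q| ≤ ε + C * ‖p - q‖ := by
  have hL0 : 0 ≤ L := (abs_nonneg _).trans (hL 0)
  rw [Metric.uniformContinuous_iff] at hc
  obtain ⟨δ, hδ, H⟩ := hc ε hε
  refine ⟨2 * L / δ, by positivity, fun p q => ?_⟩
  by_cases h : dist p q < δ
  · have := (H h).le
    rw [Real.dist_eq] at this
    have h2 : 0 ≤ 2 * L / δ * ‖p - q‖ := by positivity
    linarith
  · rw [not_lt, dist_eq_norm] at h
    have h2 : 2 * L ≤ 2 * L / δ * ‖p - q‖ := by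
      rw [div_mul_eq_mul_div, le_div_iff₀ hδ]
      exact mul_le_mul_of_nonneg_left h (by positivity)
    have := abs_sub (c p) (c q)
    linarith [hL p, hL q]

variable [IsProbabilityMeasure P]

open scoped Topology in
lemma davie_continuous (hW : IsBrownianSheet P d W) (hc : ∀ ω, Continuous fun p => W p ω) {s t b : ℝ} (hs0 : 0 < s) (hs1 : s ≤ 1)
    (ht : 0 ≤ t) (htb : t ≤ b) (hb : b ≤ 1) {c : ℝ × EuclideanSpace ℝ (Fin d) → ℝ} (hcc : Continuous c) (hcs : HasCompactSupport c)
    {L : ℝ} (hL : ∀ z, |c z| ≤ L) (x₁ x₂ : EuclideanSpace ℝ (Fin d)) :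
    ∫ ω, (∫ r in t..b, (c (r, x₁ + (W (s, r) ω - W (s, t) ω)) - c (r, x₂ + (W (s, r) ω - W (s, t) ω)))) ^ 2 ∂P ≤
      16 * L ^ 2 * (b - t) * ‖x₁ - x₂‖ ^ 2 / s := by
  have hL0 : 0 ≤ L := (abs_nonneg _).trans (hL 0)
  rcases eq_or_ne x₁ x₂ with rfl | hx
  · simp
  set x := x₁ - x₂ with hxdef
  have hx0 : 0 < ‖x‖ := norm_pos_iff.2 (sub_ne_zero.2 hx)
  set e := (‖x‖⁻¹ : ℝ) • x with hedef
  have he : ‖e‖ = 1 := norm_smul_inv_norm (𝕜 := ℝ) (sub_ne_zero.2 hx)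
  have hxe : x₂ + ‖x‖ • e = x₁ := by
    rw [hedef, smul_smul, mul_inv_cancel₀ hx0.ne', one_smul, hxdef]; abel
  set h := b - t with hh
  have h0 : 0 ≤ h := sub_nonneg.2 htb
  have huc : UniformContinuous c := hcs.uniformContinuous_of_continuous hcc
  set K := ‖x‖ * L with hK
  have hK0 : 0 ≤ K := by positivity
  set I := ∫ ω, (∫ r in t..b, (c (r, x₁ + (W (s, r) ω - W (s, t) ω)) - c (r, x₂ + (W (s, r) ω - W (s, t) ω)))) ^ 2 ∂P with hI
  -- the Riemann sums
  set g : ℕ → ℕ → EuclideanSpace ℝ (Fin d) → ℝ := fun m k z => c (t + k * (h / m), z + x₁) - c (t + k * (h / m), z + x₂) with hg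
  have hgb : ∀ m k z, |g m k z| ≤ 2 * L := fun m k z => by
    refine (abs_sub _ _).trans ?_
    linarith [hL (t + k * (h / m), z + x₁), hL (t + k * (h / m), z + x₂)]
  have hgm : ∀ m k, Measurable (g m k) := fun m k => by
    have : Continuous (g m k) := by simp only [hg]; fun_prop
    exact this.measurable
  have hlim : Tendsto (fun m : ℕ => ∫ ω, (s * (h / m) * ∑ k ∈ Finset.range m, g m k (walk W s t (h / m) k ω)) ^ 2 ∂P) atTop (𝓝 (s ^ 2 * I)) := by
    rw [hI, ← integral_const_mul]
    refine tendsto_integral_of_dominated_convergence (fun _ => (s * h * (2 * L)) ^ 2) (fun m => ?_) (integrable_const _) (fun m => ae_of_all _ fun ω => ?_) (ae_of_all _ fun ω => ?_)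
    · have : Measurable fun ω => (s * (h / m) * ∑ k ∈ Finset.range m, g m k (walk W s t (h / m) k ω)) ^ 2 :=
        ((Finset.measurable_fun_sum _ fun k _ => (hgm m k).comp (walk_measurable hW k)).const_mul _).pow_const _
      exact this.aestronglyMeasurable
    · rw [norm_pow]
      refine pow_le_pow_left₀ (norm_nonneg _) ?_ 2
      rw [norm_mul, Real.norm_of_nonneg (by positivity)]
      rcases Nat.eq_zero_or_pos m with rfl | hm
      · simp; positivity
      have hm0 : (0 : ℝ) < m := by exact_mod_cast hm
      have := norm_sum_le_of_le (Finset.range m) (f := fun k => g m k (walk W s t (h / m) k ω)) (n := fun _ => 2 * L) (fun k _ => hgb _ _ _)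
      rw [Finset.sum_const, Finset.card_range, nsmul_eq_mul] at this
      refine (mul_le_mul_of_nonneg_left this (by positivity)).trans_eq ?_
      field_simp
    · have hWc : Continuous fun r => W (s, r) ω := (hc ω).comp (by fun_prop)
      have hu : Continuous fun r => c (r, x₁ + (W (s, r) ω - W (s, t) ω)) - c (r, x₂ + (W (s, r) ω - W (s, t) ω)) := by fun_prop
      have := (tendsto_riemann_sum hu htb).const_mul s
      have := this.pow 2
      rw [mul_pow] at this
      refine this.congr fun m => ?_
      simp only [hg, walk, ← hh]
      rw [mul_assoc]
      congr 4
      ext k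
      rw [add_comm x₁, add_comm x₂]
  -- the bound for fixed `ε`
  have hbound : ∀ ε > 0, s ^ 2 * I ≤ (4 * K * √(h * s) + 2 * ε * √(gmom 4) * (s * h)) ^ 2 := by
    intro ε hε
    obtain ⟨C, hC, hmod⟩ := modulus_affine huc hL hε
    have hmod' : ∀ (r : ℝ) z w, |c (r, z + w) - c (r, z)| ≤ ε + C * ‖w‖ := fun r z w => by
      have := hmod (r, z + w) (r, z)
      simpa using this
    have hm0 : Tendsto (fun m : ℕ => √(s * (h / m))) atTop (𝓝 0) := by
      have : Tendsto (fun m : ℕ => s * (h / m)) atTop (𝓝 (s * 0)) := (tendsto_const_div_atTop_nhds_zero_nat h).const_mul s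
      have := this.sqrt
      simpa using this
    have hR : Tendsto (fun m : ℕ => (4 * K * √(h * s) + 2 * ε * √(gmom 4) * (s * h) + 2 * C * √(gmom 6) * (s * h) * √(s * (h / m)) +
        2 * L * √(gmom 4 + 1) * √(s * h) * √(s * (h / m))) ^ 2) atTop (𝓝 ((4 * K * √(h * s) + 2 * ε * √(gmom 4) * (s * h) + 2 * C * √(gmom 6) * (s * h) * 0 +
        2 * L * √(gmom 4 + 1) * √(s * h) * 0) ^ 2)) :=
      (((hm0.const_mul _).const_add _).add (hm0.const_mul _)).pow 2
    simp only [mul_zero, add_zero] at hR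
    refine le_of_tendsto_of_tendsto hlim hR ?_
    filter_upwards [eventually_gt_atTop 0] with m hm
    have hm' : (0 : ℝ) < m := by exact_mod_cast hm
    have hmΔ : m * (h / m) = h := by field_simp
    have hΔ0 : 0 ≤ s * (h / m) := by positivity
    have wt : WalkTimes s t (h / m) m := ⟨hs0.le, hs1, ht, by positivity, by rw [hmΔ, hh]; linarith⟩
    have lp := fun k : ℕ => line_primitive (c := fun z => c (t + k * (h / m), z)) (by fun_prop) (fun z => hL _) (fun z w => hmod' _ z w) hC x₂ e he ‖x‖ hx0.le
    have := davie_discrete hW wt he (φ := fun k z => ∫ θ in (0:ℝ)..‖x‖, c (t + k * (h / m), z + x₂ + θ • e)) (g := g m)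
      (fun k => (lp k).1.measurable) (hgm m) hK0 (by positivity : 0 ≤ 2 * L) (by positivity : 0 ≤ 2 * ε) (by positivity : 0 ≤ 2 * C)
      (fun k z => (lp k).2.1 z) (hgb m) (fun k z y => by
        have := (lp k).2.2 z y
        rw [hxe] at this
        exact this)
    refine this.trans_eq ?_
    congr 1
    have q1 : √(s * (h / m)) ^ 2 = s * (h / m) := Real.sq_sqrt hΔ0
    have q2 : √(m * (gmom 4 + 1)) * (s * (h / m)) = √(gmom 4 + 1) * √(s * h) * √(s * (h / m)) := by
      have e1 : √(s * h) = √m * √(s * (h / m)) := by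
        rw [← Real.sqrt_mul hm'.le, mul_left_comm, hmΔ]
      rw [Real.sqrt_mul hm'.le, e1]
      nth_rw 1 [← q1]
      ring
    have q3 : m * (s * (h / m)) = h * s := by rw [mul_left_comm, hmΔ, mul_comm]
    rw [q3]
    have q4 : √(s * (h / m)) ^ 3 = s * (h / m) * √(s * (h / m)) := by rw [pow_succ, q1]
    rw [q4, q1, mul_assoc (2 * L), q2]
    have q5 : (m:ℝ) * (2 * ε * (√(gmom 4) * (s * (h / m))) + 2 * C * (√(gmom 6) * (s * (h / m) * √(s * (h / m))))) =
      2 * ε * √(gmom 4) * (m * (s * (h / m))) + 2 * C * √(gmom 6) * (m * (s * (h / m))) * √(s * (h / m)) := by ring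
    rw [q5, q3]
    ring
  have hfin : s ^ 2 * I ≤ (4 * K * √(h * s)) ^ 2 := by
    have hε : Tendsto (fun ε : ℝ => (4 * K * √(h * s) + 2 * ε * √(gmom 4) * (s * h)) ^ 2) (𝓝[>] 0) (𝓝 ((4 * K * √(h * s) + 2 * 0 * √(gmom 4) * (s * h)) ^ 2)) := by
      have : Continuous fun ε : ℝ => (4 * K * √(h * s) + 2 * ε * √(gmom 4) * (s * h)) ^ 2 := by fun_prop
      exact (this.tendsto 0).mono_left nhdsWithin_le_nhds
    have := ge_of_tendsto hε (eventually_mem_nhdsWithin.mono fun ε hε => hbound ε hε)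
    simpa using this
  rw [mul_pow, mul_pow, Real.sq_sqrt (by positivity), hK] at hfin
  rw [le_div_iff₀ hs0]
  have : s * (I * s) ≤ s * (16 * L ^ 2 * h * ‖x‖ ^ 2) := by linarith
  exact le_of_mul_le_mul_left this hs0

end

section

lemma measurable_uncurry_of_continuous' {α β γ : Type*} [TopologicalSpace α] [MeasurableSpace α] [SecondCountableTopology α]
    [TopologicalSpace.MetrizableSpace α] [OpensMeasurableSpace α] [MeasurableSpace β] [TopologicalSpace γ] [TopologicalSpace.PseudoMetrizableSpace γ]
    [MeasurableSpace γ] [BorelSpace γ] {u : α → β → γ} (h1 : ∀ x, Continuous fun a => u a x) (h2 : ∀ a, Measurable (u a)) :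
    Measurable fun q : α × β => u q.1 q.2 :=
  measurable_uncurry_of_continuous_of_measurable (u := u) h1 h2

lemma measurable_integral_left {α F : Type*} [MeasurableSpace α] {ν : Measure α} [SFinite ν] [NormedAddCommGroup F] [NormedSpace ℝ F]
    [SecondCountableTopology F] [MeasurableSpace F] [BorelSpace F] {J : α → Ω → F} (h : Measurable fun q : α × Ω => J q.1 q.2) :
    Measurable fun ω => ∫ r, J r ω ∂ν :=
  ((h.comp measurable_swap).stronglyMeasurable.integral_prod_right' (ν := ν)).measurable

variable [IsProbabilityMeasure P]

lemma sq_le_sq_add {a b L : ℝ} (ha : |a| ≤ L) (hb : |b| ≤ L) : a ^ 2 ≤ b ^ 2 + 2 * L * |a - b| := by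
  have h1 : a ^ 2 - b ^ 2 ≤ |a + b| * |a - b| := by
    rw [← abs_mul]; refine le_trans (le_of_eq (by ring)) (le_abs_self _)
  have h2 : |a + b| ≤ 2 * L := (abs_add_le _ _).trans (by linarith)
  nlinarith [mul_le_mul_of_nonneg_right h2 (abs_nonneg (a - b))]

lemma davie_measurable (hW : IsBrownianSheet P d W) (hc : ∀ ω, Continuous fun p => W p ω) {s t b : ℝ} (hs0 : 0 < s) (hs1 : s ≤ 1)
    (ht : 0 ≤ t) (htb : t ≤ b) (hb : b ≤ 1) {f : ℝ × EuclideanSpace ℝ (Fin d) → ℝ} (hf : Measurable f)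
    {L : ℝ} (hL : ∀ z, |f z| ≤ L) (x₁ x₂ : EuclideanSpace ℝ (Fin d)) :
    ∫ ω, (∫ r in t..b, (f (r, x₁ + (W (s, r) ω - W (s, t) ω)) - f (r, x₂ + (W (s, r) ω - W (s, t) ω)))) ^ 2 ∂P ≤
      16 * L ^ 2 * (b - t) * ‖x₁ - x₂‖ ^ 2 / s := by
  have hL0 : 0 ≤ L := (abs_nonneg _).trans (hL 0)
  set ν := (volume.restrict (Ioc t b)).prod P with hν
  have hpath : ∀ x, Measurable fun q : ℝ × Ω => (q.1, x + (W (s, q.1) q.2 - W (s, t) q.2)) := fun x => by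
    have h1 : Measurable fun q : ℝ × Ω => W (s, q.1) q.2 :=
      measurable_uncurry_of_continuous' (u := fun r ω => W (s, r) ω) (fun ω => (hc ω).comp (by fun_prop)) (fun r => hW.1 _)
    exact measurable_fst.prodMk ((h1.sub ((hW.1 _).comp measurable_snd)).const_add x)
  set μ := ν.map (fun q : ℝ × Ω => (q.1, x₁ + (W (s, q.1) q.2 - W (s, t) q.2))) + ν.map (fun q : ℝ × Ω => (q.1, x₂ + (W (s, q.1) q.2 - W (s, t) q.2))) with hμ
  have hfin : IsFiniteMeasure μ := by rw [hμ]; infer_instance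
  have hfm : MemLp f 1 μ := MemLp.of_bound hf.aestronglyMeasurable L (ae_of_all _ hL)
  refine le_of_forall_pos_le_add fun η hη => ?_
  set ε := η / (4 * L * (b - t) + 1) with hε
  have hbt : 0 ≤ b - t := sub_nonneg.2 htb
  have hε0 : 0 < ε := by positivity
  obtain ⟨c', hcs', hcε, hcc', -⟩ := hfm.exists_hasCompactSupport_eLpNorm_sub_le (by simp) (ε := ENNReal.ofReal ε) (by simpa using hε0)
  set c : ℝ × EuclideanSpace ℝ (Fin d) → ℝ := fun z => max (-L) (min L (c' z)) with hcdef
  have hcc : Continuous c := by fun_prop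
  have hcL : ∀ z, |c z| ≤ L := fun z => abs_le.2 ⟨le_max_left _ _, max_le (by linarith) (min_le_left _ _)⟩
  have hcs : HasCompactSupport c := by
    refine hcs'.comp_left (g := fun y => max (-L) (min L y)) ?_
    simp [hL0]
  have hfc : ∀ z, |f z - c z| ≤ |f z - c' z| := fun z => by
    have h := abs_le.1 (hL z)
    have : f z = max (-L) (min L (f z)) := by rw [min_eq_right h.2, max_eq_right h.1]
    conv_lhs => rw [this]
    have e1 := abs_max_sub_max_le_max (-L) (min L (f z)) (-L) (min L (c' z))
    have e2 := abs_min_sub_min_le_max L (f z) L (c' z)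
    simp only [sub_self, abs_zero, abs_nonneg, max_eq_right] at e1 e2
    exact e1.trans e2
  have hdist : ∫ z, |f z - c z| ∂μ ≤ ε := by
    have hm : AEStronglyMeasurable (fun z => |f z - c z|) μ := (hf.sub hcc.measurable).abs.aestronglyMeasurable
    rw [integral_eq_lintegral_of_nonneg_ae (ae_of_all _ fun _ => abs_nonneg _) hm]
    refine ENNReal.toReal_le_of_le_ofReal hε0.le (le_trans ?_ hcε)
    rw [eLpNorm_one_eq_lintegral_enorm]
    refine lintegral_mono fun z => ?_
    rw [← ofReal_norm]
    exact ENNReal.ofReal_le_ofReal (hfc z)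
  have hfint : Integrable (fun z => |f z - c z|) μ := by
    refine Integrable.of_bound (hf.sub hcc.measurable).abs.aestronglyMeasurable (2 * L) (ae_of_all _ fun z => ?_)
    rw [Real.norm_eq_abs, abs_abs]
    refine (abs_sub _ _).trans (by linarith [hL z, hcL z])
  have hm : ∀ μ' : Measure (ℝ × EuclideanSpace ℝ (Fin d)), AEStronglyMeasurable (fun z => |f z - c z|) μ' := fun _ => (hf.sub hcc.measurable).abs.aestronglyMeasurable
  set H : (ℝ × EuclideanSpace ℝ (Fin d) → ℝ) → Ω → ℝ → ℝ := fun f ω r => f (r, x₁ + (W (s, r) ω - W (s, t) ω)) - f (r, x₂ + (W (s, r) ω - W (s, t) ω)) with hH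
  have hHm : ∀ g : ℝ × EuclideanSpace ℝ (Fin d) → ℝ, Measurable g → Measurable fun q : Ω × ℝ => H g q.1 q.2 := fun g hg =>
    ((hg.comp (hpath x₁)).sub (hg.comp (hpath x₂))).comp measurable_swap
  have hHb : ∀ g : ℝ × EuclideanSpace ℝ (Fin d) → ℝ, (∀ z, |g z| ≤ L) → ∀ ω r, |H g ω r| ≤ 2 * L := fun g hg ω r =>
    (abs_sub _ _).trans (by linarith [hg (r, x₁ + (W (s, r) ω - W (s, t) ω)), hg (r, x₂ + (W (s, r) ω - W (s, t) ω))])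
  have hHi : ∀ g : ℝ × EuclideanSpace ℝ (Fin d) → ℝ, Measurable g → (∀ z, |g z| ≤ L) → ∀ ω, IntervalIntegrable (H g ω) volume t b := fun g hg hb ω => by
    rw [intervalIntegrable_iff_integrableOn_Ioc_of_le htb]
    exact Integrable.of_bound ((hHm g hg).comp measurable_prodMk_left).aestronglyMeasurable (2 * L) (ae_of_all _ fun r => hHb g hb ω r)
  have hIb : ∀ g : ℝ × EuclideanSpace ℝ (Fin d) → ℝ, Measurable g → (∀ z, |g z| ≤ L) → ∀ ω, |∫ r in t..b, H g ω r| ≤ 2 * L * (b - t) := fun g hg hb ω => by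
    refine (intervalIntegral.norm_integral_le_of_norm_le_const (f := H g ω) fun r hr => hHb g hb ω r).trans_eq ?_
    rw [abs_of_nonneg hbt]
  have hIm : ∀ g : ℝ × EuclideanSpace ℝ (Fin d) → ℝ, Measurable g → Measurable fun ω => ∫ r in t..b, H g ω r := fun g hg => by
    simp only [intervalIntegral.integral_of_le htb]
    exact ((hHm g hg).stronglyMeasurable.integral_prod_right (ν := volume.restrict (Ioc t b))).measurable
  have hdc := davie_continuous hW hc hs0 hs1 ht htb hb hcc hcs hcL x₁ x₂
  -- comparison of the two functionals
  set D : Ω → ℝ → ℝ := fun ω r => |f (r, x₁ + (W (s, r) ω - W (s, t) ω)) - c (r, x₁ + (W (s, r) ω - W (s, t) ω))| +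
    |f (r, x₂ + (W (s, r) ω - W (s, t) ω)) - c (r, x₂ + (W (s, r) ω - W (s, t) ω))| with hD
  have hfint' : Integrable (fun q : ℝ × Ω => D q.2 q.1) ν := by
    rw [hμ, integrable_add_measure] at hfint
    exact (hfint.1.comp_measurable (hpath x₁)).add (hfint.2.comp_measurable (hpath x₂))
  have hDint : ∫ ω, (∫ r in t..b, D ω r) ∂P ≤ ε := by
    simp only [intervalIntegral.integral_of_le htb]
    have e1 : ∫ ω, (∫ r in Ioc t b, D ω r) ∂P = ∫ q, D q.2 q.1 ∂ν := by
      rw [hν, integral_prod_symm _ hfint']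
    rw [e1]
    refine le_trans (le_of_eq ?_) hdist
    have hint2 := hfint
    rw [hμ, integrable_add_measure] at hint2
    rw [hμ, integral_add_measure hint2.1 hint2.2, integral_map (hpath x₁).aemeasurable (hm _),
      integral_map (hpath x₂).aemeasurable (hm _), 
      ← integral_add]
    · exact hint2.1.comp_measurable (hpath x₁)
    · exact hint2.2.comp_measurable (hpath x₂)
  have hDi : Integrable (fun ω => ∫ r in t..b, D ω r) P := by
    simp only [intervalIntegral.integral_of_le htb]
    exact (hfint'.swap).integral_prod_left
  have hpt : ∀ ω, (∫ r in t..b, H f ω r) ^ 2 ≤ (∫ r in t..b, H c ω r) ^ 2 + 4 * L * (b - t) * ∫ r in t..b, D ω r := by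
    intro ω
    refine (sq_le_sq_add (hIb f hf hL ω) (hIb c hcc.measurable hcL ω)).trans ?_
    have hmD : Measurable (D ω) := by
      have h1 := fun x => (hpath x).comp (measurable_prodMk_right (y := ω))
      exact ((hf.comp (h1 x₁)).sub (hcc.measurable.comp (h1 x₁))).abs.add ((hf.comp (h1 x₂)).sub (hcc.measurable.comp (h1 x₂))).abs
    have : |(∫ r in t..b, H f ω r) - ∫ r in t..b, H c ω r| ≤ ∫ r in t..b, D ω r := by
      rw [← intervalIntegral.integral_sub (hHi f hf hL ω) (hHi c hcc.measurable hcL ω)]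
      rw [← Real.norm_eq_abs]
      refine intervalIntegral.norm_integral_le_of_norm_le htb (ae_of_all _ fun r _ => ?_) ?_
      · simp only [hH, hD]
        rw [Real.norm_eq_abs]
        refine le_trans (le_of_eq ?_) (abs_sub _ _)
        congr 1; ring
      · rw [intervalIntegrable_iff_integrableOn_Ioc_of_le htb]
        refine Integrable.of_bound hmD.aestronglyMeasurable (4 * L) (ae_of_all _ fun r => ?_)
        simp only [hD]
        rw [Real.norm_of_nonneg (by positivity)]
        have a1 := abs_sub (f (r, x₁ + (W (s, r) ω - W (s, t) ω))) (c (r, x₁ + (W (s, r) ω - W (s, t) ω)))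
        have a2 := abs_sub (f (r, x₂ + (W (s, r) ω - W (s, t) ω))) (c (r, x₂ + (W (s, r) ω - W (s, t) ω)))
        linarith [hL (r, x₁ + (W (s, r) ω - W (s, t) ω)), hcL (r, x₁ + (W (s, r) ω - W (s, t) ω)), hL (r, x₂ + (W (s, r) ω - W (s, t) ω)), hcL (r, x₂ + (W (s, r) ω - W (s, t) ω))]
    have := mul_le_mul_of_nonneg_left this (by positivity : 0 ≤ 2 * (2 * L * (b - t)))
    linarith
  have hci : Integrable (fun ω => (∫ r in t..b, H c ω r) ^ 2) P :=
    Integrable.of_bound ((hIm c hcc.measurable).pow_const 2).aestronglyMeasurable ((2 * L * (b - t)) ^ 2) (ae_of_all _ fun ω => by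
      rw [norm_pow]
      exact pow_le_pow_left₀ (norm_nonneg _) (hIb c hcc.measurable hcL ω) 2)
  calc _ ≤ ∫ ω, ((∫ r in t..b, H c ω r) ^ 2 + 4 * L * (b - t) * ∫ r in t..b, D ω r) ∂P :=
        integral_mono_of_nonneg (ae_of_all _ fun ω => sq_nonneg _) (hci.add (hDi.const_mul _)) (ae_of_all _ hpt)
    _ = (∫ ω, (∫ r in t..b, H c ω r) ^ 2 ∂P) + 4 * L * (b - t) * ∫ ω, (∫ r in t..b, D ω r) ∂P := by
        rw [integral_add hci (hDi.const_mul _), integral_const_mul]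
    _ ≤ _ := by
        refine add_le_add hdc ?_
        refine (mul_le_mul_of_nonneg_left hDint (by positivity)).trans ?_
        rw [hε, mul_div_assoc', div_le_iff₀ (by positivity)]
        nlinarith

lemma integral_sq_eq {Ω' : Type*} [MeasurableSpace Ω'] {ν : Measure Ω'} [IsProbabilityMeasure ν] {J : ℝ → Ω' → ℝ}
    (hJ : Measurable fun q : ℝ × Ω' => J q.1 q.2) {K : ℝ} (hK : ∀ r ω, |J r ω| ≤ K) (t b : ℝ) :
    ∫ ω, (∫ r in Ioc t b, J r ω) ^ 2 ∂ν = ∫ r in Ioc t b, ∫ r' in Ioc t b, (∫ ω, J r ω * J r' ω ∂ν) := by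
  have h1 : ∀ ω, (∫ r in Ioc t b, J r ω) ^ 2 = ∫ r in Ioc t b, ∫ r' in Ioc t b, J r ω * J r' ω := fun ω => by
    simp only [integral_const_mul, integral_mul_const, pow_two]
  have hb : ∀ r r' ω, ‖J r ω * J r' ω‖ ≤ K * K := fun r r' ω => by
    rw [norm_mul]; exact mul_le_mul (hK _ _) (hK _ _) (norm_nonneg _) ((abs_nonneg _).trans (hK r ω))
  have hm : Measurable fun q : (Ω' × ℝ) × ℝ => J q.1.2 q.1.1 * J q.2 q.1.1 :=
    (hJ.comp (by fun_prop : Measurable fun q : (Ω' × ℝ) × ℝ => (q.1.2, q.1.1))).mul (hJ.comp (by fun_prop : Measurable fun q : (Ω' × ℝ) × ℝ => (q.2, q.1.1)))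
  simp only [h1]
  rw [integral_integral_swap]
  · refine integral_congr_ae (ae_of_all _ fun r => ?_)
    simp only
    rw [integral_integral_swap]
    have h2 : Measurable fun q : Ω' × ℝ => J r q.1 * J q.2 q.1 :=
      (hJ.comp (by fun_prop : Measurable fun q : Ω' × ℝ => (r, q.1))).mul (hJ.comp (by fun_prop : Measurable fun q : Ω' × ℝ => (q.2, q.1)))
    exact Integrable.of_bound h2.aestronglyMeasurable (K * K) (ae_of_all _ fun q => hb _ _ _)
  · refine Integrable.of_bound (hm.stronglyMeasurable.integral_prod_right (ν := volume.restrict (Ioc t b))).aestronglyMeasurable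
      (K * K * (volume.restrict (Ioc t b)).real univ) (ae_of_all _ fun q => ?_)
    exact norm_integral_le_of_norm_le_const (ae_of_all _ fun r => hb _ _ _)

lemma davie_transfer (hW : IsBrownianSheet P d W) (hc : ∀ ω, Continuous fun p => W p ω) {s t b : ℝ} (hs0 : 0 < s) (hs1 : s ≤ 1)
    (ht : 0 ≤ t) (htb : t ≤ b) (hb : b ≤ 1) {f : ℝ × EuclideanSpace ℝ (Fin d) → ℝ} (hf : Measurable f)
    {L : ℝ} (hL : ∀ z, |f z| ≤ L) {Q : Measure Ω} [IsProbabilityMeasure Q] {I : ℝ → Ω → EuclideanSpace ℝ (Fin d)}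
    (hIc : ∀ ω, Continuous fun r => I r ω) (hIm : ∀ r, Measurable (I r)) {g : Ω → EuclideanSpace ℝ (Fin d) × EuclideanSpace ℝ (Fin d)}
    (hg : Measurable g)
    (hind : ∀ r ∈ Ioc t b, ∀ r' ∈ Ioc t b, Q.map (fun ω => (g ω, (I r ω, I r' ω))) =
      (Q.map g).prod (P.map fun ω => (W (s, r) ω - W (s, t) ω, W (s, r') ω - W (s, t) ω))) :
    ∫⁻ ω, ENNReal.ofReal ((∫ r in t..b, (f (r, (g ω).1 + I r ω) - f (r, (g ω).2 + I r ω))) ^ 2) ∂Q ≤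
      ENNReal.ofReal (16 * L ^ 2 * (b - t) / s) * ∫⁻ ω, ENNReal.ofReal (‖(g ω).1 - (g ω).2‖ ^ 2) ∂Q := by
  have hL0 : 0 ≤ L := (abs_nonneg _).trans (hL 0)
  have hbt : 0 ≤ b - t := sub_nonneg.2 htb
  have hpQ : IsProbabilityMeasure (Q.map g) := Measure.isProbabilityMeasure_map hg.aemeasurable
  set ψ : ℝ → (EuclideanSpace ℝ (Fin d) × EuclideanSpace ℝ (Fin d)) → EuclideanSpace ℝ (Fin d) → ℝ := fun r x z => f (r, x.1 + z) - f (r, x.2 + z) with hψ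
  have hψm : Measurable fun q : ℝ × (EuclideanSpace ℝ (Fin d) × EuclideanSpace ℝ (Fin d)) × EuclideanSpace ℝ (Fin d) => ψ q.1 q.2.1 q.2.2 :=
    (hf.comp (by fun_prop)).sub (hf.comp (by fun_prop))
  have hψb : ∀ r x z, |ψ r x z| ≤ 2 * L := fun r x z => (abs_sub _ _).trans (by linarith [hL (r, x.1 + z), hL (r, x.2 + z)])
  have hI' : Measurable fun q : ℝ × Ω => I q.1 q.2 := measurable_uncurry_of_continuous' (u := I) hIc hIm
  have hB' : Measurable fun q : ℝ × Ω => W (s, q.1) q.2 - W (s, t) q.2 :=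
    (measurable_uncurry_of_continuous' (u := fun r ω => W (s, r) ω) (fun ω => (hc ω).comp (by fun_prop)) (fun r => hW.1 _)).sub ((hW.1 _).comp measurable_snd)
  have hJ1 : Measurable fun q : ℝ × Ω => ψ q.1 (g q.2) (I q.1 q.2) :=
    hψm.comp (measurable_fst.prodMk ((hg.comp measurable_snd).prodMk hI'))
  have hJ2 : Measurable fun q : ℝ × ((EuclideanSpace ℝ (Fin d) × EuclideanSpace ℝ (Fin d)) × Ω) => ψ q.1 q.2.1 (W (s, q.1) q.2.2 - W (s, t) q.2.2) :=
    hψm.comp (measurable_fst.prodMk ((by fun_prop : Measurable fun q : ℝ × ((EuclideanSpace ℝ (Fin d) × EuclideanSpace ℝ (Fin d)) × Ω) => q.2.1).prodMk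
      (hB'.comp (by fun_prop : Measurable fun q : ℝ × ((EuclideanSpace ℝ (Fin d) × EuclideanSpace ℝ (Fin d)) × Ω) => (q.1, q.2.2)))))
  have key : ∫ ω, (∫ r in Ioc t b, ψ r (g ω) (I r ω)) ^ 2 ∂Q =
      ∫ q, (∫ r in Ioc t b, ψ r q.1 (W (s, r) q.2 - W (s, t) q.2)) ^ 2 ∂((Q.map g).prod P) := by
    rw [integral_sq_eq hJ1 (fun _ _ => hψb _ _ _), integral_sq_eq hJ2 (fun _ _ => hψb _ _ _)]
    refine setIntegral_congr_fun measurableSet_Ioc fun r hr => setIntegral_congr_fun measurableSet_Ioc fun r' hr' => ?_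
    have hm : Measurable fun y : (EuclideanSpace ℝ (Fin d) × EuclideanSpace ℝ (Fin d)) × (EuclideanSpace ℝ (Fin d) × EuclideanSpace ℝ (Fin d)) =>
        ψ r y.1 y.2.1 * ψ r' y.1 y.2.2 :=
      (hψm.comp (measurable_const.prodMk (measurable_fst.prodMk measurable_snd.fst))).mul
        (hψm.comp (measurable_const.prodMk (measurable_fst.prodMk measurable_snd.snd)))
    have e1 := integral_map (μ := Q) (hg.prodMk ((hIm r).prodMk (hIm r'))).aemeasurable hm.aestronglyMeasurable
    have hBm : Measurable fun ω => (W (s, r) ω - W (s, t) ω, W (s, r') ω - W (s, t) ω) :=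
      ((hW.1 _).sub (hW.1 _)).prodMk ((hW.1 _).sub (hW.1 _))
    have e2 := integral_map (μ := (Q.map g).prod P) (φ := Prod.map id fun ω => (W (s, r) ω - W (s, t) ω, W (s, r') ω - W (s, t) ω)) (measurable_id.prodMap hBm).aemeasurable hm.aestronglyMeasurable
    rw [← Measure.map_prod_map _ _ measurable_id hBm, Measure.map_id, ← hind r hr r' hr'] at e2
    exact e1.symm.trans e2
  have hsqm : Measurable fun q : (EuclideanSpace ℝ (Fin d) × EuclideanSpace ℝ (Fin d)) × Ω =>
      (∫ r in Ioc t b, ψ r q.1 (W (s, r) q.2 - W (s, t) q.2)) ^ 2 :=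
    (measurable_integral_left (J := fun r (q : (EuclideanSpace ℝ (Fin d) × EuclideanSpace ℝ (Fin d)) × Ω) => ψ r q.1 (W (s, r) q.2 - W (s, t) q.2)) hJ2).pow_const 2
  have hsqb : ∀ (x : EuclideanSpace ℝ (Fin d) × EuclideanSpace ℝ (Fin d)) (ζ : ℝ → EuclideanSpace ℝ (Fin d)),
      ‖(∫ r in Ioc t b, ψ r x (ζ r)) ^ 2‖ ≤ (2 * L * (volume.restrict (Ioc t b)).real univ) ^ 2 := fun x ζ => by
    rw [norm_pow]
    exact pow_le_pow_left₀ (norm_nonneg _) (norm_integral_le_of_norm_le_const (ae_of_all _ fun r => hψb _ _ _)) 2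
  have hsqi : Integrable (fun q : (EuclideanSpace ℝ (Fin d) × EuclideanSpace ℝ (Fin d)) × Ω =>
      (∫ r in Ioc t b, ψ r q.1 (W (s, r) q.2 - W (s, t) q.2)) ^ 2) ((Q.map g).prod P) :=
    Integrable.of_bound hsqm.aestronglyMeasurable _ (ae_of_all _ fun q => hsqb _ _)
  have hsqm1 : Measurable fun ω => (∫ r in Ioc t b, ψ r (g ω) (I r ω)) ^ 2 :=
    (measurable_integral_left (J := fun r ω => ψ r (g ω) (I r ω)) hJ1).pow_const 2
  have hsqi1 : Integrable (fun ω => (∫ r in Ioc t b, ψ r (g ω) (I r ω)) ^ 2) Q :=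
    Integrable.of_bound hsqm1.aestronglyMeasurable _ (ae_of_all _ fun q => hsqb _ _)
  simp only [intervalIntegral.integral_of_le htb]
  rw [← ofReal_integral_eq_lintegral_ofReal hsqi1 (ae_of_all _ fun _ => sq_nonneg _), key,
    ofReal_integral_eq_lintegral_ofReal hsqi (ae_of_all _ fun _ => sq_nonneg _), lintegral_prod _ (hsqm.ennreal_ofReal.aemeasurable),
    ← lintegral_const_mul' _ _ ENNReal.ofReal_ne_top,
    ← lintegral_map (f := fun x : EuclideanSpace ℝ (Fin d) × EuclideanSpace ℝ (Fin d) => ENNReal.ofReal (16 * L ^ 2 * (b - t) / s) * ENNReal.ofReal (‖x.1 - x.2‖ ^ 2)) (by fun_prop) hg]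
  refine lintegral_mono fun x => ?_
  have hxi : Integrable (fun ω => (∫ r in Ioc t b, ψ r x (W (s, r) ω - W (s, t) ω)) ^ 2) P :=
    Integrable.of_bound (hsqm.comp measurable_prodMk_left).aestronglyMeasurable _ (ae_of_all _ fun q => hsqb x _)
  rw [← ofReal_integral_eq_lintegral_ofReal hxi (ae_of_all _ fun _ => sq_nonneg _), ← ENNReal.ofReal_mul (by positivity)]
  refine ENNReal.ofReal_le_ofReal ?_
  have := davie_measurable hW hc hs0 hs1 ht htb hb hf hL x.1 x.2
  simp only [intervalIntegral.integral_of_le htb] at this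
  refine this.trans_eq ?_
  ring

/-- Davie's estimate for vector-valued functions and a process whose increments are, under `Q`,
independent of the starting points and distributed as those of the sheet. -/
lemma davie_vector (hW : IsBrownianSheet P d W) (hc : ∀ ω, Continuous fun p => W p ω) {s t b : ℝ} (hs0 : 0 < s) (hs1 : s ≤ 1)
    (ht : 0 ≤ t) (htb : t ≤ b) (hb : b ≤ 1) {f : ℝ × EuclideanSpace ℝ (Fin d) → EuclideanSpace ℝ (Fin d)} (hf : Measurable f)
    {L : ℝ} (hL : ∀ z, ‖f z‖ ≤ L) {Q : Measure Ω} [IsProbabilityMeasure Q] {I : ℝ → Ω → EuclideanSpace ℝ (Fin d)}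
    (hIc : ∀ ω, Continuous fun r => I r ω) (hIm : ∀ r, Measurable (I r)) {g : Ω → EuclideanSpace ℝ (Fin d) × EuclideanSpace ℝ (Fin d)}
    (hg : Measurable g)
    (hind : ∀ r ∈ Ioc t b, ∀ r' ∈ Ioc t b, Q.map (fun ω => (g ω, (I r ω, I r' ω))) =
      (Q.map g).prod (P.map fun ω => (W (s, r) ω - W (s, t) ω, W (s, r') ω - W (s, t) ω))) :
    ∫⁻ ω, ‖∫ r in t..b, (f (r, (g ω).1 + I r ω) - f (r, (g ω).2 + I r ω))‖ₑ ^ 2 ∂Q ≤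
      ENNReal.ofReal (16 * d * L ^ 2 * (b - t) / s) * ∫⁻ ω, ‖(g ω).1 - (g ω).2‖ₑ ^ 2 ∂Q := by
  have hL0 : 0 ≤ L := (norm_nonneg _).trans (hL 0)
  have hbt : 0 ≤ b - t := sub_nonneg.2 htb
  have hI' : Measurable fun q : ℝ × Ω => I q.1 q.2 := measurable_uncurry_of_continuous' (u := I) hIc hIm
  have hm : Measurable fun q : Ω × ℝ => f (q.2, (g q.1).1 + I q.2 q.1) - f (q.2, (g q.1).2 + I q.2 q.1) := by
    have h1 := hI'.comp (measurable_swap : Measurable (Prod.swap : Ω × ℝ → ℝ × Ω))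
    exact (hf.comp (measurable_snd.prodMk ((hg.fst.comp measurable_fst).add h1))).sub (hf.comp (measurable_snd.prodMk ((hg.snd.comp measurable_fst).add h1)))
  have hfint : ∀ ω, IntegrableOn (fun r => f (r, (g ω).1 + I r ω) - f (r, (g ω).2 + I r ω)) (Ioc t b) := fun ω =>
    Integrable.of_bound (hm.comp measurable_prodMk_left).aestronglyMeasurable (L + L) (ae_of_all _ fun r => (norm_sub_le _ _).trans (add_le_add (hL _) (hL _)))
  have hcoord : ∀ ω, ‖∫ r in t..b, (f (r, (g ω).1 + I r ω) - f (r, (g ω).2 + I r ω))‖ₑ ^ 2 =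
      ∑ i, ENNReal.ofReal ((∫ r in t..b, (f (r, (g ω).1 + I r ω) i - f (r, (g ω).2 + I r ω) i)) ^ 2) := fun ω => by
    rw [← ofReal_norm, ← ENNReal.ofReal_pow (norm_nonneg _), EuclideanSpace.norm_sq_eq, ENNReal.ofReal_sum_of_nonneg fun _ _ => sq_nonneg _]
    refine Finset.sum_congr rfl fun i _ => ?_
    simp only [intervalIntegral.integral_of_le htb]
    rw [Real.norm_eq_abs, sq_abs]
    congr 2
    exact ((EuclideanSpace.proj (𝕜 := ℝ) i).integral_comp_comm (hfint ω)).symm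
  simp only [hcoord]
  rw [lintegral_finsetSum']
  · have h1 := fun i => davie_transfer hW hc hs0 hs1 ht htb hb (f := fun z => f z i) (by fun_prop) (fun z => (PiLp.norm_apply_le (f z) i).trans (hL z)) hIc hIm hg hind
    refine (Finset.sum_le_sum fun i _ => h1 i).trans (le_of_eq ?_)
    rw [Finset.sum_const, Finset.card_univ, Fintype.card_fin, nsmul_eq_mul, ← mul_assoc]
    congr 1
    · rw [← ENNReal.ofReal_natCast, ← ENNReal.ofReal_mul (Nat.cast_nonneg _)]
      congr 1; ring
    · refine lintegral_congr fun ω => ?_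
      rw [← ofReal_norm, ENNReal.ofReal_pow (norm_nonneg _)]
  · intro i _
    have : Measurable fun q : Ω × ℝ => f (q.2, (g q.1).1 + I q.2 q.1) i - f (q.2, (g q.1).2 + I q.2 q.1) i := by
      have := (EuclideanSpace.proj (𝕜 := ℝ) i).measurable.comp hm
      exact this
    simp only [intervalIntegral.integral_of_le htb]
    exact ((this.stronglyMeasurable.integral_prod_right (ν := volume.restrict (Ioc t b))).measurable.pow_const 2).ennreal_ofReal.aemeasurable

end

lemma sheetSigma_eq_comap (p : ℝ × ℝ) : sheetSigma W p =
    MeasurableSpace.comap (fun ω (q : Icc (0 : ℝ × ℝ) p) => W q ω) inferInstance := by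
  unfold sheetSigma
  simp only [MeasurableSpace.pi, MeasurableSpace.comap_iSup, MeasurableSpace.comap_comp]
  rw [iSup_subtype']
  rfl

lemma sheetSigma_le (hm : ∀ p, Measurable (W p)) (p : ℝ × ℝ) : sheetSigma W p ≤ ‹MeasurableSpace Ω› :=
  iSup₂_le fun q _ => (hm q).comap_le

lemma sheetSigma_mono {p q : ℝ × ℝ} (h : p ≤ q) : sheetSigma W p ≤ sheetSigma W q :=
  iSup₂_le fun r hr => le_iSup₂_of_le r ⟨hr.1, hr.2.trans h⟩ le_rfl

lemma measurable_sheet {p q : ℝ × ℝ} (h : q ∈ Icc 0 p) : Measurable[sheetSigma W p] (W q) :=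
  (comap_measurable (W q)).mono (le_iSup₂_of_le q h le_rfl) le_rfl

/-- Elements of the first Wiener chaos carried by the strip `t < q.2 ≤ u`. -/
def strip (W : ℝ × ℝ → Ω → EuclideanSpace ℝ (Fin d)) (t u : ℝ) :
    Submodule ℝ ((ℝ × ℝ → EuclideanSpace ℝ (Fin d)) × (Ω → ℝ)) where
  carrier := {y | y ∈ wienerSpan W ∧ (∀ q : ℝ × ℝ, q.2 ∉ Ioc t u → y.1 q = 0) ∧
    Measurable[sheetSigma W (1, u)] y.2}
  add_mem' := by
    rintro a b ⟨ha, ha', ha''⟩ ⟨hb, hb', hb''⟩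
    refine ⟨add_mem ha hb, fun q hq => by simp [ha' q hq, hb' q hq], ?_⟩
    exact ha''.add hb''
  zero_mem' := ⟨zero_mem _, fun q _ => rfl, @measurable_const _ _ _ (sheetSigma W (1, u)) _⟩
  smul_mem' := by
    rintro c a ⟨ha, ha', ha''⟩
    refine ⟨Submodule.smul_mem _ c ha, fun q hq => by simp [ha' q hq], ?_⟩
    exact ha''.const_mul c

lemma mem_strip_iff {t u : ℝ} {y : (ℝ × ℝ → EuclideanSpace ℝ (Fin d)) × (Ω → ℝ)} : y ∈ strip W t u ↔ y ∈ wienerSpan W ∧ (∀ q : ℝ × ℝ, q.2 ∉ Ioc t u → y.1 q = 0) ∧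
    Measurable[sheetSigma W (1, u)] y.2 := Iff.rfl

lemma strip_mem {t u : ℝ} {y} (h : y ∈ strip W t u) : y ∈ wienerSpan W := (mem_strip_iff.1 h).1

lemma strip_zero {t u : ℝ} {y} (h : y ∈ strip W t u) (q : ℝ × ℝ) (hq : q.2 ∉ Ioc t u) : y.1 q = 0 := (mem_strip_iff.1 h).2.1 q hq

lemma strip_measurable {t u : ℝ} {y} (h : y ∈ strip W t u) : Measurable[sheetSigma W (1, u)] y.2 := (mem_strip_iff.1 h).2.2

lemma sheetSigma_mono_snd {t u : ℝ} (h : t ≤ u) : sheetSigma W (1, t) ≤ sheetSigma W (1, u) :=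
  sheetSigma_mono (Prod.mk_le_mk.2 ⟨le_rfl, h⟩)

lemma strip_indep [IsProbabilityMeasure P] (hW : IsBrownianSheet P d W) {t u : ℝ} (ht1 : t ≤ 1) {κ : Type*}
    {y : κ → _} (hy : ∀ j, y j ∈ strip W t u) :
    Indep (sheetSigma W (1, t)) (MeasurableSpace.comap (fun ω j => (y j).2 ω) inferInstance) P := by
  rw [sheetSigma_eq_comap]
  refine indep_vec_of_wip hW (fun (q : Icc (0 : ℝ × ℝ) (1, t)) c => wpt W q c) (fun q c => wpt_mem ?_ c)
    (fun q c => rfl) (fun j => strip_mem (hy j)) fun q c j => ?_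
  · exact ⟨q.2.1, q.2.2.trans ⟨le_rfl, ht1⟩⟩
  · unfold wip wpt
    rw [← integral_zero (ℝ × ℝ) ℝ]
    congr 1
    ext x
    by_cases hx : x ∈ Icc (0 : ℝ × ℝ) q
    · rw [strip_zero (hy j) x fun h => absurd h.1 (not_lt.2 (hx.2.2.trans q.2.2.2)), inner_zero_right]
    · simp [hx]

/-- Finite combinations of strip elements with coefficients measurable at the lower end of the strip. -/
def IsStep (W : ℝ × ℝ → Ω → EuclideanSpace ℝ (Fin d)) (t u : ℝ)
    (z : Ω → (ℝ × ℝ → EuclideanSpace ℝ (Fin d)) × (Ω → ℝ)) : Prop :=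
  ∃ (ι : Type) (_ : Fintype ι) (a : ι → Ω → ℝ) (y : ι → _), (∀ l, Measurable[sheetSigma W (1, t)] (a l)) ∧
    (∀ l, y l ∈ strip W t u) ∧ ∀ ω, z ω = ∑ l, a l ω • y l

lemma IsStep.mem {t u : ℝ} {z : Ω → (ℝ × ℝ → EuclideanSpace ℝ (Fin d)) × (Ω → ℝ)} (h : IsStep W t u z) (ω : Ω) : z ω ∈ strip W t u := by
  obtain ⟨ι, _, a, y, ha, hy, hz⟩ := h
  rw [hz]
  exact Submodule.sum_mem _ fun l _ => Submodule.smul_mem _ _ (hy l)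

lemma IsStep.of_mem {t u : ℝ} {g : (ℝ × ℝ → EuclideanSpace ℝ (Fin d)) × (Ω → ℝ)} (h : g ∈ strip W t u) :
    IsStep W t u fun _ => g :=
  ⟨Unit, inferInstance, fun _ _ => 1, fun _ => g, fun _ => @measurable_const _ _ _ (sheetSigma W (1, t)) _, fun _ => h, fun _ => by simp⟩

lemma IsStep.add {t u : ℝ} {z z' : Ω → (ℝ × ℝ → EuclideanSpace ℝ (Fin d)) × (Ω → ℝ)} (h : IsStep W t u z) (h' : IsStep W t u z') :
    IsStep W t u fun ω => z ω + z' ω := by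
  obtain ⟨ι, _, a, y, ha, hy, hz⟩ := h
  obtain ⟨ι', _, a', y', ha', hy', hz'⟩ := h'
  refine ⟨ι ⊕ ι', inferInstance, Sum.elim a a', Sum.elim y y', ?_, ?_, fun ω => by simp [hz, hz']⟩
  · rintro (l | l); exacts [ha l, ha' l]
  · rintro (l | l); exacts [hy l, hy' l]

lemma IsStep.smul {t u : ℝ} {z : Ω → (ℝ × ℝ → EuclideanSpace ℝ (Fin d)) × (Ω → ℝ)} (h : IsStep W t u z) (c : ℝ) :
    IsStep W t u fun ω => c • z ω := by
  obtain ⟨ι, _, a, y, ha, hy, hz⟩ := h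
  exact ⟨ι, inferInstance, a, fun l => c • y l, ha, fun l => Submodule.smul_mem _ _ (hy l), fun ω => by
    simp [hz, Finset.smul_sum, smul_comm c]⟩

lemma wip_sum_sum {ι : Type*} [Fintype ι] {y : ι → _} (hy : ∀ l, y l ∈ wienerSpan W) (a : ι → ℝ) :
    wip (∑ l, a l • y l) (∑ l, a l • y l) = ∑ l, ∑ m, a l * a m * wip (y l) (y m) := by
  unfold wip
  simp only [Prod.fst_sum, Finset.sum_apply, Prod.smul_fst, Pi.smul_apply, sum_inner, inner_sum, real_inner_smul_left,
    real_inner_smul_right]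
  have hI := fun l m => ((integrable_inner_wiener (hy m) (hy l)).const_mul (a m)).const_mul (a l)
  rw [integral_finsetSum _ fun j _ => integrable_finsetSum _ fun k _ => hI _ _]
  refine Finset.sum_congr rfl fun j _ => ?_
  rw [integral_finsetSum _ fun k _ => hI _ _]
  refine Finset.sum_congr rfl fun k _ => ?_
  simp_rw [integral_const_mul, mul_assoc, real_inner_comm]

/-- The exponential density of a step. -/
def stepD (z : Ω → (ℝ × ℝ → EuclideanSpace ℝ (Fin d)) × (Ω → ℝ)) (ω : Ω) : ℝ :=
  Real.exp ((z ω).2 ω - wip (z ω) (z ω) / 2)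

lemma stepD_pos (z : Ω → (ℝ × ℝ → EuclideanSpace ℝ (Fin d)) × (Ω → ℝ)) (ω : Ω) : 0 < stepD z ω := Real.exp_pos _

lemma IsStep.measurable_wip {t u : ℝ} {z : Ω → (ℝ × ℝ → EuclideanSpace ℝ (Fin d)) × (Ω → ℝ)} (h : IsStep W t u z) :
    Measurable[sheetSigma W (1, t)] fun ω => wip (z ω) (z ω) := by
  obtain ⟨ι, _, a, y, ha, hy, hz⟩ := h
  simp_rw [hz, wip_sum_sum fun l => strip_mem (hy l)]
  exact @Finset.measurable_fun_sum _ _ _ _ _ _ (sheetSigma W (1, t)) _ _ fun l _ =>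
    @Finset.measurable_fun_sum _ _ _ _ _ _ (sheetSigma W (1, t)) _ _ fun m _ => ((ha l).mul (ha m)).mul_const _

lemma IsStep.measurable_eval {t u : ℝ} (htu : t ≤ u) {z : Ω → (ℝ × ℝ → EuclideanSpace ℝ (Fin d)) × (Ω → ℝ)} (h : IsStep W t u z) :
    Measurable[sheetSigma W (1, u)] fun ω => (z ω).2 ω := by
  obtain ⟨ι, _, a, y, ha, hy, hz⟩ := h
  simp_rw [hz, Prod.snd_sum, Finset.sum_apply]
  exact @Finset.measurable_fun_sum _ _ _ _ _ _ (sheetSigma W (1, u)) _ _ fun l _ =>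
    ((ha l).mono (sheetSigma_mono_snd htu) le_rfl).mul (strip_measurable (hy l))

lemma IsStep.measurable_stepD {t u : ℝ} (htu : t ≤ u) {z : Ω → (ℝ × ℝ → EuclideanSpace ℝ (Fin d)) × (Ω → ℝ)} (h : IsStep W t u z) :
    Measurable[sheetSigma W (1, u)] (stepD z) :=
  Real.measurable_exp.comp ((h.measurable_eval htu).sub
    ((h.measurable_wip.mono (sheetSigma_mono_snd htu) le_rfl).div_const 2))

lemma lintegral_stepD [IsProbabilityMeasure P] (hW : IsBrownianSheet P d W) {t u : ℝ} (ht1 : t ≤ 1)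
    {z : Ω → (ℝ × ℝ → EuclideanSpace ℝ (Fin d)) × (Ω → ℝ)} (h : IsStep W t u z) {Ψ : Ω → ℝ≥0∞} (hΨ : Measurable[sheetSigma W (1, t)] Ψ) :
    ∫⁻ ω, Ψ ω * ENNReal.ofReal (stepD z ω) ∂P = ∫⁻ ω, Ψ ω ∂P := by
  obtain ⟨ι, _, a, y, ha, hy, hz⟩ := h
  have hle := sheetSigma_le hW.1 (1, t)
  have hX : Measurable[sheetSigma W (1, t)] fun ω => (Ψ ω, fun l => a l ω) :=
    hΨ.prodMk (@measurable_pi_lambda _ _ _ (sheetSigma W (1, t)) _ _ fun l => ha l)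
  have hζ : Measurable fun ω l => (y l).2 ω := measurable_pi_lambda _ fun l => wiener_measurable hW (strip_mem (hy l))
  have hind : IndepFun (fun ω => (Ψ ω, fun l => a l ω)) (fun ω l => (y l).2 ω) P :=
    indep_of_indep_of_le_left (strip_indep hW ht1 hy) hX.comap_le
  have hmap := (indepFun_iff_map_prod_eq_prod_map_map (hX.mono hle le_rfl).aemeasurable hζ.aemeasurable).1 hind
  let H : (ℝ≥0∞ × (ι → ℝ)) × (ι → ℝ) → ℝ≥0∞ := fun x => x.1.1 *
    ENNReal.ofReal (Real.exp (∑ l, x.1.2 l * x.2 l - (∑ l, ∑ m, x.1.2 l * x.1.2 m * wip (y l) (y m)) / 2))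
  have hH : Measurable H := by
    refine (measurable_fst.comp measurable_fst).mul (ENNReal.measurable_ofReal.comp (Real.measurable_exp.comp ?_))
    fun_prop
  have e1 : ∀ ω, Ψ ω * ENNReal.ofReal (stepD z ω) = H ((Ψ ω, fun l => a l ω), fun l => (y l).2 ω) := by
    intro ω
    simp only [H, stepD, hz, wip_sum_sum fun l => strip_mem (hy l)]
    simp [Prod.snd_sum, Finset.sum_apply]
  simp_rw [e1]
  rw [← lintegral_map (f := H) (g := fun ω => ((Ψ ω, fun l => a l ω), fun l => (y l).2 ω)) hH ((hX.mono hle le_rfl).prodMk hζ), hmap, lintegral_prod _ hH.aemeasurable,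
    lintegral_map hH.lintegral_prod_right' (hX.mono hle le_rfl)]
  refine lintegral_congr fun ω => ?_
  rw [lintegral_map (f := fun y => H ((Ψ ω, fun l => a l ω), y)) (hH.comp measurable_prodMk_left) hζ]
  simp only [H]
  have hm : ∑ l, a l ω • y l ∈ wienerSpan W := Submodule.sum_mem _ fun l _ => Submodule.smul_mem _ _ (strip_mem (hy l))
  have := wiener_lintegral_exp hW hm
  rw [show (∫ q, ‖(∑ l, a l ω • y l).1 q‖ ^ 2) = wip (∑ l, a l ω • y l) (∑ l, a l ω • y l) by
    unfold wip; simp_rw [real_inner_self_eq_norm_sq], wip_sum_sum fun l => strip_mem (hy l)] at this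
  simp_rw [Real.exp_sub, div_eq_mul_inv, ENNReal.ofReal_mul (Real.exp_pos _).le, ← mul_assoc]
  rw [lintegral_mul_const' _ _ ENNReal.ofReal_ne_top, lintegral_const_mul]
  · have e2 : ∀ ω', Real.exp (∑ l, a l ω * (y l).2 ω') = Real.exp ((∑ l, a l ω • y l).2 ω') := fun ω' => by
      simp [Prod.snd_sum, Finset.sum_apply]
    simp_rw [e2]
    rw [this, mul_assoc, ← ENNReal.ofReal_mul (Real.exp_pos _).le, div_eq_mul_inv, mul_inv_cancel₀ (Real.exp_pos _).ne']
    simp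
  · refine ENNReal.measurable_ofReal.comp (Real.measurable_exp.comp ?_)
    exact Finset.measurable_fun_sum _ fun l _ => (wiener_measurable hW (strip_mem (hy l))).const_mul _

lemma lintegral_prod_stepD [IsProbabilityMeasure P] (hW : IsBrownianSheet P d W) {τ : ℕ → ℝ} (hτ : Monotone τ) {m n : ℕ} (hmn : m ≤ n) (hn : τ n ≤ 1)
    {z : ℕ → Ω → (ℝ × ℝ → EuclideanSpace ℝ (Fin d)) × (Ω → ℝ)} (h : ∀ k < n, IsStep W (τ k) (τ (k + 1)) (z k))
    {Ψ : Ω → ℝ≥0∞} (hΨ : Measurable[sheetSigma W (1, τ m)] Ψ) :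
    ∫⁻ ω, Ψ ω * ENNReal.ofReal (∏ k ∈ Finset.Ico m n, stepD (z k) ω) ∂P = ∫⁻ ω, Ψ ω ∂P := by
  induction n, hmn using Nat.le_induction with
  | base => simp
  | succ n hmn ih =>
    rw [← ih ((hτ n.le_succ).trans hn) fun k hk => h k (hk.trans n.lt_succ_self)]
    simp_rw [Finset.prod_Ico_succ_top hmn, ENNReal.ofReal_mul (Finset.prod_nonneg fun k _ => (stepD_pos (z k) _).le), ← mul_assoc]
    refine lintegral_stepD hW ((hτ n.le_succ).trans hn) (h n n.lt_succ_self) ?_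
    refine (hΨ.mono (sheetSigma_mono_snd (hτ hmn)) le_rfl).mul (ENNReal.measurable_ofReal.comp ?_)
    refine @Finset.measurable_fun_prod _ _ _ _ _ _ (sheetSigma W (1, τ n)) _ _ fun k hk => ?_
    rw [Finset.mem_Ico] at hk
    exact ((h k (hk.2.trans n.lt_succ_self)).measurable_stepD (hτ k.le_succ)).mono (sheetSigma_mono_snd (hτ hk.2)) le_rfl

/-- Finite measures are determined by their (finite) exponential moments. -/
lemma ext_of_lintegral_exp {V : Type*} [NormedAddCommGroup V] [NormedSpace ℝ V] [MeasurableSpace V] [BorelSpace V]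
    [SecondCountableTopology V] [CompleteSpace V] {μ ν : Measure V} [IsFiniteMeasure μ] [IsFiniteMeasure ν]
    (hfin : ∀ L : StrongDual ℝ V, ∫⁻ v, ENNReal.ofReal (Real.exp (L v)) ∂μ ≠ ∞)
    (h : ∀ L : StrongDual ℝ V, ∫⁻ v, ENNReal.ofReal (Real.exp (L v)) ∂μ = ∫⁻ v, ENNReal.ofReal (Real.exp (L v)) ∂ν) :
    μ = ν := by
  refine Measure.ext_of_charFunDual (funext fun L => ?_)
  have hi : ∀ t : ℝ, Integrable (fun v => Real.exp (t * L v)) μ := fun t => by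
    refine ⟨(Real.measurable_exp.comp (L.continuous.measurable.const_mul t)).aestronglyMeasurable, ?_⟩
    rw [hasFiniteIntegral_iff_ofReal (ae_of_all _ fun v => (Real.exp_pos _).le)]
    exact (hfin (t • L)).lt_top
  have hmgf : mgf L μ = mgf L ν := by
    ext t
    unfold mgf
    rw [integral_eq_lintegral_of_nonneg_ae (ae_of_all _ fun v => (Real.exp_pos _).le)
      (Real.measurable_exp.comp (L.continuous.measurable.const_mul t)).aestronglyMeasurable,
      integral_eq_lintegral_of_nonneg_ae (ae_of_all _ fun v => (Real.exp_pos _).le)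
      (Real.measurable_exp.comp (L.continuous.measurable.const_mul t)).aestronglyMeasurable]
    congr 1
    exact h (t • L)
  have h0 : μ = 0 ↔ ν = 0 := by
    have := h 0
    simp only [zero_apply, Real.exp_zero, ENNReal.ofReal_one, lintegral_one] at this
    rw [← Measure.measure_univ_eq_zero, this, Measure.measure_univ_eq_zero]
  have hs : integrableExpSet L μ = univ := eq_univ_of_forall fun t => hi t
  have := eqOn_complexMGF_of_mgf' hmgf h0 (x := Complex.I) (by simp [hs])
  simpa [complexMGF, charFunDual_apply, mul_comm] using this

/-- Uniform grid. -/
def grid (N k : ℕ) : ℝ := k / N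

lemma grid_mono (N : ℕ) : Monotone (grid N) := fun i j h => by
  unfold grid; gcongr

lemma grid_le_one {N k : ℕ} (h : k ≤ N) : grid N k ≤ 1 := by
  unfold grid; exact div_le_one_of_le₀ (by exact_mod_cast h) (by positivity)

lemma grid_nonneg (N k : ℕ) : 0 ≤ grid N k := by unfold grid; positivity

lemma grid_zero (N : ℕ) : grid N 0 = 0 := by simp [grid]

lemma grid_self {N : ℕ} (hN : 0 < N) : grid N N = 1 := by
  unfold grid; exact div_self (by positivity)

/-- A drift which on each strip of the grid is given by a step. -/
structure IsSimple (W : ℝ × ℝ → Ω → EuclideanSpace ℝ (Fin d)) (N : ℕ) (L : ℝ) (β : ℝ × ℝ → Ω → EuclideanSpace ℝ (Fin d))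
    (z : ℕ → Ω → (ℝ × ℝ → EuclideanSpace ℝ (Fin d)) × (Ω → ℝ)) : Prop where
  pos : 0 < N
  step : ∀ k < N, IsStep W (grid N k) (grid N (k + 1)) (z k)
  eq : ∀ k < N, ∀ q ω, 0 ≤ q.1 → q.1 ≤ 1 → grid N k < q.2 → q.2 ≤ grid N (k + 1) → β q ω = (z k ω).1 q
  bdd : ∀ k < N, ∀ ω, wip (z k ω) (z k ω) ≤ L ^ 2 / N

/-- The Girsanov density removing the drift. -/
def rho (N : ℕ) (z : ℕ → Ω → (ℝ × ℝ → EuclideanSpace ℝ (Fin d)) × (Ω → ℝ)) (ω : Ω) : ℝ :=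
  ∏ k ∈ Finset.Ico 0 N, stepD (fun ω => -z k ω) ω

lemma rho_pos (N : ℕ) (z : ℕ → Ω → (ℝ × ℝ → EuclideanSpace ℝ (Fin d)) × (Ω → ℝ)) (ω : Ω) : 0 < rho N z ω :=
  Finset.prod_pos fun _ _ => stepD_pos _ _

lemma IsStep.neg {t u : ℝ} {z : Ω → (ℝ × ℝ → EuclideanSpace ℝ (Fin d)) × (Ω → ℝ)} (h : IsStep W t u z) :
    IsStep W t u fun ω => -z ω := by
  simpa using h.smul (-1)

lemma stepD_smul (z : Ω → (ℝ × ℝ → EuclideanSpace ℝ (Fin d)) × (Ω → ℝ)) (ω : Ω) (c : ℝ) :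
    stepD (fun ω => c • z ω) ω = Real.exp (c * (z ω).2 ω - c ^ 2 * wip (z ω) (z ω) / 2) := by
  unfold stepD
  rw [wip_smul_left, wip_smul_right]
  congr 1
  simp only [Prod.smul_snd, Pi.smul_apply, smul_eq_mul]
  ring

lemma stepD_neg (z : Ω → (ℝ × ℝ → EuclideanSpace ℝ (Fin d)) × (Ω → ℝ)) (ω : Ω) :
    stepD (fun ω => -z ω) ω = Real.exp (-(z ω).2 ω - wip (z ω) (z ω) / 2) := by
  have := stepD_smul z ω (-1)
  simp only [neg_smul, one_smul] at this
  rw [this]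
  congr 1
  ring

namespace IsSimple
variable {N : ℕ} {L : ℝ} {β : ℝ × ℝ → Ω → EuclideanSpace ℝ (Fin d)} {z : ℕ → Ω → (ℝ × ℝ → EuclideanSpace ℝ (Fin d)) × (Ω → ℝ)}

lemma measurable_rho (hW : IsBrownianSheet P d W) (h : IsSimple W N L β z) : Measurable (rho N z) := by
  refine Finset.measurable_fun_prod _ fun k hk => ?_
  rw [Finset.mem_Ico] at hk
  exact ((h.step k hk.2).neg.measurable_stepD (grid_mono N k.le_succ)).mono (sheetSigma_le hW.1 _) le_rfl

lemma lintegral_rho [IsProbabilityMeasure P] (hW : IsBrownianSheet P d W) (h : IsSimple W N L β z) :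
    ∫⁻ ω, ENNReal.ofReal (rho N z ω) ∂P = 1 := by
  have := lintegral_prod_stepD hW (grid_mono N) (Nat.zero_le N) (grid_le_one le_rfl) (fun k hk => (h.step k hk).neg)
    (Ψ := fun _ => 1) (@measurable_const _ _ _ (sheetSigma W (1, grid N 0)) _)
  simpa [rho] using this

lemma lintegral_prod_exp_le [IsProbabilityMeasure P] (hW : IsBrownianSheet P d W) (h : IsSimple W N L β z) (c : ℝ)
    {D : Ω → ℝ} (hD : ∀ ω, D ω ≤ ∏ k ∈ Finset.Ico 0 N, (stepD (fun ω => c • z k ω) ω * Real.exp (wip (z k ω) (z k ω)))) :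
    ∫⁻ ω, ENNReal.ofReal (D ω) ∂P ≤ ENNReal.ofReal (Real.exp (L ^ 2)) := by
  have h1 := lintegral_prod_stepD hW (grid_mono N) (Nat.zero_le N) (grid_le_one le_rfl) (fun k hk => (h.step k hk).smul c)
    (Ψ := fun _ => 1) (@measurable_const _ _ _ (sheetSigma W (1, grid N 0)) _)
  simp only [one_mul, lintegral_one, measure_univ] at h1
  have h2 : ∀ ω, ENNReal.ofReal (D ω) ≤ ENNReal.ofReal (∏ k ∈ Finset.Ico 0 N, stepD (fun ω => c • z k ω) ω) * ENNReal.ofReal (Real.exp (L ^ 2)) := by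
    intro ω
    have h0 : 0 ≤ ∏ k ∈ Finset.Ico 0 N, stepD (fun ω => c • z k ω) ω := Finset.prod_nonneg fun k _ => (stepD_pos _ _).le
    rw [← ENNReal.ofReal_mul h0]
    refine ENNReal.ofReal_le_ofReal ((hD ω).trans ?_)
    rw [Finset.prod_mul_distrib, ← Real.exp_sum]
    refine mul_le_mul_of_nonneg_left (Real.exp_le_exp.2 ?_) h0
    have hN := h.pos
    calc ∑ k ∈ Finset.Ico 0 N, wip (z k ω) (z k ω) ≤ ∑ k ∈ Finset.Ico 0 N, L ^ 2 / N :=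
          Finset.sum_le_sum fun k hk => h.bdd k (Finset.mem_Ico.1 hk).2 ω
      _ = L ^ 2 := by rw [Finset.sum_const, Nat.card_Ico, nsmul_eq_mul, Nat.sub_zero]; field_simp
  calc _ ≤ ∫⁻ ω, ENNReal.ofReal (∏ k ∈ Finset.Ico 0 N, stepD (fun ω => c • z k ω) ω) * ENNReal.ofReal (Real.exp (L ^ 2)) ∂P := lintegral_mono h2
    _ = _ := by rw [lintegral_mul_const' _ _ ENNReal.ofReal_ne_top, h1, one_mul]

lemma lintegral_rho_sq [IsProbabilityMeasure P] (hW : IsBrownianSheet P d W) (h : IsSimple W N L β z) :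
    ∫⁻ ω, ENNReal.ofReal (rho N z ω ^ 2) ∂P ≤ ENNReal.ofReal (Real.exp (L ^ 2)) := by
  refine h.lintegral_prod_exp_le hW (-2) fun ω => le_of_eq ?_
  rw [rho, ← Finset.prod_pow]
  refine Finset.prod_congr rfl fun k _ => ?_
  rw [stepD_smul, stepD_neg, ← Real.exp_add, ← Real.exp_nat_mul]
  congr 1
  push_cast
  ring

lemma lintegral_rho_inv [IsProbabilityMeasure P] (hW : IsBrownianSheet P d W) (h : IsSimple W N L β z) :
    ∫⁻ ω, ENNReal.ofReal ((rho N z ω)⁻¹) ∂P ≤ ENNReal.ofReal (Real.exp (L ^ 2)) := by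
  refine h.lintegral_prod_exp_le hW 1 fun ω => le_of_eq ?_
  rw [rho, ← Finset.prod_inv_distrib]
  refine Finset.prod_congr rfl fun k _ => ?_
  rw [stepD_smul, stepD_neg, ← Real.exp_add, ← Real.exp_neg]
  congr 1
  ring

lemma girsanov_exp [IsProbabilityMeasure P] (hW : IsBrownianSheet P d W) (h : IsSimple W N L β z) {m : ℕ} (hm : m ≤ N)
    {g : ℕ → (ℝ × ℝ → EuclideanSpace ℝ (Fin d)) × (Ω → ℝ)} (hg : ∀ k < N, g k ∈ strip W (grid N k) (grid N (k + 1)))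
    {Ψ : Ω → ℝ≥0∞} (hΨ : Measurable[sheetSigma W (1, grid N m)] Ψ) :
    ∫⁻ ω, Ψ ω * ENNReal.ofReal (rho N z ω * Real.exp (∑ k ∈ Finset.Ico m N, ((g k).2 ω + wip (g k) (z k ω)))) ∂P =
      (∫⁻ ω, Ψ ω * ENNReal.ofReal (rho N z ω) ∂P) * ENNReal.ofReal (Real.exp (∑ k ∈ Finset.Ico m N, wip (g k) (g k) / 2)) := by
  set Ψ' : Ω → ℝ≥0∞ := fun ω => Ψ ω * ENNReal.ofReal (∏ k ∈ Finset.Ico 0 m, stepD (fun ω => -z k ω) ω)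
  have hΨ' : Measurable[sheetSigma W (1, grid N m)] Ψ' := by
    refine hΨ.mul (ENNReal.measurable_ofReal.comp ?_)
    refine @Finset.measurable_fun_prod _ _ _ _ _ _ (sheetSigma W (1, grid N m)) _ _ fun k hk => ?_
    rw [Finset.mem_Ico] at hk
    exact ((h.step k (hk.2.trans_le hm)).neg.measurable_stepD (grid_mono N k.le_succ)).mono (sheetSigma_mono_snd (grid_mono N hk.2)) le_rfl
  have h1 := lintegral_prod_stepD hW (grid_mono N) hm (grid_le_one le_rfl) (fun k hk => (h.step k hk).neg) hΨ'
  have h2 := lintegral_prod_stepD hW (grid_mono N) hm (grid_le_one le_rfl)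
    (fun k hk => (IsStep.of_mem (hg k hk)).add (h.step k hk).neg) hΨ'
  have hpos : ∀ ω, 0 ≤ ∏ k ∈ Finset.Ico 0 m, stepD (fun ω => -z k ω) ω := fun ω => Finset.prod_nonneg fun k _ => (stepD_pos _ _).le
  have e1 : ∀ ω, Ψ ω * ENNReal.ofReal (rho N z ω) = Ψ' ω * ENNReal.ofReal (∏ k ∈ Finset.Ico m N, stepD (fun ω => -z k ω) ω) := by
    intro ω
    simp only [Ψ', rho]
    rw [mul_assoc, ← ENNReal.ofReal_mul (hpos ω), Finset.prod_Ico_consecutive _ (Nat.zero_le m) hm]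
  have e2 : ∀ ω, Ψ ω * ENNReal.ofReal (rho N z ω * Real.exp (∑ k ∈ Finset.Ico m N, ((g k).2 ω + wip (g k) (z k ω)))) =
      Ψ' ω * ENNReal.ofReal (∏ k ∈ Finset.Ico m N, stepD (fun ω => g k + -z k ω) ω) * ENNReal.ofReal (Real.exp (∑ k ∈ Finset.Ico m N, wip (g k) (g k) / 2)) := by
    intro ω
    simp only [Ψ', rho]
    rw [mul_assoc, mul_assoc, ← ENNReal.ofReal_mul (Finset.prod_nonneg fun k _ => (stepD_pos _ _).le), ← ENNReal.ofReal_mul (hpos ω),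
      ← Finset.prod_Ico_consecutive _ (Nat.zero_le m) hm, mul_assoc]
    congr 3
    rw [Real.exp_sum, Real.exp_sum, ← Finset.prod_mul_distrib, ← Finset.prod_mul_distrib]
    refine Finset.prod_congr rfl fun k hk => ?_
    rw [Finset.mem_Ico] at hk
    rw [stepD_neg, stepD, ← Real.exp_add, ← Real.exp_add]
    have hz := strip_mem ((h.step k hk.2).mem ω)
    have hg' := strip_mem (hg k hk.2)
    rw [← sub_eq_add_neg, wip_sub_left hg' hz (sub_mem hg' hz), wip_sub_right hg' hz hg', wip_sub_right hg' hz hz,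
      wip_comm (z k ω) (g k)]
    congr 1
    simp only [Prod.snd_sub, Pi.sub_apply]
    ring
  simp_rw [e1, e2]
  rw [lintegral_mul_const' _ _ ENNReal.ofReal_ne_top, h1, h2]

end IsSimple

/-- The sheet started at `ξ` with drift `β`. -/
def drifted (W : ℝ × ℝ → Ω → EuclideanSpace ℝ (Fin d)) (ξ : EuclideanSpace ℝ (Fin d))
    (β : ℝ × ℝ → Ω → EuclideanSpace ℝ (Fin d)) (p : ℝ × ℝ) (ω : Ω) : EuclideanSpace ℝ (Fin d) :=
  ξ + W p ω + ∫ q in Icc 0 p, β q ω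

/-- The truncation of `⟪c, W p⟫` to the `k`-th strip. -/
def wstrip (W : ℝ × ℝ → Ω → EuclideanSpace ℝ (Fin d)) (N k : ℕ) (p : ℝ × ℝ) (c : EuclideanSpace ℝ (Fin d)) :
    (ℝ × ℝ → EuclideanSpace ℝ (Fin d)) × (Ω → ℝ) :=
  wpt W (p.1, min p.2 (grid N (k + 1))) c - wpt W (p.1, min p.2 (grid N k)) c

lemma trunc_mem {N k : ℕ} {p : ℝ × ℝ} (hp : p ∈ Icc (0 : ℝ × ℝ) 1) :
    (p.1, min p.2 (grid N k)) ∈ Icc (0 : ℝ × ℝ) 1 :=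
  ⟨⟨hp.1.1, le_min hp.1.2 (grid_nonneg N k)⟩, hp.2.1, (min_le_left _ _).trans hp.2.2⟩

lemma trunc_subset {N k : ℕ} {p : ℝ × ℝ} :
    Icc (0 : ℝ × ℝ) (p.1, min p.2 (grid N k)) ⊆ Icc 0 (p.1, min p.2 (grid N (k + 1))) :=
  Icc_subset_Icc_right (Prod.mk_le_mk.2 ⟨le_rfl, min_le_min_left _ (grid_mono N k.le_succ)⟩)

lemma wstrip_fst (N k : ℕ) (p : ℝ × ℝ) (c : EuclideanSpace ℝ (Fin d)) :
    (wstrip W N k p c).1 = (Icc (0 : ℝ × ℝ) (p.1, min p.2 (grid N (k + 1))) \ Icc (0 : ℝ × ℝ) (p.1, min p.2 (grid N k))).indicator fun _ => c := by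
  rw [wstrip, Prod.fst_sub, wpt, wpt, indicator_sdiff trunc_subset]

lemma mem_trunc_diff {N k : ℕ} {p q : ℝ × ℝ}
    (hq : q ∈ Icc (0 : ℝ × ℝ) (p.1, min p.2 (grid N (k + 1))) \ Icc (0 : ℝ × ℝ) (p.1, min p.2 (grid N k))) :
    0 ≤ q.1 ∧ q.1 ≤ p.1 ∧ q.2 ∈ Ioc (grid N k) (grid N (k + 1)) := by
  obtain ⟨⟨⟨h1, h2⟩, h3, h4⟩, h5⟩ := hq
  have h4' := le_min_iff.1 h4
  refine ⟨h1, h3, not_le.1 fun h => h5 ⟨⟨h1, h2⟩, h3, le_min h4'.1 h⟩, h4'.2⟩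

lemma wstrip_mem {N k : ℕ} {p : ℝ × ℝ} (hp : p ∈ Icc (0 : ℝ × ℝ) 1) (c : EuclideanSpace ℝ (Fin d)) :
    wstrip W N k p c ∈ strip W (grid N k) (grid N (k + 1)) := by
  refine mem_strip_iff.2 ⟨sub_mem (wpt_mem (trunc_mem hp) c) (wpt_mem (trunc_mem hp) c), fun q hq => ?_, ?_⟩
  · rw [wstrip_fst, indicator_of_notMem]
    exact fun h => hq (mem_trunc_diff h).2.2
  · have h : ∀ j ≤ k + 1, Measurable[sheetSigma W (1, grid N (k + 1))] fun ω => ⟪c, W (p.1, min p.2 (grid N j)) ω⟫ := fun j hj =>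
      (continuous_const.inner continuous_id).measurable.comp
        (measurable_sheet ⟨(trunc_mem hp).1, hp.2.1, (min_le_right _ _).trans (grid_mono N hj)⟩)
    exact (h (k + 1) le_rfl).sub (h k k.le_succ)

lemma sum_wstrip {N m : ℕ} (hm : m ≤ N) {L : ℝ} {ξ : EuclideanSpace ℝ (Fin d)} {β : ℝ × ℝ → Ω → EuclideanSpace ℝ (Fin d)}
    {z : ℕ → Ω → (ℝ × ℝ → EuclideanSpace ℝ (Fin d)) × (Ω → ℝ)} (h : IsSimple W N L β z) {ω : Ω} (hβ : IntegrableOn (fun q => β q ω) (Icc 0 1))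
    {p : ℝ × ℝ} (hp : p ∈ Icc (0 : ℝ × ℝ) 1) (c : EuclideanSpace ℝ (Fin d)) :
    ∑ k ∈ Finset.Ico m N, ((wstrip W N k p c).2 ω + wip (wstrip W N k p c) (z k ω)) =
      ⟪c, drifted W ξ β p ω - drifted W ξ β (p.1, min p.2 (grid N m)) ω⟫ := by
  have hN : min p.2 (grid N N) = p.2 := by rw [grid_self h.pos]; exact min_eq_left hp.2.2
  have key : ∀ k ∈ Finset.Ico m N, (wstrip W N k p c).2 ω + wip (wstrip W N k p c) (z k ω) =
      ⟪c, drifted W ξ β (p.1, min p.2 (grid N (k + 1))) ω⟫ - ⟪c, drifted W ξ β (p.1, min p.2 (grid N k)) ω⟫ := by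
    intro k hk
    rw [Finset.mem_Ico] at hk
    have hsub : ∀ j, Icc (0 : ℝ × ℝ) (p.1, min p.2 (grid N j)) ⊆ Icc 0 1 := fun j => Icc_subset_Icc_right (trunc_mem hp).2
    have e : wip (wstrip W N k p c) (z k ω) = ⟪c, (∫ q in Icc (0 : ℝ × ℝ) (p.1, min p.2 (grid N (k + 1))), β q ω) -
        ∫ q in Icc (0 : ℝ × ℝ) (p.1, min p.2 (grid N k)), β q ω⟫ := by
      rw [← setIntegral_sdiff measurableSet_Icc (hβ.mono_set (hsub _)) trunc_subset,
        ← integral_inner (hβ.mono_set (sdiff_subset.trans (hsub _))), wip, wstrip_fst,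
        ← integral_indicator (measurableSet_Icc.diff measurableSet_Icc)]
      congr 1
      ext q
      by_cases hq : q ∈ Icc (0 : ℝ × ℝ) (p.1, min p.2 (grid N (k + 1))) \ Icc (0 : ℝ × ℝ) (p.1, min p.2 (grid N k))
      · obtain ⟨h1, h2, h3⟩ := mem_trunc_diff hq
        rw [indicator_of_mem hq, indicator_of_mem hq, h.eq k hk.2 q ω h1 (h2.trans hp.2.1) h3.1 h3.2]
      · rw [indicator_of_notMem hq, indicator_of_notMem hq, inner_zero_left]
    rw [e]
    simp only [wstrip, wpt, Prod.snd_sub, Pi.sub_apply, drifted, inner_add_right, inner_sub_right]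
    ring
  rw [Finset.sum_congr rfl key, Finset.sum_Ico_sub (fun k => ⟪c, drifted W ξ β (p.1, min p.2 (grid N k)) ω⟫) hm, hN, inner_sub_right]

lemma isSimple_zero {N : ℕ} (hN : 0 < N) : IsSimple W N 0 (fun _ _ => 0) (fun _ _ => 0) where
  pos := hN
  step k _ := IsStep.of_mem (zero_mem _)
  eq _ _ _ _ _ _ _ _ := rfl
  bdd k _ ω := by simp [wip]

/-- The Girsanov measure. -/
def girsanov (P : Measure Ω) (N : ℕ) (z : ℕ → Ω → (ℝ × ℝ → EuclideanSpace ℝ (Fin d)) × (Ω → ℝ)) : Measure Ω :=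
  P.withDensity fun ω => ENNReal.ofReal (rho N z ω)

namespace IsSimple
variable {N : ℕ} {L : ℝ} {β : ℝ × ℝ → Ω → EuclideanSpace ℝ (Fin d)} {z : ℕ → Ω → (ℝ × ℝ → EuclideanSpace ℝ (Fin d)) × (Ω → ℝ)}

lemma lintegral_girsanov (hW : IsBrownianSheet P d W) (h : IsSimple W N L β z) {φ : Ω → ℝ≥0∞} (hφ : Measurable φ) :
    ∫⁻ ω, φ ω ∂(girsanov P N z) = ∫⁻ ω, φ ω * ENNReal.ofReal (rho N z ω) ∂P := by
  rw [girsanov, lintegral_withDensity_eq_lintegral_mul _ (h.measurable_rho hW).ennreal_ofReal hφ]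
  simp only [Pi.mul_apply, mul_comm]

lemma isProbabilityMeasure_girsanov [IsProbabilityMeasure P] (hW : IsBrownianSheet P d W) (h : IsSimple W N L β z) :
    IsProbabilityMeasure (girsanov P N z) :=
  ⟨by rw [girsanov, withDensity_apply _ MeasurableSet.univ, setLIntegral_univ, h.lintegral_rho hW]⟩

lemma girsanov_exp_drifted [IsProbabilityMeasure P] (hW : IsBrownianSheet P d W) (h : IsSimple W N L β z) {ξ : EuclideanSpace ℝ (Fin d)}
    (hβ : ∀ ω, IntegrableOn (fun q => β q ω) (Icc 0 1)) {m : ℕ} (hm : m ≤ N) {ι : Type*} [Fintype ι] {p : ι → ℝ × ℝ}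
    (hp : ∀ i, p i ∈ Icc (0 : ℝ × ℝ) 1) (c : ι → EuclideanSpace ℝ (Fin d)) {Ψ : Ω → ℝ≥0∞} (hΨ : Measurable[sheetSigma W (1, grid N m)] Ψ) :
    ∫⁻ ω, Ψ ω * ENNReal.ofReal (rho N z ω * Real.exp (∑ i, ⟪c i, drifted W ξ β (p i) ω - drifted W ξ β ((p i).1, min (p i).2 (grid N m)) ω⟫)) ∂P =
      (∫⁻ ω, Ψ ω * ENNReal.ofReal (rho N z ω) ∂P) * ENNReal.ofReal (Real.exp (∑ k ∈ Finset.Ico m N,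
        wip (∑ i, wstrip W N k (p i) (c i)) (∑ i, wstrip W N k (p i) (c i)) / 2)) := by
  rw [← h.girsanov_exp hW hm (g := fun k => ∑ i, wstrip W N k (p i) (c i))
    (fun _ _ => Submodule.sum_mem _ fun i _ => wstrip_mem (hp i) (c i)) hΨ]
  refine lintegral_congr fun ω => ?_
  congr 4
  simp_rw [← sum_wstrip hm h (hβ ω) (hp _) (c _)]
  rw [Finset.sum_comm]
  refine Finset.sum_congr rfl fun k hk => ?_
  rw [Finset.mem_Ico] at hk
  rw [Finset.sum_add_distrib, Prod.snd_sum, Finset.sum_apply]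
  congr 1
  simp only [wip]
  rw [← integral_finsetSum _ fun i _ => integrable_inner_wiener (strip_mem (wstrip_mem (hp i) (c i))) (strip_mem ((h.step k hk.2).mem ω))]
  simp only [Prod.fst_sum, Finset.sum_apply, sum_inner]

/-- Under the Girsanov measure the increments of the drifted sheet past a grid level are those of the
sheet, independent of the past. -/
lemma girsanov_map_restrict [IsProbabilityMeasure P] (hW : IsBrownianSheet P d W) (h : IsSimple W N L β z) {ξ : EuclideanSpace ℝ (Fin d)}
    (hβ : ∀ ω, IntegrableOn (fun q => β q ω) (Icc 0 1)) (hX : ∀ p ∈ Icc (0 : ℝ × ℝ) 1, Measurable (drifted W ξ β p))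
    {m : ℕ} (hm : m ≤ N) {ι : Type*} [Fintype ι] {p : ι → ℝ × ℝ}
    (hp : ∀ i, p i ∈ Icc (0 : ℝ × ℝ) 1) {A : Set Ω} (hA : MeasurableSet[sheetSigma W (1, grid N m)] A) :
    ((girsanov P N z).restrict A).map (fun ω i => drifted W ξ β (p i) ω - drifted W ξ β ((p i).1, min (p i).2 (grid N m)) ω) =
      girsanov P N z A • P.map (fun ω i => W (p i) ω - W ((p i).1, min (p i).2 (grid N m)) ω) := by
  classical
  have hA' : MeasurableSet A := sheetSigma_le hW.1 _ A hA
  have hQ := h.isProbabilityMeasure_girsanov hW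
  have hI : Measurable fun ω i => drifted W ξ β (p i) ω - drifted W ξ β ((p i).1, min (p i).2 (grid N m)) ω :=
    measurable_pi_lambda _ fun i => (hX _ (hp i)).sub (hX _ (trunc_mem (hp i)))
  have hJ : Measurable fun ω i => W (p i) ω - W ((p i).1, min (p i).2 (grid N m)) ω :=
    measurable_pi_lambda _ fun i => (hW.1 _).sub (hW.1 _)
  have := Measure.isProbabilityMeasure_map (μ := P) hJ.aemeasurable
  have hL : ∀ M : StrongDual ℝ (ι → EuclideanSpace ℝ (Fin d)), ∃ c : ι → EuclideanSpace ℝ (Fin d), ∀ v, M v = ∑ i, ⟪c i, v i⟫ := by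
    intro M
    refine ⟨fun i => (InnerProductSpace.toDual ℝ _).symm (M.comp (ContinuousLinearMap.single ℝ (fun _ => EuclideanSpace ℝ (Fin d)) i)), fun v => ?_⟩
    simp only [InnerProductSpace.toDual_symm_apply, ContinuousLinearMap.comp_apply, ContinuousLinearMap.single_apply]
    rw [← map_sum, Finset.univ_sum_single]
  have hmE : ∀ M : StrongDual ℝ (ι → EuclideanSpace ℝ (Fin d)), Measurable fun v => ENNReal.ofReal (Real.exp (M v)) := fun M =>
    ENNReal.measurable_ofReal.comp (Real.measurable_exp.comp M.continuous.measurable)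
  have k1 : ∀ c : ι → EuclideanSpace ℝ (Fin d), ∫⁻ ω, ENNReal.ofReal (Real.exp (∑ i, ⟪c i, W (p i) ω - W ((p i).1, min (p i).2 (grid N m)) ω⟫)) ∂P =
      ENNReal.ofReal (Real.exp (∑ k ∈ Finset.Ico m N, wip (∑ i, wstrip W N k (p i) (c i)) (∑ i, wstrip W N k (p i) (c i)) / 2)) := by
    intro c
    have := (isSimple_zero (W := W) h.pos).girsanov_exp_drifted hW (ξ := 0) (fun ω => integrableOn_zero) hm hp c (Ψ := fun _ => 1)
      (@measurable_const _ _ _ (sheetSigma W (1, grid N m)) _)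
    simpa [drifted, rho, stepD, wip] using this
  have k2 : ∀ M : StrongDual ℝ (ι → EuclideanSpace ℝ (Fin d)),
      ∫⁻ v, ENNReal.ofReal (Real.exp (M v)) ∂(((girsanov P N z).restrict A).map (fun ω i => drifted W ξ β (p i) ω - drifted W ξ β ((p i).1, min (p i).2 (grid N m)) ω)) =
      girsanov P N z A * ∫⁻ v, ENNReal.ofReal (Real.exp (M v)) ∂(P.map (fun ω i => W (p i) ω - W ((p i).1, min (p i).2 (grid N m)) ω)) := by
    intro M
    obtain ⟨c, hc⟩ := hL M
    rw [lintegral_map (hmE M) hI, lintegral_map (hmE M) hJ, ← lintegral_indicator hA', h.lintegral_girsanov hW (Measurable.indicator ((hmE M).comp hI) hA' : Measurable (A.indicator fun ω => ENNReal.ofReal (Real.exp (M fun i => drifted W ξ β (p i) ω - drifted W ξ β ((p i).1, min (p i).2 (grid N m)) ω)))),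
      ← lintegral_indicator_one hA', h.lintegral_girsanov hW (measurable_one.indicator hA')]
    simp_rw [hc]
    rw [k1, ← h.girsanov_exp_drifted hW hβ hm hp c (Ψ := A.indicator 1) (by
      exact Measurable.indicator (m := sheetSigma W (1, grid N m)) (@measurable_const _ _ _ (sheetSigma W (1, grid N m)) _) hA) (ξ := ξ)]
    refine lintegral_congr fun ω => ?_
    by_cases hω : ω ∈ A
    · simp only [indicator_of_mem hω, Pi.one_apply, one_mul]
      rw [mul_comm, ENNReal.ofReal_mul (rho_pos N z ω).le]
    · simp [hω]
  have := Measure.smul_finite (P.map (fun ω i => W (p i) ω - W ((p i).1, min (p i).2 (grid N m)) ω)) (measure_ne_top (girsanov P N z) A)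
  refine ext_of_lintegral_exp (fun M => ?_) fun M => ?_
  · rw [k2 M, lintegral_map (hmE M) hJ]
    obtain ⟨c, hc⟩ := hL M
    simp_rw [hc]
    rw [k1]
    exact ENNReal.mul_ne_top (measure_ne_top _ _) ENNReal.ofReal_ne_top
  · rw [k2 M, lintegral_smul_measure, smul_eq_mul]

lemma girsanov_map_prod [IsProbabilityMeasure P] (hW : IsBrownianSheet P d W) (h : IsSimple W N L β z) {ξ : EuclideanSpace ℝ (Fin d)}
    (hβ : ∀ ω, IntegrableOn (fun q => β q ω) (Icc 0 1)) (hX : ∀ p ∈ Icc (0 : ℝ × ℝ) 1, Measurable (drifted W ξ β p))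
    {m : ℕ} (hm : m ≤ N) {ι : Type*} [Fintype ι] {p : ι → ℝ × ℝ}
    (hp : ∀ i, p i ∈ Icc (0 : ℝ × ℝ) 1) {α : Type*} [MeasurableSpace α] {g : Ω → α} (hg : Measurable[sheetSigma W (1, grid N m)] g) :
    (girsanov P N z).map (fun ω => (g ω, fun i => drifted W ξ β (p i) ω - drifted W ξ β ((p i).1, min (p i).2 (grid N m)) ω)) =
      ((girsanov P N z).map g).prod (P.map (fun ω i => W (p i) ω - W ((p i).1, min (p i).2 (grid N m)) ω)) := by
  have hQ := h.isProbabilityMeasure_girsanov hW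
  have hg' : Measurable g := hg.mono (sheetSigma_le hW.1 _) le_rfl
  have hI : Measurable fun ω i => drifted W ξ β (p i) ω - drifted W ξ β ((p i).1, min (p i).2 (grid N m)) ω :=
    measurable_pi_lambda _ fun i => (hX _ (hp i)).sub (hX _ (trunc_mem (hp i)))
  have hJ : Measurable fun ω i => W (p i) ω - W ((p i).1, min (p i).2 (grid N m)) ω :=
    measurable_pi_lambda _ fun i => (hW.1 _).sub (hW.1 _)
  have := Measure.isProbabilityMeasure_map (μ := P) hJ.aemeasurable
  have := Measure.isProbabilityMeasure_map (μ := girsanov P N z) hg'.aemeasurable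
  refine (Measure.prod_eq fun s t hs ht => ?_).symm
  rw [Measure.map_apply (hg'.prodMk hI) (hs.prod ht), Measure.map_apply hg' hs]
  have := congrArg (fun μ => μ t) (h.girsanov_map_restrict hW hβ hX hm hp (hg hs))
  simp only [Measure.smul_apply, smul_eq_mul] at this
  rw [← this, Measure.map_apply hI ht, Measure.restrict_apply (hI ht), inter_comm]
  rfl

lemma girsanov_map_drifted [IsProbabilityMeasure P] (hW : IsBrownianSheet P d W) (h : IsSimple W N L β z) {ξ : EuclideanSpace ℝ (Fin d)}
    (hβ : ∀ ω, IntegrableOn (fun q => β q ω) (Icc 0 1)) (hX : ∀ p ∈ Icc (0 : ℝ × ℝ) 1, Measurable (drifted W ξ β p))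
    {p : ℝ × ℝ} (hp : p ∈ Icc (0 : ℝ × ℝ) 1) :
    (girsanov P N z).map (drifted W ξ β p) = P.map (fun ω => ξ + W p ω) := by
  have hQ := h.isProbabilityMeasure_girsanov hW
  have key := h.girsanov_map_restrict hW hβ hX (Nat.zero_le N) (ι := Unit) (p := fun _ => p) (fun _ => hp)
    (A := univ) (@MeasurableSet.univ _ (sheetSigma W (1, grid N 0)))
  rw [Measure.restrict_univ, measure_univ, one_smul, grid_zero, min_eq_right (show (0:ℝ) ≤ p.2 from hp.1.2)] at key
  have h0 : (p.1, (0 : ℝ)) ∈ Icc (0 : ℝ × ℝ) 1 := ⟨⟨hp.1.1, le_rfl⟩, hp.2.1, zero_le_one⟩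
  have e0 : ∀ ω, W (p.1, 0) ω = 0 := fun ω => hW.2.2.1 ω _ h0 (Or.inr rfl)
  have e1 : ∀ ω, drifted W ξ β (p.1, 0) ω = ξ := by
    intro ω
    rw [drifted, e0, setIntegral_measure_zero, add_zero, add_zero]
    rw [volume_Icc_prod]; simp
  simp only [e0, e1, sub_zero] at key
  have hm : Measurable fun v : Unit → EuclideanSpace ℝ (Fin d) => ξ + v () := by fun_prop
  have key2 := congrArg (fun μ => μ.map fun v : Unit → EuclideanSpace ℝ (Fin d) => ξ + v ()) key
  rw [Measure.map_map hm (measurable_pi_lambda _ fun _ => (hX p hp).sub_const _), Measure.map_map hm (measurable_pi_lambda _ fun _ => hW.1 p)] at key2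
  have e2 : drifted W ξ β p = (fun v : Unit → EuclideanSpace ℝ (Fin d) => ξ + v ()) ∘ fun ω _ => drifted W ξ β p ω - ξ := by
    ext1 ω; simp
  rw [e2]
  exact key2

end IsSimple

section

/-- A bounded drift that is progressively measurable for the filtration of the sheet. -/
structure Adm (W : ℝ × ℝ → Ω → EuclideanSpace ℝ (Fin d)) (L : ℝ)
    (β : ℝ × ℝ → Ω → EuclideanSpace ℝ (Fin d)) : Prop where
  bdd : ∀ q ω, ‖β q ω‖ ≤ L
  prog : ∀ p ∈ Icc (0 : ℝ × ℝ) 1, @Measurable _ _ (@Prod.instMeasurableSpace _ _ _ (sheetSigma W p)) _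
    fun x : (ℝ × ℝ) × Ω => (Icc (0 : ℝ × ℝ) p).indicator (fun q => β q x.2) x.1

lemma sheetSigma_prod_le (hm : ∀ p, Measurable (W p)) (p : ℝ × ℝ) :
    @Prod.instMeasurableSpace (ℝ × ℝ) Ω _ (sheetSigma W p) ≤ Prod.instMeasurableSpace :=
  sup_le_sup le_rfl (MeasurableSpace.comap_mono (sheetSigma_le hm p))

lemma one_mem_unit : (1 : ℝ × ℝ) ∈ Icc (0 : ℝ × ℝ) 1 := ⟨zero_le_one, le_rfl⟩

lemma Measurable.piecewise_fst {g g' : (ℝ × ℝ) × Ω → EuclideanSpace ℝ (Fin d)} (hg : Measurable g) (hg' : Measurable g') {A : Set (ℝ × ℝ)} (hA : MeasurableSet A)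
    [DecidablePred (· ∈ A)] : Measurable fun x : (ℝ × ℝ) × Ω => if x.1 ∈ A then g x else g' x :=
  Measurable.ite (hA.preimage measurable_fst) hg hg'

namespace Adm
variable {L : ℝ} {β β' : ℝ × ℝ → Ω → EuclideanSpace ℝ (Fin d)}

lemma measurable (hm : ∀ p, Measurable (W p)) (h : Adm W L β) :
    Measurable fun x : (ℝ × ℝ) × Ω => (Icc (0 : ℝ × ℝ) 1).indicator (fun q => β q x.2) x.1 :=
  (h.prog 1 one_mem_unit).mono (sheetSigma_prod_le hm 1) le_rfl

lemma measurable_section (hm : ∀ p, Measurable (W p)) (h : Adm W L β) (ω : Ω) :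
    Measurable ((Icc (0 : ℝ × ℝ) 1).indicator fun q => β q ω) :=
  (h.measurable hm).comp (measurable_id.prodMk measurable_const)

lemma integrable (hm : ∀ p, Measurable (W p)) (h : Adm W L β) (ω : Ω) :
    Integrable ((Icc (0 : ℝ × ℝ) 1).indicator fun q => β q ω) := by
  have hs : AEStronglyMeasurable ((Icc (0 : ℝ × ℝ) 1).indicator fun q => β q ω) (volume.restrict (Icc (0 : ℝ × ℝ) 1)) :=
    (h.measurable_section hm ω).aestronglyMeasurable
  have := IntegrableOn.of_bound (s := Icc (0 : ℝ × ℝ) 1) isCompact_Icc.measure_lt_top hs L (ae_of_all _ fun q => ?_)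
  · rwa [← integrable_indicator_iff measurableSet_Icc, indicator_indicator, inter_self] at this
  · exact (norm_indicator_le_norm_self _ _).trans (h.bdd q ω)

lemma integrableOn (hm : ∀ p, Measurable (W p)) (h : Adm W L β) (ω : Ω) :
    IntegrableOn (fun q => β q ω) (Icc (0 : ℝ × ℝ) 1) :=
  (integrable_indicator_iff measurableSet_Icc).1 (h.integrable hm ω)

lemma piecewise (h : Adm W L β) (h' : Adm W L β') {A : Set (ℝ × ℝ)} (hA : MeasurableSet A) [DecidablePred (· ∈ A)] :
    Adm W L fun q ω => if q ∈ A then β q ω else β' q ω where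
  bdd q ω := by split_ifs; exacts [h.bdd q ω, h'.bdd q ω]
  prog p hp := by
    have := @Measurable.piecewise_fst Ω (sheetSigma W p) d _ _ (h.prog p hp) (h'.prog p hp) A hA _
    refine (congrArg _ (funext fun x => ?_)).mp this
    by_cases hx : x.1 ∈ A <;> by_cases hx' : x.1 ∈ Icc 0 p <;> simp [hx, hx']

lemma zero (hL : 0 ≤ L) : Adm W L fun _ _ => 0 where
  bdd q ω := by simpa
  prog p hp := by
    simp only [indicator_zero]
    exact @measurable_const _ _ _ (@Prod.instMeasurableSpace (ℝ × ℝ) Ω _ (sheetSigma W p)) _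

end Adm

/-- The average over the grid cell preceding the cell with upper corner `a / N`. -/
def cellAvg (N : ℕ) (h : ℝ × ℝ → EuclideanSpace ℝ (Fin d)) (a : ℤ × ℤ) : EuclideanSpace ℝ (Fin d) :=
  ⨍ y in Metric.closedBall (((a.1 : ℝ) - 3 / 2) / N, ((a.2 : ℝ) - 3 / 2) / N) (1 / (2 * N)), h y

lemma mem_cell {N : ℕ} (hN : 0 < N) {a : ℤ × ℤ} {y : ℝ × ℝ}
    (hy : y ∈ Metric.closedBall (((a.1 : ℝ) - 3 / 2) / N, ((a.2 : ℝ) - 3 / 2) / N) (1 / (2 * N))) :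
    y ≤ (((a.1 : ℝ) - 1) / N, ((a.2 : ℝ) - 1) / N) := by
  have hN' : (0 : ℝ) < N := by exact_mod_cast hN
  rw [Metric.mem_closedBall, Prod.dist_eq, max_le_iff, Real.dist_eq, Real.dist_eq] at hy
  have e : ∀ x : ℝ, (x - 1) / N = (x - 3 / 2) / N + 1 / (2 * N) := fun x => by field_simp; ring
  exact ⟨by simp only [e]; linarith [(abs_le.1 hy.1).2], by simp only [e]; linarith [(abs_le.1 hy.2).2]⟩

lemma cellAvg_congr {N : ℕ} {h h' : ℝ × ℝ → EuclideanSpace ℝ (Fin d)} (hN : 0 < N) {a : ℤ × ℤ}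
    (hh : ∀ y ≤ (((a.1 : ℝ) - 1) / N, ((a.2 : ℝ) - 1) / N), h y = h' y) : cellAvg N h a = cellAvg N h' a := by
  unfold cellAvg
  rw [setAverage_eq, setAverage_eq, setIntegral_congr_fun Metric.isClosed_closedBall.measurableSet fun y hy => hh y (mem_cell hN hy)]

lemma norm_cellAvg_le {N : ℕ} {h : ℝ × ℝ → EuclideanSpace ℝ (Fin d)} {L : ℝ} (hL : ∀ y, ‖h y‖ ≤ L) (a : ℤ × ℤ) :
    ‖cellAvg N h a‖ ≤ L := by
  have hL0 : 0 ≤ L := (norm_nonneg _).trans (hL 0)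
  unfold cellAvg
  set B := Metric.closedBall (((a.1 : ℝ) - 3 / 2) / N, ((a.2 : ℝ) - 3 / 2) / N) (1 / (2 * N))
  rw [setAverage_eq, norm_smul]
  have h1 : ‖∫ y in B, h y‖ ≤ L * volume.real B := norm_setIntegral_le_of_norm_le_const (isCompact_closedBall _ _).measure_lt_top fun y _ => hL y
  rw [norm_inv, Real.norm_of_nonneg measureReal_nonneg]
  rcases (measureReal_nonneg (μ := volume) (s := B)).eq_or_lt with h0 | h0
  · rw [← h0]; simpa
  · rw [inv_mul_le_iff₀ h0, mul_comm]; exact h1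

/-- Averages over the preceding cell of the grid of mesh `1 / N`. -/
def avg (N : ℕ) (β : ℝ × ℝ → Ω → EuclideanSpace ℝ (Fin d)) (q : ℝ × ℝ) (ω : Ω) : EuclideanSpace ℝ (Fin d) :=
  cellAvg N ((Icc (0 : ℝ × ℝ) 1).indicator fun y => β y ω) (⌈(N : ℝ) * q.1⌉, ⌈(N : ℝ) * q.2⌉)

lemma cell_le {N : ℕ} (hN : 0 < N) (x : ℝ) : ((⌈(N : ℝ) * x⌉ : ℝ) - 1) / N ≤ x := by
  have hN' : (0 : ℝ) < N := by exact_mod_cast hN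
  rw [div_le_iff₀ hN']
  linarith [Int.ceil_lt_add_one ((N : ℝ) * x), mul_comm x N]

lemma tendsto_avg {β : ℝ × ℝ → Ω → EuclideanSpace ℝ (Fin d)} {ω : Ω}
    (hβ : Integrable ((Icc (0 : ℝ × ℝ) 1).indicator fun q => β q ω)) :
    ∀ᵐ q, q ∈ Icc (0 : ℝ × ℝ) 1 → Tendsto (fun N => avg N β q ω) atTop (nhds (β q ω)) := by
  filter_upwards [IsUnifLocDoublingMeasure.ae_tendsto_average (μ := volume) hβ.locallyIntegrable 3] with q hq hq1
  have := @hq ℕ atTop (fun N => (((⌈(N : ℝ) * q.1⌉ : ℝ) - 3 / 2) / N, ((⌈(N : ℝ) * q.2⌉ : ℝ) - 3 / 2) / N)) (fun N => 1 / (2 * N)) ?_ ?_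
  · rw [indicator_of_mem hq1] at this
    exact this
  · refine tendsto_nhdsWithin_iff.2 ⟨?_, ?_⟩
    · have h := (tendsto_one_div_atTop_nhds_zero_nat (𝕜 := ℝ)).const_mul (1 / 2)
      simp only [mul_zero] at h
      refine h.congr fun N => ?_
      rw [div_mul_div_comm, one_mul]
    · filter_upwards [eventually_gt_atTop 0] with N hN
      have hN' : (0 : ℝ) < N := by exact_mod_cast hN
      exact mem_Ioi.2 (by positivity)
  · filter_upwards [eventually_gt_atTop 0] with N hN
    have hN' : (0 : ℝ) < N := by exact_mod_cast hN
    have key : ∀ x : ℝ, |x - ((⌈(N : ℝ) * x⌉ : ℝ) - 3 / 2) / N| ≤ 3 * (1 / (2 * N)) := by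
      intro x
      have e : x - ((⌈(N : ℝ) * x⌉ : ℝ) - 3 / 2) / N = (N * x - ⌈(N : ℝ) * x⌉ + 3 / 2) / N := by field_simp; ring
      rw [e, abs_div, abs_of_pos hN', div_le_iff₀ hN']
      have e2 : 3 * (1 / (2 * (N : ℝ))) * N = 3 / 2 := by field_simp
      rw [e2, abs_le]
      constructor <;> linarith [Int.ceil_lt_add_one ((N : ℝ) * x), Int.le_ceil ((N : ℝ) * x)]
    rw [Metric.mem_closedBall, Prod.dist_eq, max_le_iff, Real.dist_eq, Real.dist_eq]
    exact ⟨key _, key _⟩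

lemma measurable_cellAvg {N : ℕ} {g : ℝ × ℝ → Ω → EuclideanSpace ℝ (Fin d)}
    (hg : Measurable fun x : (ℝ × ℝ) × Ω => g x.1 x.2) (a : ℤ × ℤ) : Measurable fun ω => cellAvg N (fun y => g y ω) a := by
  unfold cellAvg
  simp only [average]
  exact measurable_integral_left (J := g) hg

lemma Adm.avg_eq {N : ℕ} (hN : 0 < N) {β : ℝ × ℝ → Ω → EuclideanSpace ℝ (Fin d)} {a : ℤ × ℤ} {p : ℝ × ℝ} (hp : p ∈ Icc (0 : ℝ × ℝ) 1)
    (ha : (((a.1 : ℝ) - 1) / N, ((a.2 : ℝ) - 1) / N) ≤ p) (ω : Ω) :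
    cellAvg N ((Icc (0 : ℝ × ℝ) 1).indicator fun y => β y ω) a = cellAvg N ((Icc (0 : ℝ × ℝ) p).indicator fun y => β y ω) a := by
  refine cellAvg_congr hN fun y hy => ?_
  by_cases h0 : 0 ≤ y
  · rw [indicator_of_mem, indicator_of_mem]
    exacts [⟨h0, hy.trans ha⟩, ⟨h0, (hy.trans ha).trans hp.2⟩]
  · rw [indicator_of_notMem, indicator_of_notMem]
    exacts [fun h => h0 h.1, fun h => h0 h.1]

lemma Adm.measurable_cellAvg {N : ℕ} (hN : 0 < N) {L : ℝ} {β : ℝ × ℝ → Ω → EuclideanSpace ℝ (Fin d)} (h : Adm W L β) {a : ℤ × ℤ} {p : ℝ × ℝ} (hp : p ∈ Icc (0 : ℝ × ℝ) 1)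
    (ha : (((a.1 : ℝ) - 1) / N, ((a.2 : ℝ) - 1) / N) ≤ p) :
    Measurable[sheetSigma W p] fun ω => cellAvg N ((Icc (0 : ℝ × ℝ) 1).indicator fun y => β y ω) a := by
  simp_rw [Adm.avg_eq hN hp ha]
  exact @_root_.measurable_cellAvg _ (sheetSigma W p) _ N (fun y ω => (Icc (0 : ℝ × ℝ) p).indicator (fun y => β y ω) y) (h.prog p hp) a

attribute [irreducible] cellAvg

lemma measurable_ceil_pair (N : ℕ) : Measurable fun q : ℝ × ℝ => (⌈(N : ℝ) * q.1⌉, ⌈(N : ℝ) * q.2⌉) :=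
  (Int.measurable_ceil.comp (measurable_fst.const_mul _)).prodMk (Int.measurable_ceil.comp (measurable_snd.const_mul _))

lemma measurable_cellAvg_ceil {N : ℕ} {g : ℝ × ℝ → Ω → EuclideanSpace ℝ (Fin d)}
    (hg : Measurable fun x : (ℝ × ℝ) × Ω => g x.1 x.2) :
    Measurable fun x : (ℝ × ℝ) × Ω => cellAvg N (fun y => g y x.2) (⌈(N : ℝ) * x.1.1⌉, ⌈(N : ℝ) * x.1.2⌉) := by
  have hF : Measurable fun x : (ℤ × ℤ) × Ω => cellAvg N (fun y => g y x.2) x.1 :=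
    measurable_from_prod_countable_right fun a => measurable_cellAvg hg a
  have hG : Measurable fun x : (ℝ × ℝ) × Ω => ((⌈(N : ℝ) * x.1.1⌉, ⌈(N : ℝ) * x.1.2⌉), x.2) :=
    ((measurable_ceil_pair N).comp measurable_fst).prodMk measurable_snd
  exact hF.comp hG

lemma Measurable.indicator_fst {g : (ℝ × ℝ) × Ω → EuclideanSpace ℝ (Fin d)} (hg : Measurable g) {A : Set (ℝ × ℝ)} (hA : MeasurableSet A) :
    Measurable fun x : (ℝ × ℝ) × Ω => A.indicator (fun q => g (q, x.2)) x.1 :=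
  hg.indicator (hA.preimage measurable_fst)

lemma measurable_indicator_avg {N : ℕ} (hN : 0 < N) {β : ℝ × ℝ → Ω → EuclideanSpace ℝ (Fin d)} {p : ℝ × ℝ} (hp : p ∈ Icc (0 : ℝ × ℝ) 1)
    (h : Measurable fun x : (ℝ × ℝ) × Ω => (Icc (0 : ℝ × ℝ) p).indicator (fun q => β q x.2) x.1) :
    Measurable fun x : (ℝ × ℝ) × Ω => (Icc (0 : ℝ × ℝ) p).indicator (fun q => avg N β q x.2) x.1 := by
  have h2 := measurable_cellAvg_ceil (N := N) (g := fun q ω => (Icc (0 : ℝ × ℝ) p).indicator (fun q => β q ω) q) h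
  have h3 := Measurable.indicator_fst h2 (A := Icc 0 p) measurableSet_Icc
  have e : (fun x : (ℝ × ℝ) × Ω => (Icc (0 : ℝ × ℝ) p).indicator (fun q => avg N β q x.2) x.1) =
      fun x => (Icc 0 p).indicator (fun q => cellAvg N (fun y => (Icc (0 : ℝ × ℝ) p).indicator (fun q => β q x.2) y) (⌈(N : ℝ) * q.1⌉, ⌈(N : ℝ) * q.2⌉)) x.1 :=
    funext fun x => congrFun (indicator_congr fun q hq => Adm.avg_eq hN hp (le_trans ⟨cell_le hN _, cell_le hN _⟩ hq.2) x.2) x.1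
  rw [e]
  exact h3

lemma norm_avg_le {N : ℕ} {β : ℝ × ℝ → Ω → EuclideanSpace ℝ (Fin d)} {L : ℝ} (hL : ∀ q ω, ‖β q ω‖ ≤ L) (q : ℝ × ℝ) (ω : Ω) : ‖avg N β q ω‖ ≤ L := by
  have h : ∀ y, ‖(Icc (0 : ℝ × ℝ) 1).indicator (fun y => β y ω) y‖ ≤ L := fun y => (norm_indicator_le_norm_self (fun y => β y ω) y).trans (hL y ω)
  unfold avg
  generalize (⌈(N : ℝ) * q.1⌉, ⌈(N : ℝ) * q.2⌉) = a
  exact norm_cellAvg_le h a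

attribute [irreducible] avg

lemma adm_avg {N : ℕ} (hN : 0 < N) {L : ℝ} {β : ℝ × ℝ → Ω → EuclideanSpace ℝ (Fin d)} (h : Adm W L β) : Adm W L (avg N β) where
  bdd q ω := norm_avg_le h.bdd q ω
  prog p hp := @measurable_indicator_avg Ω (sheetSigma W p) d N hN β p hp (h.prog p hp)

end

lemma grid_succ_sub (N k : ℕ) : grid N (k + 1) - grid N k = 1 / N := by
  unfold grid; push_cast; ring

lemma ceil_of_mem_grid {N : ℕ} (hN : 0 < N) {j : ℕ} {x : ℝ} (hx : x ∈ Ioc (grid N j) (grid N (j + 1))) : ⌈(N : ℝ) * x⌉ = (j : ℤ) + 1 := by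
  have hN' : (0 : ℝ) < N := by exact_mod_cast hN
  obtain ⟨h1, h2⟩ := hx
  unfold grid at h1 h2
  rw [div_lt_iff₀ hN'] at h1
  rw [le_div_iff₀ hN'] at h2
  push_cast at h2
  rw [Int.ceil_eq_iff]
  push_cast
  constructor <;> linarith

lemma exists_mem_grid {N : ℕ} (hN : 0 < N) {x : ℝ} (h0 : 0 < x) (h1 : x ≤ 1) : ∃ j < N, x ∈ Ioc (grid N j) (grid N (j + 1)) := by
  have hN' : (0 : ℝ) < N := by exact_mod_cast hN
  have hpos : 0 < (N : ℝ) * x := by positivity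
  obtain ⟨j, hj⟩ : ∃ j, ⌈(N : ℝ) * x⌉₊ = j + 1 := Nat.exists_eq_succ_of_ne_zero (Nat.ceil_pos.2 hpos).ne'
  have hj' := (Nat.ceil_eq_iff (Nat.succ_ne_zero j)).1 hj
  refine ⟨j, ?_, ?_, ?_⟩
  · have : (j : ℝ) < N := by
      have := hj'.1
      simp only [Nat.succ_eq_add_one, Nat.add_sub_cancel] at this
      nlinarith
    exact_mod_cast this
  · unfold grid
    rw [div_lt_iff₀ hN']
    have := hj'.1
    simp only [Nat.succ_eq_add_one, Nat.add_sub_cancel] at this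
    linarith
  · unfold grid
    rw [le_div_iff₀ hN']
    have := hj'.2
    linarith

lemma grid_mem_unit {N j : ℕ} (hj : j ≤ N) : ((grid N j, 1) : ℝ × ℝ) ∈ Icc (0 : ℝ × ℝ) 1 :=
  ⟨⟨grid_nonneg N j, zero_le_one⟩, grid_le_one hj, le_rfl⟩

lemma wstrip_grid_fst {N k : ℕ} (hk : k < N) (s : ℝ) (c : EuclideanSpace ℝ (Fin d)) :
    (wstrip W N k (s, 1) c).1 = (Icc 0 s ×ˢ Ioc (grid N k) (grid N (k + 1))).indicator fun _ => c := by
  rw [wstrip_fst]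
  congr 1
  simp only [min_eq_right (grid_le_one hk.le), min_eq_right (grid_le_one (show k + 1 ≤ N from hk))]
  ext ⟨x, y⟩
  have h0 := grid_nonneg N k
  simp only [Set.mem_sdiff, mem_Icc, Prod.le_def, Prod.fst_zero, Prod.snd_zero, mem_prod, mem_Ioc]
  constructor
  · rintro ⟨⟨⟨h1, h2⟩, h3, h4⟩, h5⟩
    exact ⟨⟨h1, h3⟩, not_le.1 fun h => h5 ⟨⟨h1, h2⟩, h3, h⟩, h4⟩
  · rintro ⟨⟨h1, h2⟩, h3, h4⟩
    exact ⟨⟨⟨h1, h0.trans h3.le⟩, h2, h4⟩, fun h => absurd h.2.2 (not_le.2 h3)⟩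

/-- The element of the Gaussian space attached to a cell of the grid. -/
def gridCell (W : ℝ × ℝ → Ω → EuclideanSpace ℝ (Fin d)) (N j k : ℕ) (c : EuclideanSpace ℝ (Fin d)) :
    (ℝ × ℝ → EuclideanSpace ℝ (Fin d)) × (Ω → ℝ) :=
  wstrip W N k (grid N (j + 1), 1) c - wstrip W N k (grid N j, 1) c

lemma gridCell_fst {N j k : ℕ} (hk : k < N) (c : EuclideanSpace ℝ (Fin d)) :
    (gridCell W N j k c).1 = (Ioc (grid N j) (grid N (j + 1)) ×ˢ Ioc (grid N k) (grid N (k + 1))).indicator fun _ => c := by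
  rw [gridCell, Prod.fst_sub, wstrip_grid_fst hk, wstrip_grid_fst hk,
    ← indicator_sdiff (prod_mono (Icc_subset_Icc_right (grid_mono N j.le_succ)) le_rfl)]
  congr 1
  ext ⟨x, y⟩
  have h0 := grid_nonneg N j
  simp only [Set.mem_sdiff, mem_Icc, mem_prod, mem_Ioc]
  constructor
  · rintro ⟨⟨⟨h1, h2⟩, h3, h4⟩, h5⟩
    exact ⟨⟨not_le.1 fun h => h5 ⟨⟨h1, h⟩, h3, h4⟩, h2⟩, h3, h4⟩
  · rintro ⟨⟨h1, h2⟩, h3, h4⟩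
    exact ⟨⟨⟨h0.trans h1.le, h2⟩, h3, h4⟩, fun h => absurd h.1.2 (not_le.2 h1)⟩

lemma gridCell_mem {N j k : ℕ} (hj : j < N) (c : EuclideanSpace ℝ (Fin d)) :
    gridCell W N j k c ∈ strip W (grid N k) (grid N (k + 1)) :=
  sub_mem (wstrip_mem (grid_mem_unit hj) c) (wstrip_mem (grid_mem_unit hj.le) c)

/-- The Gaussian representation of the averaged drift on a strip. -/
def avgStep (W : ℝ × ℝ → Ω → EuclideanSpace ℝ (Fin d)) (N : ℕ) (β : ℝ × ℝ → Ω → EuclideanSpace ℝ (Fin d)) (k : ℕ) (ω : Ω) :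
    (ℝ × ℝ → EuclideanSpace ℝ (Fin d)) × (Ω → ℝ) :=
  ∑ l : Fin N × Fin d, cellAvg N ((Icc (0 : ℝ × ℝ) 1).indicator fun y => β y ω) ((l.1 : ℤ) + 1, (k : ℤ) + 1) l.2 •
    gridCell W N l.1 k (EuclideanSpace.single l.2 1)

lemma avg_of_nonpos {N : ℕ} {β : ℝ × ℝ → Ω → EuclideanSpace ℝ (Fin d)} (hN : 0 < N) {q : ℝ × ℝ} (hq : q.1 ≤ 0) (ω : Ω) : avg N β q ω = 0 := by
  have hN' : (0 : ℝ) < N := by exact_mod_cast hN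
  rw [avg, cellAvg_congr (h' := fun _ => 0) hN, cellAvg]
  · simp
  · intro y hy
    refine indicator_of_notMem (fun h => ?_) _
    have h1 := hy.1.trans_lt (show ((⌈(N : ℝ) * q.1⌉ : ℝ) - 1) / N < 0 from ?_)
    · exact absurd h.1.1 (not_le.2 h1)
    · refine div_neg_of_neg_of_pos ?_ hN'
      have : ⌈(N : ℝ) * q.1⌉ ≤ 0 := Int.ceil_le.2 (by push_cast; nlinarith)
      have : ((⌈(N : ℝ) * q.1⌉ : ℤ) : ℝ) ≤ 0 := by exact_mod_cast this
      linarith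

lemma avgStep_fst {N k : ℕ} (hk : k < N) (β : ℝ × ℝ → Ω → EuclideanSpace ℝ (Fin d)) (ω : Ω) (q : ℝ × ℝ) :
    (avgStep W N β k ω).1 q = (Icc 0 1 ×ˢ Ioc (grid N k) (grid N (k + 1))).indicator (fun q => avg N β q ω) q := by
  have hN : 0 < N := by omega
  have e1 : (avgStep W N β k ω).1 q = ∑ j : Fin N, (Ioc (grid N j) (grid N (j + 1)) ×ˢ Ioc (grid N k) (grid N (k + 1))).indicator
      (fun _ => cellAvg N ((Icc (0 : ℝ × ℝ) 1).indicator fun y => β y ω) ((j : ℤ) + 1, (k : ℤ) + 1)) q := by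
    unfold avgStep
    rw [Prod.fst_sum, Finset.sum_apply, Fintype.sum_prod_type]
    refine Finset.sum_congr rfl fun j _ => ?_
    simp only [Prod.smul_fst, Pi.smul_apply, gridCell_fst hk]
    by_cases hq : q ∈ Ioc (grid N j) (grid N (j + 1)) ×ˢ Ioc (grid N k) (grid N (k + 1))
    · simp only [indicator_of_mem hq]
      ext i
      simp [Finset.sum_apply, Pi.single_apply]
    · simp only [indicator_of_notMem hq, smul_zero, Finset.sum_const_zero]
  rw [e1]
  by_cases hq : q ∈ Icc 0 1 ×ˢ Ioc (grid N k) (grid N (k + 1))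
  · rw [indicator_of_mem hq]
    rcases hq.1.1.eq_or_lt with h0 | h0
    · rw [avg_of_nonpos hN h0.symm.le]
      refine Finset.sum_eq_zero fun j _ => indicator_of_notMem (fun h => ?_) _
      exact absurd (h.1.1.trans_eq h0.symm) (not_lt.2 (grid_nonneg N j))
    · obtain ⟨j, hj, hqj⟩ := exists_mem_grid hN h0 hq.1.2
      rw [Finset.sum_eq_single_of_mem (⟨j, hj⟩ : Fin N) (Finset.mem_univ _), indicator_of_mem (show q ∈ Ioc (grid N j) (grid N (j + 1)) ×ˢ Ioc (grid N k) (grid N (k + 1)) from ⟨hqj, hq.2⟩), avg,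
        ceil_of_mem_grid hN hqj, ceil_of_mem_grid hN hq.2]
      intro j' _ hj'
      refine indicator_of_notMem (fun h => hj' (Fin.ext ?_)) _
      have h1 := (ceil_of_mem_grid hN h.1).symm.trans (ceil_of_mem_grid hN hqj)
      exact_mod_cast add_right_cancel h1
  · rw [indicator_of_notMem hq]
    refine Finset.sum_eq_zero fun j _ => indicator_of_notMem (fun h => hq ⟨⟨?_, ?_⟩, h.2⟩) _
    · exact (grid_nonneg N j).trans h.1.1.le
    · exact h.1.2.trans (grid_le_one j.2)

lemma isSimple_avg {N : ℕ} (hN : 0 < N) {L : ℝ} {β : ℝ × ℝ → Ω → EuclideanSpace ℝ (Fin d)} (h : Adm W L β) :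
    IsSimple W N L (avg N β) (avgStep W N β) where
  pos := hN
  step k hk := by
    refine ⟨Fin N × Fin d, inferInstance, _, _, fun l => ?_, fun l => gridCell_mem l.1.2 _, fun ω => rfl⟩
    have hp : ((1, grid N k) : ℝ × ℝ) ∈ Icc (0 : ℝ × ℝ) 1 := ⟨⟨zero_le_one, grid_nonneg N k⟩, le_rfl, grid_le_one hk.le⟩
    have hm := h.measurable_cellAvg hN (a := ((l.1 : ℤ) + 1, (k : ℤ) + 1)) hp ?_
    · exact (EuclideanSpace.proj (𝕜 := ℝ) l.2).continuous.measurable.comp hm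
    · refine ⟨?_, ?_⟩
      · have := grid_le_one l.1.2.le
        unfold grid at this
        simpa using this
      · simp [grid]
  eq k hk q ω h0 h1 h2 h3 := by
    rw [avgStep_fst hk, indicator_of_mem]
    exact ⟨⟨h0, h1⟩, h2, h3⟩
  bdd k hk ω := by
    have hN' : (0 : ℝ) < N := by exact_mod_cast hN
    have hS : MeasurableSet (Icc (0 : ℝ) 1 ×ˢ Ioc (grid N k) (grid N (k + 1))) := measurableSet_Icc.prod measurableSet_Ioc
    have hv : volume (Icc (0 : ℝ) 1 ×ˢ Ioc (grid N k) (grid N (k + 1))) = ENNReal.ofReal (1 / N) := by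
      rw [Measure.volume_eq_prod, Measure.prod_prod, Real.volume_Icc, Real.volume_Ioc, grid_succ_sub]
      simp
    have e : ∀ q, ⟪(avgStep W N β k ω).1 q, (avgStep W N β k ω).1 q⟫ ≤ (Icc (0 : ℝ) 1 ×ˢ Ioc (grid N k) (grid N (k + 1))).indicator (fun _ => L ^ 2) q := by
      intro q
      rw [avgStep_fst hk]
      by_cases hq : q ∈ Icc (0 : ℝ) 1 ×ˢ Ioc (grid N k) (grid N (k + 1))
      · rw [indicator_of_mem hq, indicator_of_mem hq, real_inner_self_eq_norm_sq]
        exact pow_le_pow_left₀ (norm_nonneg _) (norm_avg_le h.bdd q ω) 2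
      · rw [indicator_of_notMem hq, indicator_of_notMem hq, inner_zero_left]
    have hi : Integrable ((Icc (0 : ℝ) 1 ×ˢ Ioc (grid N k) (grid N (k + 1))).indicator (fun _ : ℝ × ℝ => L ^ 2)) :=
      (integrable_indicator_iff hS).2 (integrableOn_const (by rw [hv]; exact ENNReal.ofReal_ne_top))
    calc wip (avgStep W N β k ω) (avgStep W N β k ω) ≤ ∫ q, (Icc (0 : ℝ) 1 ×ˢ Ioc (grid N k) (grid N (k + 1))).indicator (fun _ => L ^ 2) q :=
          integral_mono_of_nonneg (ae_of_all _ fun q => real_inner_self_nonneg) hi (ae_of_all _ e)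
      _ = L ^ 2 / N := by
          rw [integral_indicator hS, setIntegral_const, measureReal_def, hv, ENNReal.toReal_ofReal (by positivity), smul_eq_mul]
          ring

lemma continuous_integral_Icc {F : Type*} [NormedAddCommGroup F] [NormedSpace ℝ F] {h : ℝ × ℝ → F} (hh : Integrable h) :
    Continuous fun p : ℝ × ℝ => ∫ q in Icc 0 p, h q := by
  simp_rw [← integral_indicator measurableSet_Icc]
  refine continuous_iff_continuousAt.2 fun p => ?_
  refine continuousAt_of_dominated (bound := fun q => ‖h q‖) (Eventually.of_forall fun x => hh.aestronglyMeasurable.indicator measurableSet_Icc)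
    (Eventually.of_forall fun x => ae_of_all _ fun q => norm_indicator_le_norm_self _ _) hh.norm ?_
  have h1 : ∀ᵐ q : ℝ × ℝ, q.1 ≠ p.1 := by
    rw [Measure.volume_eq_prod]
    exact Measure.quasiMeasurePreserving_fst.ae (Measure.ae_ne volume p.1)
  have h2 : ∀ᵐ q : ℝ × ℝ, q.2 ≠ p.2 := by
    rw [Measure.volume_eq_prod]
    exact Measure.quasiMeasurePreserving_snd.ae (Measure.ae_ne volume p.2)
  filter_upwards [h1, h2] with q hq1 hq2
  have key : ∀ {x y : ℝ} (π : ℝ × ℝ → ℝ), Continuous π → π p = y → x ≠ y → ∀ᶠ z in nhds p, (x ≤ π z ↔ x ≤ y) := by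
    intro x y π hπ hy hxy
    rcases lt_or_gt_of_ne hxy with h | h
    · filter_upwards [hπ.continuousAt.eventually (lt_mem_nhds (show x < π p by rw [hy]; exact h))] with z hz
      exact ⟨fun _ => h.le, fun _ => hz.le⟩
    · filter_upwards [hπ.continuousAt.eventually (gt_mem_nhds (show π p < x by rw [hy]; exact h))] with z hz
      exact ⟨fun h' => absurd h' (not_le.2 hz), fun h' => absurd h' (not_le.2 h)⟩
  refine (continuousAt_const (y := (Icc 0 p).indicator h q)).congr ?_
  filter_upwards [key Prod.fst continuous_fst rfl hq1, key Prod.snd continuous_snd rfl hq2] with z hz1 hz2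
  have : q ∈ Icc 0 z ↔ q ∈ Icc 0 p := by
    simp only [mem_Icc, Prod.le_def, hz1, hz2]
  by_cases hq : q ∈ Icc 0 p
  · rw [indicator_of_mem hq, indicator_of_mem (this.2 hq)]
  · rw [indicator_of_notMem hq, indicator_of_notMem (mt this.1 hq)]

lemma setIntegral_Icc_eq {F : Type*} [NormedAddCommGroup F] [NormedSpace ℝ F] {h : ℝ × ℝ → F} {p p' : ℝ × ℝ} (hp : p ≤ p') :
    ∫ q in Icc 0 p, h q = ∫ q in Icc 0 p, (Icc 0 p').indicator h q :=
  setIntegral_congr_fun measurableSet_Icc fun q hq => (indicator_of_mem (show q ∈ Icc 0 p' from ⟨hq.1, hq.2.trans hp⟩) h).symm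

lemma continuous_inf_prod (a : ℝ × ℝ) : Continuous fun p : ℝ × ℝ => p ⊓ a :=
  (continuous_fst.min continuous_const).prodMk (continuous_snd.min continuous_const)

lemma continuous_sup_prod (a : ℝ × ℝ) : Continuous fun p : ℝ × ℝ => a ⊔ p :=
  (continuous_const.max continuous_fst).prodMk (continuous_const.max continuous_snd)

namespace Adm
variable {L : ℝ} {β β' : ℝ × ℝ → Ω → EuclideanSpace ℝ (Fin d)} {ξ : EuclideanSpace ℝ (Fin d)}

lemma continuous_integral (hm : ∀ p, Measurable (W p)) (h : Adm W L β) (ω : Ω) :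
    Continuous fun p : ℝ × ℝ => ∫ q in Icc 0 (p ⊓ 1), β q ω := by
  have := (continuous_integral_Icc (h.integrable hm ω)).comp (continuous_inf_prod 1)
  refine this.congr fun p => ?_
  exact (setIntegral_Icc_eq inf_le_right).symm

lemma measurable_integral (h : Adm W L β) {p p' : ℝ × ℝ} (hp : p ≤ p') (hp' : p' ∈ Icc (0 : ℝ × ℝ) 1) :
    Measurable[sheetSigma W p'] fun ω => ∫ q in Icc 0 p, β q ω := by
  have e : (fun ω => ∫ q in Icc 0 p, β q ω) = fun ω => ∫ q in Icc 0 p, (Icc 0 p').indicator (fun q => β q ω) q := funext fun ω => setIntegral_Icc_eq hp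
  rw [e]
  exact @measurable_integral_left _ (sheetSigma W p') _ _ _ _ _ _ _ _ _ _ (fun q ω => (Icc (0 : ℝ × ℝ) p').indicator (fun q => β q ω) q) (h.prog p' hp')

lemma measurable_drifted (h : Adm W L β) {p p' : ℝ × ℝ} (h0 : 0 ≤ p) (hp : p ≤ p') (hp' : p' ∈ Icc (0 : ℝ × ℝ) 1) :
    Measurable[sheetSigma W p'] (drifted W ξ β p) :=
  ((measurable_sheet ⟨h0, hp⟩).const_add ξ).add (h.measurable_integral hp hp')

end Adm

/-- The drift `f` along the process whose drift is `β` read with delay `δ` in the second variable. -/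
def feedback (W : ℝ × ℝ → Ω → EuclideanSpace ℝ (Fin d)) (ξ : EuclideanSpace ℝ (Fin d))
    (f : (ℝ × ℝ) × EuclideanSpace ℝ (Fin d) → EuclideanSpace ℝ (Fin d)) (δ : ℝ)
    (β : ℝ × ℝ → Ω → EuclideanSpace ℝ (Fin d)) (q : ℝ × ℝ) (ω : Ω) : EuclideanSpace ℝ (Fin d) :=
  f (q, ξ + W q ω + ∫ r in Icc 0 (q.1, q.2 - δ), β r ω)

/-- Substituting an adapted continuous process into a measurable function. -/
lemma adm_comp {L : ℝ} {f : (ℝ × ℝ) × EuclideanSpace ℝ (Fin d) → EuclideanSpace ℝ (Fin d)} (hf : Measurable f) (hL : ∀ x, ‖f x‖ ≤ L)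
    {X : ℝ × ℝ → Ω → EuclideanSpace ℝ (Fin d)} (hXc : ∀ ω, ContinuousOn (fun p => X p ω) (Icc 0 1))
    (hXm : ∀ p ∈ Icc (0 : ℝ × ℝ) 1, Measurable[sheetSigma W p] (X p)) : Adm W L fun q ω => f (q, X q ω) where
  bdd q ω := hL _
  prog p hp := by
    have hmem : ∀ q, (0 ⊔ q) ⊓ p ∈ Icc 0 p := fun q => ⟨le_inf le_sup_left hp.1, inf_le_right⟩
    have h1 : @Measurable _ _ (@Prod.instMeasurableSpace (ℝ × ℝ) Ω _ (sheetSigma W p)) _ fun x : (ℝ × ℝ) × Ω => X ((0 ⊔ x.1) ⊓ p) x.2 := by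
      refine @measurable_uncurry_of_continuous' _ _ _ _ _ _ _ _ (sheetSigma W p) _ _ _ _ (fun q ω => X ((0 ⊔ q) ⊓ p) ω) (fun ω => ?_) (fun q => ?_)
      · exact (hXc ω).comp_continuous ((continuous_inf_prod p).comp (continuous_sup_prod 0)) fun q => ⟨(hmem q).1, (hmem q).2.trans hp.2⟩
      · have := hXm ((0 ⊔ q) ⊓ p) ⟨(hmem q).1, (hmem q).2.trans hp.2⟩
        exact this.mono (sheetSigma_mono (hmem q).2) le_rfl
    have h2 := hf.comp ((@measurable_fst _ _ _ (sheetSigma W p)).prodMk h1)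
    have h3 := @Measurable.indicator_fst Ω (sheetSigma W p) d _ h2 (Icc 0 p) measurableSet_Icc
    refine (congrArg _ (funext fun x => ?_)).mp h3
    refine congrFun (indicator_congr fun q hq => ?_) x.1
    simp only [Function.comp_apply]
    rw [sup_eq_right.2 hq.1, inf_eq_left.2 hq.2]

lemma adm_feedback (hm : ∀ p, Measurable (W p)) (hc : ∀ ω, Continuous fun p => W p ω) {L : ℝ} {f : (ℝ × ℝ) × EuclideanSpace ℝ (Fin d) → EuclideanSpace ℝ (Fin d)}
    (hf : Measurable f) (hL : ∀ x, ‖f x‖ ≤ L) (ξ : EuclideanSpace ℝ (Fin d)) {δ : ℝ} (hδ : 0 ≤ δ) {L' : ℝ} {β : ℝ × ℝ → Ω → EuclideanSpace ℝ (Fin d)} (h : Adm W L' β) :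
    Adm W L (feedback W ξ f δ β) := by
  have hle : ∀ q : ℝ × ℝ, (q.1, q.2 - δ) ≤ q := fun q => ⟨le_rfl, by simpa⟩
  refine adm_comp hf hL (X := fun q ω => ξ + W q ω + ∫ r in Icc 0 (q.1, q.2 - δ), β r ω) (fun ω => ?_) fun p hp => ?_
  · refine (continuous_const.add (hc ω)).continuousOn.add ?_
    have := (h.continuous_integral hm ω).comp (show Continuous fun q : ℝ × ℝ => (q.1, q.2 - δ) by fun_prop)
    refine this.continuousOn.congr fun q hq => ?_
    simp only [Function.comp_apply]
    rw [inf_eq_left.2 ((hle q).trans hq.2)]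
  · exact ((measurable_sheet ⟨hp.1, le_rfl⟩).const_add ξ).add (h.measurable_integral (hle p) hp)

lemma lintegral_mul_le_sqrt {α : Type*} [MeasurableSpace α] {μ : Measure α} {F G : α → ℝ≥0∞} (hF : AEMeasurable F μ) (hG : AEMeasurable G μ) :
    ∫⁻ x, F x * G x ∂μ ≤ (∫⁻ x, F x ^ 2 ∂μ) ^ (1 / 2 : ℝ) * (∫⁻ x, G x ^ 2 ∂μ) ^ (1 / 2 : ℝ) := by
  have := ENNReal.lintegral_mul_le_Lp_mul_Lq μ Real.HolderConjugate.two_two hF hG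
  simpa using this

lemma lintegral_le_sqrt {α : Type*} [MeasurableSpace α] {μ : Measure α} [IsProbabilityMeasure μ] {F : α → ℝ≥0∞} (hF : AEMeasurable F μ) :
    ∫⁻ x, F x ∂μ ≤ (∫⁻ x, F x ^ 2 ∂μ) ^ (1 / 2 : ℝ) := by
  simpa using lintegral_mul_le_sqrt (G := fun _ => 1) hF aemeasurable_const

/-- The constant of the change of measure. -/
def girC (L : ℝ) : ℝ≥0∞ := ENNReal.ofReal (Real.exp (L ^ 2 / 2))

lemma girC_eq (L : ℝ) : ENNReal.ofReal (Real.exp (L ^ 2)) ^ (1 / 2 : ℝ) = girC L := by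
  rw [ENNReal.ofReal_rpow_of_pos (Real.exp_pos _), ← Real.exp_mul, girC]
  congr 2
  ring

lemma girC_ne_top (L : ℝ) : girC L ≠ ∞ := ENNReal.ofReal_ne_top

namespace IsSimple
variable {N : ℕ} {L : ℝ} {β : ℝ × ℝ → Ω → EuclideanSpace ℝ (Fin d)} {z : ℕ → Ω → (ℝ × ℝ → EuclideanSpace ℝ (Fin d)) × (Ω → ℝ)}

lemma lintegral_girsanov_le [IsProbabilityMeasure P] (hW : IsBrownianSheet P d W) (h : IsSimple W N L β z) {F : Ω → ℝ≥0∞} (hF : Measurable F) :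
    ∫⁻ ω, F ω ∂(girsanov P N z) ≤ (∫⁻ ω, F ω ^ 2 ∂P) ^ (1 / 2 : ℝ) * girC L := by
  rw [h.lintegral_girsanov hW hF]
  refine (lintegral_mul_le_sqrt hF.aemeasurable (h.measurable_rho hW).ennreal_ofReal.aemeasurable).trans ?_
  gcongr
  rw [← girC_eq]
  refine ENNReal.rpow_le_rpow (le_trans (le_of_eq ?_) (h.lintegral_rho_sq hW)) (by norm_num)
  exact lintegral_congr fun ω => (ENNReal.ofReal_pow (rho_pos N z ω).le 2).symm

lemma lintegral_le_girsanov [IsProbabilityMeasure P] (hW : IsBrownianSheet P d W) (h : IsSimple W N L β z) {F : Ω → ℝ≥0∞} (hF : Measurable F) :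
    ∫⁻ ω, F ω ∂P ≤ (∫⁻ ω, F ω ^ 2 ∂(girsanov P N z)) ^ (1 / 2 : ℝ) * girC L := by
  have hm := h.measurable_rho hW
  have e : ∀ ω, F ω = (F ω * ENNReal.ofReal (√(rho N z ω))) * ENNReal.ofReal (√(rho N z ω)⁻¹) := fun ω => by
    rw [mul_assoc, ← ENNReal.ofReal_mul (Real.sqrt_nonneg _), ← Real.sqrt_mul (rho_pos N z ω).le, mul_inv_cancel₀ (rho_pos N z ω).ne']
    simp
  rw [lintegral_congr e]
  refine (lintegral_mul_le_sqrt (hF.mul hm.sqrt.ennreal_ofReal).aemeasurable hm.inv.sqrt.ennreal_ofReal.aemeasurable).trans ?_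
  refine mul_le_mul' (le_of_eq ?_) ?_
  · rw [h.lintegral_girsanov hW (hF.pow_const 2)]
    congr 1
    refine lintegral_congr fun ω => ?_
    simp only [Pi.mul_apply]
    rw [mul_pow, ← ENNReal.ofReal_pow (Real.sqrt_nonneg _), Real.sq_sqrt (rho_pos N z ω).le]
  · rw [← girC_eq]
    refine ENNReal.rpow_le_rpow (le_trans (le_of_eq ?_) (h.lintegral_rho_inv hW)) (by norm_num)
    refine lintegral_congr fun ω => ?_
    simp only [Pi.inv_apply]
    rw [← ENNReal.ofReal_pow (Real.sqrt_nonneg _), Real.sq_sqrt (inv_nonneg.2 (rho_pos N z ω).le)]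

lemma prob_drifted_le [IsProbabilityMeasure P] (hW : IsBrownianSheet P d W) (h : IsSimple W N L β z) (hA : Adm W L β) (ξ : EuclideanSpace ℝ (Fin d)) {p : ℝ × ℝ}
    (hp : p ∈ Icc (0 : ℝ × ℝ) 1) {A : Set (EuclideanSpace ℝ (Fin d))} (hAm : MeasurableSet A) :
    P (drifted W ξ β p ⁻¹' A) ≤ (P ((fun ω => ξ + W p ω) ⁻¹' A)) ^ (1 / 2 : ℝ) * girC L := by
  have hX : ∀ p ∈ Icc (0 : ℝ × ℝ) 1, Measurable (drifted W ξ β p) := fun p hp =>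
    (hA.measurable_drifted hp.1 le_rfl hp).mono (sheetSigma_le hW.1 _) le_rfl
  have h1 := h.lintegral_le_girsanov hW (F := (drifted W ξ β p ⁻¹' A).indicator 1) (measurable_one.indicator (hX p hp hAm))
  have h2 : ∀ ω, ((drifted W ξ β p ⁻¹' A).indicator 1 ω : ℝ≥0∞) ^ 2 = (drifted W ξ β p ⁻¹' A).indicator 1 ω := fun ω => by
    by_cases hω : ω ∈ drifted W ξ β p ⁻¹' A <;> simp [hω]
  simp_rw [h2, lintegral_indicator_one (hX p hp hAm)] at h1
  refine h1.trans (le_of_eq ?_)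
  rw [← Measure.map_apply (hX p hp) hAm, h.girsanov_map_drifted hW (hA.integrableOn hW.1) hX hp, Measure.map_apply ((hW.1 p).const_add ξ) hAm]

end IsSimple

lemma tendsto_integral_avg (hm : ∀ p, Measurable (W p)) {L : ℝ} {β : ℝ × ℝ → Ω → EuclideanSpace ℝ (Fin d)} (h : Adm W L β) (ω : Ω) :
    Tendsto (fun N => ∫⁻ q in Icc (0 : ℝ × ℝ) 1, ‖avg (N + 1) β q ω - β q ω‖ₑ) atTop (nhds 0) := by
  have hmeas : ∀ N : ℕ, AEMeasurable (fun q => ‖avg (N + 1) β q ω - β q ω‖ₑ) (volume.restrict (Icc (0 : ℝ × ℝ) 1)) := fun N =>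
    ((((adm_avg N.succ_pos h).integrableOn hm ω).aestronglyMeasurable.sub (h.integrableOn hm ω).aestronglyMeasurable).enorm)
  have := tendsto_lintegral_of_dominated_convergence' (μ := volume.restrict (Icc (0 : ℝ × ℝ) 1))
    (F := fun N q => ‖avg (N + 1) β q ω - β q ω‖ₑ) (f := fun _ => 0) (fun _ => ENNReal.ofReal (L + L)) hmeas
    (fun N => ae_of_all _ fun q => ?_) ?_ ?_
  · simpa using this
  · beta_reduce
    rw [← ofReal_norm]
    exact ENNReal.ofReal_le_ofReal ((norm_sub_le _ _).trans (add_le_add ((adm_avg N.succ_pos h).bdd q ω) (h.bdd q ω)))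
  · rw [lintegral_const]
    exact ENNReal.mul_ne_top ENNReal.ofReal_ne_top (by rw [Measure.restrict_apply_univ]; exact isCompact_Icc.measure_lt_top.ne)
  · filter_upwards [ae_restrict_of_ae (tendsto_avg (h.integrable hm ω)), ae_restrict_mem measurableSet_Icc] with q hq hq1
    have h1 := ((hq hq1).comp (tendsto_add_atTop_nat 1)).sub_const (β q ω)
    rw [sub_self] at h1
    have h2 := h1.enorm
    simp only [Function.comp_apply, enorm_zero] at h2
    exact h2

lemma enorm_drifted_sub_le {ξ : EuclideanSpace ℝ (Fin d)} {β β' : ℝ × ℝ → Ω → EuclideanSpace ℝ (Fin d)} {ω : Ω}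
    (h : IntegrableOn (fun q => β q ω) (Icc (0 : ℝ × ℝ) 1)) (h' : IntegrableOn (fun q => β' q ω) (Icc (0 : ℝ × ℝ) 1)) {p : ℝ × ℝ} (hp : p ≤ 1) :
    ‖drifted W ξ β p ω - drifted W ξ β' p ω‖ₑ ≤ ∫⁻ q in Icc (0 : ℝ × ℝ) 1, ‖β q ω - β' q ω‖ₑ := by
  have hs : Icc (0 : ℝ × ℝ) p ⊆ Icc 0 1 := Icc_subset_Icc_right hp
  have e : drifted W ξ β p ω - drifted W ξ β' p ω = ∫ q in Icc (0 : ℝ × ℝ) p, (β q ω - β' q ω) := by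
    rw [integral_sub (h.mono_set hs) (h'.mono_set hs)]
    simp [drifted]
  rw [e]
  exact (enorm_integral_le_lintegral_enorm _).trans (lintegral_mono_set hs)

lemma tendsto_drifted_avg (hm : ∀ p, Measurable (W p)) {L : ℝ} {β : ℝ × ℝ → Ω → EuclideanSpace ℝ (Fin d)} (h : Adm W L β) (ξ : EuclideanSpace ℝ (Fin d)) {p : ℝ × ℝ} (hp : p ≤ 1) (ω : Ω) :
    Tendsto (fun N => drifted W ξ (avg (N + 1) β) p ω) atTop (nhds (drifted W ξ β p ω)) := by
  rw [tendsto_iff_edist_tendsto_0]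
  refine tendsto_of_tendsto_of_tendsto_of_le_of_le tendsto_const_nhds (tendsto_integral_avg hm h ω) (fun _ => bot_le) fun N => ?_
  simp only [edist_eq_enorm_sub]
  exact enorm_drifted_sub_le ((adm_avg N.succ_pos h).integrableOn hm ω) (h.integrableOn hm ω) hp

/-- The law of a process with bounded drift is controlled by that of the sheet, uniformly in the drift. -/
lemma Adm.prob_drifted_le [IsProbabilityMeasure P] (hW : IsBrownianSheet P d W) {L : ℝ} {β : ℝ × ℝ → Ω → EuclideanSpace ℝ (Fin d)}
    (h : Adm W L β) (ξ : EuclideanSpace ℝ (Fin d)) {p : ℝ × ℝ} (hp : p ∈ Icc (0 : ℝ × ℝ) 1) {A : Set (EuclideanSpace ℝ (Fin d))} (hA : MeasurableSet A) :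
    P (drifted W ξ β p ⁻¹' A) ≤ (P ((fun ω => ξ + W p ω) ⁻¹' A)) ^ (1 / 2 : ℝ) * girC L := by
  have hX : ∀ {β : ℝ × ℝ → Ω → EuclideanSpace ℝ (Fin d)}, Adm W L β → Measurable (drifted W ξ β p) := fun h =>
    (h.measurable_drifted hp.1 le_rfl hp).mono (sheetSigma_le hW.1 _) le_rfl
  have hopen : ∀ U : Set (EuclideanSpace ℝ (Fin d)), IsOpen U →
      P (drifted W ξ β p ⁻¹' U) ≤ (P ((fun ω => ξ + W p ω) ⁻¹' U)) ^ (1 / 2 : ℝ) * girC L := by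
    intro U hU
    have hsub : drifted W ξ β p ⁻¹' U ⊆ liminf (fun N => drifted W ξ (avg (N + 1) β) p ⁻¹' U) atTop := by
      intro ω hω
      rw [mem_liminf_iff_eventually_mem]
      exact (tendsto_drifted_avg hW.1 h ξ hp.2 ω).eventually (hU.mem_nhds hω)
    refine (measure_mono hsub).trans ?_
    have hL : 0 ≤ L := by
      rcases isEmpty_or_nonempty Ω with _ | ⟨⟨ω⟩⟩
      · exact absurd (measure_univ (μ := P)) (by simp [Set.eq_empty_of_isEmpty])
      · exact (norm_nonneg _).trans (h.bdd 0 ω)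
    have h1 : ∀ N : ℕ, P (drifted W ξ (avg (N + 1) β) p ⁻¹' U) ≤ (P ((fun ω => ξ + W p ω) ⁻¹' U)) ^ (1 / 2 : ℝ) * girC L :=
      fun N => (isSimple_avg N.succ_pos h).prob_drifted_le hW (adm_avg N.succ_pos h) ξ hp hU.measurableSet
    rw [liminf_eq_iSup_iInf_of_nat]
    simp only [iSup_eq_iUnion, iInf_eq_iInter]
    rw [Monotone.measure_iUnion]
    · refine iSup_le fun n => (measure_mono (iInter₂_subset n le_rfl)).trans (h1 n)
    · intro m n hmn
      exact biInter_subset_biInter_left fun k hk => le_trans hmn hk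
  have : IsProbabilityMeasure (P.map fun ω => ξ + W p ω) := Measure.isProbabilityMeasure_map ((hW.1 p).const_add ξ).aemeasurable
  have hlim : Tendsto (fun n : ℕ => (P ((fun ω => ξ + W p ω) ⁻¹' A) + (n : ℝ≥0∞)⁻¹) ^ (1 / 2 : ℝ) * girC L) atTop
      (nhds ((P ((fun ω => ξ + W p ω) ⁻¹' A) + 0) ^ (1 / 2 : ℝ) * girC L)) := by
    refine ENNReal.Tendsto.mul_const ?_ (Or.inr (girC_ne_top L))
    exact (ENNReal.continuous_rpow_const.tendsto _).comp (tendsto_const_nhds.add ENNReal.tendsto_inv_nat_nhds_zero)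
  rw [add_zero] at hlim
  refine ge_of_tendsto' hlim fun n => ?_
  obtain ⟨U, hAU, hU, hle⟩ := Set.exists_isOpen_le_add A (P.map fun ω => ξ + W p ω) (ε := (n : ℝ≥0∞)⁻¹) (by simp)
  rw [Measure.map_apply ((hW.1 p).const_add ξ) hU.measurableSet, Measure.map_apply ((hW.1 p).const_add ξ) hA] at hle
  refine (measure_mono (preimage_mono hAU)).trans ((hopen U hU).trans ?_)
  gcongr

lemma enorm_modulus_affine {F G : Type*} [NormedAddCommGroup F] [NormedAddCommGroup G] {g : F → G} (hg : UniformContinuous g) {L : ℝ} (hL : ∀ z, ‖g z‖ ≤ L)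
    {ε : ℝ≥0∞} (hε : 0 < ε) : ∃ C : ℝ≥0, ∀ p q, ‖g p - g q‖ₑ ≤ ε + C * ‖p - q‖ₑ := by
  have hL0 : 0 ≤ L := (norm_nonneg _).trans (hL 0)
  rw [EMetric.uniformContinuous_iff] at hg
  obtain ⟨δ, hδ, H⟩ := hg ε hε
  obtain ⟨r, hr0, hr⟩ := ENNReal.lt_iff_exists_nnreal_btwn.1 hδ
  have hr0' : (0 : ℝ≥0) < r := by exact_mod_cast hr0
  refine ⟨(L + L).toNNReal / r, fun p q => ?_⟩
  by_cases h : edist p q < δ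
  · have := (H h).le
    rw [edist_eq_enorm_sub] at this
    exact this.trans le_self_add
  · rw [not_lt, edist_eq_enorm_sub] at h
    have h1 : ‖g p - g q‖ₑ ≤ ENNReal.ofReal (L + L) := by
      rw [← ofReal_norm]
      exact ENNReal.ofReal_le_ofReal ((norm_sub_le _ _).trans (add_le_add (hL p) (hL q)))
    refine h1.trans (le_trans ?_ le_add_self)
    calc ENNReal.ofReal (L + L) = (((L + L).toNNReal / r : ℝ≥0) : ℝ≥0∞) * r := by
          rw [← ENNReal.coe_mul, div_mul_cancel₀ _ hr0'.ne', ENNReal.ofReal]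
      _ ≤ _ := by gcongr; exact hr.le.trans h

/-- Bounded measurable functions act continuously, in `L¹`, on families of random variables whose laws
are uniformly dominated by a fixed finite measure. -/
theorem tendsto_comp_of_dominated {α F G ι : Type*} [MeasurableSpace α] {μ : Measure α} [IsProbabilityMeasure μ]
    [NormedAddCommGroup F] [NormedSpace ℝ F] [FiniteDimensional ℝ F] [MeasurableSpace F] [BorelSpace F]
    [NormedAddCommGroup G] [NormedSpace ℝ G] [MeasurableSpace G] [BorelSpace G] [SecondCountableTopology G]
    {Γ : Measure F} [IsFiniteMeasure Γ] {K : ℝ≥0∞} (hK : K ≠ ∞) {f : F → G} (hf : Measurable f) {L : ℝ} (hL : ∀ z, ‖f z‖ ≤ L)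
    {l : Filter ι} {φ ψ : ι → α → F} (hφm : ∀ i, AEMeasurable (φ i) μ) (hψm : ∀ i, AEMeasurable (ψ i) μ)
    (hφ : ∀ i A, MeasurableSet A → μ (φ i ⁻¹' A) ≤ K * Γ A ^ (1 / 2 : ℝ)) (hψ : ∀ i A, MeasurableSet A → μ (ψ i ⁻¹' A) ≤ K * Γ A ^ (1 / 2 : ℝ))
    (h : Tendsto (fun i => ∫⁻ x, ‖φ i x - ψ i x‖ₑ ∂μ) l (nhds 0)) :
    Tendsto (fun i => ∫⁻ x, ‖f (φ i x) - f (ψ i x)‖ₑ ∂μ) l (nhds 0) := by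
  have : ProperSpace F := FiniteDimensional.proper ℝ F
  set c := ENNReal.ofReal (L + L) with hc
  rw [ENNReal.tendsto_nhds_zero]
  intro ε hε
  rcases eq_or_ne ε ∞ with rfl | hε'
  · exact Eventually.of_forall fun _ => le_top
  obtain ⟨η, hη, hηε⟩ : ∃ η : ℝ≥0∞, 0 < η ∧ 6 * η ≤ ε := ⟨ε / 6, ENNReal.div_pos hε.ne' (by norm_num), by rw [ENNReal.mul_div_cancel (by norm_num) (by norm_num)]⟩
  have hη' : η ≠ ∞ := fun h => by simp [h] at hηε; exact hε' hηε
  set x := η / (c * K + 1) with hx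
  have hcK : c * K + 1 ≠ ∞ := ENNReal.add_ne_top.2 ⟨ENNReal.mul_ne_top ENNReal.ofReal_ne_top hK, ENNReal.one_ne_top⟩
  have hx0 : x ≠ 0 := (ENNReal.div_pos hη.ne' hcK).ne'
  have hfm : MemLp f 1 Γ := MemLp.of_bound hf.aestronglyMeasurable L (ae_of_all _ hL)
  obtain ⟨g, hgs, hgε, hgc, -⟩ := hfm.exists_hasCompactSupport_eLpNorm_sub_le ENNReal.one_ne_top (ε := η * x ^ 2)
    (mul_ne_zero hη.ne' (pow_ne_zero _ hx0))
  obtain ⟨L', hL'⟩ := hgs.exists_bound_of_continuous hgc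
  obtain ⟨C, hC⟩ := enorm_modulus_affine (hgs.uniformContinuous_of_continuous hgc) hL' hη
  have hBm : Measurable fun z => ‖f z - g z‖ₑ := (hf.sub hgc.measurable).enorm
  set B := {z | η ≤ ‖f z - g z‖ₑ}
  have hB : MeasurableSet B := measurableSet_le measurable_const hBm
  have hΓB : Γ B ≤ x ^ 2 := by
    rw [eLpNorm_one_eq_lintegral_enorm] at hgε
    have h1 := mul_meas_ge_le_lintegral (μ := Γ) hBm η
    have h2 := h1.trans hgε
    rwa [ENNReal.mul_le_mul_iff_right hη.ne' hη'] at h2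
  have key : ∀ φ : α → F, AEMeasurable φ μ → (∀ A, MeasurableSet A → μ (φ ⁻¹' A) ≤ K * Γ A ^ (1 / 2 : ℝ)) →
      ∫⁻ y, min ‖f (φ y) - g (φ y)‖ₑ c ∂μ ≤ 2 * η := by
    intro φ hφm hφ
    have hBn : NullMeasurableSet (φ ⁻¹' B) μ := hφm.nullMeasurable hB
    calc ∫⁻ y, min ‖f (φ y) - g (φ y)‖ₑ c ∂μ ≤ ∫⁻ y, (η + (φ ⁻¹' B).indicator (fun _ => c) y) ∂μ := by
          refine lintegral_mono fun y => ?_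
          by_cases hy : y ∈ φ ⁻¹' B
          · simp only [indicator_of_mem hy]
            exact (min_le_right _ _).trans le_add_self
          · refine (min_le_left _ _).trans (le_trans ?_ le_self_add)
            exact (not_le.1 hy).le
      _ = η + c * μ (φ ⁻¹' B) := by
          rw [lintegral_add_left measurable_const, lintegral_const, measure_univ, mul_one, lintegral_indicator_const₀ hBn]
      _ ≤ η + c * (K * (x ^ 2) ^ (1 / 2 : ℝ)) := by gcongr; exact (hφ B hB).trans (by gcongr)
      _ = η + c * K * x := by
          rw [← ENNReal.rpow_natCast, ← ENNReal.rpow_mul]; norm_num [mul_assoc]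
      _ ≤ η + η := by
          gcongr
          calc c * K * x ≤ (c * K + 1) * x := by gcongr; exact le_self_add
            _ = η := by rw [hx, ENNReal.mul_div_cancel (by simp) hcK]
      _ = 2 * η := (two_mul η).symm
  have hlim : Tendsto (fun i => (C : ℝ≥0∞) * ∫⁻ x, ‖φ i x - ψ i x‖ₑ ∂μ) l (nhds 0) := by
    have := ENNReal.Tendsto.const_mul h (Or.inr (ENNReal.coe_ne_top (r := C)))
    rwa [mul_zero] at this
  filter_upwards [(ENNReal.tendsto_nhds_zero.1 hlim) η hη] with i hi
  have hm1 : AEMeasurable (fun y => min ‖f (φ i y) - g (φ i y)‖ₑ c) μ := (hBm.min measurable_const).comp_aemeasurable (hφm i)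
  have hm2 : AEMeasurable (fun y => min ‖f (ψ i y) - g (ψ i y)‖ₑ c) μ := (hBm.min measurable_const).comp_aemeasurable (hψm i)
  calc ∫⁻ y, ‖f (φ i y) - f (ψ i y)‖ₑ ∂μ
      ≤ ∫⁻ y, (min ‖f (φ i y) - g (φ i y)‖ₑ c + (min ‖f (ψ i y) - g (ψ i y)‖ₑ c + (η + C * ‖φ i y - ψ i y‖ₑ))) ∂μ := by
        refine lintegral_mono fun y => ?_
        have h1 : ‖f (φ i y) - f (ψ i y)‖ₑ ≤ c := by
          rw [← ofReal_norm]
          exact ENNReal.ofReal_le_ofReal ((norm_sub_le _ _).trans (add_le_add (hL _) (hL _)))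
        have h2 : ‖f (φ i y) - f (ψ i y)‖ₑ ≤ ‖f (φ i y) - g (φ i y)‖ₑ + (‖f (ψ i y) - g (ψ i y)‖ₑ + ‖g (φ i y) - g (ψ i y)‖ₑ) := by
          calc _ = ‖(f (φ i y) - g (φ i y)) + (-(f (ψ i y) - g (ψ i y)) + (g (φ i y) - g (ψ i y)))‖ₑ := by congr 1; abel
            _ ≤ _ := (enorm_add_le _ _).trans (by gcongr; exact (enorm_add_le _ _).trans (by rw [enorm_neg]))
        beta_reduce
        rcases le_total ‖f (φ i y) - g (φ i y)‖ₑ c with h3 | h3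
        · rcases le_total ‖f (ψ i y) - g (ψ i y)‖ₑ c with h4 | h4
          · rw [min_eq_left h3, min_eq_left h4]
            refine h2.trans ?_
            gcongr
            exact hC _ _
          · rw [min_eq_right h4]
            exact h1.trans (le_self_add.trans le_add_self)
        · rw [min_eq_right h3]
          exact h1.trans le_self_add
    _ = ∫⁻ y, min ‖f (φ i y) - g (φ i y)‖ₑ c ∂μ + (∫⁻ y, min ‖f (ψ i y) - g (ψ i y)‖ₑ c ∂μ + (η + C * ∫⁻ y, ‖φ i y - ψ i y‖ₑ ∂μ)) := by
        rw [lintegral_add_left' hm1, lintegral_add_left' hm2, lintegral_add_left measurable_const, lintegral_const_mul' _ _ ENNReal.coe_ne_top]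
        simp
    _ ≤ 2 * η + (2 * η + (η + η)) := by
        gcongr
        · exact key _ (hφm i) (hφ i)
        · exact key _ (hψm i) (hψ i)
    _ = 6 * η := by ring
    _ ≤ ε := hηε

/-- The projection of the plane onto the unit square. -/
def clamp (p : ℝ × ℝ) : ℝ × ℝ := 0 ⊔ (p ⊓ 1)

lemma clamp_mem (p : ℝ × ℝ) : clamp p ∈ Icc (0 : ℝ × ℝ) 1 := ⟨le_sup_left, sup_le one_mem_unit.1 inf_le_right⟩

lemma clamp_eq {p : ℝ × ℝ} (hp : p ∈ Icc (0 : ℝ × ℝ) 1) : clamp p = p := by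
  rw [clamp, inf_eq_left.2 hp.2, sup_eq_right.2 hp.1]

lemma continuous_clamp : Continuous clamp := (continuous_sup_prod 0).comp (continuous_inf_prod 1)

lemma clamp_le {p q : ℝ × ℝ} (hq : 0 ≤ q) (h : p ⊓ 1 ≤ q) : clamp p ≤ q := sup_le hq h

/-- Lebesgue measure on the unit square. -/
def unitVol : Measure (ℝ × ℝ) := volume.restrict (Icc 0 1)

instance : IsProbabilityMeasure unitVol where
  measure_univ := by
    rw [unitVol, Measure.restrict_apply_univ, volume_Icc_prod]
    simp

lemma ae_unitVol {p : ℝ × ℝ → Prop} (h : ∀ q ∈ Icc (0 : ℝ × ℝ) 1, p q) : ∀ᵐ q ∂unitVol, p q :=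
  (ae_restrict_mem measurableSet_Icc).mono h

lemma ae_unitVol_prod [SFinite P] {p : (ℝ × ℝ) × Ω → Prop} (h : ∀ x : (ℝ × ℝ) × Ω, x.1 ∈ Icc (0 : ℝ × ℝ) 1 → p x) : ∀ᵐ x ∂(unitVol.prod P), p x :=
  (Measure.quasiMeasurePreserving_fst.ae (ae_unitVol fun _ hq => hq)).mono h

lemma measurable_clamp {X : ℝ × ℝ → Ω → EuclideanSpace ℝ (Fin d)} (hXc : ∀ ω, ContinuousOn (fun p => X p ω) (Icc 0 1))
    (hXm : ∀ p ∈ Icc (0 : ℝ × ℝ) 1, Measurable (X p)) : Measurable fun x : (ℝ × ℝ) × Ω => X (clamp x.1) x.2 :=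
  measurable_uncurry_of_continuous' (u := fun p ω => X (clamp p) ω) (fun ω => (hXc ω).comp_continuous continuous_clamp clamp_mem) fun p => hXm _ (clamp_mem p)

namespace Adm
variable {L : ℝ} {β β' : ℝ × ℝ → Ω → EuclideanSpace ℝ (Fin d)} {ξ : EuclideanSpace ℝ (Fin d)}

lemma continuousOn_integral (hm : ∀ p, Measurable (W p)) (h : Adm W L β) (ω : Ω) :
    ContinuousOn (fun p : ℝ × ℝ => ∫ q in Icc 0 p, β q ω) (Icc 0 1) :=
  (h.continuous_integral hm ω).continuousOn.congr fun p hp => by beta_reduce; rw [inf_eq_left.2 hp.2]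

lemma continuousOn_drifted (hm : ∀ p, Measurable (W p)) (hc : ∀ ω, Continuous fun p => W p ω) (h : Adm W L β) (ω : Ω) :
    ContinuousOn (fun p => drifted W ξ β p ω) (Icc 0 1) :=
  (continuous_const.add (hc ω)).continuousOn.add (h.continuousOn_integral hm ω)

lemma measurable_drifted' (hm : ∀ p, Measurable (W p)) (h : Adm W L β) {p : ℝ × ℝ} (hp : p ∈ Icc (0 : ℝ × ℝ) 1) : Measurable (drifted W ξ β p) :=
  (h.measurable_drifted hp.1 le_rfl hp).mono (sheetSigma_le hm _) le_rfl

lemma measurable_drifted_clamp (hm : ∀ p, Measurable (W p)) (hc : ∀ ω, Continuous fun p => W p ω) (h : Adm W L β) :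
    Measurable fun x : (ℝ × ℝ) × Ω => drifted W ξ β (clamp x.1) x.2 :=
  measurable_clamp (h.continuousOn_drifted hm hc) fun _ => h.measurable_drifted' hm

end Adm

/-- A process on the unit square whose one-point laws are controlled by those of the sheet. -/
structure Dominated (P : Measure Ω) (W : ℝ × ℝ → Ω → EuclideanSpace ℝ (Fin d)) (ξ : EuclideanSpace ℝ (Fin d)) (L : ℝ) (X : ℝ × ℝ → Ω → EuclideanSpace ℝ (Fin d)) : Prop where
  meas : Measurable fun x : (ℝ × ℝ) × Ω => X (clamp x.1) x.2
  le : ∀ p ∈ Icc (0 : ℝ × ℝ) 1, ∀ A, MeasurableSet A → P (X p ⁻¹' A) ≤ (P ((fun ω => ξ + W p ω) ⁻¹' A)) ^ (1 / 2 : ℝ) * girC L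

lemma Adm.dominated [IsProbabilityMeasure P] (hW : IsBrownianSheet P d W) (hc : ∀ ω, Continuous fun p => W p ω) {L : ℝ} {β : ℝ × ℝ → Ω → EuclideanSpace ℝ (Fin d)}
    (h : Adm W L β) (ξ : EuclideanSpace ℝ (Fin d)) : Dominated P W ξ L (drifted W ξ β) :=
  ⟨h.measurable_drifted_clamp hW.1 hc, fun _ hp _ hA => h.prob_drifted_le hW ξ hp hA⟩

namespace Dominated
variable {ξ : EuclideanSpace ℝ (Fin d)} {L : ℝ} {X : ℝ × ℝ → Ω → EuclideanSpace ℝ (Fin d)}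

/-- The joint law of a point of the square and the value of the shifted sheet. -/
def _root_.sheetLaw (P : Measure Ω) (W : ℝ × ℝ → Ω → EuclideanSpace ℝ (Fin d)) (ξ : EuclideanSpace ℝ (Fin d)) : Measure ((ℝ × ℝ) × EuclideanSpace ℝ (Fin d)) :=
  (unitVol.prod P).map fun x => (x.1, ξ + W x.1 x.2)

lemma measure_le [IsProbabilityMeasure P] (hm : ∀ p, Measurable (W p)) (hc : ∀ ω, Continuous fun p => W p ω) (h : Dominated P W ξ L X) {A : Set ((ℝ × ℝ) × EuclideanSpace ℝ (Fin d))}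
    (hA : MeasurableSet A) : (unitVol.prod P) ((fun x : (ℝ × ℝ) × Ω => (x.1, X (clamp x.1) x.2)) ⁻¹' A) ≤ girC L * sheetLaw P W ξ A ^ (1 / 2 : ℝ) := by
  have hWm : Measurable fun x : (ℝ × ℝ) × Ω => (x.1, ξ + W x.1 x.2) :=
    measurable_fst.prodMk ((measurable_uncurry_of_continuous' (u := fun p ω => W p ω) hc hm).const_add ξ)
  have hX := measurable_fst.prodMk h.meas
  have hsec : Measurable fun p => P (Prod.mk p ⁻¹' ((fun x : (ℝ × ℝ) × Ω => (x.1, ξ + W x.1 x.2)) ⁻¹' A)) := measurable_measure_prodMk_left (hWm hA)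
  rw [sheetLaw, Measure.map_apply hWm hA, Measure.prod_apply (hX hA), Measure.prod_apply (hWm hA), mul_comm]
  calc _ ≤ ∫⁻ p, (P (Prod.mk p ⁻¹' ((fun x : (ℝ × ℝ) × Ω => (x.1, ξ + W x.1 x.2)) ⁻¹' A))) ^ (1 / 2 : ℝ) * girC L ∂unitVol := by
        refine lintegral_mono_ae (ae_unitVol fun p hp => ?_)
        have := h.le p hp (Prod.mk p ⁻¹' A) (measurable_prodMk_left hA)
        simpa only [preimage_preimage, clamp_eq hp] using this
    _ = (∫⁻ p, (P (Prod.mk p ⁻¹' ((fun x : (ℝ × ℝ) × Ω => (x.1, ξ + W x.1 x.2)) ⁻¹' A))) ^ (1 / 2 : ℝ) ∂unitVol) * girC L :=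
        lintegral_mul_const' _ _ (girC_ne_top L)
    _ ≤ _ := by
        gcongr
        refine (lintegral_le_sqrt (hsec.pow_const _).aemeasurable).trans (le_of_eq ?_)
        congr 1
        refine lintegral_congr fun p => ?_
        rw [← ENNReal.rpow_natCast, ← ENNReal.rpow_mul]
        norm_num

theorem tendsto_comp [IsProbabilityMeasure P] (hm : ∀ p, Measurable (W p)) (hc : ∀ ω, Continuous fun p => W p ω) {f : (ℝ × ℝ) × EuclideanSpace ℝ (Fin d) → EuclideanSpace ℝ (Fin d)}
    (hf : Measurable f) (hL : ∀ x, ‖f x‖ ≤ L) {ι : Type*} {l : Filter ι} {X Z : ι → ℝ × ℝ → Ω → EuclideanSpace ℝ (Fin d)} {L' : ℝ}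
    (hX : ∀ i, Dominated P W ξ L' (X i)) (hZ : ∀ i, Dominated P W ξ L' (Z i))
    (h : Tendsto (fun i => ∫⁻ x, ‖X i x.1 x.2 - Z i x.1 x.2‖ₑ ∂(unitVol.prod P)) l (nhds 0)) :
    Tendsto (fun i => ∫⁻ x, ‖f (x.1, X i x.1 x.2) - f (x.1, Z i x.1 x.2)‖ₑ ∂(unitVol.prod P)) l (nhds 0) := by
  have : IsProbabilityMeasure (sheetLaw P W ξ) := Measure.isProbabilityMeasure_map
    (measurable_fst.prodMk ((measurable_uncurry_of_continuous' (u := fun p ω => W p ω) hc hm).const_add ξ)).aemeasurable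
  have := tendsto_comp_of_dominated (μ := unitVol.prod P) (Γ := sheetLaw P W ξ) (girC_ne_top L') hf hL (l := l)
    (φ := fun i x => (x.1, X i (clamp x.1) x.2)) (ψ := fun i x => (x.1, Z i (clamp x.1) x.2))
    (fun i => (measurable_fst.prodMk (hX i).meas).aemeasurable) (fun i => (measurable_fst.prodMk (hZ i).meas).aemeasurable)
    (fun i A hA => (hX i).measure_le hm hc hA) (fun i A hA => (hZ i).measure_le hm hc hA) ?_
  · refine this.congr fun i => lintegral_congr_ae (ae_unitVol_prod fun x hx => ?_)
    simp only [clamp_eq hx]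
  · refine h.congr fun i => lintegral_congr_ae (ae_unitVol_prod fun x hx => ?_)
    simp only [clamp_eq hx, Prod.mk_sub_mk, sub_self, enorm_eq_nnnorm, Prod.nnnorm_def, nnnorm_zero]
    rw [max_eq_right (zero_le)]

end Dominated

/-- The process with drift `β` up to the second coordinate `τ p.2` and drift `β'` afterwards. -/
def mixed (W : ℝ × ℝ → Ω → EuclideanSpace ℝ (Fin d)) (ξ : EuclideanSpace ℝ (Fin d)) (β β' : ℝ × ℝ → Ω → EuclideanSpace ℝ (Fin d)) (τ : ℝ → ℝ) (p : ℝ × ℝ) (ω : Ω) : EuclideanSpace ℝ (Fin d) :=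
  drifted W ξ β' p ω + ((∫ q in Icc 0 (p.1, τ p.2), β q ω) - ∫ q in Icc 0 (p.1, τ p.2), β' q ω)

lemma mixed_eq_drifted (hm : ∀ p, Measurable (W p)) {L : ℝ} {β β' : ℝ × ℝ → Ω → EuclideanSpace ℝ (Fin d)} {ξ : EuclideanSpace ℝ (Fin d)} (h : Adm W L β) (h' : Adm W L β')
    {τ : ℝ → ℝ} {p : ℝ × ℝ} (hp : p ∈ Icc (0 : ℝ × ℝ) 1) (hτ : τ p.2 ≤ p.2) (ω : Ω) :
    mixed W ξ β β' τ p ω = drifted W ξ (fun q ω => if q ∈ {q : ℝ × ℝ | q.2 ≤ τ p.2} then β q ω else β' q ω) p ω := by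
  set A := {q : ℝ × ℝ | q.2 ≤ τ p.2}
  have hA : MeasurableSet A := measurableSet_le measurable_snd measurable_const
  have hs : Icc (0 : ℝ × ℝ) p ⊆ Icc 0 1 := Icc_subset_Icc_right hp.2
  have hI : Icc (0 : ℝ × ℝ) p ∩ A = Icc 0 (p.1, τ p.2) := by
    ext q
    simp only [mem_inter_iff, mem_Icc, Prod.le_def, A, mem_ofPred_eq]
    exact ⟨fun h => ⟨h.1.1, h.1.2.1, h.2⟩, fun h => ⟨⟨h.1, h.2.1, h.2.2.trans hτ⟩, h.2.2⟩⟩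
  have i1 := (h.integrableOn hm ω).mono_set hs
  have i2 := (h'.integrableOn hm ω).mono_set hs
  simp only [mixed, drifted, add_assoc]
  congr 2
  have e1 : ∀ γ : ℝ × ℝ → Ω → EuclideanSpace ℝ (Fin d), ∫ q in Icc 0 (p.1, τ p.2), γ q ω = ∫ q in Icc 0 p, A.indicator (fun q => γ q ω) q := fun γ => by
    rw [setIntegral_indicator hA, hI]
  have i3 : Integrable (fun a => A.indicator (fun q => β q ω) a - A.indicator (fun q => β' q ω) a) (volume.restrict (Icc 0 p)) :=
    (i1.indicator hA).sub (i2.indicator hA)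
  rw [e1, e1, ← integral_sub (i1.indicator hA) (i2.indicator hA), ← integral_add i2 i3]
  refine integral_congr_ae (ae_of_all _ fun q => ?_)
  by_cases hq : q ∈ A
  · simp only [indicator_of_mem hq, if_pos (show q ∈ {q : ℝ × ℝ | q.2 ≤ τ p.2} from hq), add_sub_cancel]
  · simp only [indicator_of_notMem hq, if_neg (show q ∉ {q : ℝ × ℝ | q.2 ≤ τ p.2} from hq), sub_zero, add_zero]

lemma Adm.dominated_mixed [IsProbabilityMeasure P] (hW : IsBrownianSheet P d W) (hc : ∀ ω, Continuous fun p => W p ω) {L : ℝ} {β β' : ℝ × ℝ → Ω → EuclideanSpace ℝ (Fin d)}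
    (h : Adm W L β) (h' : Adm W L β') (ξ : EuclideanSpace ℝ (Fin d)) {τ : ℝ → ℝ} (hτm : Measurable τ) (hτ : ∀ t ∈ Icc (0 : ℝ) 1, τ t ≤ t) :
    Dominated P W ξ L (mixed W ξ β β' τ) where
  meas := by
    have key : ∀ {γ : ℝ × ℝ → Ω → EuclideanSpace ℝ (Fin d)}, Adm W L γ → Measurable fun x : (ℝ × ℝ) × Ω => ∫ q in Icc 0 ((clamp x.1).1, τ (clamp x.1).2), γ q x.2 := by
      intro γ hγ
      have h1 : Measurable fun x : (ℝ × ℝ) × Ω => ∫ q in Icc 0 (x.1 ⊓ 1), γ q x.2 :=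
        measurable_uncurry_of_continuous' (u := fun p ω => ∫ q in Icc 0 (p ⊓ 1), γ q ω) (hγ.continuous_integral hW.1) fun p =>
          (hγ.measurable_integral inf_le_right one_mem_unit).mono (sheetSigma_le hW.1 _) le_rfl
      have hcl := continuous_clamp.measurable
      have h2 := h1.comp (((hcl.fst.prodMk (hτm.comp hcl.snd)).comp measurable_fst).prodMk measurable_snd : Measurable fun x : (ℝ × ℝ) × Ω => (((clamp x.1).1, τ (clamp x.1).2), x.2))
      refine (congrArg _ (funext fun x => ?_)).mp h2
      have hcm := clamp_mem x.1
      have : (((clamp x.1).1, τ (clamp x.1).2) : ℝ × ℝ) ≤ 1 := ⟨hcm.2.1, (hτ _ ⟨hcm.1.2, hcm.2.2⟩).trans hcm.2.2⟩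
      simp only [Function.comp_apply]
      rw [inf_eq_left.2 this]
    exact (h'.measurable_drifted_clamp hW.1 hc).add ((key h).sub (key h'))
  le p hp A hA := by
    have hB : MeasurableSet {q : ℝ × ℝ | q.2 ≤ τ p.2} := measurableSet_le measurable_snd measurable_const
    have := (h.piecewise h' hB).prob_drifted_le hW ξ hp hA
    rwa [← funext (mixed_eq_drifted hW.1 h h' hp (hτ _ ⟨hp.1.2, hp.2.2⟩))] at this

lemma measurable_intervalIntegral {α E : Type*} [MeasurableSpace α] [NormedAddCommGroup E] [NormedSpace ℝ E] [MeasurableSpace E] [BorelSpace E] [SecondCountableTopology E]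
    {g : ℝ → α → E} (hg : Measurable fun x : ℝ × α => g x.1 x.2) {a b : α → ℝ} (ha : Measurable a) (hb : Measurable b) :
    Measurable fun x => ∫ r in a x..b x, g r x := by
  have key : ∀ {a b : α → ℝ}, Measurable a → Measurable b → Measurable fun x => ∫ r in Ioc (a x) (b x), g r x := by
    intro a b ha hb
    have hS : MeasurableSet {x : ℝ × α | x.1 ∈ Ioc (a x.2) (b x.2)} :=
      (measurableSet_lt (ha.comp measurable_snd) measurable_fst).inter (measurableSet_le measurable_fst (hb.comp measurable_snd))
    have h2 := (hg.indicator hS).stronglyMeasurable.integral_prod_left' (μ := (volume : Measure ℝ))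
    refine (congrArg _ (funext fun x => ?_)).mp h2.measurable
    rw [← integral_indicator measurableSet_Ioc]
    rfl
  simp only [intervalIntegral]
  exact (key ha hb).sub (key hb ha)

lemma intervalIntegrable_of_bounded {E : Type*} [NormedAddCommGroup E] [MeasurableSpace E] [BorelSpace E] [SecondCountableTopology E] {g : ℝ → E} (hg : Measurable g) {C : ℝ} (hC : ∀ r, ‖g r‖ ≤ C) (a b : ℝ) :
    IntervalIntegrable g volume a b :=
  (intervalIntegrable_const (c := C)).mono_fun hg.aestronglyMeasurable (ae_of_all _ fun r => (hC r).trans (le_abs_self C))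

lemma measurable_perturbation_step {f : (ℝ × ℝ) × EuclideanSpace ℝ (Fin d) → EuclideanSpace ℝ (Fin d)} (hf : Measurable f) {v : ℝ → Ω → EuclideanSpace ℝ (Fin d)}
    (hv : Measurable fun x : ℝ × Ω => v x.1 x.2) {Y e : ℝ × ℝ → Ω → EuclideanSpace ℝ (Fin d)} (hY : Measurable fun x : (ℝ × ℝ) × Ω => Y x.1 x.2)
    (he : Measurable fun x : (ℝ × ℝ) × Ω => e x.1 x.2) (a b : ℝ) :
    Measurable fun x : ℝ × Ω => v x.1 x.2 + ∫ r in a..b, (f ((x.1, r), Y (x.1, r) x.2 + ∫ q in (0 : ℝ)..x.1, v q x.2) - f ((x.1, r), Y (x.1, r) x.2) + e (x.1, r) x.2) := by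
  have hu : Measurable fun x : ℝ × Ω => ∫ q in (0 : ℝ)..x.1, v q x.2 :=
    measurable_intervalIntegral (g := fun q (x : ℝ × Ω) => v q x.2) (hv.comp (measurable_fst.prodMk measurable_snd.snd)) measurable_const measurable_fst
  have hq : Measurable fun x : ℝ × (ℝ × Ω) => ((x.2.1, x.1) : ℝ × ℝ) := measurable_snd.fst.prodMk measurable_fst
  have hY' : Measurable fun x : ℝ × (ℝ × Ω) => Y (x.2.1, x.1) x.2.2 := hY.comp (hq.prodMk measurable_snd.snd)
  have he' : Measurable fun x : ℝ × (ℝ × Ω) => e (x.2.1, x.1) x.2.2 := he.comp (hq.prodMk measurable_snd.snd)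
  refine hv.add (measurable_intervalIntegral (g := fun r (x : ℝ × Ω) => f ((x.1, r), Y (x.1, r) x.2 + ∫ q in (0 : ℝ)..x.1, v q x.2) - f ((x.1, r), Y (x.1, r) x.2) + e (x.1, r) x.2)
    ?_ measurable_const measurable_const)
  exact ((hf.comp (hq.prodMk (hY'.add (hu.comp measurable_snd)))).sub (hf.comp (hq.prodMk hY'))).add he'

lemma measurable_comp_of_continuous {X : ℝ × ℝ → Ω → EuclideanSpace ℝ (Fin d)} {g : ℝ × ℝ → ℝ × ℝ} (hX : ∀ ω, Continuous fun q => X (g q) ω) (hm : ∀ q, Measurable (X (g q))) :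
    Measurable fun x : (ℝ × ℝ) × Ω => X (g x.1) x.2 :=
  measurable_uncurry_of_continuous' (u := fun q ω => X (g q) ω) hX hm

/-- The data for the comparison of a perturbed equation with the process of simple drift `β`. -/
structure Perturbed (P : Measure Ω) (W : ℝ × ℝ → Ω → EuclideanSpace ℝ (Fin d)) (L : ℝ) (f : (ℝ × ℝ) × EuclideanSpace ℝ (Fin d) → EuclideanSpace ℝ (Fin d))
    (N : ℕ) (β : ℝ × ℝ → Ω → EuclideanSpace ℝ (Fin d)) (z : ℕ → Ω → (ℝ × ℝ → EuclideanSpace ℝ (Fin d)) × (Ω → ℝ)) (e : ℕ → ℝ × ℝ → Ω → EuclideanSpace ℝ (Fin d)) : Prop where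
  sheet : IsBrownianSheet P d W
  cont : ∀ ω, Continuous fun p => W p ω
  meas : Measurable f
  bdd : ∀ x, ‖f x‖ ≤ L
  pos : 0 < N
  adm : Adm W L β
  simple : IsSimple W N L β z
  meas_e : ∀ k, @Measurable _ _ (@Prod.instMeasurableSpace _ _ _ (sheetSigma W (1, grid N (k + 1)))) _ fun x : (ℝ × ℝ) × Ω => e k x.1 x.2
  bdd_e : ∀ k q ω, ‖e k q ω‖ ≤ 4 * L

section
variable (W) (ξ : EuclideanSpace ℝ (Fin d)) (f : (ℝ × ℝ) × EuclideanSpace ℝ (Fin d) → EuclideanSpace ℝ (Fin d))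
    (N : ℕ) (β : ℝ × ℝ → Ω → EuclideanSpace ℝ (Fin d)) (e : ℕ → ℝ × ℝ → Ω → EuclideanSpace ℝ (Fin d))

/-- The drifted process, read after projection on the unit square. -/
def proj (p : ℝ × ℝ) (ω : Ω) : EuclideanSpace ℝ (Fin d) := drifted W ξ β (clamp p) ω

/-- The derivative in the first variable of the solution of the discretised perturbed equation. -/
def vhat : ℕ → ℝ → Ω → EuclideanSpace ℝ (Fin d)
  | 0 => fun _ _ => 0
  | k + 1 => fun s ω => vhat k s ω + ∫ r in grid N k..grid N (k + 1),
      (f ((s, r), proj W ξ β (s, r) ω + ∫ q in (0 : ℝ)..s, vhat k q ω) - f ((s, r), proj W ξ β (s, r) ω) + e k (s, r) ω)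

/-- The solution of the discretised perturbed equation. -/
def uhat (k : ℕ) (s : ℝ) (ω : Ω) : EuclideanSpace ℝ (Fin d) := ∫ q in (0 : ℝ)..s, vhat W ξ f N β e k q ω

/-- The increment of the drift generated by the frozen displacement `u`. -/
def incr (u : ℝ → Ω → EuclideanSpace ℝ (Fin d)) (a b : ℝ) (s : ℝ) (ω : Ω) : EuclideanSpace ℝ (Fin d) :=
  ∫ r in a..b, (f ((s, r), proj W ξ β (s, r) ω + u s ω) - f ((s, r), proj W ξ β (s, r) ω))

end

namespace Perturbed
variable {L : ℝ} {ξ : EuclideanSpace ℝ (Fin d)} {f : (ℝ × ℝ) × EuclideanSpace ℝ (Fin d) → EuclideanSpace ℝ (Fin d)}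
    {N : ℕ} {β : ℝ × ℝ → Ω → EuclideanSpace ℝ (Fin d)} {z : ℕ → Ω → (ℝ × ℝ → EuclideanSpace ℝ (Fin d)) × (Ω → ℝ)} {e : ℕ → ℝ × ℝ → Ω → EuclideanSpace ℝ (Fin d)}

lemma nonneg (h : Perturbed P W L f N β z e) : 0 ≤ L := (norm_nonneg _).trans (h.bdd 0)

lemma measurable_proj_stopped (h : Perturbed P W L f N β z e) (ξ : EuclideanSpace ℝ (Fin d)) {t : ℝ} (ht : 0 ≤ t) :
    @Measurable _ _ (@Prod.instMeasurableSpace _ _ _ (sheetSigma W (1, t))) _ fun x : (ℝ × ℝ) × Ω => proj W ξ β (x.1.1, min x.1.2 t) x.2 := by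
  have hcont : Continuous fun q : ℝ × ℝ => clamp (q.1, min q.2 t) := continuous_clamp.comp (continuous_fst.prodMk (continuous_snd.min continuous_const))
  refine @measurable_comp_of_continuous Ω (sheetSigma W (1, t)) d (drifted W ξ β) (fun q => clamp (q.1, min q.2 t)) (fun ω => ?_) (fun q => ?_)
  · exact (h.adm.continuousOn_drifted h.sheet.1 h.cont ω).comp_continuous hcont fun q => clamp_mem _
  · refine (h.adm.measurable_drifted (clamp_mem _).1 le_rfl (clamp_mem _)).mono (sheetSigma_mono ?_) le_rfl
    exact clamp_le ⟨zero_le_one, ht⟩ ⟨inf_le_right, inf_le_left.trans (min_le_right _ _)⟩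

lemma measurable_vhat_adapted (h : Perturbed P W L f N β z e) (k : ℕ) :
    @Measurable _ _ (@Prod.instMeasurableSpace _ _ _ (sheetSigma W (1, grid N k))) _ fun x : ℝ × Ω => vhat W ξ f N β e k x.1 x.2 := by
  induction k with
  | zero => exact @measurable_const _ _ _ (@Prod.instMeasurableSpace _ _ _ (sheetSigma W (1, grid N 0))) _
  | succ k ih =>
    have hmono : sheetSigma W (1, grid N k) ≤ sheetSigma W (1, grid N (k + 1)) := sheetSigma_mono ⟨le_rfl, grid_mono N k.le_succ⟩
    have hv : @Measurable _ _ (@Prod.instMeasurableSpace _ _ _ (sheetSigma W (1, grid N (k + 1)))) _ fun x : ℝ × Ω => vhat W ξ f N β e k x.1 x.2 :=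
      ih.mono (sup_le_sup le_rfl (MeasurableSpace.comap_mono hmono)) le_rfl
    have hY := h.measurable_proj_stopped ξ (grid_nonneg N (k + 1))
    have he := h.meas_e k
    have := @measurable_perturbation_step Ω (sheetSigma W (1, grid N (k + 1))) d f h.meas (vhat W ξ f N β e k) hv (fun q ω => proj W ξ β (q.1, min q.2 (grid N (k + 1))) ω) (e k) hY he (grid N k) (grid N (k + 1))
    refine (congrArg _ (funext fun x => ?_)).mp this
    simp only [vhat]
    congr 1
    refine intervalIntegral.integral_congr fun r hr => ?_
    rw [uIcc_of_le (grid_mono N k.le_succ)] at hr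
    simp only [min_eq_left hr.2]

lemma measurable_vhat (h : Perturbed P W L f N β z e) (k : ℕ) : Measurable fun x : ℝ × Ω => vhat W ξ f N β e k x.1 x.2 :=
  (h.measurable_vhat_adapted k).mono (sup_le_sup le_rfl (MeasurableSpace.comap_mono (sheetSigma_le h.sheet.1 _))) le_rfl

lemma measurable_proj (h : Perturbed P W L f N β z e) (ξ : EuclideanSpace ℝ (Fin d)) : Measurable fun x : (ℝ × ℝ) × Ω => proj W ξ β x.1 x.2 :=
  h.adm.measurable_drifted_clamp h.sheet.1 h.cont

lemma continuous_proj (h : Perturbed P W L f N β z e) (ξ : EuclideanSpace ℝ (Fin d)) (ω : Ω) : Continuous fun p => proj W ξ β p ω :=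
  (h.adm.continuousOn_drifted h.sheet.1 h.cont ω).comp_continuous continuous_clamp clamp_mem

lemma norm_vhat_succ_sub_le (h : Perturbed P W L f N β z e) (k : ℕ) (s : ℝ) (ω : Ω) :
    ‖vhat W ξ f N β e (k + 1) s ω - vhat W ξ f N β e k s ω‖ ≤ 6 * L * (1 / N) := by
  simp only [vhat, add_sub_cancel_left]
  refine (intervalIntegral.norm_integral_le_of_norm_le_const (C := 6 * L) fun r _ => ?_).trans (le_of_eq ?_)
  · calc _ ≤ L + L + 4 * L := (norm_add_le _ _).trans (add_le_add ((norm_sub_le _ _).trans (add_le_add (h.bdd _) (h.bdd _))) (h.bdd_e _ _ _))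
      _ = 6 * L := by ring
  · rw [grid_succ_sub, abs_of_nonneg (by positivity)]

lemma norm_vhat_sub_le (h : Perturbed P W L f N β z e) {i j : ℕ} (hij : i ≤ j) (s : ℝ) (ω : Ω) :
    ‖vhat W ξ f N β e j s ω - vhat W ξ f N β e i s ω‖ ≤ 6 * L * (((j : ℝ) - i) / N) := by
  induction j, hij using Nat.le_induction with
  | base => simp
  | succ j hij ih =>
    calc _ = ‖(vhat W ξ f N β e (j + 1) s ω - vhat W ξ f N β e j s ω) + (vhat W ξ f N β e j s ω - vhat W ξ f N β e i s ω)‖ := by congr 1; abel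
      _ ≤ 6 * L * (1 / N) + 6 * L * (((j : ℝ) - i) / N) := (norm_add_le _ _).trans (add_le_add (h.norm_vhat_succ_sub_le j s ω) ih)
      _ = _ := by push_cast; ring

lemma norm_vhat_le (h : Perturbed P W L f N β z e) (k : ℕ) (s : ℝ) (ω : Ω) : ‖vhat W ξ f N β e k s ω‖ ≤ 6 * L * (k / N) := by
  simpa [vhat] using h.norm_vhat_sub_le (ξ := ξ) k.zero_le s ω

lemma measurable_uhat (h : Perturbed P W L f N β z e) (k : ℕ) : Measurable fun x : ℝ × Ω => uhat W ξ f N β e k x.1 x.2 :=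
  measurable_intervalIntegral (g := fun q (x : ℝ × Ω) => vhat W ξ f N β e k q x.2) ((h.measurable_vhat k).comp (measurable_fst.prodMk measurable_snd.snd)) measurable_const measurable_fst

end Perturbed

namespace Perturbed
variable {L : ℝ} {ξ : EuclideanSpace ℝ (Fin d)} {f : (ℝ × ℝ) × EuclideanSpace ℝ (Fin d) → EuclideanSpace ℝ (Fin d)}
    {N : ℕ} {β : ℝ × ℝ → Ω → EuclideanSpace ℝ (Fin d)} {z : ℕ → Ω → (ℝ × ℝ → EuclideanSpace ℝ (Fin d)) × (Ω → ℝ)} {e : ℕ → ℝ × ℝ → Ω → EuclideanSpace ℝ (Fin d)}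

lemma girsanov_map_proj [IsProbabilityMeasure P] (h : Perturbed P W L f N β z e) (ξ : EuclideanSpace ℝ (Fin d)) {m : ℕ} (hm : m ≤ N) {s : ℝ} (hs : s ∈ Icc (0 : ℝ) 1)
    {F : Type*} [MeasurableSpace F] {g : Ω → F} (hg : Measurable[sheetSigma W (1, grid N m)] g) {r r' : ℝ} (hr : r ∈ Ioc (grid N m) 1) (hr' : r' ∈ Ioc (grid N m) 1) :
    (girsanov P N z).map (fun ω => (g ω, (proj W ξ β (s, r) ω - proj W ξ β (s, grid N m) ω, proj W ξ β (s, r') ω - proj W ξ β (s, grid N m) ω))) =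
      ((girsanov P N z).map g).prod (P.map fun ω => (W (s, r) ω - W (s, grid N m) ω, W (s, r') ω - W (s, grid N m) ω)) := by
  have hQ := h.simple.isProbabilityMeasure_girsanov h.sheet
  have hmem : ∀ {r : ℝ}, r ∈ Ioc (grid N m) 1 → ((s, r) : ℝ × ℝ) ∈ Icc (0 : ℝ × ℝ) 1 := fun hr => ⟨⟨hs.1, (grid_nonneg N m).trans hr.1.le⟩, ⟨hs.2, hr.2⟩⟩
  have hmem' : ((s, grid N m) : ℝ × ℝ) ∈ Icc (0 : ℝ × ℝ) 1 := ⟨⟨hs.1, grid_nonneg N m⟩, ⟨hs.2, grid_le_one hm⟩⟩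
  have hX : ∀ p ∈ Icc (0 : ℝ × ℝ) 1, Measurable (drifted W ξ β p) := fun p hp => h.adm.measurable_drifted' h.sheet.1 hp
  have hgm : Measurable g := hg.mono (sheetSigma_le h.sheet.1 _) le_rfl
  have hp : ∀ i, (![(s, r), (s, r')] : Fin 2 → ℝ × ℝ) i ∈ Icc (0 : ℝ × ℝ) 1 := fun i => by fin_cases i <;> [exact hmem hr; exact hmem hr']
  have key := h.simple.girsanov_map_prod h.sheet (ξ := ξ) (fun ω => h.adm.integrableOn h.sheet.1 ω) hX hm (ι := Fin 2) (p := ![(s, r), (s, r')])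
    hp hg
  have hφ : Measurable fun v : Fin 2 → EuclideanSpace ℝ (Fin d) => (v 0, v 1) := (measurable_pi_apply 0).prodMk (measurable_pi_apply 1)
  have hI : Measurable fun ω (i : Fin 2) => drifted W ξ β ((![(s, r), (s, r')] : Fin 2 → ℝ × ℝ) i) ω -
      drifted W ξ β (((![(s, r), (s, r')] : Fin 2 → ℝ × ℝ) i).1, min ((![(s, r), (s, r')] : Fin 2 → ℝ × ℝ) i).2 (grid N m)) ω := by
    exact measurable_pi_lambda _ fun i => (hX _ (hp i)).sub (hX _ (trunc_mem (hp i)))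
  have hJ : Measurable fun ω (i : Fin 2) => W ((![(s, r), (s, r')] : Fin 2 → ℝ × ℝ) i) ω -
      W (((![(s, r), (s, r')] : Fin 2 → ℝ × ℝ) i).1, min ((![(s, r), (s, r')] : Fin 2 → ℝ × ℝ) i).2 (grid N m)) ω :=
    measurable_pi_lambda _ fun i => (h.sheet.1 _).sub (h.sheet.1 _)
  have : IsProbabilityMeasure ((girsanov P N z).map g) := Measure.isProbabilityMeasure_map hgm.aemeasurable
  have := Measure.isProbabilityMeasure_map (μ := P) hJ.aemeasurable
  have key2 := congrArg (Measure.map (Prod.map (id : F → F) fun v : Fin 2 → EuclideanSpace ℝ (Fin d) => (v 0, v 1))) key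
  rw [← Measure.map_prod_map _ _ measurable_id hφ, Measure.map_id, Measure.map_map hφ hJ, Measure.map_map (measurable_id.prodMap hφ) (hgm.prodMk hI)] at key2
  simpa [Function.comp_def, min_eq_right hr.1.le, min_eq_right hr'.1.le, proj, clamp_eq (hmem hr), clamp_eq (hmem hr'), clamp_eq hmem'] using key2

lemma davie [IsProbabilityMeasure P] (h : Perturbed P W L f N β z e) (ξ : EuclideanSpace ℝ (Fin d)) {m j : ℕ} (hmj : m ≤ j) (hj : j ≤ N) {u₁ u₂ : Ω → EuclideanSpace ℝ (Fin d)}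
    (hu₁ : Measurable[sheetSigma W (1, grid N m)] u₁) (hu₂ : Measurable[sheetSigma W (1, grid N m)] u₂) {s : ℝ} (hs : s ∈ Ioc (0 : ℝ) 1) :
    ∫⁻ ω, ‖∫ r in grid N m..grid N j, (f ((s, r), proj W ξ β (s, r) ω + u₁ ω) - f ((s, r), proj W ξ β (s, r) ω + u₂ ω))‖ₑ ^ 2 ∂girsanov P N z ≤
      ENNReal.ofReal (16 * d * L ^ 2 * (grid N j - grid N m) / s) * ∫⁻ ω, ‖u₁ ω - u₂ ω‖ₑ ^ 2 ∂girsanov P N z := by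
  have hQ := h.simple.isProbabilityMeasure_girsanov h.sheet
  have hY : Measurable[sheetSigma W (1, grid N m)] (proj W ξ β (s, grid N m)) := by
    have h1 := h.measurable_proj_stopped ξ (grid_nonneg N m)
    have h2 := h1.comp (@measurable_prodMk_left _ _ _ (sheetSigma W (1, grid N m)) (s, grid N m))
    simpa [Function.comp_def] using h2
  have hle := sheetSigma_le h.sheet.1 ((1, grid N m) : ℝ × ℝ)
  have hc := h.continuous_proj ξ
  have hg₁ := hY.add hu₁
  have hg₂ := hY.add hu₂
  have hg := hg₁.prodMk hg₂
  have key := davie_vector h.sheet h.cont hs.1 hs.2 (grid_nonneg N m) (grid_mono N hmj) (grid_le_one hj) (f := fun x => f ((s, x.1), x.2))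
    (h.meas.comp ((measurable_const.prodMk measurable_fst).prodMk measurable_snd)) (fun x => h.bdd _) (Q := girsanov P N z)
    (I := fun r ω => proj W ξ β (s, r) ω - proj W ξ β (s, grid N m) ω)
    (fun ω => ((hc ω).comp (Continuous.prodMk_right s)).sub continuous_const)
    (fun r => ((h.measurable_proj ξ).comp measurable_prodMk_left).sub (hY.mono hle le_rfl))
    (g := fun ω => (proj W ξ β (s, grid N m) ω + u₁ ω, proj W ξ β (s, grid N m) ω + u₂ ω)) (hg.mono hle le_rfl)
    (fun r hr r' hr' => h.girsanov_map_proj ξ (hmj.trans hj) ⟨hs.1.le, hs.2⟩ hg ⟨hr.1, hr.2.trans (grid_le_one hj)⟩ ⟨hr'.1, hr'.2.trans (grid_le_one hj)⟩)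
  have e1 : ∀ a u b : EuclideanSpace ℝ (Fin d), a + u + (b - a) = b + u := fun a u b => by abel
  simpa only [e1, add_sub_add_left_eq_sub] using key

end Perturbed

lemma enorm_integral_sq_le {α E : Type*} [MeasurableSpace α] [NormedAddCommGroup E] [NormedSpace ℝ E] {μ : Measure α} {F : α → E} (hF : AEStronglyMeasurable F μ) :
    ‖∫ x, F x ∂μ‖ₑ ^ 2 ≤ μ univ * ∫⁻ x, ‖F x‖ₑ ^ 2 ∂μ := by
  have h1 := lintegral_mul_le_sqrt hF.enorm (aemeasurable_const (b := (1 : ℝ≥0∞)))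
  simp only [mul_one, one_pow, lintegral_one] at h1
  calc ‖∫ x, F x ∂μ‖ₑ ^ 2 ≤ ((∫⁻ x, ‖F x‖ₑ ^ 2 ∂μ) ^ (1 / 2 : ℝ) * μ univ ^ (1 / 2 : ℝ)) ^ 2 :=
        pow_le_pow_left' ((enorm_integral_le_lintegral_enorm _).trans h1) 2
    _ = μ univ * ∫⁻ x, ‖F x‖ₑ ^ 2 ∂μ := by
        rw [mul_pow, ← ENNReal.rpow_mul_natCast, ← ENNReal.rpow_mul_natCast, mul_comm]
        norm_num

lemma enorm_intervalIntegral_sq_le {E : Type*} [NormedAddCommGroup E] [NormedSpace ℝ E] {a b : ℝ} (hab : a ≤ b) {F : ℝ → E} (hF : StronglyMeasurable F) :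
    ‖∫ x in a..b, F x‖ₑ ^ 2 ≤ ENNReal.ofReal (b - a) * ∫⁻ x in Ioc a b, ‖F x‖ₑ ^ 2 := by
  rw [intervalIntegral.integral_of_le hab]
  simpa using enorm_integral_sq_le (μ := volume.restrict (Ioc a b)) hF.aestronglyMeasurable

namespace Perturbed
variable {L : ℝ} {ξ : EuclideanSpace ℝ (Fin d)} {f : (ℝ × ℝ) × EuclideanSpace ℝ (Fin d) → EuclideanSpace ℝ (Fin d)}
    {N : ℕ} {β : ℝ × ℝ → Ω → EuclideanSpace ℝ (Fin d)} {z : ℕ → Ω → (ℝ × ℝ → EuclideanSpace ℝ (Fin d)) × (Ω → ℝ)} {e : ℕ → ℝ × ℝ → Ω → EuclideanSpace ℝ (Fin d)}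

lemma davie_integral [IsProbabilityMeasure P] (h : Perturbed P W L f N β z e) (ξ : EuclideanSpace ℝ (Fin d)) {m j : ℕ} (hmj : m ≤ j) (hj : j ≤ N) {w₁ w₂ : ℝ → Ω → EuclideanSpace ℝ (Fin d)}
    (hw₁ : @Measurable _ _ (@Prod.instMeasurableSpace _ _ _ (sheetSigma W (1, grid N m))) _ fun x : ℝ × Ω => w₁ x.1 x.2)
    (hw₂ : @Measurable _ _ (@Prod.instMeasurableSpace _ _ _ (sheetSigma W (1, grid N m))) _ fun x : ℝ × Ω => w₂ x.1 x.2)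
    {C : ℝ} (hC₁ : ∀ q ω, ‖w₁ q ω‖ ≤ C) (hC₂ : ∀ q ω, ‖w₂ q ω‖ ≤ C) :
    ∫⁻ s in Ioc (0 : ℝ) 1, ∫⁻ ω, ‖∫ r in grid N m..grid N j, (f ((s, r), proj W ξ β (s, r) ω + ∫ q in (0 : ℝ)..s, w₁ q ω) - f ((s, r), proj W ξ β (s, r) ω + ∫ q in (0 : ℝ)..s, w₂ q ω))‖ₑ ^ 2 ∂girsanov P N z ≤
      ENNReal.ofReal (16 * d * L ^ 2 * (grid N j - grid N m)) * ∫⁻ s in Ioc (0 : ℝ) 1, ∫⁻ ω, ‖w₁ s ω - w₂ s ω‖ₑ ^ 2 ∂girsanov P N z := by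
  have hQ := h.simple.isProbabilityMeasure_girsanov h.sheet
  have hsub : 0 ≤ grid N j - grid N m := sub_nonneg.2 (grid_mono N hmj)
  have hle : @Prod.instMeasurableSpace ℝ Ω _ (sheetSigma W (1, grid N m)) ≤ Prod.instMeasurableSpace :=
    sup_le_sup le_rfl (MeasurableSpace.comap_mono (sheetSigma_le h.sheet.1 _))
  have hm₁ : Measurable fun x : ℝ × Ω => w₁ x.1 x.2 := hw₁.mono hle le_rfl
  have hm₂ : Measurable fun x : ℝ × Ω => w₂ x.1 x.2 := hw₂.mono hle le_rfl
  have hmS : Measurable fun x : ℝ × Ω => ‖w₁ x.1 x.2 - w₂ x.1 x.2‖ₑ ^ 2 := (hm₁.sub hm₂).enorm.pow_const 2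
  have hu : ∀ {w : ℝ → Ω → EuclideanSpace ℝ (Fin d)}, (@Measurable _ _ (@Prod.instMeasurableSpace _ _ _ (sheetSigma W (1, grid N m))) _ fun x : ℝ × Ω => w x.1 x.2) →
      ∀ s : ℝ, Measurable[sheetSigma W (1, grid N m)] fun ω => ∫ q in (0 : ℝ)..s, w q ω := fun {w} hw s =>
    @measurable_intervalIntegral Ω _ (sheetSigma W (1, grid N m)) _ _ _ _ _ (fun q ω => w q ω) hw (fun _ => 0) (fun _ => s)
      (@measurable_const _ _ _ (sheetSigma W (1, grid N m)) _) (@measurable_const _ _ _ (sheetSigma W (1, grid N m)) _)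
  set K := ∫⁻ s in Ioc (0 : ℝ) 1, ∫⁻ ω, ‖w₁ s ω - w₂ s ω‖ₑ ^ 2 ∂girsanov P N z with hK
  have hsq : ∀ s ∈ Ioc (0 : ℝ) 1, ∫⁻ ω, ‖(∫ q in (0 : ℝ)..s, w₁ q ω) - ∫ q in (0 : ℝ)..s, w₂ q ω‖ₑ ^ 2 ∂girsanov P N z ≤ ENNReal.ofReal s * K := by
    intro s hs
    have h1 : ∀ ω, ‖(∫ q in (0 : ℝ)..s, w₁ q ω) - ∫ q in (0 : ℝ)..s, w₂ q ω‖ₑ ^ 2 ≤ ENNReal.ofReal s * ∫⁻ q in Ioc (0 : ℝ) 1, ‖w₁ q ω - w₂ q ω‖ₑ ^ 2 := by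
      intro ω
      have hω : ∀ {w : ℝ → Ω → EuclideanSpace ℝ (Fin d)}, (Measurable fun x : ℝ × Ω => w x.1 x.2) → Measurable fun q => w q ω := fun hw => hw.comp measurable_prodMk_right
      rw [← intervalIntegral.integral_sub (intervalIntegrable_of_bounded (hω hm₁) (hC₁ · ω) _ _) (intervalIntegrable_of_bounded (hω hm₂) (hC₂ · ω) _ _)]
      refine (enorm_intervalIntegral_sq_le hs.1.le ((hω hm₁).sub (hω hm₂)).stronglyMeasurable).trans ?_
      rw [sub_zero]
      exact mul_le_mul' le_rfl (lintegral_mono_set (Ioc_subset_Ioc_right hs.2))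
    refine (lintegral_mono h1).trans ?_
    rw [lintegral_const_mul' _ _ ENNReal.ofReal_ne_top, hK, ← lintegral_lintegral_swap (f := fun s ω => ‖w₁ s ω - w₂ s ω‖ₑ ^ 2) hmS.aemeasurable]
  have hs : ∀ s ∈ Ioc (0 : ℝ) 1, ∫⁻ ω, ‖∫ r in grid N m..grid N j, (f ((s, r), proj W ξ β (s, r) ω + ∫ q in (0 : ℝ)..s, w₁ q ω) - f ((s, r), proj W ξ β (s, r) ω + ∫ q in (0 : ℝ)..s, w₂ q ω))‖ₑ ^ 2 ∂girsanov P N z ≤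
      ENNReal.ofReal (16 * d * L ^ 2 * (grid N j - grid N m)) * K := by
    intro s hs
    refine (h.davie ξ hmj hj (hu hw₁ s) (hu hw₂ s) hs).trans ((mul_le_mul' le_rfl (hsq s hs)).trans (le_of_eq ?_))
    rw [← mul_assoc, ← ENNReal.ofReal_mul (by have := hs.1; positivity), div_mul_cancel₀ _ hs.1.ne']
  calc _ ≤ ∫⁻ s in Ioc (0 : ℝ) 1, ENNReal.ofReal (16 * d * L ^ 2 * (grid N j - grid N m)) * K := setLIntegral_mono measurable_const hs
    _ = _ := by simp

end Perturbed

lemma lintegral_enorm_sq_eq {α E : Type*} [MeasurableSpace α] [NormedAddCommGroup E] {μ : Measure α} {F : α → E} (hF : MemLp F 2 μ) :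
    ∫⁻ x, ‖F x‖ₑ ^ 2 ∂μ = ENNReal.ofReal (‖hF.toLp F‖ ^ 2) := by
  have h := eLpNorm_eq_lintegral_rpow_enorm_toReal (f := F) (μ := μ) two_ne_zero ENNReal.ofNat_ne_top
  simp only [ENNReal.toReal_ofNat, ENNReal.rpow_ofNat] at h
  rw [Lp.norm_toLp, ENNReal.ofReal_pow ENNReal.toReal_nonneg, ENNReal.ofReal_toReal hF.eLpNorm_ne_top, h, ← ENNReal.rpow_mul_natCast]
  norm_num

lemma norm_toLp_le_mul {α E F : Type*} [MeasurableSpace α] [NormedAddCommGroup E] [NormedAddCommGroup F] {μ : Measure α} {f : α → E} {g : α → F}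
    (hf : MemLp f 2 μ) (hg : MemLp g 2 μ) {c : ℝ} (hc : 0 ≤ c) (h : ∫⁻ x, ‖f x‖ₑ ^ 2 ∂μ ≤ ENNReal.ofReal (c ^ 2) * ∫⁻ x, ‖g x‖ₑ ^ 2 ∂μ) :
    ‖hf.toLp f‖ ≤ c * ‖hg.toLp g‖ := by
  rw [lintegral_enorm_sq_eq hf, lintegral_enorm_sq_eq hg, ← ENNReal.ofReal_mul (sq_nonneg c), ENNReal.ofReal_le_ofReal_iff (by positivity), ← mul_pow] at h
  exact (sq_le_sq₀ (norm_nonneg _) (by positivity)).1 h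

lemma norm_toLp_le {α E : Type*} [MeasurableSpace α] [NormedAddCommGroup E] {μ : Measure α} {f : α → E}
    (hf : MemLp f 2 μ) {c : ℝ} (hc : 0 ≤ c) (h : ∫⁻ x, ‖f x‖ₑ ^ 2 ∂μ ≤ ENNReal.ofReal (c ^ 2)) : ‖hf.toLp f‖ ≤ c := by
  rw [lintegral_enorm_sq_eq hf, ENNReal.ofReal_le_ofReal_iff (by positivity)] at h
  exact (sq_le_sq₀ (norm_nonneg _) hc).1 h

lemma grid_sub_grid (N i j : ℕ) : grid N j - grid N i = ((j : ℝ) - i) / N := (sub_div _ _ _).symm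

lemma sum_intervalIntegral_le {N i j : ℕ} (hj : j ≤ N) {E : Type*} [NormedAddCommGroup E] [NormedSpace ℝ E] (F : ℕ → ℝ → E) :
    ‖∑ k ∈ Finset.Ico i j, ∫ r in grid N k..grid N (k + 1), F k r‖ₑ ≤ ∑ k ∈ Finset.range N, ∫⁻ r in Ioc (grid N k) (grid N (k + 1)), ‖F k r‖ₑ := by
  refine (enorm_sum_le _ _).trans ((Finset.sum_le_sum fun k _ => ?_).trans (Finset.sum_le_sum_of_subset fun k hk => ?_))
  · rw [intervalIntegral.integral_of_le (grid_mono N k.le_succ)]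
    exact enorm_integral_le_lintegral_enorm _
  · exact Finset.mem_range.2 ((Finset.mem_Ico.1 hk).2.trans_le hj)

lemma sum_lintegral_le {N : ℕ} (hN : 0 < N) {E : Type*} [NormedAddCommGroup E] {C : ℝ} {F : ℕ → ℝ → E} (hF : ∀ k r, ‖F k r‖ ≤ C) :
    ∑ k ∈ Finset.range N, ∫⁻ r in Ioc (grid N k) (grid N (k + 1)), ‖F k r‖ₑ ≤ ENNReal.ofReal C := by
  have h1 : ∀ k ∈ Finset.range N, ∫⁻ r in Ioc (grid N k) (grid N (k + 1)), ‖F k r‖ₑ ≤ ENNReal.ofReal C * ENNReal.ofReal (1 / N) := fun k _ =>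
    (lintegral_mono fun r => (ofReal_norm (F k r)).symm.le.trans (ENNReal.ofReal_le_ofReal (hF k r))).trans (by rw [setLIntegral_const, Real.volume_Ioc, grid_succ_sub])
  refine (Finset.sum_le_sum h1).trans (le_of_eq ?_)
  rw [Finset.sum_const, Finset.card_range, nsmul_eq_mul, mul_left_comm, ← ENNReal.ofReal_natCast, ← ENNReal.ofReal_mul (by positivity), mul_one_div_cancel (by positivity), ENNReal.ofReal_one, mul_one]

/-- The total mass of the perturbation. -/
def errTot (N : ℕ) (e : ℕ → ℝ × ℝ → Ω → EuclideanSpace ℝ (Fin d)) (ω : Ω) : ℝ≥0∞ :=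
  ∫⁻ s in Ioc (0 : ℝ) 1, ∑ k ∈ Finset.range N, ∫⁻ r in Ioc (grid N k) (grid N (k + 1)), ‖e k (s, r) ω‖ₑ

lemma measurable_displacement {f : (ℝ × ℝ) × EuclideanSpace ℝ (Fin d) → EuclideanSpace ℝ (Fin d)} (hf : Measurable f) {Y : ℝ × ℝ → Ω → EuclideanSpace ℝ (Fin d)}
    (hY : Measurable fun x : (ℝ × ℝ) × Ω => Y x.1 x.2) {u : ℝ → Ω → EuclideanSpace ℝ (Fin d)} (hu : Measurable fun x : ℝ × Ω => u x.1 x.2) (a b : ℝ) :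
    Measurable fun x : ℝ × Ω => ∫ r in a..b, (f ((x.1, r), Y (x.1, r) x.2 + u x.1 x.2) - f ((x.1, r), Y (x.1, r) x.2)) := by
  have hq : Measurable fun x : ℝ × (ℝ × Ω) => ((x.2.1, x.1) : ℝ × ℝ) := measurable_snd.fst.prodMk measurable_fst
  have hY' : Measurable fun x : ℝ × (ℝ × Ω) => Y (x.2.1, x.1) x.2.2 := hY.comp (hq.prodMk measurable_snd.snd)
  exact measurable_intervalIntegral (g := fun r (x : ℝ × Ω) => f ((x.1, r), Y (x.1, r) x.2 + u x.1 x.2) - f ((x.1, r), Y (x.1, r) x.2))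
    ((hf.comp (hq.prodMk (hY'.add (hu.comp measurable_snd)))).sub (hf.comp (hq.prodMk hY'))) measurable_const measurable_const

namespace Perturbed
variable {L : ℝ} {ξ : EuclideanSpace ℝ (Fin d)} {f : (ℝ × ℝ) × EuclideanSpace ℝ (Fin d) → EuclideanSpace ℝ (Fin d)}
    {N : ℕ} {β : ℝ × ℝ → Ω → EuclideanSpace ℝ (Fin d)} {z : ℕ → Ω → (ℝ × ℝ → EuclideanSpace ℝ (Fin d)) × (Ω → ℝ)} {e : ℕ → ℝ × ℝ → Ω → EuclideanSpace ℝ (Fin d)}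

lemma measurable_e (h : Perturbed P W L f N β z e) (k : ℕ) : Measurable fun x : (ℝ × ℝ) × Ω => e k x.1 x.2 :=
  (h.meas_e k).mono (sup_le_sup le_rfl (MeasurableSpace.comap_mono (sheetSigma_le h.sheet.1 _))) le_rfl

lemma measurable_e_sum (h : Perturbed P W L f N β z e) :
    Measurable fun x : ℝ × Ω => ∑ k ∈ Finset.range N, ∫⁻ r in Ioc (grid N k) (grid N (k + 1)), ‖e k (x.1, r) x.2‖ₑ := by
  refine Finset.measurable_sum _ fun k _ => ?_
  have : Measurable fun x : (ℝ × Ω) × ℝ => ‖e k (x.1.1, x.2) x.1.2‖ₑ :=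
    ((h.measurable_e k).comp ((measurable_fst.fst.prodMk measurable_snd).prodMk measurable_fst.snd)).enorm
  exact this.lintegral_prod_right'

lemma measurable_errTot (h : Perturbed P W L f N β z e) : Measurable (errTot N e) :=
  Measurable.lintegral_prod_left' h.measurable_e_sum

lemma errTot_le (h : Perturbed P W L f N β z e) (ω : Ω) : errTot N e ω ≤ ENNReal.ofReal (4 * L) := by
  refine (lintegral_mono fun s => sum_lintegral_le h.pos fun k r => h.bdd_e k (s, r) ω).trans ?_
  simp

lemma lintegral_errTot_girsanov_le [IsProbabilityMeasure P] (h : Perturbed P W L f N β z e) :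
    ∫⁻ ω, errTot N e ω ∂girsanov P N z ≤ (ENNReal.ofReal (4 * L) * ∫⁻ ω, errTot N e ω ∂P) ^ (1 / 2 : ℝ) * girC L := by
  refine (h.simple.lintegral_girsanov_le h.sheet h.measurable_errTot).trans ?_
  rw [← lintegral_const_mul' _ _ ENNReal.ofReal_ne_top]
  gcongr with ω
  rw [sq]
  gcongr
  exact h.errTot_le ω

lemma measurable_incr (h : Perturbed P W L f N β z e) (ξ : EuclideanSpace ℝ (Fin d)) {u : ℝ → Ω → EuclideanSpace ℝ (Fin d)} (hu : Measurable fun x : ℝ × Ω => u x.1 x.2) (a b : ℝ) :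
    Measurable fun x : ℝ × Ω => incr W ξ f β u a b x.1 x.2 :=
  measurable_displacement h.meas (h.measurable_proj ξ) hu a b

lemma intervalIntegrable_comp (h : Perturbed P W L f N β z e) (ξ : EuclideanSpace ℝ (Fin d)) (s : ℝ) (ω : Ω) (u : EuclideanSpace ℝ (Fin d)) (a b : ℝ) :
    IntervalIntegrable (fun r => f ((s, r), proj W ξ β (s, r) ω + u)) volume a b := by
  have hq : Measurable fun r : ℝ => ((s, r) : ℝ × ℝ) := measurable_prodMk_left
  have hY : Measurable fun r : ℝ => proj W ξ β (s, r) ω := ((h.continuous_proj ξ ω).comp (Continuous.prodMk_right s)).measurable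
  have hm : Measurable fun r : ℝ => f ((s, r), proj W ξ β (s, r) ω + u) := h.meas.comp (hq.prodMk (hY.add_const u))
  exact intervalIntegrable_of_bounded hm (fun r => h.bdd _) a b

lemma incr_sub_sub (h : Perturbed P W L f N β z e) (u u' : ℝ → Ω → EuclideanSpace ℝ (Fin d)) (a b c : ℝ) (s : ℝ) (ω : Ω) :
    incr W ξ f β u a c s ω - incr W ξ f β u a b s ω - incr W ξ f β u' b c s ω =
      ∫ r in b..c, (f ((s, r), proj W ξ β (s, r) ω + u s ω) - f ((s, r), proj W ξ β (s, r) ω + u' s ω)) := by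
  have h0 : ∀ a b, IntervalIntegrable (fun r => f ((s, r), proj W ξ β (s, r) ω)) volume a b := fun a b => by
    simpa using h.intervalIntegrable_comp ξ s ω 0 a b
  have hi := fun u : EuclideanSpace ℝ (Fin d) => h.intervalIntegrable_comp ξ s ω u
  have e1 : incr W ξ f β u a c s ω = incr W ξ f β u a b s ω + incr W ξ f β u b c s ω :=
    (intervalIntegral.integral_add_adjacent_intervals ((hi _ _ _).sub (h0 _ _)) ((hi _ _ _).sub (h0 _ _))).symm
  rw [e1, add_sub_cancel_left, incr, incr, ← intervalIntegral.integral_sub ((hi _ _ _).sub (h0 _ _)) ((hi _ _ _).sub (h0 _ _))]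
  simp only [sub_sub_sub_cancel_right]

lemma norm_incr_le (h : Perturbed P W L f N β z e) (u : ℝ → Ω → EuclideanSpace ℝ (Fin d)) (a b s : ℝ) (ω : Ω) :
    ‖incr W ξ f β u a b s ω‖ ≤ (L + L) * |b - a| :=
  intervalIntegral.norm_integral_le_of_norm_le_const fun _ _ => (norm_sub_le _ _).trans (add_le_add (h.bdd _) (h.bdd _))

end Perturbed

/-- The constant of the linear growth in the sewing argument. -/
def sewC (d : ℕ) (L : ℝ) : ℝ := max 1 (4 * √d * L)

lemma sq_sewC_le {L : ℝ} {r : ℝ} (hr : 0 ≤ r) (d : ℕ) : 16 * d * L ^ 2 * r ≤ (max 1 (4 * √d * |L|) * √r) ^ 2 := by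
  rw [mul_pow, Real.sq_sqrt hr]
  gcongr
  calc 16 * d * L ^ 2 = (4 * √d * |L|) ^ 2 := by rw [mul_pow, mul_pow, Real.sq_sqrt (Nat.cast_nonneg d), sq_abs]; ring
    _ ≤ _ := by gcongr; exact le_max_right _ _

lemma sum_toLp {α E ι : Type*} [MeasurableSpace α] [NormedAddCommGroup E] {μ : Measure α} {F : ι → α → E} (hF : ∀ k, MemLp (F k) 2 μ) (S : Finset ι) :
    ∑ k ∈ S, (hF k).toLp (F k) = (memLp_finsetSum' S fun k _ => hF k).toLp (∑ k ∈ S, F k) := by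
  classical
  refine Lp.ext ?_
  refine EventuallyEq.trans ?_ (MemLp.coeFn_toLp _).symm
  induction S using Finset.induction_on with
  | empty => simpa using Lp.coeFn_zero E 2 μ
  | insert a S ha ih =>
    rw [Finset.sum_insert ha, Finset.sum_insert ha]
    exact (Lp.coeFn_add _ _).trans ((hF a).coeFn_toLp.add ih)

namespace Perturbed
variable {L : ℝ} {f : (ℝ × ℝ) × EuclideanSpace ℝ (Fin d) → EuclideanSpace ℝ (Fin d)}
    {N : ℕ} {β : ℝ × ℝ → Ω → EuclideanSpace ℝ (Fin d)} {z : ℕ → Ω → (ℝ × ℝ → EuclideanSpace ℝ (Fin d)) × (Ω → ℝ)} {e : ℕ → ℝ × ℝ → Ω → EuclideanSpace ℝ (Fin d)}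

lemma enorm_error_sq_le (h : Perturbed P W L f N β z e) {i j : ℕ} (hj : j ≤ N) (s : ℝ) (ω : Ω) :
    ‖∑ k ∈ Finset.Ico i j, ∫ r in grid N k..grid N (k + 1), e k (s, r) ω‖ₑ ^ 2 ≤
      ENNReal.ofReal (4 * L) * ∑ k ∈ Finset.range N, ∫⁻ r in Ioc (grid N k) (grid N (k + 1)), ‖e k (s, r) ω‖ₑ := by
  have h1 := sum_intervalIntegral_le (i := i) hj fun k r => e k (s, r) ω
  rw [sq]
  exact mul_le_mul' (h1.trans (sum_lintegral_le h.pos fun k r => h.bdd_e k (s, r) ω)) h1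

variable (ξ : EuclideanSpace ℝ (Fin d))

lemma vhat_succ_sub_sub (h : Perturbed P W L f N β z e) (k : ℕ) (s : ℝ) (ω : Ω) :
    vhat W ξ f N β e (k + 1) s ω - vhat W ξ f N β e k s ω - incr W ξ f β (uhat W ξ f N β e k) (grid N k) (grid N (k + 1)) s ω =
      ∫ r in grid N k..grid N (k + 1), e k (s, r) ω := by
  have h0 : ∀ a b, IntervalIntegrable (fun r => f ((s, r), proj W ξ β (s, r) ω)) volume a b := fun a b => by
    simpa using h.intervalIntegrable_comp ξ s ω 0 a b
  have hm : Measurable fun r => e k (s, r) ω := (h.measurable_e k).comp (measurable_prodMk_left.prodMk measurable_const)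
  have he := intervalIntegrable_of_bounded hm (fun r => h.bdd_e k (s, r) ω) (grid N k) (grid N (k + 1))
  simp only [vhat, add_sub_cancel_left]
  rw [intervalIntegral.integral_add ((h.intervalIntegrable_comp ξ s ω _ _ _).sub (h0 _ _)) he]
  exact add_sub_cancel_left _ _

/-- The product measure on which the sewing argument takes place. -/
def sewMeasure (P : Measure Ω) (N : ℕ) (z : ℕ → Ω → (ℝ × ℝ → EuclideanSpace ℝ (Fin d)) × (Ω → ℝ)) : Measure (ℝ × Ω) :=
  (volume.restrict (Ioc (0 : ℝ) 1)).prod (girsanov P N z)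

lemma isProbabilityMeasure_sewMeasure [IsProbabilityMeasure P] (h : Perturbed P W L f N β z e) : IsProbabilityMeasure (sewMeasure P N z) := by
  have hQ := h.simple.isProbabilityMeasure_girsanov h.sheet
  have : IsProbabilityMeasure (volume.restrict (Ioc (0 : ℝ) 1)) := ⟨by simp⟩
  exact inferInstanceAs (IsProbabilityMeasure (Measure.prod _ _))

lemma lintegral_sewMeasure [IsProbabilityMeasure P] (h : Perturbed P W L f N β z e) {F : ℝ → Ω → ℝ≥0∞} (hF : Measurable fun x : ℝ × Ω => F x.1 x.2) :
    ∫⁻ x, F x.1 x.2 ∂sewMeasure P N z = ∫⁻ s in Ioc (0 : ℝ) 1, ∫⁻ ω, F s ω ∂girsanov P N z := by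
  have hQ := h.simple.isProbabilityMeasure_girsanov h.sheet
  exact lintegral_prod _ hF.aemeasurable

lemma memLp_vhat [IsProbabilityMeasure P] (h : Perturbed P W L f N β z e) (k : ℕ) :
    MemLp (fun x : ℝ × Ω => vhat W ξ f N β e k x.1 x.2) 2 (sewMeasure P N z) :=
  have := h.isProbabilityMeasure_sewMeasure
  MemLp.of_bound (h.measurable_vhat k).aestronglyMeasurable _ (ae_of_all _ fun x => h.norm_vhat_le k x.1 x.2)

lemma memLp_incr [IsProbabilityMeasure P] (h : Perturbed P W L f N β z e) (i j : ℕ) :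
    MemLp (fun x : ℝ × Ω => incr W ξ f β (uhat W ξ f N β e i) (grid N i) (grid N j) x.1 x.2) 2 (sewMeasure P N z) :=
  have := h.isProbabilityMeasure_sewMeasure
  MemLp.of_bound (h.measurable_incr ξ (h.measurable_uhat i) _ _).aestronglyMeasurable _ (ae_of_all _ fun x => h.norm_incr_le _ _ _ x.1 x.2)

lemma davie_sewMeasure [IsProbabilityMeasure P] (h : Perturbed P W L f N β z e) {m j : ℕ} (hmj : m ≤ j) (hj : j ≤ N) {w₁ w₂ : ℝ → Ω → EuclideanSpace ℝ (Fin d)}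
    (hw₁ : @Measurable _ _ (@Prod.instMeasurableSpace _ _ _ (sheetSigma W (1, grid N m))) _ fun x : ℝ × Ω => w₁ x.1 x.2)
    (hw₂ : @Measurable _ _ (@Prod.instMeasurableSpace _ _ _ (sheetSigma W (1, grid N m))) _ fun x : ℝ × Ω => w₂ x.1 x.2)
    {C : ℝ} (hC₁ : ∀ q ω, ‖w₁ q ω‖ ≤ C) (hC₂ : ∀ q ω, ‖w₂ q ω‖ ≤ C) {F : ℝ × Ω → EuclideanSpace ℝ (Fin d)} (hFm : MemLp F 2 (sewMeasure P N z))
    (hwm : MemLp (fun x : ℝ × Ω => w₁ x.1 x.2 - w₂ x.1 x.2) 2 (sewMeasure P N z))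
    (hF : ∀ s ω, F (s, ω) = ∫ r in grid N m..grid N j, (f ((s, r), proj W ξ β (s, r) ω + ∫ q in (0 : ℝ)..s, w₁ q ω) - f ((s, r), proj W ξ β (s, r) ω + ∫ q in (0 : ℝ)..s, w₂ q ω)))
    (hFmeas : Measurable F) :
    ‖hFm.toLp F‖ ≤ sewC d L * √(((j : ℝ) - m) / N) * ‖hwm.toLp _‖ := by
  have hle : @Prod.instMeasurableSpace ℝ Ω _ (sheetSigma W (1, grid N m)) ≤ Prod.instMeasurableSpace :=
    sup_le_sup le_rfl (MeasurableSpace.comap_mono (sheetSigma_le h.sheet.1 _))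
  have hsub : 0 ≤ grid N j - grid N m := sub_nonneg.2 (grid_mono N hmj)
  refine norm_toLp_le_mul hFm hwm (by unfold sewC; positivity) ?_
  have e1 := h.lintegral_sewMeasure (F := fun s ω => ‖F (s, ω)‖ₑ ^ 2) (hFmeas.enorm.pow_const 2)
  have e2 := h.lintegral_sewMeasure (F := fun s ω => ‖w₁ s ω - w₂ s ω‖ₑ ^ 2) ((((hw₁.mono hle le_rfl).sub (hw₂.mono hle le_rfl))).enorm.pow_const 2)
  simp only [Prod.mk.eta] at e1
  rw [e1, e2]
  have key := h.davie_integral ξ hmj hj hw₁ hw₂ hC₁ hC₂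
  simp only [← hF] at key
  refine key.trans (mul_le_mul' (ENNReal.ofReal_le_ofReal ?_) le_rfl)
  rw [← grid_sub_grid]
  have := sq_sewC_le (L := L) hsub d
  rwa [abs_of_nonneg h.nonneg] at this

lemma sewData [IsProbabilityMeasure P] (h : Perturbed P W L f N β z e) {ε : ℝ} (hε : 0 ≤ ε)
    (he : ENNReal.ofReal (4 * L) * ((ENNReal.ofReal (4 * L) * ∫⁻ ω, errTot N e ω ∂P) ^ (1 / 2 : ℝ) * girC L) ≤ ENNReal.ofReal (ε ^ 2)) :
    SewData N (fun k => (h.memLp_vhat ξ k).toLp _) (fun i j => (h.memLp_incr ξ i j).toLp _) (sewC d L) (6 * L) ε := by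
  have hprob := h.isProbabilityMeasure_sewMeasure
  have hzero : ∀ m, @Measurable _ _ (@Prod.instMeasurableSpace _ _ _ (sheetSigma W (1, grid N m))) _ fun _ : ℝ × Ω => (0 : EuclideanSpace ℝ (Fin d)) := fun m =>
    @measurable_const _ _ _ (@Prod.instMeasurableSpace _ _ _ (sheetSigma W (1, grid N m))) _
  have hbd : ∀ i, i ≤ N → ∀ q ω, ‖vhat W ξ f N β e i q ω‖ ≤ 6 * L := fun i hi q ω => by
    refine (h.norm_vhat_le i q ω).trans (mul_le_of_le_one_right (by linarith [h.nonneg]) ?_)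
    exact div_le_one_of_le₀ (by exact_mod_cast hi) (Nat.cast_nonneg N)
  constructor
  · intro i j hij hj
    have hw : MemLp (fun x : ℝ × Ω => vhat W ξ f N β e i x.1 x.2 - 0) 2 (sewMeasure P N z) := by simpa using h.memLp_vhat ξ i
    have := h.davie_sewMeasure ξ hij hj (w₁ := vhat W ξ f N β e i) (w₂ := fun _ _ => 0) (h.measurable_vhat_adapted i) (hzero i)
      (hbd i (hij.trans hj)) (fun _ _ => by simpa using h.nonneg) (h.memLp_incr ξ i j) hw (fun s ω => by simp [incr, uhat])
      (h.measurable_incr ξ (h.measurable_uhat i) _ _)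
    simpa only [sub_zero] using this
  · intro i m j him hmj hj
    have hw := (h.memLp_vhat ξ i).sub (h.memLp_vhat ξ m)
    have hF := ((h.memLp_incr ξ i j).sub (h.memLp_incr ξ i m)).sub (h.memLp_incr ξ m j)
    have hmono : sheetSigma W (1, grid N i) ≤ sheetSigma W (1, grid N m) := sheetSigma_mono ⟨le_rfl, grid_mono N him⟩
    have hi : @Measurable _ _ (@Prod.instMeasurableSpace _ _ _ (sheetSigma W (1, grid N m))) _ fun x : ℝ × Ω => vhat W ξ f N β e i x.1 x.2 :=
      (h.measurable_vhat_adapted i).mono (sup_le_sup le_rfl (MeasurableSpace.comap_mono hmono)) le_rfl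
    have := h.davie_sewMeasure ξ hmj hj (w₁ := vhat W ξ f N β e i) (w₂ := vhat W ξ f N β e m) hi (h.measurable_vhat_adapted m)
      (hbd i (him.trans (hmj.trans hj))) (hbd m (hmj.trans hj)) hF hw (fun s ω => h.incr_sub_sub _ _ _ _ _ s ω)
      (((h.measurable_incr ξ (h.measurable_uhat i) _ _).sub (h.measurable_incr ξ (h.measurable_uhat i) _ _)).sub (h.measurable_incr ξ (h.measurable_uhat m) _ _))
    rw [norm_sub_rev ((h.memLp_vhat ξ m).toLp _)]
    exact this
  · intro i j hij hj
    have e1 : ∀ k, (h.memLp_vhat ξ (k + 1)).toLp _ - (h.memLp_vhat ξ k).toLp _ - (h.memLp_incr ξ k (k + 1)).toLp _ =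
        ((((h.memLp_vhat ξ (k + 1)).sub (h.memLp_vhat ξ k)).sub (h.memLp_incr ξ k (k + 1))).toLp _) := fun k => rfl
    simp only [e1, sum_toLp]
    refine norm_toLp_le _ hε (le_trans ?_ he)
    refine le_trans ?_ (mul_le_mul' le_rfl h.lintegral_errTot_girsanov_le)
    have hQ := h.simple.isProbabilityMeasure_girsanov h.sheet
    have e2 : ∫⁻ ω, errTot N e ω ∂girsanov P N z = ∫⁻ s in Ioc (0 : ℝ) 1, ∫⁻ ω, (∑ k ∈ Finset.range N, ∫⁻ r in Ioc (grid N k) (grid N (k + 1)), ‖e k (s, r) ω‖ₑ) ∂girsanov P N z :=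
      (lintegral_lintegral_swap (f := fun s ω => ∑ k ∈ Finset.range N, ∫⁻ r in Ioc (grid N k) (grid N (k + 1)), ‖e k (s, r) ω‖ₑ) h.measurable_e_sum.aemeasurable).symm
    rw [e2, ← h.lintegral_sewMeasure h.measurable_e_sum, ← lintegral_const_mul' _ _ ENNReal.ofReal_ne_top]
    refine lintegral_mono fun x => ?_
    simp only [Finset.sum_apply, Pi.sub_apply, h.vhat_succ_sub_sub]
    exact h.enorm_error_sq_le hj x.1 x.2
  · intro i j hij hj
    have hij' : (0 : ℝ) ≤ (j : ℝ) - i := sub_nonneg.2 (by exact_mod_cast hij)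
    have hc : 0 ≤ 6 * L * (((j : ℝ) - i) / N) := by have := h.nonneg; positivity
    rw [← MemLp.toLp_sub]
    refine norm_toLp_le _ hc ?_
    calc _ ≤ ∫⁻ _, ENNReal.ofReal ((6 * L * (((j : ℝ) - i) / N)) ^ 2) ∂sewMeasure P N z := lintegral_mono fun x => by
          rw [ENNReal.ofReal_pow hc, ← ofReal_norm]
          exact pow_le_pow_left' (ENNReal.ofReal_le_ofReal (h.norm_vhat_sub_le hij x.1 x.2)) 2
      _ = _ := by simp

lemma lintegral_uhat_le [IsProbabilityMeasure P] (h : Perturbed P W L f N β z e) {η : ℝ} {j : ℕ}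
    (hv : ‖(h.memLp_vhat ξ j).toLp _‖ ≤ η) {s : ℝ} (hs : s ∈ Icc (0 : ℝ) 1) :
    ∫⁻ ω, ‖uhat W ξ f N β e j s ω‖ₑ ∂P ≤ ENNReal.ofReal η * girC L := by
  have hQ := h.simple.isProbabilityMeasure_girsanov h.sheet
  have hη : 0 ≤ η := (norm_nonneg _).trans hv
  have hum : Measurable fun ω => uhat W ξ f N β e j s ω := (h.measurable_uhat j).comp measurable_prodMk_left
  have hvm := (h.measurable_vhat (ξ := ξ) j).enorm.pow_const 2
  refine (h.simple.lintegral_le_girsanov h.sheet hum.enorm).trans (mul_le_mul' ?_ le_rfl)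
  have e1 : ∫⁻ ω, ‖uhat W ξ f N β e j s ω‖ₑ ^ 2 ∂girsanov P N z ≤ ENNReal.ofReal (η ^ 2) := by
    calc _ ≤ ∫⁻ ω, ∫⁻ q in Ioc (0 : ℝ) 1, ‖vhat W ξ f N β e j q ω‖ₑ ^ 2 ∂volume ∂girsanov P N z := lintegral_mono fun ω => by
          refine (enorm_intervalIntegral_sq_le hs.1 ((h.measurable_vhat j).comp measurable_prodMk_right).stronglyMeasurable).trans ?_
          refine (mul_le_mul' (ENNReal.ofReal_le_one.2 (by linarith [hs.2])) (lintegral_mono_set (Ioc_subset_Ioc_right hs.2))).trans (le_of_eq (one_mul _))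
      _ = ∫⁻ x, ‖vhat W ξ f N β e j x.1 x.2‖ₑ ^ 2 ∂sewMeasure P N z := by
          rw [h.lintegral_sewMeasure (F := fun s ω => ‖vhat W ξ f N β e j s ω‖ₑ ^ 2) hvm]
          exact (lintegral_lintegral_swap (f := fun s ω => ‖vhat W ξ f N β e j s ω‖ₑ ^ 2) hvm.aemeasurable).symm
      _ ≤ _ := by
          rw [lintegral_enorm_sq_eq (h.memLp_vhat ξ j)]
          gcongr
  refine (ENNReal.rpow_le_rpow e1 (by norm_num)).trans (le_of_eq ?_)
  rw [ENNReal.ofReal_pow hη, ← ENNReal.rpow_natCast_mul]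
  norm_num

end Perturbed

/-- Small perturbations lead to small displacements, uniformly in the mesh. -/
lemma exists_stability [IsProbabilityMeasure P] (W : ℝ × ℝ → Ω → EuclideanSpace ℝ (Fin d)) {L : ℝ} (hL : 0 ≤ L) {η : ℝ} (hη : 0 < η) :
    ∃ δ : ℝ, 0 < δ ∧ ∃ n₀ : ℕ, ∀ n ≥ n₀, ∀ {f : (ℝ × ℝ) × EuclideanSpace ℝ (Fin d) → EuclideanSpace ℝ (Fin d)} {β : ℝ × ℝ → Ω → EuclideanSpace ℝ (Fin d)}
      {z : ℕ → Ω → (ℝ × ℝ → EuclideanSpace ℝ (Fin d)) × (Ω → ℝ)} {e : ℕ → ℝ × ℝ → Ω → EuclideanSpace ℝ (Fin d)} (ξ : EuclideanSpace ℝ (Fin d)),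
      Perturbed P W L f (2 ^ n) β z e →
      ENNReal.ofReal (4 * L) * ((ENNReal.ofReal (4 * L) * ∫⁻ ω, errTot (2 ^ n) e ω ∂P) ^ (1 / 2 : ℝ) * girC L) ≤ ENNReal.ofReal (δ ^ 2) →
      ∀ j ≤ 2 ^ n, ∀ s ∈ Icc (0 : ℝ) 1, ∫⁻ ω, ‖uhat W ξ f (2 ^ n) β e j s ω‖ₑ ∂P ≤ ENNReal.ofReal η * girC L := by
  obtain ⟨δ, hδ, n₀, H⟩ := sewing (sewC d L) (6 * L) (le_max_left _ _) (by positivity) hη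
  refine ⟨δ, hδ, n₀, fun n hn {f β z e} ξ h he j hj s hs => ?_⟩
  refine h.lintegral_uhat_le ξ (H n hn _ _ δ hδ.le le_rfl (h.sewData ξ hδ.le he) ?_ j hj) hs
  exact MemLp.toLp_zero _

/-- The index of the grid cell containing `r`. -/
def cellIdx (N : ℕ) (r : ℝ) : ℕ := ⌈(N : ℝ) * r⌉₊ - 1

lemma measurable_cellIdx (N : ℕ) : Measurable (cellIdx N) :=
  (measurable_of_countable fun n : ℕ => n - 1).comp (Nat.measurable_ceil.comp (measurable_const_mul (N : ℝ)))

lemma cellIdx_zero (N : ℕ) : cellIdx N 0 = 0 := by simp [cellIdx]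

lemma cellIdx_of_mem {N k : ℕ} (hN : 0 < N) {r : ℝ} (hr : r ∈ Ioc (grid N k) (grid N (k + 1))) : cellIdx N r = k := by
  have h := ceil_of_mem_grid hN hr
  have h2 : ⌈(N : ℝ) * r⌉₊ = k + 1 := by
    rw [← Int.toNat_natCast (k + 1), Nat.cast_succ, ← h]
    rfl
  rw [cellIdx, h2, Nat.add_sub_cancel]

lemma cellIdx_spec {N : ℕ} (hN : 0 < N) {r : ℝ} (hr : r ∈ Icc (0 : ℝ) 1) :
    cellIdx N r < N ∧ grid N (cellIdx N r) ≤ r ∧ r ≤ grid N (cellIdx N r + 1) := by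
  rcases hr.1.eq_or_lt with h0 | h0
  · rw [← h0, cellIdx_zero, grid_zero]
    exact ⟨hN, le_rfl, grid_nonneg _ _⟩
  · obtain ⟨j, hj, hm⟩ := exists_mem_grid hN h0 hr.2
    rw [cellIdx_of_mem hN hm]
    exact ⟨hj, hm.1.le, hm.2⟩

lemma sub_grid_cellIdx_le {N : ℕ} (hN : 0 < N) {r : ℝ} (hr : r ∈ Icc (0 : ℝ) 1) : r - grid N (cellIdx N r) ≤ 1 / N := by
  have := cellIdx_spec hN hr
  rw [← grid_succ_sub N (cellIdx N r)]
  linarith [this.2.2]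

lemma sum_lintegral_cell (g : ℝ → ℝ≥0∞) (N n : ℕ) :
    ∑ k ∈ Finset.range n, ∫⁻ r in Ioc (grid N k) (grid N (k + 1)), g r = ∫⁻ r in Ioc 0 (grid N n), g r := by
  induction n with
  | zero => simp [grid_zero]
  | succ n ih =>
    rw [Finset.sum_range_succ, ih, ← lintegral_union measurableSet_Ioc, Ioc_union_Ioc_eq_Ioc (grid_nonneg N n) (grid_mono N n.le_succ)]
    exact Set.disjoint_left.2 fun x h1 h2 => absurd h1.2 (not_le.2 h2.1)

lemma lintegral_unitVol {F : ℝ × ℝ → ℝ≥0∞} (hF : Measurable F) :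
    ∫⁻ q, F q ∂unitVol = ∫⁻ s in Ioc (0 : ℝ) 1, ∫⁻ r in Ioc (0 : ℝ) 1, F (s, r) := by
  have : unitVol = (volume.restrict (Ioc (0 : ℝ) 1)).prod (volume.restrict (Ioc (0 : ℝ) 1)) := by
    rw [unitVol, Measure.restrict_congr_set Ioc_ae_eq_Icc, Measure.prod_restrict, ← Measure.volume_eq_prod, Icc_prod_Icc]
    rfl
  rw [this, lintegral_prod _ hF.aemeasurable]

lemma measurable_cellIdx_comp {α : Type*} [MeasurableSpace α] {g : ℕ → (ℝ × ℝ) × α → EuclideanSpace ℝ (Fin d)} (hg : ∀ k, Measurable (g k)) (N : ℕ) :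
    Measurable fun x : (ℝ × ℝ) × α => g (cellIdx N x.1.2) x :=
  (measurable_from_prod_countable_right (f := fun y : ℕ × ((ℝ × ℝ) × α) => g y.1 y.2) hg).comp
    (((measurable_cellIdx N).comp measurable_fst.snd).prodMk measurable_id)

lemma Perturbed.lintegral_errTot [SFinite P] {L : ℝ} {f : (ℝ × ℝ) × EuclideanSpace ℝ (Fin d) → EuclideanSpace ℝ (Fin d)}
    {N : ℕ} {β : ℝ × ℝ → Ω → EuclideanSpace ℝ (Fin d)} {z : ℕ → Ω → (ℝ × ℝ → EuclideanSpace ℝ (Fin d)) × (Ω → ℝ)} {e : ℕ → ℝ × ℝ → Ω → EuclideanSpace ℝ (Fin d)}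
    (h : Perturbed P W L f N β z e) :
    ∫⁻ ω, errTot N e ω ∂P = ∫⁻ x, ‖e (cellIdx N x.1.2) x.1 x.2‖ₑ ∂(unitVol.prod P) := by
  have hm : Measurable fun x : (ℝ × ℝ) × Ω => e (cellIdx N x.1.2) x.1 x.2 := measurable_cellIdx_comp (g := fun k x => e k x.1 x.2) h.measurable_e N
  rw [lintegral_prod_symm _ hm.enorm.aemeasurable]
  refine lintegral_congr fun ω => ?_
  rw [lintegral_unitVol (F := fun q => ‖e (cellIdx N q.2) q ω‖ₑ) (hm.comp measurable_prodMk_right).enorm, errTot]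
  refine lintegral_congr fun s => ?_
  have := sum_lintegral_cell (fun r => ‖e (cellIdx N r) (s, r) ω‖ₑ) N N
  rw [grid_self h.pos] at this
  rw [← this]
  refine Finset.sum_congr rfl fun k _ => setLIntegral_congr_fun measurableSet_Ioc fun r hr => ?_
  simp only [cellIdx_of_mem h.pos hr]

lemma inf_one_eq {p : ℝ × ℝ} (hp : p ≤ 1) : p ⊓ 1 = p := inf_eq_left.2 hp

/-- The difference of the integrated drifts at `(s, t)`. -/
def disp (β β' : ℝ × ℝ → Ω → EuclideanSpace ℝ (Fin d)) (t s : ℝ) (ω : Ω) : EuclideanSpace ℝ (Fin d) :=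
  (∫ q in Icc 0 ((s, t) ⊓ 1), β q ω) - ∫ q in Icc 0 ((s, t) ⊓ 1), β' q ω

lemma measurable_uncurry_real {D : ℝ → Ω → EuclideanSpace ℝ (Fin d)} (hc : ∀ ω, Continuous fun s => D s ω) (hm : ∀ s, Measurable (D s)) :
    Measurable fun x : ℝ × Ω => D x.1 x.2 :=
  measurable_uncurry_of_continuous' (u := fun s ω => D s ω) hc hm

lemma Adm.measurable_disp (hm : ∀ p, Measurable (W p)) {L : ℝ} {β β' : ℝ × ℝ → Ω → EuclideanSpace ℝ (Fin d)} (h : Adm W L β) (h' : Adm W L β') {t : ℝ} (ht : t ∈ Icc (0 : ℝ) 1) :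
    @Measurable _ _ (@Prod.instMeasurableSpace _ _ _ (sheetSigma W (1, t))) _ fun x : ℝ × Ω => disp β β' t x.1 x.2 := by
  have hc : Continuous fun s : ℝ => (s, t) := continuous_id.prodMk continuous_const
  have hp : ∀ s : ℝ, ((s, t) : ℝ × ℝ) ⊓ 1 ≤ (1, t) := fun s => ⟨inf_le_right, inf_le_left⟩
  have hp' : ((1, t) : ℝ × ℝ) ∈ Icc (0 : ℝ × ℝ) 1 := ⟨⟨zero_le_one, ht.1⟩, le_rfl, ht.2⟩
  refine @measurable_uncurry_real Ω (sheetSigma W (1, t)) d (fun s ω => disp β β' t s ω) (fun ω => ?_) (fun s => ?_)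
  · exact ((h.continuous_integral hm ω).comp hc).sub ((h'.continuous_integral hm ω).comp hc)
  · have h1 := h.measurable_integral (hp s) hp'
    have h2 := h'.measurable_integral (hp s) hp'
    exact @Measurable.sub _ Ω _ _ (sheetSigma W (1, t)) _ _ _ h1 h2

lemma measurable_indicator_error {f : (ℝ × ℝ) × EuclideanSpace ℝ (Fin d) → EuclideanSpace ℝ (Fin d)} (hf : Measurable f) {S : Set Ω} (hS : MeasurableSet S)
    {A B Y : ℝ × ℝ → Ω → EuclideanSpace ℝ (Fin d)} {D : ℝ → Ω → EuclideanSpace ℝ (Fin d)} (hA : Measurable fun x : (ℝ × ℝ) × Ω => A x.1 x.2)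
    (hB : Measurable fun x : (ℝ × ℝ) × Ω => B x.1 x.2) (hY : Measurable fun x : (ℝ × ℝ) × Ω => Y x.1 x.2) (hD : Measurable fun x : ℝ × Ω => D x.1 x.2) :
    Measurable fun x : (ℝ × ℝ) × Ω => S.indicator (fun ω => A x.1 ω - B x.1 ω - (f (x.1, Y x.1 ω + D x.1.1 ω) - f (x.1, Y x.1 ω))) x.2 := by
  have hD' : Measurable fun x : (ℝ × ℝ) × Ω => D x.1.1 x.2 := hD.comp (measurable_fst.fst.prodMk measurable_snd)
  have h1 : Measurable fun x : (ℝ × ℝ) × Ω => A x.1 x.2 - B x.1 x.2 - (f (x.1, Y x.1 x.2 + D x.1.1 x.2) - f (x.1, Y x.1 x.2)) :=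
    (hA.sub hB).sub ((hf.comp (measurable_fst.prodMk (hY.add hD'))).sub (hf.comp (measurable_fst.prodMk hY)))
  exact h1.indicator (measurable_snd hS)

section
variable (W) (ξ : EuclideanSpace ℝ (Fin d)) (f : (ℝ × ℝ) × EuclideanSpace ℝ (Fin d) → EuclideanSpace ℝ (Fin d))
    (N : ℕ) (β β' : ℝ × ℝ → Ω → EuclideanSpace ℝ (Fin d)) (G : ℕ → Set Ω)

/-- The error made when the difference of two drifts is viewed as a solution of the discretised equation. -/
def locErr (k : ℕ) (q : ℝ × ℝ) (ω : Ω) : EuclideanSpace ℝ (Fin d) :=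
  if k < N then (G (k + 1)).indicator (fun ω => (Icc (0 : ℝ × ℝ) (1, grid N (k + 1))).indicator (fun q => β q ω) q - (Icc (0 : ℝ × ℝ) (1, grid N (k + 1))).indicator (fun q => β' q ω) q -
    (f (q, proj W ξ β' (q.1, min q.2 (grid N (k + 1))) ω + disp β β' (grid N k) q.1 ω) - f (q, proj W ξ β' (q.1, min q.2 (grid N (k + 1))) ω))) ω else 0

end

section
variable {L : ℝ} {ξ : EuclideanSpace ℝ (Fin d)} {f : (ℝ × ℝ) × EuclideanSpace ℝ (Fin d) → EuclideanSpace ℝ (Fin d)}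
    {N : ℕ} {β β' : ℝ × ℝ → Ω → EuclideanSpace ℝ (Fin d)} {z : ℕ → Ω → (ℝ × ℝ → EuclideanSpace ℝ (Fin d)) × (Ω → ℝ)} {G : ℕ → Set Ω}

lemma norm_indicator_le_of_bdd {α : Type*} {L : ℝ} {g : α → EuclideanSpace ℝ (Fin d)} (hg : ∀ q, ‖g q‖ ≤ L) (S : Set α) (q : α) : ‖S.indicator g q‖ ≤ L :=
  (norm_indicator_le_norm_self _ _).trans (hg q)

lemma perturbed_locErr (hW : IsBrownianSheet P d W) (hc : ∀ ω, Continuous fun p => W p ω) (hf : Measurable f) (hL : ∀ x, ‖f x‖ ≤ L) (hs : IsSimple W N L β' z)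
    (h : Adm W L β) (h' : Adm W L β') (hG : ∀ k ≤ N, MeasurableSet[sheetSigma W (1, grid N k)] (G k)) :
    Perturbed P W L f N β' z (locErr W ξ f N β β' G) := by
  have h0 : 0 ≤ L := (norm_nonneg _).trans (hL 0)
  have base : Perturbed P W L f N β' z (fun _ _ _ => 0) := ⟨hW, hc, hf, hL, hs.pos, h', hs, fun k => @measurable_const _ _ _ (@Prod.instMeasurableSpace _ _ _ (sheetSigma W (1, grid N (k + 1)))) _,
    fun _ _ _ => by rw [norm_zero]; positivity⟩
  refine ⟨hW, hc, hf, hL, hs.pos, h', hs, fun k => ?_, fun k q ω => ?_⟩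
  · by_cases hk : k < N
    · simp only [locErr, if_pos hk]
      have hp : ((1, grid N (k + 1)) : ℝ × ℝ) ∈ Icc (0 : ℝ × ℝ) 1 := ⟨⟨zero_le_one, grid_nonneg _ _⟩, le_rfl, grid_le_one hk⟩
      have hY := base.measurable_proj_stopped ξ (grid_nonneg N (k + 1))
      have hmono : sheetSigma W (1, grid N k) ≤ sheetSigma W (1, grid N (k + 1)) := sheetSigma_mono ⟨le_rfl, grid_mono N k.le_succ⟩
      have hD : @Measurable _ _ (@Prod.instMeasurableSpace _ _ _ (sheetSigma W (1, grid N (k + 1)))) _ fun x : ℝ × Ω => disp β β' (grid N k) x.1 x.2 :=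
        (h.measurable_disp hW.1 h' ⟨grid_nonneg N k, grid_le_one hk.le⟩).mono (sup_le_sup le_rfl (MeasurableSpace.comap_mono hmono)) le_rfl
      have hA := h.prog _ hp
      have hB := h'.prog _ hp
      have hS := hG (k + 1) hk
      exact @measurable_indicator_error Ω (sheetSigma W (1, grid N (k + 1))) d f hf (G (k + 1)) hS (fun q ω => (Icc (0 : ℝ × ℝ) (1, grid N (k + 1))).indicator (fun q => β q ω) q)
        (fun q ω => (Icc (0 : ℝ × ℝ) (1, grid N (k + 1))).indicator (fun q => β' q ω) q) (fun q ω => proj W ξ β' (q.1, min q.2 (grid N (k + 1))) ω) (disp β β' (grid N k)) hA hB hY hD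
    · simp only [locErr, if_neg hk]
      exact @measurable_const _ _ _ (@Prod.instMeasurableSpace _ _ _ (sheetSigma W (1, grid N (k + 1)))) _
  · unfold locErr
    split_ifs with hk
    · refine norm_indicator_le_of_bdd (fun ω => ?_) _ _
      calc _ ≤ (L + L) + (L + L) := (norm_sub_le _ _).trans (add_le_add
            ((norm_sub_le _ _).trans (add_le_add (norm_indicator_le_of_bdd (fun q => h.bdd q ω) _ _) (norm_indicator_le_of_bdd (fun q => h'.bdd q ω) _ _)))
            ((norm_sub_le _ _).trans (add_le_add (hL _) (hL _))))
        _ = 4 * L := by ring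
    · rw [norm_zero]; positivity

/-- The difference of two drifts on the unit square. -/
def driftDiff (β β' : ℝ × ℝ → Ω → EuclideanSpace ℝ (Fin d)) (ω : Ω) (q : ℝ × ℝ) : EuclideanSpace ℝ (Fin d) :=
  (Icc (0 : ℝ × ℝ) 1).indicator (fun q => β q ω) q - (Icc (0 : ℝ × ℝ) 1).indicator (fun q => β' q ω) q

lemma Adm.measurable_driftDiff (hm : ∀ p, Measurable (W p)) (h : Adm W L β) (h' : Adm W L β') (ω : Ω) : Measurable (driftDiff β β' ω) :=
  (h.measurable_section hm ω).sub (h'.measurable_section hm ω)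

lemma Adm.integrable_driftDiff (hm : ∀ p, Measurable (W p)) (h : Adm W L β) (h' : Adm W L β') (ω : Ω) : Integrable (driftDiff β β' ω) :=
  (h.integrable hm ω).sub (h'.integrable hm ω)

lemma Adm.norm_driftDiff_le (h : Adm W L β) (h' : Adm W L β') (ω : Ω) (q : ℝ × ℝ) : ‖driftDiff β β' ω q‖ ≤ L + L :=
  (norm_sub_le _ _).trans (add_le_add (norm_indicator_le_of_bdd (fun q => h.bdd q ω) _ _) (norm_indicator_le_of_bdd (fun q => h'.bdd q ω) _ _))

lemma Adm.disp_eq (hm : ∀ p, Measurable (W p)) (h : Adm W L β) (h' : Adm W L β') (ω : Ω) {s t : ℝ} (hs : s ∈ Icc (0 : ℝ) 1) (ht : t ∈ Icc (0 : ℝ) 1) :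
    disp β β' t s ω = ∫ q in (0 : ℝ)..s, ∫ r in (0 : ℝ)..t, driftDiff β β' ω (q, r) := by
  have hp : ((s, t) : ℝ × ℝ) ≤ 1 := ⟨hs.2, ht.2⟩
  have hsub : Icc (0 : ℝ × ℝ) (s, t) ⊆ Icc 0 1 := Icc_subset_Icc_right hp
  have hI : Icc (0 : ℝ × ℝ) (s, t) = Icc 0 s ×ˢ Icc 0 t := (Icc_prod_Icc _ _ _ _).symm
  have e1 : disp β β' t s ω = ∫ q in Icc 0 (s, t), driftDiff β β' ω q := by
    rw [disp, inf_one_eq hp, ← integral_sub ((h.integrableOn hm ω).mono_set hsub) ((h'.integrableOn hm ω).mono_set hsub)]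
    refine setIntegral_congr_fun measurableSet_Icc fun q hq => ?_
    simp only [driftDiff, indicator_of_mem (hsub hq)]
  have hfint : IntegrableOn (driftDiff β β' ω) (Icc 0 s ×ˢ Icc 0 t) ((volume : Measure ℝ).prod volume) := by
    rw [← Measure.volume_eq_prod]
    exact (h.integrable_driftDiff hm h' ω).integrableOn
  rw [e1, hI, Measure.volume_eq_prod, setIntegral_prod _ hfint, integral_Icc_eq_integral_Ioc,
    intervalIntegral.integral_of_le hs.1]
  refine setIntegral_congr_fun measurableSet_Ioc fun q _ => ?_
  simp only [integral_Icc_eq_integral_Ioc, intervalIntegral.integral_of_le ht.1]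

lemma vhat_locErr (hW : IsBrownianSheet P d W) (h : Adm W L β) (h' : Adm W L β') (hG : ∀ k ≤ N, G N ⊆ G k) {ω : Ω} (hω : ω ∈ G N) {k : ℕ} (hk : k ≤ N) :
    (∀ s ∈ Icc (0 : ℝ) 1, vhat W ξ f N β' (locErr W ξ f N β β' G) k s ω = ∫ r in (0 : ℝ)..grid N k, driftDiff β β' ω (s, r)) ∧
    ∀ s ∈ Icc (0 : ℝ) 1, uhat W ξ f N β' (locErr W ξ f N β β' G) k s ω = disp β β' (grid N k) s ω := by
  have step : ∀ k ≤ N, (∀ s ∈ Icc (0 : ℝ) 1, vhat W ξ f N β' (locErr W ξ f N β β' G) k s ω = ∫ r in (0 : ℝ)..grid N k, driftDiff β β' ω (s, r)) →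
      ∀ s ∈ Icc (0 : ℝ) 1, uhat W ξ f N β' (locErr W ξ f N β β' G) k s ω = disp β β' (grid N k) s ω := by
    intro k hk hv s hs
    rw [h.disp_eq hW.1 h' ω hs ⟨grid_nonneg N k, grid_le_one hk⟩, uhat]
    refine intervalIntegral.integral_congr (E := EuclideanSpace ℝ (Fin d)) fun q hq => ?_
    rw [uIcc_of_le hs.1] at hq
    exact hv q ⟨hq.1, hq.2.trans hs.2⟩
  induction k with
  | zero =>
    have h0 : ∀ s ∈ Icc (0 : ℝ) 1, vhat W ξ f N β' (locErr W ξ f N β β' G) 0 s ω = ∫ r in (0 : ℝ)..grid N 0, driftDiff β β' ω (s, r) := fun s _ => by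
      simp [vhat, grid_zero]
    exact ⟨h0, step 0 hk h0⟩
  | succ k ih =>
    obtain ⟨hv, hu⟩ := ih (Nat.le_of_succ_le hk)
    have hfint : ∀ s a b, IntervalIntegrable (fun r => driftDiff β β' ω (s, r)) volume a b := fun s a b =>
      intervalIntegrable_of_bounded ((h.measurable_driftDiff hW.1 h' ω).comp measurable_prodMk_left) (fun r => h.norm_driftDiff_le h' ω (s, r)) a b
    have h1 : ∀ s ∈ Icc (0 : ℝ) 1, vhat W ξ f N β' (locErr W ξ f N β β' G) (k + 1) s ω = ∫ r in (0 : ℝ)..grid N (k + 1), driftDiff β β' ω (s, r) := by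
      intro s hs
      rw [← intervalIntegral.integral_add_adjacent_intervals (hfint s 0 (grid N k)) (hfint s _ _), ← hv s hs, vhat]
      refine congrArg (vhat W ξ f N β' (locErr W ξ f N β β' G) k s ω + ·) ?_
      refine intervalIntegral.integral_congr (E := EuclideanSpace ℝ (Fin d)) fun r hr => ?_
      rw [uIcc_of_le (grid_mono N k.le_succ)] at hr
      have hq1 : ((s, r) : ℝ × ℝ) ∈ Icc (0 : ℝ × ℝ) (1, grid N (k + 1)) := ⟨⟨hs.1, (grid_nonneg N k).trans hr.1⟩, hs.2, hr.2⟩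
      have hq2 : ((s, r) : ℝ × ℝ) ∈ Icc (0 : ℝ × ℝ) 1 := ⟨hq1.1, hs.2, hr.2.trans (grid_le_one hk)⟩
      have hu' := hu s hs
      rw [uhat] at hu'
      simp only [hu', locErr, if_pos (Nat.lt_of_succ_le hk), indicator_of_mem (hG (k + 1) hk hω), indicator_of_mem hq1, driftDiff, indicator_of_mem hq2, min_eq_left hr.2]
      abel
    exact ⟨h1, step (k + 1) hk h1⟩

lemma enorm_locErr_le (hN : 0 < N) {q : ℝ × ℝ} (hq : q ∈ Icc (0 : ℝ × ℝ) 1) (ω : Ω) :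
    ‖locErr W ξ f N β β' G (cellIdx N q.2) q ω‖ₑ ≤ (G (cellIdx N q.2 + 1)).indicator (fun ω => ‖β q ω - f (q, drifted W ξ β q ω)‖ₑ) ω +
      (‖f (q, drifted W ξ β q ω) - f (q, mixed W ξ β β' (fun r => grid N (cellIdx N r)) q ω)‖ₑ + ‖β' q ω - f (q, drifted W ξ β' q ω)‖ₑ) := by
  obtain ⟨h1, h2, h3⟩ := cellIdx_spec hN ⟨hq.1.2, hq.2.2⟩
  rw [locErr, if_pos h1]
  by_cases hω : ω ∈ G (cellIdx N q.2 + 1)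
  · have hq1 : q ∈ Icc (0 : ℝ × ℝ) (1, grid N (cellIdx N q.2 + 1)) := ⟨hq.1, hq.2.1, h3⟩
    have hle : ((q.1, grid N (cellIdx N q.2)) : ℝ × ℝ) ≤ 1 := ⟨hq.2.1, h2.trans hq.2.2⟩
    rw [indicator_of_mem hω, indicator_of_mem hω, indicator_of_mem hq1, indicator_of_mem hq1, min_eq_left h3, proj, clamp_eq hq, disp, inf_one_eq hle]
    calc _ = ‖(β q ω - f (q, drifted W ξ β q ω)) + ((f (q, drifted W ξ β q ω) - f (q, mixed W ξ β β' (fun r => grid N (cellIdx N r)) q ω)) -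
          (β' q ω - f (q, drifted W ξ β' q ω)))‖ₑ := by rw [mixed]; congr 1; abel
      _ ≤ _ := (enorm_add_le _ _).trans (add_le_add le_rfl enorm_sub_le)
  · rw [indicator_of_notMem hω, indicator_of_notMem hω, enorm_zero]
    exact zero_le
end

section
variable {L : ℝ} {ξ : EuclideanSpace ℝ (Fin d)} {f : (ℝ × ℝ) × EuclideanSpace ℝ (Fin d) → EuclideanSpace ℝ (Fin d)}
    {β β' : ℝ × ℝ → Ω → EuclideanSpace ℝ (Fin d)}

lemma drifted_sub_eq_disp {p : ℝ × ℝ} (hp : p ∈ Icc (0 : ℝ × ℝ) 1) (ω : Ω) : drifted W ξ β p ω - drifted W ξ β' p ω = disp β β' p.2 p.1 ω := by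
  rw [disp, Prod.mk.eta, inf_one_eq hp.2, drifted, drifted, add_sub_add_left_eq_sub]

lemma Adm.norm_disp_sub_le (hm : ∀ p, Measurable (W p)) (h : Adm W L β) (h' : Adm W L β') (ω : Ω) {s t t' : ℝ} (hs : s ∈ Icc (0 : ℝ) 1) (ht : t ∈ Icc (0 : ℝ) 1)
    (ht' : t' ∈ Icc (0 : ℝ) 1) (htt : t ≤ t') : ‖disp β β' t' s ω - disp β β' t s ω‖ ≤ 2 * L * (t' - t) := by
  have hL : 0 ≤ L := (norm_nonneg _).trans (h.bdd 0 ω)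
  have hi : ∀ q a b, IntervalIntegrable (fun r => driftDiff β β' ω (q, r)) volume a b := fun q a b =>
    intervalIntegrable_of_bounded ((h.measurable_driftDiff hm h' ω).comp measurable_prodMk_left) (fun r => h.norm_driftDiff_le h' ω (q, r)) a b
  have hb : ∀ q a b, ‖∫ r in a..b, driftDiff β β' ω (q, r)‖ ≤ (L + L) * |b - a| := fun q a b =>
    intervalIntegral.norm_integral_le_of_norm_le_const fun r _ => h.norm_driftDiff_le h' ω (q, r)
  have hmeas : ∀ b : ℝ, Measurable fun q : ℝ => ∫ r in (0 : ℝ)..b, driftDiff β β' ω (q, r) := fun b =>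
    measurable_intervalIntegral (g := fun r q => driftDiff β β' ω (q, r)) ((h.measurable_driftDiff hm h' ω).comp measurable_swap) measurable_const measurable_const
  have hI : ∀ b : ℝ, IntervalIntegrable (fun q => ∫ r in (0 : ℝ)..b, driftDiff β β' ω (q, r)) volume 0 s := fun b =>
    intervalIntegrable_of_bounded (hmeas b) (fun q => hb q 0 b) 0 s
  rw [h.disp_eq hm h' ω hs ht, h.disp_eq hm h' ω hs ht', ← intervalIntegral.integral_sub (hI t') (hI t)]
  refine (intervalIntegral.norm_integral_le_of_norm_le_const (C := (L + L) * |t' - t|) fun q _ => ?_).trans ?_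
  · rw [intervalIntegral.integral_interval_sub_left (hi q 0 t') (hi q 0 t)]
    exact hb q t t'
  · rw [sub_zero, abs_of_nonneg hs.1, abs_of_nonneg (sub_nonneg.2 htt)]
    have : 0 ≤ (L + L) * (t' - t) := mul_nonneg (by linarith) (sub_nonneg.2 htt)
    nlinarith [hs.2]

lemma Adm.enorm_drifted_sub_mixed_le (hm : ∀ p, Measurable (W p)) (h : Adm W L β) (h' : Adm W L β') {τ : ℝ → ℝ} {p : ℝ × ℝ} (hp : p ∈ Icc (0 : ℝ × ℝ) 1)
    (hτ : τ p.2 ∈ Icc 0 p.2) (ω : Ω) {c : ℝ} (hc : p.2 - τ p.2 ≤ c) : ‖drifted W ξ β p ω - mixed W ξ β β' τ p ω‖ₑ ≤ ENNReal.ofReal (2 * L * c) := by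
  have hL : 0 ≤ L := (norm_nonneg _).trans (h.bdd 0 ω)
  have hle : ((p.1, τ p.2) : ℝ × ℝ) ≤ 1 := ⟨hp.2.1, hτ.2.trans hp.2.2⟩
  have e : drifted W ξ β p ω - mixed W ξ β β' τ p ω = disp β β' p.2 p.1 ω - disp β β' (τ p.2) p.1 ω := by
    rw [← drifted_sub_eq_disp (W := W) (ξ := ξ) hp, disp, inf_one_eq hle, mixed]
    abel
  rw [e, ← ofReal_norm]
  refine ENNReal.ofReal_le_ofReal ((h.norm_disp_sub_le hm h' ω ⟨hp.1.1, hp.2.1⟩ ⟨hτ.1, hτ.2.trans hp.2.2⟩ ⟨hp.1.2, hp.2.2⟩ hτ.2).trans ?_)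
  gcongr

lemma aemeasurable_enorm_comp_sub [SFinite P] {X Z : ℝ × ℝ → Ω → EuclideanSpace ℝ (Fin d)} (hf : Measurable f) (hX : Measurable fun x : (ℝ × ℝ) × Ω => X (clamp x.1) x.2)
    (hZ : Measurable fun x : (ℝ × ℝ) × Ω => Z (clamp x.1) x.2) :
    AEMeasurable (fun x : (ℝ × ℝ) × Ω => ‖f (x.1, X x.1 x.2) - f (x.1, Z x.1 x.2)‖ₑ) (unitVol.prod P) := by
  have h1 : Measurable fun x : (ℝ × ℝ) × Ω => ‖f (x.1, X (clamp x.1) x.2) - f (x.1, Z (clamp x.1) x.2)‖ₑ :=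
    ((hf.comp (measurable_fst.prodMk hX)).sub (hf.comp (measurable_fst.prodMk hZ))).enorm
  refine ⟨_, h1, ae_unitVol_prod fun x hx => ?_⟩
  simp only [clamp_eq hx]

lemma aemeasurable_enorm_sub_comp [SFinite P] {X : ℝ × ℝ → Ω → EuclideanSpace ℝ (Fin d)} (hm : ∀ p, Measurable (W p)) (h : Adm W L β) (hf : Measurable f)
    (hX : Measurable fun x : (ℝ × ℝ) × Ω => X (clamp x.1) x.2) :
    AEMeasurable (fun x : (ℝ × ℝ) × Ω => ‖β x.1 x.2 - f (x.1, X x.1 x.2)‖ₑ) (unitVol.prod P) := by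
  refine ⟨_, ((h.measurable hm).sub (hf.comp (measurable_fst.prodMk hX))).enorm, ae_unitVol_prod fun x hx => ?_⟩
  simp only [Pi.sub_apply, clamp_eq hx, indicator_of_mem hx, Function.comp]

theorem tendsto_lintegral_errTot [IsProbabilityMeasure P] (hW : IsBrownianSheet P d W) (hc : ∀ ω, Continuous fun p => W p ω) (hf : Measurable f) (hL : ∀ x, ‖f x‖ ≤ L)
    {ι : Type*} {l : Filter ι} {N : ι → ℕ} (hN : Tendsto N l atTop) {β β' : ι → ℝ × ℝ → Ω → EuclideanSpace ℝ (Fin d)}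
    {z : ι → ℕ → Ω → (ℝ × ℝ → EuclideanSpace ℝ (Fin d)) × (Ω → ℝ)} {G : ι → ℕ → Set Ω}
    (hs : ∀ i, IsSimple W (N i) L (β' i) (z i)) (h : ∀ i, Adm W L (β i)) (h' : ∀ i, Adm W L (β' i))
    (hG : ∀ i, ∀ k ≤ N i, MeasurableSet[sheetSigma W (1, grid (N i) k)] (G i k))
    (h1 : Tendsto (fun i => ∫⁻ x, ‖β' i x.1 x.2 - f (x.1, drifted W ξ (β' i) x.1 x.2)‖ₑ ∂(unitVol.prod P)) l (nhds 0))
    (h2 : Tendsto (fun i => ∫⁻ x, (G i (cellIdx (N i) x.1.2 + 1)).indicator (fun ω => ‖β i x.1 ω - f (x.1, drifted W ξ (β i) x.1 ω)‖ₑ) x.2 ∂(unitVol.prod P)) l (nhds 0)) :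
    Tendsto (fun i => ∫⁻ ω, errTot (N i) (locErr W ξ f (N i) (β i) (β' i) (G i)) ω ∂P) l (nhds 0) := by
  have hτ : ∀ i, ∀ t ∈ Icc (0 : ℝ) 1, grid (N i) (cellIdx (N i) t) ≤ t := fun i t ht => (cellIdx_spec (hs i).pos ht).2.1
  have hτm : ∀ i, Measurable fun r => grid (N i) (cellIdx (N i) r) := fun i => (measurable_of_countable (grid (N i))).comp (measurable_cellIdx (N i))
  have hX : ∀ i, Dominated P W ξ L (drifted W ξ (β i)) := fun i => (h i).dominated hW hc ξ
  have hZ : ∀ i, Dominated P W ξ L (mixed W ξ (β i) (β' i) fun r => grid (N i) (cellIdx (N i) r)) := fun i => (h i).dominated_mixed hW hc (h' i) ξ (hτm i) (hτ i)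
  have hmid : Tendsto (fun i => ∫⁻ x, ‖drifted W ξ (β i) x.1 x.2 - mixed W ξ (β i) (β' i) (fun r => grid (N i) (cellIdx (N i) r)) x.1 x.2‖ₑ ∂(unitVol.prod P)) l (nhds 0) := by
    have hlim : Tendsto (fun i => ENNReal.ofReal (2 * L * (1 / N i))) l (nhds 0) := by
      have := (tendsto_one_div_atTop_nhds_zero_nat (𝕜 := ℝ)).comp hN
      simpa using ENNReal.tendsto_ofReal (this.const_mul (2 * L))
    refine tendsto_of_tendsto_of_tendsto_of_le_of_le tendsto_const_nhds hlim (fun _ => zero_le) fun i => ?_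
    refine (lintegral_mono_ae (g := fun _ => ENNReal.ofReal (2 * L * (1 / N i))) (ae_unitVol_prod fun x hx => ?_)).trans (by simp)
    have hx2 : x.1.2 ∈ Icc (0 : ℝ) 1 := ⟨hx.1.2, hx.2.2⟩
    exact (h i).enorm_drifted_sub_mixed_le hW.1 (h' i) (τ := fun r => grid (N i) (cellIdx (N i) r)) hx ⟨grid_nonneg _ _, hτ i _ hx2⟩ x.2 (sub_grid_cellIdx_le (hs i).pos hx2)
  have h3 := Dominated.tendsto_comp hW.1 hc hf hL hX hZ hmid
  have hsum := h2.add (h3.add h1)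
  rw [add_zero, add_zero] at hsum
  refine tendsto_of_tendsto_of_tendsto_of_le_of_le tendsto_const_nhds hsum (fun _ => zero_le) fun i => ?_
  simp only
  have hXZ := aemeasurable_enorm_comp_sub (P := P) hf (hX i).meas (hZ i).meas
  have hXZY : AEMeasurable (fun x : (ℝ × ℝ) × Ω => ‖f (x.1, drifted W ξ (β i) x.1 x.2) - f (x.1, mixed W ξ (β i) (β' i) (fun r => grid (N i) (cellIdx (N i) r)) x.1 x.2)‖ₑ +
      ‖β' i x.1 x.2 - f (x.1, drifted W ξ (β' i) x.1 x.2)‖ₑ) (unitVol.prod P) :=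
    hXZ.add (aemeasurable_enorm_sub_comp hW.1 (h' i) hf ((h' i).dominated hW hc ξ).meas)
  rw [(perturbed_locErr hW hc hf hL (hs i) (h i) (h' i) (hG i)).lintegral_errTot,
    ← lintegral_add_left' hXZ, ← lintegral_add_right' _ hXZY]
  exact lintegral_mono_ae (ae_unitVol_prod fun x hx => enorm_locErr_le (hs i).pos hx x.2)

/-- Two drifts which nearly solve the equation, the first one up to an adapted exit, generate nearby processes. -/
theorem eventually_lintegral_drifted_sub_le [IsProbabilityMeasure P] (hW : IsBrownianSheet P d W) (hc : ∀ ω, Continuous fun p => W p ω) (hf : Measurable f) (hL : ∀ x, ‖f x‖ ≤ L)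
    {ι : Type*} {l : Filter ι} {n : ι → ℕ} (hn : Tendsto n l atTop) {β β' : ι → ℝ × ℝ → Ω → EuclideanSpace ℝ (Fin d)}
    {z : ι → ℕ → Ω → (ℝ × ℝ → EuclideanSpace ℝ (Fin d)) × (Ω → ℝ)} {G : ι → ℕ → Set Ω}
    (hs : ∀ i, IsSimple W (2 ^ n i) L (β' i) (z i)) (h : ∀ i, Adm W L (β i)) (h' : ∀ i, Adm W L (β' i))
    (hG : ∀ i, ∀ k ≤ 2 ^ n i, MeasurableSet[sheetSigma W (1, grid (2 ^ n i) k)] (G i k)) (hGa : ∀ i, ∀ k ≤ 2 ^ n i, G i (2 ^ n i) ⊆ G i k)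
    (h1 : Tendsto (fun i => ∫⁻ x, ‖β' i x.1 x.2 - f (x.1, drifted W ξ (β' i) x.1 x.2)‖ₑ ∂(unitVol.prod P)) l (nhds 0))
    (h2 : Tendsto (fun i => ∫⁻ x, (G i (cellIdx (2 ^ n i) x.1.2 + 1)).indicator (fun ω => ‖β i x.1 ω - f (x.1, drifted W ξ (β i) x.1 ω)‖ₑ) x.2 ∂(unitVol.prod P)) l (nhds 0))
    {η : ℝ} (hη : 0 < η) :
    ∀ᶠ i in l, ∀ p ∈ Icc (0 : ℝ × ℝ) 1, ∫⁻ ω, (G i (2 ^ n i)).indicator (fun ω => ‖drifted W ξ (β i) p ω - drifted W ξ (β' i) p ω‖ₑ) ω ∂P ≤ ENNReal.ofReal η := by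
  have hL0 : 0 ≤ L := (norm_nonneg _).trans (hL 0)
  have hN : Tendsto (fun i => 2 ^ n i) l atTop := (tendsto_pow_atTop_atTop_of_one_lt (r := 2) (by norm_num)).comp hn
  have herr := tendsto_lintegral_errTot hW hc hf hL hN hs h h' hG h1 h2
  obtain ⟨η', hη', hη'c⟩ : ∃ η' : ℝ, 0 < η' ∧ ENNReal.ofReal η' * girC L ≤ ENNReal.ofReal (η / 2) := by
    obtain ⟨c, hc0, hc⟩ : ∃ c : ℝ, 0 < c ∧ girC L ≤ ENNReal.ofReal c :=
      ⟨(girC L).toReal + 1, by positivity, (ENNReal.ofReal_toReal (girC_ne_top L)).symm.le.trans (ENNReal.ofReal_le_ofReal (by linarith))⟩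
    refine ⟨η / 2 / c, by positivity, (mul_le_mul_right hc _).trans ?_⟩
    rw [← ENNReal.ofReal_mul (by positivity), div_mul_cancel₀ _ hc0.ne']
  obtain ⟨δ, hδ, n₀, hstab⟩ := exists_stability (P := P) W hL0 hη'
  have hcond : Tendsto (fun i => ENNReal.ofReal (4 * L) * ((ENNReal.ofReal (4 * L) * ∫⁻ ω, errTot (2 ^ n i) (locErr W ξ f (2 ^ n i) (β i) (β' i) (G i)) ω ∂P) ^ (1 / 2 : ℝ) * girC L)) l (nhds 0) := by
    have e1 := ENNReal.Tendsto.const_mul (a := ENNReal.ofReal (4 * L)) herr (Or.inr ENNReal.ofReal_ne_top)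
    have e2 := (ENNReal.continuous_rpow_const (y := (1 / 2 : ℝ))).tendsto _ |>.comp e1
    have e3 := ENNReal.Tendsto.mul_const e2 (b := girC L) (Or.inr (girC_ne_top L))
    have e4 := ENNReal.Tendsto.const_mul (a := ENNReal.ofReal (4 * L)) e3 (Or.inr ENNReal.ofReal_ne_top)
    simpa using e4
  have hsmall : ∀ᶠ i in l, 2 * L * (1 / ((2 ^ n i : ℕ) : ℝ)) < η / 2 := by
    have := ((tendsto_one_div_atTop_nhds_zero_nat (𝕜 := ℝ)).comp hN).const_mul (2 * L)
    rw [mul_zero] at this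
    exact this.eventually (gt_mem_nhds (by positivity))
  filter_upwards [hn.eventually_ge_atTop n₀, hcond.eventually_le_const (ENNReal.ofReal_pos.2 (pow_pos hδ 2)), hsmall] with i hi1 hi2 hi3 p hp
  have hp2 : p.2 ∈ Icc (0 : ℝ) 1 := ⟨hp.1.2, hp.2.2⟩
  obtain ⟨hk, hk1, hk2⟩ := cellIdx_spec (hs i).pos hp2
  have hu := hstab (n i) hi1 ξ (perturbed_locErr hW hc hf hL (hs i) (h i) (h' i) (hG i)) hi2 (cellIdx (2 ^ n i) p.2) hk.le p.1 ⟨hp.1.1, hp.2.1⟩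
  calc _ ≤ ∫⁻ ω, (‖uhat W ξ f (2 ^ n i) (β' i) (locErr W ξ f (2 ^ n i) (β i) (β' i) (G i)) (cellIdx (2 ^ n i) p.2) p.1 ω‖ₑ + ENNReal.ofReal (η / 2)) ∂P := by
        refine lintegral_mono fun ω => ?_
        by_cases hω : ω ∈ G i (2 ^ n i)
        · rw [indicator_of_mem hω, drifted_sub_eq_disp hp, (vhat_locErr hW (h i) (h' i) (hGa i) hω hk.le).2 p.1 ⟨hp.1.1, hp.2.1⟩]
          have := (h i).norm_disp_sub_le hW.1 (h' i) ω (s := p.1) ⟨hp.1.1, hp.2.1⟩ ⟨grid_nonneg (2 ^ n i) (cellIdx (2 ^ n i) p.2), hk1.trans hp2.2⟩ hp2 hk1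
          have hle : ‖disp (β i) (β' i) p.2 p.1 ω - disp (β i) (β' i) (grid (2 ^ n i) (cellIdx (2 ^ n i) p.2)) p.1 ω‖ ≤ η / 2 :=
            (this.trans (mul_le_mul_of_nonneg_left (sub_grid_cellIdx_le (hs i).pos hp2) (by positivity))).trans hi3.le
          calc _ = ‖disp (β i) (β' i) (grid (2 ^ n i) (cellIdx (2 ^ n i) p.2)) p.1 ω + (disp (β i) (β' i) p.2 p.1 ω - disp (β i) (β' i) (grid (2 ^ n i) (cellIdx (2 ^ n i) p.2)) p.1 ω)‖ₑ := by
                rw [add_sub_cancel]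
            _ ≤ _ := (enorm_add_le _ _).trans (add_le_add le_rfl (by rw [← ofReal_norm]; exact ENNReal.ofReal_le_ofReal hle))
        · rw [indicator_of_notMem hω]
          exact zero_le
    _ ≤ ENNReal.ofReal (η / 2) + ENNReal.ofReal (η / 2) := by
        rw [lintegral_add_right _ measurable_const]
        refine add_le_add (hu.trans hη'c) ?_
        simp
    _ = ENNReal.ofReal η := by rw [← ENNReal.ofReal_add (by positivity) (by positivity), add_halves]
end

section
variable {L : ℝ} {ξ : EuclideanSpace ℝ (Fin d)} {f : (ℝ × ℝ) × EuclideanSpace ℝ (Fin d) → EuclideanSpace ℝ (Fin d)}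
    {β β' : ℝ × ℝ → Ω → EuclideanSpace ℝ (Fin d)}

lemma iterate_feedback_eq {δ : ℝ} (K : ℕ) {q : ℝ × ℝ} (h0 : 0 ≤ q.2) (hq : q.2 < K * δ) (ω : Ω) :
    (feedback W ξ f δ)^[K + 1] (fun _ _ => 0) q ω = (feedback W ξ f δ)^[K] (fun _ _ => 0) q ω := by
  induction K generalizing q with
  | zero => exact absurd h0 (by simpa using hq)
  | succ K ih =>
    rw [Function.iterate_succ_apply']
    conv_rhs => rw [Function.iterate_succ_apply']
    simp only [feedback]
    congr 3
    refine setIntegral_congr_fun measurableSet_Icc fun r hr => ih hr.1.2 ?_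
    have := hr.2.2
    simp only at this
    push_cast at hq
    linarith

/-- The equation with delay in the second variable has a solution. -/
lemma exists_feedback_eq (hm : ∀ p, Measurable (W p)) (hc : ∀ ω, Continuous fun p => W p ω) (hf : Measurable f) (hL : ∀ x, ‖f x‖ ≤ L) (ξ : EuclideanSpace ℝ (Fin d)) {δ : ℝ} (hδ : 0 < δ) :
    ∃ β : ℝ × ℝ → Ω → EuclideanSpace ℝ (Fin d), Adm W L β ∧ ∀ q ∈ Icc (0 : ℝ × ℝ) 1, ∀ ω, β q ω = feedback W ξ f δ β q ω := by
  obtain ⟨K, hK⟩ := exists_nat_gt (1 / δ)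
  refine ⟨(feedback W ξ f δ)^[K] fun _ _ => 0, ?_, fun q hq ω => ?_⟩
  · have : ∀ K, Adm W L ((feedback W ξ f δ)^[K] fun _ _ => 0) := by
      intro K
      induction K with
      | zero => exact Adm.zero ((norm_nonneg _).trans (hL 0))
      | succ K ih =>
        rw [Function.iterate_succ_apply']
        exact adm_feedback hm hc hf hL ξ hδ.le ih
    exact this K
  · rw [← Function.iterate_succ_apply' (feedback W ξ f δ)]
    refine (iterate_feedback_eq K hq.1.2 (lt_of_le_of_lt hq.2.2 ?_) ω).symm
    rwa [div_lt_iff₀ hδ] at hK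

lemma feedback_eq_mixed {δ : ℝ} (q : ℝ × ℝ) (ω : Ω) :
    feedback W ξ f δ β q ω = f (q, mixed W ξ β (fun _ _ => 0) (fun t => max 0 (t - δ)) q ω) := by
  simp only [feedback, mixed, drifted, integral_zero, add_zero, sub_zero]
  rcases le_or_gt 0 (q.2 - δ) with h | h
  · rw [max_eq_right h]
  · have e1 : Icc (0 : ℝ × ℝ) (q.1, q.2 - δ) = ∅ := Icc_eq_empty fun h' => absurd h'.2 (not_le.2 h)
    have e2 : volume (Icc (0 : ℝ × ℝ) (q.1, max 0 (q.2 - δ))) = 0 := by rw [volume_Icc_prod, max_eq_left h.le]; simp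
    rw [e1, setIntegral_empty, setIntegral_measure_zero _ e2]

/-- Adapted drifts which solve the equation up to a vanishing error. -/
lemma exists_approx_solution [IsProbabilityMeasure P] (hW : IsBrownianSheet P d W) (hc : ∀ ω, Continuous fun p => W p ω) (hf : Measurable f) (hL : ∀ x, ‖f x‖ ≤ L)
    (ξ : EuclideanSpace ℝ (Fin d)) : ∃ β : ℕ → ℝ × ℝ → Ω → EuclideanSpace ℝ (Fin d), (∀ n, Adm W L (β n)) ∧
      Tendsto (fun n => ∫⁻ x, ‖β n x.1 x.2 - f (x.1, drifted W ξ (β n) x.1 x.2)‖ₑ ∂(unitVol.prod P)) atTop (nhds 0) := by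
  have hL0 : 0 ≤ L := (norm_nonneg _).trans (hL 0)
  have hδ : ∀ n : ℕ, (0 : ℝ) < 1 / ((n : ℝ) + 1) := fun n => by positivity
  choose β hβ hfix using fun n : ℕ => exists_feedback_eq hW.1 hc hf hL ξ (hδ n)
  refine ⟨β, hβ, ?_⟩
  have hτ : ∀ n : ℕ, ∀ t ∈ Icc (0 : ℝ) 1, max 0 (t - 1 / ((n : ℝ) + 1)) ∈ Icc 0 t := fun n t ht => ⟨le_max_left _ _, max_le ht.1 (by linarith [hδ n])⟩
  have hX : ∀ n, Dominated P W ξ L (drifted W ξ (β n)) := fun n => (hβ n).dominated hW hc ξ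
  have hZ : ∀ n : ℕ, Dominated P W ξ L (mixed W ξ (β n) (fun _ _ => 0) fun t => max 0 (t - 1 / ((n : ℝ) + 1))) := fun n =>
    (hβ n).dominated_mixed hW hc (Adm.zero hL0) ξ (measurable_const.max (measurable_id.sub_const _)) fun t ht => (hτ n t ht).2
  have key := Dominated.tendsto_comp hW.1 hc hf hL (l := atTop) hZ hX ?_
  · refine key.congr fun n => lintegral_congr_ae (ae_unitVol_prod fun x hx => ?_)
    simp only
    rw [hfix n x.1 hx, feedback_eq_mixed]
  · have hlim : Tendsto (fun n : ℕ => ENNReal.ofReal (2 * L * (1 / ((n : ℝ) + 1)))) atTop (nhds 0) := by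
      simpa using ENNReal.tendsto_ofReal ((tendsto_one_div_add_atTop_nhds_zero_nat (𝕜 := ℝ)).const_mul (2 * L))
    refine tendsto_of_tendsto_of_tendsto_of_le_of_le tendsto_const_nhds hlim (fun _ => zero_le) fun n => ?_
    refine (lintegral_mono_ae (g := fun _ => ENNReal.ofReal (2 * L * (1 / ((n : ℝ) + 1)))) (ae_unitVol_prod fun x hx => ?_)).trans (by simp)
    rw [← enorm_neg, neg_sub]
    refine (hβ n).enorm_drifted_sub_mixed_le hW.1 (Adm.zero hL0) (τ := fun t => max 0 (t - 1 / ((n : ℝ) + 1))) hx (hτ n _ ⟨hx.1.2, hx.2.2⟩) x.2 ?_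
    linarith [le_max_right 0 (x.1.2 - 1 / ((n : ℝ) + 1))]

lemma Adm.measurable_enorm_sub (hm : ∀ p, Measurable (W p)) (h : Adm W L β) (h' : Adm W L β') :
    Measurable fun x : (ℝ × ℝ) × Ω => ‖(Icc (0 : ℝ × ℝ) 1).indicator (fun q => β q x.2) x.1 - (Icc (0 : ℝ × ℝ) 1).indicator (fun q => β' q x.2) x.1‖ₑ :=
  ((h.measurable hm).sub (h'.measurable hm)).enorm

lemma Adm.measurable_lintegral_sub (hm : ∀ p, Measurable (W p)) (h : Adm W L β) (h' : Adm W L β') :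
    Measurable fun ω => ∫⁻ q in Icc (0 : ℝ × ℝ) 1, ‖β q ω - β' q ω‖ₑ := by
  refine (congrArg _ (funext fun ω => ?_)).mp ((h.measurable_enorm_sub hm h').lintegral_prod_left' (μ := unitVol))
  exact setLIntegral_congr_fun measurableSet_Icc fun q hq => by simp only [indicator_of_mem hq]

lemma Adm.lintegral_sub_eq [IsProbabilityMeasure P] (hm : ∀ p, Measurable (W p)) (h : Adm W L β) (h' : Adm W L β') :
    ∫⁻ x, ‖β x.1 x.2 - β' x.1 x.2‖ₑ ∂(unitVol.prod P) = ∫⁻ ω, (∫⁻ q in Icc (0 : ℝ × ℝ) 1, ‖β q ω - β' q ω‖ₑ) ∂P := by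
  rw [lintegral_congr_ae (ae_unitVol_prod fun x hx => ?_), lintegral_prod_symm _ (h.measurable_enorm_sub hm h').aemeasurable]
  · refine lintegral_congr fun ω => setLIntegral_congr_fun measurableSet_Icc fun q hq => ?_
    simp only [indicator_of_mem hq]
  · simp only [indicator_of_mem hx]

lemma Adm.lintegral_drifted_sub_le [IsProbabilityMeasure P] (hm : ∀ p, Measurable (W p)) (h : Adm W L β) (h' : Adm W L β') (ξ : EuclideanSpace ℝ (Fin d)) :
    ∫⁻ x, ‖drifted W ξ β x.1 x.2 - drifted W ξ β' x.1 x.2‖ₑ ∂(unitVol.prod P) ≤ ∫⁻ x, ‖β x.1 x.2 - β' x.1 x.2‖ₑ ∂(unitVol.prod P) := by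
  have hg := h.measurable_lintegral_sub hm h'
  calc _ ≤ ∫⁻ x : (ℝ × ℝ) × Ω, (∫⁻ q in Icc (0 : ℝ × ℝ) 1, ‖β q x.2 - β' q x.2‖ₑ) ∂(unitVol.prod P) :=
        lintegral_mono_ae (ae_unitVol_prod fun x hx => enorm_drifted_sub_le (h.integrableOn hm x.2) (h'.integrableOn hm x.2) hx.2)
    _ = _ := by
        have hg' : Measurable fun x : (ℝ × ℝ) × Ω => ∫⁻ q in Icc (0 : ℝ × ℝ) 1, ‖β q x.2 - β' q x.2‖ₑ := hg.comp measurable_snd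
        rw [h.lintegral_sub_eq hm h', lintegral_prod _ hg'.aemeasurable]
        simp

lemma tendsto_lintegral_avg [IsProbabilityMeasure P] (hm : ∀ p, Measurable (W p)) (h : Adm W L β) :
    Tendsto (fun m => ∫⁻ x, ‖avg (2 ^ m) β x.1 x.2 - β x.1 x.2‖ₑ ∂(unitVol.prod P)) atTop (nhds 0) := by
  have hpos : ∀ m, 0 < 2 ^ m := fun m => by positivity
  simp only [fun m => (adm_avg (hpos m) h).lintegral_sub_eq hm h (P := P)]
  have hlim := tendsto_lintegral_of_dominated_convergence (μ := P) (fun _ => ENNReal.ofReal (L + L)) (fun m => (adm_avg (hpos m) h).measurable_lintegral_sub hm h) (f := fun _ => 0)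
    (fun m => ae_of_all _ fun ω => ?_) (by simp) (ae_of_all _ fun ω => ?_)
  · simpa using hlim
  · refine (lintegral_mono fun q => ?_).trans (lintegral_const (μ := unitVol) (ENNReal.ofReal (L + L))).le |>.trans (by simp)
    rw [← ofReal_norm]
    exact ENNReal.ofReal_le_ofReal ((norm_sub_le _ _).trans (add_le_add (norm_avg_le h.bdd _ _) (h.bdd _ _)))
  · have := (tendsto_integral_avg hm h ω).comp ((tendsto_sub_atTop_nat 1).comp (tendsto_pow_atTop_atTop_of_one_lt (r := 2) (by norm_num)))
    refine this.congr fun m => ?_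
    simp only [Function.comp, Nat.sub_add_cancel (hpos m)]

/-- Simple drifts which solve the equation up to a vanishing error. -/
lemma exists_simple_approx_solution [IsProbabilityMeasure P] (hW : IsBrownianSheet P d W) (hc : ∀ ω, Continuous fun p => W p ω) (hf : Measurable f) (hL : ∀ x, ‖f x‖ ≤ L)
    (ξ : EuclideanSpace ℝ (Fin d)) : ∃ (m : ℕ → ℕ) (β : ℕ → ℝ × ℝ → Ω → EuclideanSpace ℝ (Fin d)) (z : ℕ → ℕ → Ω → (ℝ × ℝ → EuclideanSpace ℝ (Fin d)) × (Ω → ℝ)),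
      Tendsto m atTop atTop ∧ (∀ n, IsSimple W (2 ^ m n) L (β n) (z n)) ∧ (∀ n, Adm W L (β n)) ∧
      Tendsto (fun n => ∫⁻ x, ‖β n x.1 x.2 - f (x.1, drifted W ξ (β n) x.1 x.2)‖ₑ ∂(unitVol.prod P)) atTop (nhds 0) := by
  have hL0 : 0 ≤ L := (norm_nonneg _).trans (hL 0)
  have hpos : ∀ m, 0 < 2 ^ m := fun m => by positivity
  obtain ⟨γ, hγ, hlim⟩ := exists_approx_solution hW hc hf hL ξ
  have hA : ∀ n m, Adm W L (avg (2 ^ m) (γ n)) := fun n m => adm_avg (hpos m) (hγ n)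
  have hex : ∀ n : ℕ, ∃ m ≥ n, ∫⁻ x, ‖avg (2 ^ m) (γ n) x.1 x.2 - f (x.1, drifted W ξ (avg (2 ^ m) (γ n)) x.1 x.2)‖ₑ ∂(unitVol.prod P) ≤
      ENNReal.ofReal (1 / ((n : ℝ) + 1)) + ∫⁻ x, ‖γ n x.1 x.2 - f (x.1, drifted W ξ (γ n) x.1 x.2)‖ₑ ∂(unitVol.prod P) := by
    intro n
    have a1 := tendsto_lintegral_avg (P := P) hW.1 (hγ n)
    have a2 : Tendsto (fun m => ∫⁻ x, ‖drifted W ξ (avg (2 ^ m) (γ n)) x.1 x.2 - drifted W ξ (γ n) x.1 x.2‖ₑ ∂(unitVol.prod P)) atTop (nhds 0) :=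
      tendsto_of_tendsto_of_tendsto_of_le_of_le tendsto_const_nhds a1 (fun _ => zero_le) fun m => (hA n m).lintegral_drifted_sub_le hW.1 (hγ n) ξ
    have a3 := Dominated.tendsto_comp hW.1 hc hf hL (fun m => (hA n m).dominated hW hc ξ) (fun _ => (hγ n).dominated hW hc ξ) a2
    have a4 := a1.add a3
    rw [add_zero] at a4
    obtain ⟨m, hm1, hm2⟩ := ((a4.eventually_le_const (ENNReal.ofReal_pos.2 (show (0 : ℝ) < 1 / ((n : ℝ) + 1) by positivity))).and (eventually_ge_atTop n)).exists
    refine ⟨m, hm2, le_trans ?_ (add_le_add hm1 le_rfl)⟩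
    have hm3 := aemeasurable_enorm_comp_sub (P := P) hf ((hA n m).dominated hW hc ξ).meas ((hγ n).dominated hW hc ξ).meas
    have hm4 := aemeasurable_enorm_sub_comp (P := P) hW.1 (hγ n) hf ((hγ n).dominated hW hc ξ).meas
    have hm5 : AEMeasurable (fun x : (ℝ × ℝ) × Ω => ‖f (x.1, drifted W ξ (avg (2 ^ m) (γ n)) x.1 x.2) - f (x.1, drifted W ξ (γ n) x.1 x.2)‖ₑ +
      ‖γ n x.1 x.2 - f (x.1, drifted W ξ (γ n) x.1 x.2)‖ₑ) (unitVol.prod P) := hm3.add hm4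
    rw [add_assoc, ← lintegral_add_right' _ hm4, ← lintegral_add_right' _ hm5]
    refine lintegral_mono fun x => ?_
    calc _ = ‖(avg (2 ^ m) (γ n) x.1 x.2 - γ n x.1 x.2) + ((γ n x.1 x.2 - f (x.1, drifted W ξ (γ n) x.1 x.2)) -
          (f (x.1, drifted W ξ (avg (2 ^ m) (γ n)) x.1 x.2) - f (x.1, drifted W ξ (γ n) x.1 x.2)))‖ₑ := by congr 1; abel
      _ ≤ _ := (enorm_add_le _ _).trans (add_le_add le_rfl (enorm_sub_le.trans (add_comm _ _).le))
  choose m hm1 hm2 using hex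
  refine ⟨m, fun n => avg (2 ^ m n) (γ n), fun n => avgStep W (2 ^ m n) (γ n), tendsto_atTop_mono hm1 tendsto_id, fun n => isSimple_avg (hpos _) (hγ n), fun n => hA n _, ?_⟩
  have hlim2 : Tendsto (fun n : ℕ => ENNReal.ofReal (1 / ((n : ℝ) + 1))) atTop (nhds 0) := by
    simpa using ENNReal.tendsto_ofReal (tendsto_one_div_add_atTop_nhds_zero_nat (𝕜 := ℝ))
  have hlim3 := hlim2.add hlim
  rw [add_zero] at hlim3
  exact tendsto_of_tendsto_of_tendsto_of_le_of_le tendsto_const_nhds hlim3 (fun _ => zero_le) hm2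

end

section

variable {ξ : EuclideanSpace ℝ (Fin d)} {L : ℝ} {β β' : ℝ × ℝ → Ω → EuclideanSpace ℝ (Fin d)} {f : (ℝ × ℝ) × EuclideanSpace ℝ (Fin d) → EuclideanSpace ℝ (Fin d)}

/-- The pointwise limit of a sequence of vectors, replaced by zero when it is not in the ball of radius `L`. -/
def boundedLim (L : ℝ) (u : ℕ → EuclideanSpace ℝ (Fin d)) : EuclideanSpace ℝ (Fin d) :=
  (Metric.closedBall 0 L).indicator id (limUnder atTop u)

lemma norm_boundedLim_le (hL : 0 ≤ L) (u : ℕ → EuclideanSpace ℝ (Fin d)) : ‖boundedLim L u‖ ≤ L := by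
  by_cases h : limUnder atTop u ∈ Metric.closedBall (0 : EuclideanSpace ℝ (Fin d)) L
  · rw [boundedLim, indicator_of_mem h]
    simpa using h
  · rwa [boundedLim, indicator_of_notMem h, norm_zero]

lemma boundedLim_eq {u : ℕ → EuclideanSpace ℝ (Fin d)} {a : EuclideanSpace ℝ (Fin d)} (h : Tendsto u atTop (nhds a)) (hu : ∀ n, ‖u n‖ ≤ L) : boundedLim L u = a := by
  rw [boundedLim, h.limUnder_eq, indicator_of_mem, id]
  simpa using le_of_tendsto' h.norm hu

lemma measurable_boundedLim {α : Type*} [MeasurableSpace α] {g : ℕ → α → EuclideanSpace ℝ (Fin d)} (hg : ∀ n, Measurable (g n)) (L : ℝ) :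
    Measurable fun x => boundedLim L fun n => g n x :=
  (measurable_id.indicator Metric.isClosed_closedBall.measurableSet).comp (StronglyMeasurable.limUnder fun n => (hg n).stronglyMeasurable).measurable

lemma measurable_indicator_boundedLim {g : ℕ → ℝ × ℝ → Ω → EuclideanSpace ℝ (Fin d)} {p : ℝ × ℝ}
    (hg : ∀ n, Measurable fun x : (ℝ × ℝ) × Ω => (Icc (0 : ℝ × ℝ) p).indicator (fun q => g n q x.2) x.1) (L : ℝ) :
    Measurable fun x : (ℝ × ℝ) × Ω => (Icc (0 : ℝ × ℝ) p).indicator (fun q => boundedLim L fun n => g n q x.2) x.1 := by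
  refine (congrArg _ (funext fun x => ?_)).mp (Measurable.indicator_fst (measurable_boundedLim hg L) (A := Icc 0 p) measurableSet_Icc)
  refine congrFun (indicator_congr fun q hq => ?_) x.1
  simp only [indicator_of_mem hq]

lemma adm_boundedLim {g : ℕ → ℝ × ℝ → Ω → EuclideanSpace ℝ (Fin d)} (hL : 0 ≤ L) (h : ∀ n, Adm W L (g n)) :
    Adm W L fun q ω => boundedLim L fun n => g n q ω :=
  ⟨fun _ _ => norm_boundedLim_le hL _, fun p hp => @measurable_indicator_boundedLim Ω (sheetSigma W p) d g p (fun n => (h n).prog p hp) L⟩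

lemma tendsto_lintegral_boundedLim [IsProbabilityMeasure P] (hm : ∀ p, Measurable (W p)) {g : ℕ → ℝ × ℝ → Ω → EuclideanSpace ℝ (Fin d)} (h : ∀ n, Adm W L (g n))
    (hlim : ∀ᵐ x ∂(unitVol.prod P), ∃ a, Tendsto (fun n => g n x.1 x.2) atTop (nhds a)) :
    Tendsto (fun n => ∫⁻ x, ‖g n x.1 x.2 - boundedLim L (fun n => g n x.1 x.2)‖ₑ ∂(unitVol.prod P)) atTop (nhds 0) := by
  rcases isEmpty_or_nonempty Ω with hΩ | ⟨⟨ω₀⟩⟩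
  · simp [Measure.eq_zero_of_isEmpty P]
  have hL : 0 ≤ L := (norm_nonneg _).trans ((h 0).bdd 0 ω₀)
  have hg : ∀ n, AEMeasurable (fun x : (ℝ × ℝ) × Ω => ‖g n x.1 x.2 - boundedLim L (fun n => g n x.1 x.2)‖ₑ) (unitVol.prod P) := fun n =>
    ⟨_, (h n).measurable_enorm_sub hm (adm_boundedLim hL h), ae_unitVol_prod fun x hx => by simp only [indicator_of_mem hx]⟩
  have := tendsto_lintegral_of_dominated_convergence' (μ := unitVol.prod P) (fun _ => ENNReal.ofReal (L + L)) hg (f := fun _ => 0)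
    (fun n => ae_of_all _ fun x => ?_) (by simp) (hlim.mono fun x ⟨a, ha⟩ => ?_)
  · simpa using this
  · dsimp only
    rw [← ofReal_norm]
    exact ENNReal.ofReal_le_ofReal ((norm_sub_le _ _).trans (add_le_add ((h n).bdd _ _) (norm_boundedLim_le hL _)))
  · rw [boundedLim_eq ha fun n => (h n).bdd _ _]
    simpa using (ha.sub_const a).enorm

lemma Adm.aemeasurable_enorm_sub [SFinite P] (hm : ∀ p, Measurable (W p)) (h : Adm W L β) (h' : Adm W L β') :
    AEMeasurable (fun x : (ℝ × ℝ) × Ω => ‖β x.1 x.2 - β' x.1 x.2‖ₑ) (unitVol.prod P) :=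
  ⟨_, h.measurable_enorm_sub hm h', ae_unitVol_prod fun x hx => by simp only [indicator_of_mem hx]⟩

/-- Replacing the drift by a nearby one in the defect of the equation. -/
lemma defect_le [IsProbabilityMeasure P] (hW : IsBrownianSheet P d W) (hc : ∀ ω, Continuous fun p => W p ω) (hf : Measurable f) (h : Adm W L β) (h' : Adm W L β') :
    ∫⁻ x, ‖β x.1 x.2 - f (x.1, drifted W ξ β x.1 x.2)‖ₑ ∂(unitVol.prod P) ≤
      ∫⁻ x, ‖β' x.1 x.2 - β x.1 x.2‖ₑ ∂(unitVol.prod P) + ∫⁻ x, ‖β' x.1 x.2 - f (x.1, drifted W ξ β' x.1 x.2)‖ₑ ∂(unitVol.prod P) +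
        ∫⁻ x, ‖f (x.1, drifted W ξ β' x.1 x.2) - f (x.1, drifted W ξ β x.1 x.2)‖ₑ ∂(unitVol.prod P) := by
  have hX := (h.dominated hW hc ξ).meas
  have hX' := (h'.dominated hW hc ξ).meas
  rw [← lintegral_add_left' (h'.aemeasurable_enorm_sub hW.1 h), ← lintegral_add_right' _ (aemeasurable_enorm_comp_sub hf hX' hX)]
  refine lintegral_mono fun x => ?_
  calc _ = ‖(β x.1 x.2 - β' x.1 x.2) + (β' x.1 x.2 - f (x.1, drifted W ξ β' x.1 x.2)) + (f (x.1, drifted W ξ β' x.1 x.2) - f (x.1, drifted W ξ β x.1 x.2))‖ₑ := by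
        congr 1; abel
    _ ≤ _ := by
        rw [enorm_sub_rev (β' x.1 x.2)]
        exact (enorm_add_le _ _).trans (by gcongr; exact enorm_add_le _ _)

lemma tendsto_lintegral_of_forall_le [SFinite P] {ι : Type*} {l : Filter ι} {F : ι → (ℝ × ℝ) × Ω → ℝ≥0∞} (hF : ∀ i, AEMeasurable (F i) (unitVol.prod P))
    (h : ∀ η : ℝ, 0 < η → ∀ᶠ i in l, ∀ p ∈ Icc (0 : ℝ × ℝ) 1, ∫⁻ ω, F i (p, ω) ∂P ≤ ENNReal.ofReal η) :
    Tendsto (fun i => ∫⁻ x, F i x ∂(unitVol.prod P)) l (nhds 0) := by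
  refine ENNReal.tendsto_nhds_zero.2 fun ε hε => ?_
  obtain ⟨η, hη, hηε⟩ := ENNReal.lt_iff_exists_nnreal_btwn.1 hε
  refine (h η (by simpa using hη)).mono fun i hi => ?_
  rw [lintegral_prod _ (hF i)]
  refine (lintegral_mono_ae (g := fun _ => ENNReal.ofReal η) (ae_unitVol hi)).trans ?_
  simpa using hηε.le

lemma tendsto_lintegral_sub_of_approx [IsProbabilityMeasure P] (hW : IsBrownianSheet P d W) (hc : ∀ ω, Continuous fun p => W p ω) (hf : Measurable f) (hL : ∀ x, ‖f x‖ ≤ L)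
    {m : ℕ → ℕ} {β : ℕ → ℝ × ℝ → Ω → EuclideanSpace ℝ (Fin d)} {z : ℕ → ℕ → Ω → (ℝ × ℝ → EuclideanSpace ℝ (Fin d)) × (Ω → ℝ)}
    (hm : Tendsto m atTop atTop) (hs : ∀ n, IsSimple W (2 ^ m n) L (β n) (z n)) (hA : ∀ n, Adm W L (β n))
    (hdef : Tendsto (fun n => ∫⁻ x, ‖β n x.1 x.2 - f (x.1, drifted W ξ (β n) x.1 x.2)‖ₑ ∂(unitVol.prod P)) atTop (nhds 0)) :
    Tendsto (fun i : ℕ × ℕ => ∫⁻ x, ‖β i.1 x.1 x.2 - β i.2 x.1 x.2‖ₑ ∂(unitVol.prod P)) (atTop ×ˢ atTop) (nhds 0) := by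
  have hX := fun n => (hA n).dominated hW hc ξ
  have hdrift : Tendsto (fun i : ℕ × ℕ => ∫⁻ x, ‖drifted W ξ (β i.1) x.1 x.2 - drifted W ξ (β i.2) x.1 x.2‖ₑ ∂(unitVol.prod P)) (atTop ×ˢ atTop) (nhds 0) := by
    refine tendsto_lintegral_of_forall_le (fun i => ⟨_, ((hX i.1).meas.sub (hX i.2).meas).enorm, ae_unitVol_prod fun x hx => by simp [clamp_eq hx]⟩) fun η hη => ?_
    have := eventually_lintegral_drifted_sub_le hW hc hf hL (hm.comp (tendsto_snd (f := atTop) (g := atTop))) (ξ := ξ) (β := fun i : ℕ × ℕ => β i.1) (β' := fun i : ℕ × ℕ => β i.2) (z := fun i => z i.2) (G := fun _ _ => univ)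
      (fun i => hs i.2) (fun i => hA i.1) (fun i => hA i.2) (fun _ _ _ => @MeasurableSet.univ _ (sheetSigma W _)) (fun _ _ _ => Subset.rfl) (hdef.comp tendsto_snd) (by simpa [Function.comp_def] using hdef.comp tendsto_fst) hη
    simpa using this
  have hcomp := Dominated.tendsto_comp hW.1 hc hf hL (fun i : ℕ × ℕ => hX i.1) (fun i => hX i.2) hdrift
  have hsum := ((hdef.comp (tendsto_fst (f := atTop) (g := atTop))).add hcomp).add (hdef.comp (tendsto_snd (f := atTop) (g := atTop)))
  simp only [add_zero] at hsum
  refine tendsto_of_tendsto_of_tendsto_of_le_of_le tendsto_const_nhds hsum (fun _ => zero_le) fun i => ?_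
  dsimp only [Function.comp]
  rw [← lintegral_add_right' _ (aemeasurable_enorm_comp_sub hf (hX i.1).meas (hX i.2).meas), ← lintegral_add_right' _ (aemeasurable_enorm_sub_comp hW.1 (hA i.2) hf (hX i.2).meas)]
  refine lintegral_mono fun x => ?_
  calc _ = ‖(β i.1 x.1 x.2 - f (x.1, drifted W ξ (β i.1) x.1 x.2)) + (f (x.1, drifted W ξ (β i.1) x.1 x.2) - f (x.1, drifted W ξ (β i.2) x.1 x.2)) -
          (β i.2 x.1 x.2 - f (x.1, drifted W ξ (β i.2) x.1 x.2))‖ₑ := by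
        congr 1; abel
    _ ≤ _ := enorm_sub_le.trans (by gcongr; exact enorm_add_le _ _)

lemma exists_subseq_ae_tendsto {α E : Type*} [MeasurableSpace α] [NormedAddCommGroup E] [CompleteSpace E] {μ : Measure α} {u : ℕ → α → E} (hu : ∀ n, AEStronglyMeasurable (u n) μ)
    (hcau : Tendsto (fun i : ℕ × ℕ => ∫⁻ x, ‖u i.1 x - u i.2 x‖ₑ ∂μ) (atTop ×ˢ atTop) (nhds 0)) :
    ∃ φ : ℕ → ℕ, StrictMono φ ∧ ∀ᵐ x ∂μ, ∃ a, Tendsto (fun n => u (φ n) x) atTop (nhds a) := by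
  obtain ⟨φ, hφ, hlt⟩ := extraction_forall_of_eventually' (P := fun j k : ℕ => ∀ n ≥ k, ∀ n' ≥ k, ∫⁻ x, ‖u n x - u n' x‖ₑ ∂μ < (1 / 2 : ℝ≥0∞) ^ j) fun j => by
    have hpos : (0 : ℝ≥0∞) < (1 / 2) ^ j := pos_iff_ne_zero.2 (pow_ne_zero _ (by simp))
    have := hcau.eventually (gt_mem_nhds hpos)
    rw [prod_atTop_atTop_eq, eventually_atTop_prod_self] at this
    obtain ⟨k, hk⟩ := this
    exact ⟨k, fun k' hk' n hn n' hn' => hk _ _ (hk'.trans hn) (hk'.trans hn')⟩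
  refine ⟨φ, hφ, Lp.ae_tendsto_of_cauchy_eLpNorm (fun n => hu (φ n)) le_rfl (B := fun j => (1 / 2 : ℝ≥0∞) ^ j) (by simp [ENNReal.tsum_geometric]) fun j n n' hn hn' => ?_⟩
  rw [eLpNorm_one_eq_lintegral_enorm]
  exact hlt j _ (hφ.monotone hn) _ (hφ.monotone hn')

/-- The equation with bounded measurable drift has a solution, given by its progressively measurable drift. -/
theorem exists_solution_bdd [IsProbabilityMeasure P] (hW : IsBrownianSheet P d W) (hc : ∀ ω, Continuous fun p => W p ω) (hf : Measurable f) (hL : ∀ x, ‖f x‖ ≤ L)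
    (ξ : EuclideanSpace ℝ (Fin d)) : ∃ β, Adm W L β ∧ ∫⁻ x, ‖β x.1 x.2 - f (x.1, drifted W ξ β x.1 x.2)‖ₑ ∂(unitVol.prod P) = 0 := by
  have hL0 : 0 ≤ L := (norm_nonneg _).trans (hL 0)
  obtain ⟨m, β, z, hm, hs, hA, hdef⟩ := exists_simple_approx_solution hW hc hf hL ξ
  have hX := fun n => (hA n).dominated hW hc ξ
  have hcau := tendsto_lintegral_sub_of_approx hW hc hf hL hm hs hA hdef
  have hae : ∀ n, AEStronglyMeasurable (fun x : (ℝ × ℝ) × Ω => β n x.1 x.2) (unitVol.prod P) := fun n =>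
    ⟨_, ((hA n).measurable hW.1).stronglyMeasurable, ae_unitVol_prod fun x hx => by simp only [indicator_of_mem hx]⟩
  obtain ⟨φ, hφ, hlim⟩ := exists_subseq_ae_tendsto hae hcau
  obtain ⟨γ, hγ, hβγ⟩ : ∃ γ, Adm W L γ ∧ Tendsto (fun n => ∫⁻ x, ‖β (φ n) x.1 x.2 - γ x.1 x.2‖ₑ ∂(unitVol.prod P)) atTop (nhds 0) :=
    ⟨_, adm_boundedLim hL0 fun n => hA (φ n), tendsto_lintegral_boundedLim hW.1 (fun n => hA (φ n)) hlim⟩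
  have hXγ := tendsto_of_tendsto_of_tendsto_of_le_of_le tendsto_const_nhds hβγ (fun _ => zero_le) fun n => (hA (φ n)).lintegral_drifted_sub_le hW.1 hγ ξ
  have hfγ := Dominated.tendsto_comp hW.1 hc hf hL (fun n => hX (φ n)) (fun _ => hγ.dominated hW hc ξ) hXγ
  have hsum := (hβγ.add (hdef.comp hφ.tendsto_atTop)).add hfγ
  simp only [add_zero] at hsum
  exact ⟨γ, hγ, le_antisymm (ge_of_tendsto' hsum fun n => defect_le hW hc hf hγ (hA (φ n))) zero_le⟩

end

section

variable {ξ : EuclideanSpace ℝ (Fin d)} {L : ℝ} {β β' : ℝ × ℝ → Ω → EuclideanSpace ℝ (Fin d)} {f : (ℝ × ℝ) × EuclideanSpace ℝ (Fin d) → EuclideanSpace ℝ (Fin d)}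

lemma measurable_setLIntegral_sub {p : ℝ × ℝ} (h : Measurable fun x : (ℝ × ℝ) × Ω => (Icc (0 : ℝ × ℝ) p).indicator (fun q => β q x.2) x.1)
    (h' : Measurable fun x : (ℝ × ℝ) × Ω => (Icc (0 : ℝ × ℝ) p).indicator (fun q => β' q x.2) x.1) :
    Measurable fun ω => ∫⁻ q in Icc (0 : ℝ × ℝ) p, ‖β q ω - β' q ω‖ₑ := by
  have hm : Measurable fun x : (ℝ × ℝ) × Ω => ‖(Icc (0 : ℝ × ℝ) p).indicator (fun q => β q x.2) x.1 - (Icc (0 : ℝ × ℝ) p).indicator (fun q => β' q x.2) x.1‖ₑ :=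
    (h.sub h').enorm
  refine (congrArg _ (funext fun ω => ?_)).mp (hm.lintegral_prod_left' (μ := volume.restrict (Icc 0 p)))
  exact setLIntegral_congr_fun measurableSet_Icc fun q hq => by simp only [indicator_of_mem hq]

lemma adm_comp_drifted (hm : ∀ p, Measurable (W p)) (hc : ∀ ω, Continuous fun p => W p ω) (hf : Measurable f) (hL : ∀ x, ‖f x‖ ≤ L) (h : Adm W L β) (ξ : EuclideanSpace ℝ (Fin d)) :
    Adm W L fun q ω => f (q, drifted W ξ β q ω) :=
  adm_comp hf hL (h.continuousOn_drifted hm hc) fun _ hp => h.measurable_drifted hp.1 le_rfl hp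

/-- The event that the equation with drift `f` is solved up to the point `p`. -/
def solved (W : ℝ × ℝ → Ω → EuclideanSpace ℝ (Fin d)) (ξ : EuclideanSpace ℝ (Fin d)) (f : (ℝ × ℝ) × EuclideanSpace ℝ (Fin d) → EuclideanSpace ℝ (Fin d))
    (β : ℝ × ℝ → Ω → EuclideanSpace ℝ (Fin d)) (p : ℝ × ℝ) : Set Ω :=
  {ω | ∫⁻ q in Icc (0 : ℝ × ℝ) p, ‖β q ω - f (q, drifted W ξ β q ω)‖ₑ = 0}

lemma solved_anti {p p' : ℝ × ℝ} (h : p ≤ p') : solved W ξ f β p' ⊆ solved W ξ f β p := fun _ hω =>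
  le_antisymm ((lintegral_mono_set (Icc_subset_Icc_right h)).trans (le_of_eq hω)) zero_le

lemma Adm.measurableSet_solved (hm : ∀ p, Measurable (W p)) (hc : ∀ ω, Continuous fun p => W p ω) (hf : Measurable f) (hL : ∀ x, ‖f x‖ ≤ L) (h : Adm W L β) {p : ℝ × ℝ} (hp : p ∈ Icc (0 : ℝ × ℝ) 1) :
    MeasurableSet[sheetSigma W p] (solved W ξ f β p) :=
  @measurable_setLIntegral_sub Ω (sheetSigma W p) d β (fun q ω => f (q, drifted W ξ β q ω)) p (h.prog p hp) ((adm_comp_drifted hm hc hf hL h ξ).prog p hp) _ (measurableSet_singleton 0)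

lemma lintegral_solved_indicator_eq_zero [IsProbabilityMeasure P] (hm : ∀ p, Measurable (W p)) (hc : ∀ ω, Continuous fun p => W p ω) (hf : Measurable f) (hL : ∀ x, ‖f x‖ ≤ L) (h : Adm W L β)
    {N : ℕ} (hN : 0 < N) :
    ∫⁻ x, (solved W ξ f β (1, grid N (cellIdx N x.1.2 + 1))).indicator (fun ω => ‖β x.1 ω - f (x.1, drifted W ξ β x.1 ω)‖ₑ) x.2 ∂(unitVol.prod P) = 0 := by
  have hA := adm_comp_drifted hm hc hf hL h ξ
  have hp : ∀ k ≤ N, ((1, grid N k) : ℝ × ℝ) ∈ Icc (0 : ℝ × ℝ) 1 := fun k hk => ⟨⟨zero_le_one, grid_nonneg _ _⟩, ⟨le_rfl, grid_le_one hk⟩⟩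
  have hk : ∀ k, ∀ᵐ x ∂(unitVol.prod P), k ≤ N → (Icc (0 : ℝ × ℝ) (1, grid N k) ×ˢ solved W ξ f β (1, grid N k)).indicator
      (fun x => ‖β x.1 x.2 - f (x.1, drifted W ξ β x.1 x.2)‖ₑ) x = 0 := by
    intro k
    by_cases hkN : k ≤ N
    swap
    · exact ae_of_all _ fun _ h => absurd h hkN
    have hS : MeasurableSet (Icc (0 : ℝ × ℝ) (1, grid N k) ×ˢ solved W ξ f β (1, grid N k)) :=
      measurableSet_Icc.prod (sheetSigma_le hm _ _ (h.measurableSet_solved hm hc hf hL (hp k hkN)))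
    have hF := (h.aemeasurable_enorm_sub hm hA (P := P)).indicator hS
    refine ((lintegral_eq_zero_iff' hF).1 ?_).mono fun x hx _ => hx
    rw [lintegral_prod_symm _ hF]
    refine (lintegral_congr fun ω => ?_).trans lintegral_zero
    by_cases hω : ω ∈ solved W ξ f β (1, grid N k)
    · calc _ = ∫⁻ q, (Icc (0 : ℝ × ℝ) (1, grid N k)).indicator (fun q => ‖β q ω - f (q, drifted W ξ β q ω)‖ₑ) q ∂unitVol :=
            lintegral_congr fun q => by simp [indicator, hω]
        _ = ∫⁻ q in Icc (0 : ℝ × ℝ) (1, grid N k), ‖β q ω - f (q, drifted W ξ β q ω)‖ₑ ∂unitVol := lintegral_indicator measurableSet_Icc _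
        _ = 0 := le_antisymm ((lintegral_mono' (Measure.restrict_mono_measure Measure.restrict_le_self _) le_rfl).trans (le_of_eq hω)) zero_le
    · simp [hω]
  refine (lintegral_congr_ae ?_).trans lintegral_zero
  filter_upwards [ae_all_iff.2 hk, ae_unitVol_prod (P := P) fun x hx => hx] with x hx hx1
  have hx2 : x.1.2 ∈ Icc (0 : ℝ) 1 := ⟨hx1.1.2, hx1.2.2⟩
  obtain ⟨h1, -, h3⟩ := cellIdx_spec hN hx2
  have := hx _ h1
  by_cases hω : x.2 ∈ solved W ξ f β (1, grid N (cellIdx N x.1.2 + 1))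
  · rw [indicator_of_mem hω]
    rwa [indicator_of_mem] at this
    exact ⟨⟨hx1.1, ⟨hx1.2.1, h3⟩⟩, hω⟩
  · rw [indicator_of_notMem hω]

lemma ae_eq_of_continuousOn {X Y : ℝ × ℝ → Ω → EuclideanSpace ℝ (Fin d)} (hX : ∀ ω, ContinuousOn (fun p => X p ω) (Icc 0 1)) (hY : ∀ ω, ContinuousOn (fun p => Y p ω) (Icc 0 1))
    {A : Set Ω} (h : ∀ p ∈ Icc (0 : ℝ × ℝ) 1, ∀ᵐ ω ∂P, ω ∈ A → X p ω = Y p ω) : ∀ᵐ ω ∂P, ω ∈ A → ∀ p ∈ Icc (0 : ℝ × ℝ) 1, X p ω = Y p ω := by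
  filter_upwards [ae_all_iff.2 fun n => h _ (clamp_mem (TopologicalSpace.denseSeq (ℝ × ℝ) n))] with ω hω hA p hp
  have := Continuous.ext_on (TopologicalSpace.denseRange_denseSeq (ℝ × ℝ)) ((hX ω).comp_continuous continuous_clamp clamp_mem) ((hY ω).comp_continuous continuous_clamp clamp_mem)
    (fun q ⟨n, hn⟩ => hn ▸ hω n hA)
  simpa only [Function.comp, clamp_eq hp] using congrFun this p

lemma Adm.eventually_solved_lintegral_le [IsProbabilityMeasure P] (hW : IsBrownianSheet P d W) (hc : ∀ ω, Continuous fun p => W p ω) (hf : Measurable f) (hL : ∀ x, ‖f x‖ ≤ L) (h : Adm W L β)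
    {m : ℕ → ℕ} {γ : ℕ → ℝ × ℝ → Ω → EuclideanSpace ℝ (Fin d)} {z : ℕ → ℕ → Ω → (ℝ × ℝ → EuclideanSpace ℝ (Fin d)) × (Ω → ℝ)}
    (hm : Tendsto m atTop atTop) (hs : ∀ n, IsSimple W (2 ^ m n) L (γ n) (z n)) (hA : ∀ n, Adm W L (γ n))
    (hdef : Tendsto (fun n => ∫⁻ x, ‖γ n x.1 x.2 - f (x.1, drifted W ξ (γ n) x.1 x.2)‖ₑ ∂(unitVol.prod P)) atTop (nhds 0)) {η : ℝ} (hη : 0 < η) :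
    ∀ᶠ n in atTop, ∀ p ∈ Icc (0 : ℝ × ℝ) 1, ∫⁻ ω, (solved W ξ f β 1).indicator (fun ω => ‖drifted W ξ β p ω - drifted W ξ (γ n) p ω‖ₑ) ω ∂P ≤ ENNReal.ofReal η := by
  have hpos : ∀ n, 0 < 2 ^ m n := fun n => by positivity
  have := eventually_lintegral_drifted_sub_le hW hc hf hL hm (ξ := ξ) (β := fun _ => β) (G := fun n k => solved W ξ f β (1, grid (2 ^ m n) k)) hs (fun _ => h) hA
    (fun n k hk => h.measurableSet_solved hW.1 hc hf hL ⟨⟨zero_le_one, grid_nonneg _ _⟩, ⟨le_rfl, grid_le_one hk⟩⟩)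
    (fun n k hk => solved_anti (Prod.mk_le_mk.2 ⟨le_rfl, grid_mono _ hk⟩)) hdef
    (by simp only [lintegral_solved_indicator_eq_zero hW.1 hc hf hL h (hpos _), tendsto_const_nhds]) hη
  simp only [grid_self (hpos _)] at this
  exact this

/-- Pathwise uniqueness for a bounded drift, localized to the event that both processes solve the equation. -/
theorem ae_eq_of_solved [IsProbabilityMeasure P] (hW : IsBrownianSheet P d W) (hc : ∀ ω, Continuous fun p => W p ω) (hf : Measurable f) (hL : ∀ x, ‖f x‖ ≤ L)
    (h : Adm W L β) (h' : Adm W L β') :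
    ∀ᵐ ω ∂P, ω ∈ solved W ξ f β 1 ∩ solved W ξ f β' 1 → ∀ p ∈ Icc (0 : ℝ × ℝ) 1, drifted W ξ β p ω = drifted W ξ β' p ω := by
  obtain ⟨m, γ, z, hm, hs, hA, hdef⟩ := exists_simple_approx_solution hW hc hf hL ξ
  have hS := sheetSigma_le hW.1 _ _ (h.measurableSet_solved hW.1 hc hf hL (ξ := ξ) (p := 1) ⟨zero_le_one, le_rfl⟩)
  have hS' := sheetSigma_le hW.1 _ _ (h'.measurableSet_solved hW.1 hc hf hL (ξ := ξ) (p := 1) ⟨zero_le_one, le_rfl⟩)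
  refine ae_eq_of_continuousOn (h.continuousOn_drifted hW.1 hc) (h'.continuousOn_drifted hW.1 hc) fun p hp => ?_
  have hX := h.measurable_drifted' hW.1 (ξ := ξ) hp
  have hX' := h'.measurable_drifted' hW.1 (ξ := ξ) hp
  have hF : Measurable ((solved W ξ f β 1 ∩ solved W ξ f β' 1).indicator fun ω => ‖drifted W ξ β p ω - drifted W ξ β' p ω‖ₑ) :=
    (hX.sub hX').enorm.indicator (hS.inter hS')
  have hle : ∀ η : ℝ, 0 < η → ∫⁻ ω, (solved W ξ f β 1 ∩ solved W ξ f β' 1).indicator (fun ω => ‖drifted W ξ β p ω - drifted W ξ β' p ω‖ₑ) ω ∂P ≤ ENNReal.ofReal η + ENNReal.ofReal η := by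
    intro η hη
    obtain ⟨n, hn, hn'⟩ := ((h.eventually_solved_lintegral_le hW hc hf hL hm hs hA hdef hη).and (h'.eventually_solved_lintegral_le hW hc hf hL hm hs hA hdef hη)).exists
    have hXn : Measurable ((solved W ξ f β 1).indicator fun ω => ‖drifted W ξ β p ω - drifted W ξ (γ n) p ω‖ₑ) :=
      (hX.sub ((hA n).measurable_drifted' hW.1 hp)).enorm.indicator hS
    refine le_trans ?_ (add_le_add (hn p hp) (hn' p hp))
    rw [← lintegral_add_left hXn]
    refine lintegral_mono fun ω => ?_
    by_cases hω : ω ∈ solved W ξ f β 1 ∩ solved W ξ f β' 1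
    · rw [indicator_of_mem hω, indicator_of_mem hω.1, indicator_of_mem hω.2, enorm_sub_rev (drifted W ξ β' p ω)]
      rw [← sub_add_sub_cancel _ (drifted W ξ (γ n) p ω)]
      exact enorm_add_le _ _
    · rw [indicator_of_notMem hω]
      exact zero_le
  have h0 : ∫⁻ ω, (solved W ξ f β 1 ∩ solved W ξ f β' 1).indicator (fun ω => ‖drifted W ξ β p ω - drifted W ξ β' p ω‖ₑ) ω ∂P = 0 := by
    have hlim : Tendsto (fun η : ℝ => ENNReal.ofReal η + ENNReal.ofReal η) (nhdsWithin 0 (Ioi 0)) (nhds 0) := by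
      have h : Continuous fun η : ℝ => ENNReal.ofReal η + ENNReal.ofReal η := ENNReal.continuous_ofReal.add ENNReal.continuous_ofReal
      exact (h.tendsto' 0 0 (by simp)).mono_left nhdsWithin_le_nhds
    exact le_antisymm (ge_of_tendsto hlim (eventually_mem_nhdsWithin.mono hle)) zero_le
  filter_upwards [(lintegral_eq_zero_iff hF).1 h0] with ω hω hmem
  rw [indicator_of_mem hmem] at hω
  exact sub_eq_zero.1 (enorm_eq_zero.1 hω)

end

/-- The sheet extended from the unit square to a process with continuous paths on the plane. -/
def clamped (W : ℝ × ℝ → Ω → EuclideanSpace ℝ (Fin d)) (p : ℝ × ℝ) : Ω → EuclideanSpace ℝ (Fin d) := W (clamp p)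

lemma clamped_eq {p : ℝ × ℝ} (hp : p ∈ Icc (0 : ℝ × ℝ) 1) : clamped W p = W p := by rw [clamped, clamp_eq hp]

lemma IsBrownianSheet.continuous_clamped (hW : IsBrownianSheet P d W) (ω : Ω) : Continuous fun p => clamped W p ω :=
  (hW.2.1 ω).comp_continuous continuous_clamp clamp_mem

lemma IsBrownianSheet.clamped (hW : IsBrownianSheet P d W) : IsBrownianSheet P d (clamped W) := by
  refine ⟨fun p => hW.1 _, fun ω => (hW.continuous_clamped ω).continuousOn, fun ω p hp => ?_, fun n p idx c hp => ?_⟩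
  · rw [clamped_eq hp]
    exact hW.2.2.1 ω p hp
  · simp only [fun j => clamped_eq (W := W) (hp j)]
    exact hW.2.2.2 n p idx c hp

lemma sheetSigma_clamped {p : ℝ × ℝ} (hp : p ≤ 1) : sheetSigma (clamped W) p = sheetSigma W p :=
  iSup_congr fun q => iSup_congr fun hq => by rw [clamped_eq ⟨hq.1, hq.2.trans hp⟩]

lemma isStrongSolution_clamped {b : ℝ × ℝ → EuclideanSpace ℝ (Fin d) → EuclideanSpace ℝ (Fin d)} {ξ : EuclideanSpace ℝ (Fin d)} {X : ℝ × ℝ → Ω → EuclideanSpace ℝ (Fin d)} :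
    IsStrongSolution P (clamped W) b ξ X ↔ IsStrongSolution P W b ξ X := by
  refine and_congr Iff.rfl (and_congr (forall₂_congr fun p hp => by rw [sheetSigma_clamped hp.2]) (Filter.eventually_congr (ae_of_all _ fun ω => ?_)))
  exact forall₂_congr fun p hp => by rw [clamped_eq hp]

lemma setIntegral_Icc_eq_iterated {E : Type*} [NormedAddCommGroup E] [NormedSpace ℝ E] {g : ℝ × ℝ → E} {p : ℝ × ℝ} (hp : 0 ≤ p) (hg : IntegrableOn g (Icc 0 p)) :
    ∫ q in Icc 0 p, g q = ∫ t in (0 : ℝ)..p.2, ∫ s in (0 : ℝ)..p.1, g (s, t) := by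
  have e : (volume : Measure (ℝ × ℝ)).restrict (Icc 0 p) = (volume.restrict (Icc 0 p.1)).prod (volume.restrict (Icc 0 p.2)) := by
    rw [Measure.prod_restrict, ← Measure.volume_eq_prod, Icc_prod_eq]
    rfl
  rw [IntegrableOn, e] at hg
  rw [e, integral_prod_symm _ hg, intervalIntegral.integral_of_le (a := (0 : ℝ)) hp.2, integral_Icc_eq_integral_Ioc]
  simp only [intervalIntegral.integral_of_le (a := (0 : ℝ)) hp.1, integral_Icc_eq_integral_Ioc]

lemma integral_exp_snd_le {c : ℝ} (hc : 0 < c) {p : ℝ × ℝ} (hp : p ∈ Icc (0 : ℝ × ℝ) 1) :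
    ∫ q in Icc 0 p, Real.exp (c * q.2) ≤ Real.exp (c * p.2) / c := by
  rw [setIntegral_Icc_eq_iterated hp.1 (Continuous.integrableOn_Icc (by fun_prop))]
  have e : ∫ t in (0 : ℝ)..p.2, Real.exp (c * t) = (Real.exp (c * p.2) - 1) / c := by
    rw [intervalIntegral.integral_comp_mul_left Real.exp hc.ne', integral_exp, mul_zero, Real.exp_zero, smul_eq_mul, inv_mul_eq_div]
  simp only [intervalIntegral.integral_const, sub_zero, smul_eq_mul, intervalIntegral.integral_const_mul, e]
  have h1 : 0 ≤ Real.exp (c * p.2) - 1 := by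
    have : 0 ≤ c * p.2 := mul_nonneg hc.le hp.1.2
    linarith [Real.add_one_le_exp (c * p.2)]
  calc _ ≤ 1 * ((Real.exp (c * p.2) - 1) / c) := by gcongr; exact hp.2.1
    _ ≤ _ := by rw [one_mul]; gcongr; linarith

/-- A two-parameter Gronwall estimate. -/
lemma norm_le_of_linear_growth {M C : ℝ} (hM : 0 < M) {x β : ℝ × ℝ → EuclideanSpace ℝ (Fin d)} (hx : ContinuousOn x (Icc 0 1))
    (hβ : ∀ᵐ q ∂unitVol, ‖β q‖ ≤ M * (1 + ‖x q‖)) (hC : ∀ p ∈ Icc (0 : ℝ × ℝ) 1, ‖x p - ∫ q in Icc 0 p, β q‖ ≤ C) {p : ℝ × ℝ} (hp : p ∈ Icc (0 : ℝ × ℝ) 1) :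
    ‖x p‖ ≤ 2 * (C + M) * Real.exp (2 * M) := by
  have hu : ContinuousOn (fun q : ℝ × ℝ => ‖x q‖ * Real.exp (-(2 * M * q.2))) (Icc 0 1) := hx.norm.mul (by fun_prop)
  obtain ⟨r, hr, hmax⟩ := isCompact_Icc.exists_isMaxOn ⟨0, le_rfl, zero_le_one⟩ hu
  set S := ‖x r‖ * Real.exp (-(2 * M * r.2)) with hS
  have hle : ∀ q ∈ Icc (0 : ℝ × ℝ) 1, ‖x q‖ ≤ S * Real.exp (2 * M * q.2) := fun q hq => by
    have := mul_le_mul_of_nonneg_right (hmax hq) (Real.exp_pos (2 * M * q.2)).le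
    rwa [mul_assoc, ← Real.exp_add, neg_add_cancel, Real.exp_zero, mul_one] at this
  have hS0 : 0 ≤ S := by positivity
  have hrs : Icc (0 : ℝ × ℝ) r ⊆ Icc 0 1 := Icc_subset_Icc_right hr.2
  have hfint : IntegrableOn (fun q : ℝ × ℝ => M + M * S * Real.exp (2 * M * q.2)) (Icc 0 r) := Continuous.integrableOn_Icc (by fun_prop)
  have h1 : ‖∫ q in Icc 0 r, β q‖ ≤ M + M * S * (Real.exp (2 * M * r.2) / (2 * M)) := by
    refine (norm_integral_le_of_norm_le hfint ?_).trans ?_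
    · filter_upwards [ae_restrict_of_ae_restrict_of_subset hrs hβ, ae_restrict_mem measurableSet_Icc] with q hq hqr
      nlinarith [hle q (hrs hqr)]
    · rw [integral_add (Continuous.integrableOn_Icc (by fun_prop)) (Continuous.integrableOn_Icc (by fun_prop)), integral_const_mul, setIntegral_const, smul_eq_mul]
      refine add_le_add ?_ (mul_le_mul_of_nonneg_left (integral_exp_snd_le (by positivity) hr) (by positivity))
      refine mul_le_of_le_one_left hM.le ?_
      rw [measureReal_def, volume_Icc_prod, ENNReal.toReal_mul]
      rw [ENNReal.toReal_ofReal hr.1.1, ENNReal.toReal_ofReal hr.1.2]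
      exact mul_le_one₀ hr.2.1 hr.1.2 hr.2.2
  have h2 : ‖x r‖ ≤ C + (M + S * Real.exp (2 * M * r.2) / 2) := by
    calc ‖x r‖ = ‖(x r - ∫ q in Icc 0 r, β q) + ∫ q in Icc 0 r, β q‖ := by rw [sub_add_cancel]
      _ ≤ C + (M + M * S * (Real.exp (2 * M * r.2) / (2 * M))) := (norm_add_le _ _).trans (add_le_add (hC r hr) h1)
      _ = _ := by field_simp
  have hr0 : ‖x r‖ = S * Real.exp (2 * M * r.2) := by rw [hS, mul_assoc, ← Real.exp_add, neg_add_cancel, Real.exp_zero, mul_one]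
  have h3 : S ≤ 2 * (C + M) := by
    have h4 : 1 ≤ Real.exp (2 * M * r.2) := Real.one_le_exp (mul_nonneg (by positivity) hr.1.2)
    nlinarith
  calc _ ≤ S * Real.exp (2 * M * p.2) := hle p hp
    _ ≤ _ := mul_le_mul h3 (Real.exp_le_exp.2 (mul_le_of_le_one_right (by positivity) hp.2.2)) (Real.exp_pos _).le (hS0.trans h3)

section

variable {ξ : EuclideanSpace ℝ (Fin d)} {L : ℝ} {β β' : ℝ × ℝ → Ω → EuclideanSpace ℝ (Fin d)} {f : (ℝ × ℝ) × EuclideanSpace ℝ (Fin d) → EuclideanSpace ℝ (Fin d)}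

lemma Adm.mono {L' : ℝ} (hL : L ≤ L') (h : Adm W L β) : Adm W L' β := ⟨fun q ω => (h.bdd q ω).trans hL, h.prog⟩

/-- The largest point of the grid of mesh `1 / (n + 1)` below `q`. -/
def gridFloor (n : ℕ) (q : ℝ × ℝ) : ℝ × ℝ := (grid (n + 1) ⌊q.1 * (n + 1 : ℕ)⌋₊, grid (n + 1) ⌊q.2 * (n + 1 : ℕ)⌋₊)

lemma gridFloor_mem (n : ℕ) {q : ℝ × ℝ} (hq : 0 ≤ q) : gridFloor n q ∈ Icc 0 q := by
  have h : ∀ r : ℝ, 0 ≤ r → grid (n + 1) ⌊r * (n + 1 : ℕ)⌋₊ ≤ r := fun r hr => by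
    rw [grid, div_le_iff₀ (by positivity)]
    exact Nat.floor_le (by positivity)
  exact ⟨⟨grid_nonneg _ _, grid_nonneg _ _⟩, ⟨h _ hq.1, h _ hq.2⟩⟩

lemma tendsto_gridFloor {q : ℝ × ℝ} (hq : 0 ≤ q) : Tendsto (fun n => gridFloor n q) atTop (nhds q) := by
  have h : ∀ r : ℝ, 0 ≤ r → Tendsto (fun n : ℕ => grid (n + 1) ⌊r * (n + 1 : ℕ)⌋₊) atTop (nhds r) := fun r hr =>
    (tendsto_nat_floor_mul_div_atTop hr).comp (tendsto_natCast_atTop_atTop.comp (tendsto_add_atTop_nat 1))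
  exact (h _ hq.1).prodMk_nhds (h _ hq.2)

lemma measurable_indicator_comp_gridFloor {p : ℝ × ℝ} {Y : ℝ × ℝ → Ω → EuclideanSpace ℝ (Fin d)} (hY : ∀ q ∈ Icc 0 p, Measurable (Y q)) (n : ℕ) :
    Measurable fun x : (ℝ × ℝ) × Ω => (Icc (0 : ℝ × ℝ) p).indicator (fun q => Y (gridFloor n q) x.2) x.1 := by
  have h1 : Measurable fun y : (ℕ × ℕ) × Ω => (Icc (0 : ℝ × ℝ) p).indicator (fun q => Y q y.2) (grid (n + 1) y.1.1, grid (n + 1) y.1.2) :=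
    measurable_from_prod_countable_right fun k => by
      by_cases hk : (grid (n + 1) k.1, grid (n + 1) k.2) ∈ Icc (0 : ℝ × ℝ) p
      · simpa [indicator_of_mem hk] using hY _ hk
      · simp [indicator_of_notMem hk]
  have h2 : Measurable fun x : (ℝ × ℝ) × Ω => ((⌊x.1.1 * (n + 1 : ℕ)⌋₊, ⌊x.1.2 * (n + 1 : ℕ)⌋₊), x.2) := by fun_prop
  refine (congrArg _ (funext fun x => ?_)).mp (Measurable.indicator_fst (h1.comp h2) (A := Icc 0 p) measurableSet_Icc)
  refine congrFun (indicator_congr fun q hq => ?_) x.1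
  exact indicator_of_mem (s := Icc (0 : ℝ × ℝ) p) ⟨(gridFloor_mem n hq.1).1, (gridFloor_mem n hq.1).2.trans hq.2⟩ fun q => Y q x.2

lemma measurable_indicator_comp_limUnder (hf : Measurable f) {g : ℕ → ℝ × ℝ → Ω → EuclideanSpace ℝ (Fin d)} {p : ℝ × ℝ}
    (hg : ∀ n, Measurable fun x : (ℝ × ℝ) × Ω => (Icc (0 : ℝ × ℝ) p).indicator (fun q => g n q x.2) x.1) :
    Measurable fun x : (ℝ × ℝ) × Ω => (Icc (0 : ℝ × ℝ) p).indicator (fun q => f (q, limUnder atTop fun n => g n q x.2)) x.1 := by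
  have h1 := hf.comp (measurable_fst.prodMk (StronglyMeasurable.limUnder (l := atTop) fun n => (hg n).stronglyMeasurable).measurable)
  refine (congrArg _ (funext fun x => ?_)).mp (Measurable.indicator_fst h1 (A := Icc 0 p) measurableSet_Icc)
  refine congrFun (indicator_congr fun q hq => ?_) x.1
  simp only [Function.comp, indicator_of_mem hq]

/-- The drift of a continuous process adapted up to null sets has a progressively measurable version. -/
lemma exists_adm_comp (hf : Measurable f) (hL : ∀ x, ‖f x‖ ≤ L) {X : ℝ × ℝ → Ω → EuclideanSpace ℝ (Fin d)} (hXc : ∀ ω, ContinuousOn (fun p => X p ω) (Icc 0 1))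
    (hXa : ∀ p ∈ Icc (0 : ℝ × ℝ) 1, ∃ Y : Ω → EuclideanSpace ℝ (Fin d), Measurable[sheetSigma W p] Y ∧ ∀ᵐ ω ∂P, X p ω = Y ω) :
    ∃ β, Adm W L β ∧ ∀ᵐ ω ∂P, ∀ q ∈ Icc (0 : ℝ × ℝ) 1, β q ω = f (q, X q ω) := by
  choose! Y hY hXY using hXa
  refine ⟨fun q ω => f (q, limUnder atTop fun n => Y (gridFloor n q) ω), ⟨fun _ _ => hL _, fun p hp => ?_⟩, ?_⟩
  · exact @measurable_indicator_comp_limUnder Ω (sheetSigma W p) d f hf (fun n q => Y (gridFloor n q)) p fun n =>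
      @measurable_indicator_comp_gridFloor Ω (sheetSigma W p) d p Y (fun q hq => (hY q ⟨hq.1, hq.2.trans hp.2⟩).mono (sheetSigma_mono hq.2) le_rfl) n
  · have hae : ∀ᵐ ω ∂P, ∀ k : ℕ × ℕ × ℕ, (grid (k.1 + 1) k.2.1, grid (k.1 + 1) k.2.2) ∈ Icc (0 : ℝ × ℝ) 1 →
        X (grid (k.1 + 1) k.2.1, grid (k.1 + 1) k.2.2) ω = Y (grid (k.1 + 1) k.2.1, grid (k.1 + 1) k.2.2) ω :=
      ae_all_iff.2 fun k => by
        by_cases hk : (grid (k.1 + 1) k.2.1, grid (k.1 + 1) k.2.2) ∈ Icc (0 : ℝ × ℝ) 1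
        · exact (hXY _ hk).mono fun ω h _ => h
        · exact ae_of_all _ fun _ h => absurd h hk
    filter_upwards [hae] with ω hω q hq
    have hmem : ∀ n, gridFloor n q ∈ Icc (0 : ℝ × ℝ) 1 := fun n => ⟨(gridFloor_mem n hq.1).1, (gridFloor_mem n hq.1).2.trans hq.2⟩
    have hlim : Tendsto (fun n => X (gridFloor n q) ω) atTop (nhds (X q ω)) :=
      (hXc ω q hq).tendsto.comp (tendsto_nhdsWithin_iff.2 ⟨tendsto_gridFloor hq.1, Eventually.of_forall hmem⟩)
    have hlim' : Tendsto (fun n => Y (gridFloor n q) ω) atTop (nhds (X q ω)) := hlim.congr fun n => hω (n, _, _) (hmem n)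
    rw [hlim'.limUnder_eq]

end

section

lemma measurable_limUnder_atTop {d : ℕ} {α : Type*} [MeasurableSpace α] {g : ℕ → α → EuclideanSpace ℝ (Fin d)} (hg : ∀ n, Measurable (g n)) :
    Measurable fun x => limUnder atTop fun n => g n x :=
  (StronglyMeasurable.limUnder fun n => (hg n).stronglyMeasurable).measurable

variable {ξ : EuclideanSpace ℝ (Fin d)} {L : ℝ} {β β' : ℝ × ℝ → Ω → EuclideanSpace ℝ (Fin d)} {f : (ℝ × ℝ) × EuclideanSpace ℝ (Fin d) → EuclideanSpace ℝ (Fin d)}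

/-- The drift `b` cut off outside the ball of radius `N`. -/
def cutoff (b : ℝ × ℝ → EuclideanSpace ℝ (Fin d) → EuclideanSpace ℝ (Fin d)) (N : ℕ) (x : (ℝ × ℝ) × EuclideanSpace ℝ (Fin d)) : EuclideanSpace ℝ (Fin d) :=
  {x : (ℝ × ℝ) × EuclideanSpace ℝ (Fin d) | ‖x.2‖ ≤ N}.indicator (fun x => b x.1 x.2) x

variable {b : ℝ × ℝ → EuclideanSpace ℝ (Fin d) → EuclideanSpace ℝ (Fin d)} {M : ℝ} {N : ℕ}

lemma cutoff_eq {q : ℝ × ℝ} {x : EuclideanSpace ℝ (Fin d)} (hx : ‖x‖ ≤ N) : cutoff b N (q, x) = b q x := by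
  rw [cutoff, indicator_of_mem (by exact hx)]

lemma measurable_cutoff (hb : Measurable fun x : (ℝ × ℝ) × EuclideanSpace ℝ (Fin d) => b x.1 x.2) : Measurable (cutoff b N) :=
  hb.indicator (measurableSet_le measurable_snd.norm measurable_const)

lemma norm_cutoff_le' (hg : ∀ p x, ‖b p x‖ ≤ M * (1 + ‖x‖)) (x : (ℝ × ℝ) × EuclideanSpace ℝ (Fin d)) : ‖cutoff b N x‖ ≤ M * (1 + ‖x.2‖) :=
  (norm_indicator_le_norm_self _ _).trans (hg _ _)

lemma norm_cutoff_le (hM : 0 < M) (hg : ∀ p x, ‖b p x‖ ≤ M * (1 + ‖x‖)) (x : (ℝ × ℝ) × EuclideanSpace ℝ (Fin d)) : ‖cutoff b N x‖ ≤ M * (1 + N) := by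
  by_cases hx : ‖x.2‖ ≤ N
  · exact (norm_cutoff_le' hg x).trans (by gcongr)
  · rw [cutoff, indicator_of_notMem (by exact hx), norm_zero]
    positivity

lemma Adm.mem_solved_iff (hm : ∀ p, Measurable (W p)) (hc : ∀ ω, Continuous fun p => W p ω) (hf : Measurable f) (hL : ∀ x, ‖f x‖ ≤ L) (h : Adm W L β) {ω : Ω} :
    ω ∈ solved W ξ f β 1 ↔ ∀ᵐ q ∂unitVol, β q ω = f (q, drifted W ξ β q ω) := by
  have hF : AEMeasurable (fun q => ‖β q ω - f (q, drifted W ξ β q ω)‖ₑ) unitVol :=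
    ⟨_, (h.measurable_enorm_sub hm (adm_comp_drifted hm hc hf hL h ξ)).comp (measurable_id.prodMk (measurable_const (a := ω))), ae_unitVol fun q hq => by simp [indicator_of_mem hq]⟩
  refine (lintegral_eq_zero_iff' hF).trans (Filter.eventually_congr (ae_of_all _ fun q => ?_))
  rw [Pi.zero_apply, enorm_eq_zero, sub_eq_zero]

lemma ae_mem_solved [IsProbabilityMeasure P] (hm : ∀ p, Measurable (W p)) (hc : ∀ ω, Continuous fun p => W p ω) (hf : Measurable f) (hL : ∀ x, ‖f x‖ ≤ L) (h : Adm W L β)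
    (h0 : ∫⁻ x, ‖β x.1 x.2 - f (x.1, drifted W ξ β x.1 x.2)‖ₑ ∂(unitVol.prod P) = 0) : ∀ᵐ ω ∂P, ω ∈ solved W ξ f β 1 := by
  have h' := adm_comp_drifted hm hc hf hL h ξ
  rw [h.lintegral_sub_eq hm h', lintegral_eq_zero_iff (h.measurable_lintegral_sub hm h')] at h0
  exact h0

lemma Adm.setIntegral_eq_iterated (hm : ∀ p, Measurable (W p)) (h : Adm W L β) {ω : Ω} {g : ℝ × ℝ → EuclideanSpace ℝ (Fin d)} (hg : ∀ᵐ q ∂unitVol, β q ω = g q) {p : ℝ × ℝ} (hp : p ∈ Icc (0 : ℝ × ℝ) 1) :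
    ∫ q in Icc 0 p, β q ω = ∫ t in (0 : ℝ)..p.2, ∫ s in (0 : ℝ)..p.1, g (s, t) := by
  have hs : Icc (0 : ℝ × ℝ) p ⊆ Icc 0 1 := Icc_subset_Icc_right hp.2
  have hae := ae_restrict_of_ae_restrict_of_subset hs hg
  rw [integral_congr_ae hae]
  exact setIntegral_Icc_eq_iterated hp.1 (((h.integrableOn hm ω).mono_set hs).congr hae)

variable [IsProbabilityMeasure P]

lemma IsStrongSolution.exists_adm (hW : IsBrownianSheet P d W) (hc : ∀ ω, Continuous fun p => W p ω) (hb : Measurable fun x : (ℝ × ℝ) × EuclideanSpace ℝ (Fin d) => b x.1 x.2)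
    (hM : 0 < M) (hg : ∀ p x, ‖b p x‖ ≤ M * (1 + ‖x‖)) {X : ℝ × ℝ → Ω → EuclideanSpace ℝ (Fin d)} (hX : IsStrongSolution P W b ξ X) (N : ℕ) :
    ∃ β, Adm W (M * (1 + N)) β ∧ ∀ᵐ ω ∂P, (∀ p ∈ Icc (0 : ℝ × ℝ) 1, ‖X p ω‖ ≤ N) →
      ω ∈ solved W ξ (cutoff b N) β 1 ∧ ∀ p ∈ Icc (0 : ℝ × ℝ) 1, drifted W ξ β p ω = X p ω := by
  obtain ⟨β, hβ, hβX⟩ := exists_adm_comp (measurable_cutoff (N := N) hb) (norm_cutoff_le hM hg) hX.1 hX.2.1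
  refine ⟨β, hβ, ?_⟩
  filter_upwards [hβX, hX.2.2] with ω h1 h2 hN
  have h3 : ∀ p ∈ Icc (0 : ℝ × ℝ) 1, drifted W ξ β p ω = X p ω := fun p hp => by
    rw [h2 p hp, drifted, hβ.setIntegral_eq_iterated hW.1 (g := fun q => b q (X q ω)) (ae_unitVol fun q hq => by rw [h1 q hq, cutoff_eq (hN q hq)]) hp]
    abel
  refine ⟨(hβ.mem_solved_iff hW.1 hc (measurable_cutoff hb) (norm_cutoff_le hM hg)).2 (ae_unitVol fun q hq => ?_), h3⟩
  rw [h3 q hq, h1 q hq]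

theorem IsStrongSolution.ae_eq (hW : IsBrownianSheet P d W) (hc : ∀ ω, Continuous fun p => W p ω) (hb : Measurable fun x : (ℝ × ℝ) × EuclideanSpace ℝ (Fin d) => b x.1 x.2)
    (hM : 0 < M) (hg : ∀ p x, ‖b p x‖ ≤ M * (1 + ‖x‖)) {X Y : ℝ × ℝ → Ω → EuclideanSpace ℝ (Fin d)} (hX : IsStrongSolution P W b ξ X) (hY : IsStrongSolution P W b ξ Y) :
    ∀ᵐ ω ∂P, ∀ p ∈ Icc (0 : ℝ × ℝ) 1, X p ω = Y p ω := by
  choose β hβ hβX using hX.exists_adm hW hc hb hM hg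
  choose γ hγ hγY using hY.exists_adm hW hc hb hM hg
  filter_upwards [ae_all_iff.2 hβX, ae_all_iff.2 hγY, ae_all_iff.2 fun N => ae_eq_of_solved hW hc (measurable_cutoff hb) (norm_cutoff_le hM hg) (hβ N) (hγ N)] with ω h1 h2 h3 p hp
  obtain ⟨C, hC⟩ := isCompact_Icc.exists_bound_of_continuousOn (hX.1 ω)
  obtain ⟨C', hC'⟩ := isCompact_Icc.exists_bound_of_continuousOn (hY.1 ω)
  obtain ⟨N, hN⟩ := exists_nat_ge (max C C')
  obtain ⟨hs, hX'⟩ := h1 N fun p hp => (hC p hp).trans ((le_max_left _ _).trans hN)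
  obtain ⟨hs', hY'⟩ := h2 N fun p hp => (hC' p hp).trans ((le_max_right _ _).trans hN)
  rw [← hX' p hp, ← hY' p hp, h3 N ⟨hs, hs'⟩ p hp]

theorem exists_isStrongSolution (hW : IsBrownianSheet P d W) (hc : ∀ ω, Continuous fun p => W p ω) (hb : Measurable fun x : (ℝ × ℝ) × EuclideanSpace ℝ (Fin d) => b x.1 x.2)
    (hM : 0 < M) (hg : ∀ p x, ‖b p x‖ ≤ M * (1 + ‖x‖)) (ξ : EuclideanSpace ℝ (Fin d)) : ∃ X, IsStrongSolution P W b ξ X := by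
  have hf : ∀ N, Measurable (cutoff b N) := fun N => measurable_cutoff hb
  have hL : ∀ N x, ‖cutoff b N x‖ ≤ M * (1 + N) := fun N => norm_cutoff_le hM hg
  choose β hβ h0 using fun N : ℕ => exists_solution_bdd hW hc (hf N) (hL N) ξ
  have hC : ∀ ω, ∃ C, ∀ p ∈ Icc (0 : ℝ × ℝ) 1, ‖ξ + W p ω‖ ≤ C := fun ω => isCompact_Icc.exists_bound_of_continuousOn (continuous_const.add (hc ω)).continuousOn
  choose C hC using hC
  set R : Ω → ℝ := fun ω => 2 * (C ω + M) * Real.exp (2 * M) with hR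
  have hcont := fun N => (hβ N).continuousOn_drifted hW.1 hc (ξ := ξ)
  have hK : ∀ N K : ℕ, N ≤ K → Adm W (M * (1 + K)) (β N) := fun N K h => (hβ N).mono (by gcongr)
  have hsol : ∀ᵐ ω ∂P, ∀ N, (∀ᵐ q ∂unitVol, β N q ω = cutoff b N (q, drifted W ξ (β N) q ω)) ∧ ∀ p ∈ Icc (0 : ℝ × ℝ) 1, ‖drifted W ξ (β N) p ω‖ ≤ R ω :=
    ae_all_iff.2 fun N => (ae_mem_solved hW.1 hc (hf N) (hL N) (hβ N) (h0 N)).mono fun ω hω => by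
      have h1 := ((hβ N).mem_solved_iff hW.1 hc (hf N) (hL N)).1 hω
      refine ⟨h1, fun p hp => norm_le_of_linear_growth (β := fun q => β N q ω) hM (hcont N ω) (h1.mono fun q hq => ?_) (fun p hp => ?_) hp⟩
      · rw [hq]
        exact norm_cutoff_le' hg _
      · rw [drifted, add_sub_cancel_right]
        exact hC ω p hp
  have hb' : ∀ᵐ ω ∂P, ∀ N ≥ ⌈R ω⌉₊, ∀ᵐ q ∂unitVol, β N q ω = b q (drifted W ξ (β N) q ω) := hsol.mono fun ω h N hN => by
    filter_upwards [(h N).1, ae_unitVol fun q hq => (h N).2 q hq] with q hq hq'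
    rw [hq, cutoff_eq (hq'.trans (Nat.ceil_le.1 hN))]
  have heq : ∀ᵐ ω ∂P, ∀ N ≥ ⌈R ω⌉₊, ∀ p ∈ Icc (0 : ℝ × ℝ) 1, drifted W ξ (β ⌈R ω⌉₊) p ω = drifted W ξ (β N) p ω := by
    have huniq : ∀ᵐ ω ∂P, ∀ i : ℕ × ℕ, i.1 ≤ i.2 → ω ∈ solved W ξ (cutoff b i.2) (β i.1) 1 ∩ solved W ξ (cutoff b i.2) (β i.2) 1 →
        ∀ p ∈ Icc (0 : ℝ × ℝ) 1, drifted W ξ (β i.1) p ω = drifted W ξ (β i.2) p ω := ae_all_iff.2 fun i => by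
      by_cases hi : i.1 ≤ i.2
      · exact (ae_eq_of_solved hW hc (hf _) (hL _) (hK _ _ hi) (hβ _)).mono fun _ h _ => h
      · exact ae_of_all _ fun _ h => absurd h hi
    filter_upwards [huniq, hsol, hb'] with ω h1 h2 h3 N hN
    have hmem : ∀ k ≤ N, ⌈R ω⌉₊ ≤ k → ω ∈ solved W ξ (cutoff b N) (β k) 1 := fun k hkN hk => by
      refine ((hK k N hkN).mem_solved_iff hW.1 hc (hf N) (hL N)).2 ?_
      filter_upwards [h3 k hk, ae_unitVol fun q hq => (h2 k).2 q hq] with q hq hq'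
      rw [cutoff_eq (hq'.trans (Nat.ceil_le.1 hN))]
      exact hq
    exact h1 (⌈R ω⌉₊, N) hN ⟨hmem _ hN le_rfl, hmem _ le_rfl hN⟩
  refine ⟨fun p ω => drifted W ξ (β ⌈R ω⌉₊) p ω, fun ω => hcont _ ω, fun p hp => ?_, ?_⟩
  · refine ⟨fun ω => limUnder atTop fun N => drifted W ξ (β N) p ω, @measurable_limUnder_atTop d Ω (sheetSigma W p) _ fun N => (hβ N).measurable_drifted hp.1 le_rfl hp, heq.mono fun ω h => ?_⟩
    exact (tendsto_nhds_of_eventually_eq ((eventually_ge_atTop ⌈R ω⌉₊).mono fun N hN => (h N hN p hp).symm)).limUnder_eq.symm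
  · filter_upwards [hb'] with ω h p hp
    rw [drifted, (hβ _).setIntegral_eq_iterated hW.1 (h _ le_rfl) hp]
    abel

end

end

/-- existence of a strong solution and indistinguishability of any two
strong solutions, for a drift that is a difference of componentwise nondecreasing
functions and of spatial linear growth. -/
theorem statement0 {Ω : Type*} [MeasurableSpace Ω] (P : Measure Ω) [IsProbabilityMeasure P]
    (d : ℕ) (W : ℝ × ℝ → Ω → EuclideanSpace ℝ (Fin d)) (hW : IsBrownianSheet P d W)
    (ξ : EuclideanSpace ℝ (Fin d))
    (b bhat bcheck : ℝ × ℝ → EuclideanSpace ℝ (Fin d) → EuclideanSpace ℝ (Fin d))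
    (hmeas : Measurable fun q : (ℝ × ℝ) × EuclideanSpace ℝ (Fin d) => b q.1 q.2)
    (hdecomp : ∀ p x, b p x = bhat p x - bcheck p x)
    (hmono : ∀ p (x y : EuclideanSpace ℝ (Fin d)), (∀ j, x j ≤ y j) →
      ∀ i, bhat p x i ≤ bhat p y i ∧ bcheck p x i ≤ bcheck p y i)
    (M : ℝ) (hM : 0 < M)
    (hgrowth : ∀ p x, ‖b p x‖ ≤ M * (1 + ‖x‖)) :
    (∃ X, IsStrongSolution P W b ξ X) ∧
      ∀ X Y, IsStrongSolution P W b ξ X → IsStrongSolution P W b ξ Y →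
        ∀ᵐ ω ∂P, ∀ p ∈ Set.Icc (0 : ℝ × ℝ) 1, X p ω = Y p ω := by
  have hc := hW.continuous_clamped
  refine ⟨?_, fun X Y hX hY => ?_⟩
  · obtain ⟨X, hX⟩ := exists_isStrongSolution hW.clamped hc hmeas hM hgrowth ξ
    exact ⟨X, isStrongSolution_clamped.1 hX⟩
  · exact IsStrongSolution.ae_eq hW.clamped hc hmeas hM hgrowth (isStrongSolution_clamped.2 hX) (isStrongSolution_clamped.2 hY)
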